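/- Let D = {(x,y) ∈ ℝ² : y > x} be the open half-plane above the diagonal, and let < denote the restriction to D of the irreflexive part of the componentwise order on ℝ². The validity problem over the frame (D, <) is decidable: the predicate on temporal formulas 'φ is valid over (D, <)' is computable. -/

import Mathlib

namespace Temporal

/-- Temporal propositional formulas: `φ ::= q | ¬φ | φ∨φ' | Fφ | Pφ`. -/
inductive TForm : Type
  | prop : ℕ → TForm
  | neg : TForm → TForm
  | or : TForm → TForm → TForm
  | fut : TForm → TForm
  | past : TForm → TForm
  deriving DecidableEq

/-- Truth of a temporal formula at a point of a Kripke structure. -/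
def TSat {X : Type*} (R : X → X → Prop) (v : ℕ → Set X) : TForm → X → Prop
  | .prop n, x => x ∈ v n
  | .neg φ, x => ¬ TSat R v φ x
  | .or φ ψ, x => TSat R v φ x ∨ TSat R v ψ x
  | .fut φ, x => ∃ y, R x y ∧ TSat R v φ y
  | .past φ, x => ∃ y, R y x ∧ TSat R v φ y

/-- Validity of a temporal formula over a Kripke frame. -/
def TValid {X : Type*} (R : X → X → Prop) (φ : TForm) : Prop :=
  ∀ (v : ℕ → Set X) (x : X), TSat R v φ x

/-- Satisfiability of a temporal formula over a Kripke frame. -/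
def TSatisfiable {X : Type*} (R : X → X → Prop) (φ : TForm) : Prop :=
  ∃ (v : ℕ → Set X) (x : X), TSat R v φ x

/-- An explicit encoding of temporal formulas as natural numbers. -/
def encodeT : TForm → ℕ
  | .prop n => 5 * n
  | .neg φ => 5 * encodeT φ + 1
  | .or φ ψ => 5 * Nat.pair (encodeT φ) (encodeT ψ) + 2
  | .fut φ => 5 * encodeT φ + 3
  | .past φ => 5 * encodeT φ + 4

/-- The inverse decoding of natural numbers as temporal formulas. -/
def decodeT (n : ℕ) : TForm :=
  if h0 : n % 5 = 0 then .prop (n / 5)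
  else
    have hn : 0 < n := Nat.pos_of_ne_zero (by rintro rfl; simp at h0)
    have hlt : n / 5 < n := Nat.div_lt_self hn (by norm_num)
    have h1 : (n / 5).unpair.1 < n := lt_of_le_of_lt (Nat.unpair_left_le _) hlt
    have h2 : (n / 5).unpair.2 < n := lt_of_le_of_lt (Nat.unpair_right_le _) hlt
    if n % 5 = 1 then .neg (decodeT (n / 5))
    else if n % 5 = 2 then .or (decodeT (n / 5).unpair.1) (decodeT (n / 5).unpair.2)
    else if n % 5 = 3 then .fut (decodeT (n / 5))
    else .past (decodeT (n / 5))

theorem decodeT_encodeT (φ : TForm) : decodeT (encodeT φ) = φ := by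
  induction φ with
  | prop n => rw [encodeT, decodeT]; simp [Nat.mul_div_cancel_left, Nat.mul_mod_right]
  | neg φ ih => rw [encodeT, decodeT]; simp [Nat.mul_add_mod, Nat.mul_add_div, ih]
  | or φ ψ ih1 ih2 => rw [encodeT, decodeT]; simp [Nat.mul_add_mod, Nat.mul_add_div, ih1, ih2]
  | fut φ ih => rw [encodeT, decodeT]; simp [Nat.mul_add_mod, Nat.mul_add_div, ih]
  | past φ ih => rw [encodeT, decodeT]; simp [Nat.mul_add_mod, Nat.mul_add_div, ih]

theorem encodeT_decodeT (n : ℕ) : encodeT (decodeT n) = n := by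
  induction n using Nat.strong_induction_on with
  | _ n ih =>
    rw [decodeT]
    by_cases h0 : n % 5 = 0
    · simp only [h0, dif_pos]
      rw [encodeT]
      omega
    · have hn : 0 < n := Nat.pos_of_ne_zero (by rintro rfl; simp at h0)
      have hlt : n / 5 < n := Nat.div_lt_self hn (by norm_num)
      have h1 : (n / 5).unpair.1 < n := lt_of_le_of_lt (Nat.unpair_left_le _) hlt
      have h2 : (n / 5).unpair.2 < n := lt_of_le_of_lt (Nat.unpair_right_le _) hlt
      rw [dif_neg h0]
      by_cases e1 : n % 5 = 1
      · rw [if_pos e1, encodeT, ih _ hlt]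
        omega
      · rw [if_neg e1]
        by_cases e2 : n % 5 = 2
        · rw [if_pos e2, encodeT, ih _ h1, ih _ h2, Nat.pair_unpair]
          omega
        · rw [if_neg e2]
          by_cases e3 : n % 5 = 3
          · rw [if_pos e3, encodeT, ih _ hlt]
            omega
          · rw [if_neg e3, encodeT, ih _ hlt]
            omega

instance : Encodable TForm :=
  ⟨encodeT, fun n => some (decodeT n), fun φ => congrArg some (decodeT_encodeT φ)⟩

instance : Denumerable TForm :=
  ⟨fun n => ⟨decodeT n, rfl, encodeT_decodeT n⟩⟩


/-- The open half-plane `D = {(x,y) ∈ ℝ² : y > x}` above the diagonal. -/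
abbrev HalfPlane : Type := {p : ℝ × ℝ // p.1 < p.2}

end Temporal

namespace Temporal

/-- A label system. -/
structure Sys (T : Type) where
  N : ℕ
  le : T → T → Prop
  rl : T → Prop
  nF : ℕ → T → Prop
  nP : ℕ → T → Prop
  w : ℕ → T → Prop

namespace Sys
variable {T : Type}
def op (S : Sys T) : Sys T := ⟨S.N, fun a b => S.le b a, S.rl, S.nP, S.nF, S.w⟩
def gF (S : Sys T) (i : ℕ) (t : T) : Prop := S.nF i t ∨ S.w i t
def gP (S : Sys T) (i : ℕ) (t : T) : Prop := S.nP i t ∨ S.w i t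

structure Lawful (S : Sys T) : Prop where
  trans : ∀ a b c, S.le a b → S.le b c → S.le a c
  axF : ∀ i t s, i < S.N → S.rl t → S.le t s → S.gF i s → S.nF i t
  axP : ∀ i t s, i < S.N → S.rl s → S.le t s → S.gP i t → S.nP i s

theorem Lawful.op {S : Sys T} (h : S.Lawful) : S.op.Lawful :=
  ⟨fun a b c h1 h2 => h.trans c b a h2 h1, fun i t s hi hr hl hg => h.axP i s t hi hr hl hg,
   fun i t s hi hr hl hg => h.axF i s t hi hr hl hg⟩
end Sys

/-- Words: an open piece followed by (breakpoint, open piece) pairs. -/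
abbrev Wd (T : Type) := T × List (T × T)

section Words
variable {T : Type}

def Reads (β : ℝ → T) (hi : ℝ) : List (T × T) → ℝ → T → Prop
  | [], lo, e => lo < hi ∧ ∀ x, lo < x → x < hi → β x = e
  | p :: L, lo, e => ∃ m, lo < m ∧ m < hi ∧ (∀ x, lo < x → x < m → β x = e) ∧ β m = p.1 ∧
      Reads β hi L m p.2

def RdW (β : ℝ → T) (lo hi : ℝ) (w : Wd T) : Prop := Reads β hi w.2 lo w.1

def lastP (e : T) (L : List (T × T)) : T := L.foldl (fun _ p => p.2) e
def lastW (w : Wd T) : T := lastP w.1 w.2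
def revStep (acc : Wd T) (p : T × T) : Wd T := (p.2, (p.1, acc.1) :: acc.2)
def revW (w : Wd T) : Wd T := w.2.foldl revStep (w.1, [])
def lettersP (L : List (T × T)) : List T := L.flatMap (fun p => [p.1, p.2])
def letters (w : Wd T) : List T := w.1 :: lettersP w.2

theorem Reads.lt {β : ℝ → T} {hi : ℝ} {L lo e} (h : Reads β hi L lo e) : lo < hi := by
  cases L with
  | nil => exact h.1
  | cons p L => obtain ⟨m, h1, h2, _⟩ := h; exact h1.trans h2

theorem Reads.congr {β β' : ℝ → T} {hi : ℝ} {L lo e} (h : Reads β hi L lo e)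
    (hb : ∀ x, lo < x → x < hi → β x = β' x) : Reads β' hi L lo e := by
  induction L generalizing lo e with
  | nil => exact ⟨h.1, fun x h1 h2 => by rw [← hb x h1 h2]; exact h.2 x h1 h2⟩
  | cons p L ih =>
    obtain ⟨m, h1, h2, h3, h4, h5⟩ := h
    exact ⟨m, h1, h2, fun x a b => by rw [← hb x a (b.trans h2)]; exact h3 x a b,
      by rw [← hb m h1 h2]; exact h4, ih h5 (fun x a b => hb x (h1.trans a) b)⟩

theorem Reads.comp {β : ℝ → T} {hi : ℝ} {L lo e} (φ : ℝ ≃o ℝ) (h : Reads β (φ hi) L (φ lo) e) :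
    Reads (fun x => β (φ x)) hi L lo e := by
  induction L generalizing lo e with
  | nil =>
    exact ⟨φ.lt_iff_lt.1 h.1, fun x h1 h2 => h.2 _ (φ.lt_iff_lt.2 h1) (φ.lt_iff_lt.2 h2)⟩
  | cons p L ih =>
    obtain ⟨m, h1, h2, h3, h4, h5⟩ := h
    obtain ⟨m, rfl⟩ := φ.surjective m
    exact ⟨m, φ.lt_iff_lt.1 h1, φ.lt_iff_lt.1 h2, fun x a b => h3 _ (φ.lt_iff_lt.2 a) (φ.lt_iff_lt.2 b),
      h4, ih h5⟩

theorem Reads.first {β : ℝ → T} {hi : ℝ} {L lo e} (h : Reads β hi L lo e) :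
    ∃ m, lo < m ∧ m ≤ hi ∧ ∀ x, lo < x → x < m → β x = e := by
  cases L with
  | nil => exact ⟨hi, h.1, le_rfl, h.2⟩
  | cons p L => obtain ⟨m, h1, h2, h3, _⟩ := h; exact ⟨m, h1, h2.le, h3⟩

theorem Reads.last {β : ℝ → T} {hi : ℝ} {L lo e} (h : Reads β hi L lo e) :
    ∃ m, lo ≤ m ∧ m < hi ∧ ∀ x, m < x → x < hi → β x = lastP e L := by
  induction L generalizing lo e with
  | nil => exact ⟨lo, le_rfl, h.1, h.2⟩
  | cons p L ih =>
    obtain ⟨m, h1, h2, h3, h4, h5⟩ := h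
    obtain ⟨m', a, b, c⟩ := ih h5
    exact ⟨m', h1.le.trans a, b, c⟩

theorem Reads.mem {β : ℝ → T} {hi : ℝ} {L lo e} (h : Reads β hi L lo e) {x : ℝ}
    (h1 : lo < x) (h2 : x < hi) : β x ∈ letters (e, L) := by
  induction L generalizing lo e with
  | nil => simp [letters, lettersP, h.2 x h1 h2]
  | cons p L ih =>
    obtain ⟨m, a, b, c, d, f⟩ := h
    rcases lt_trichotomy x m with g | g | g
    · simp [letters, c x h1 g]
    · subst g; simp [letters, lettersP, d]
    · have := ih f g
      simp only [letters, lettersP, List.flatMap_cons, List.mem_cons, List.mem_append,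
        List.not_mem_nil, or_false] at this ⊢
      tauto

theorem Reads.att {β : ℝ → T} {hi : ℝ} {L lo e} (h : Reads β hi L lo e) {t : T}
    (ht : t ∈ letters (e, L)) : ∃ x, lo < x ∧ x < hi ∧ β x = t := by
  induction L generalizing lo e with
  | nil =>
    have : t = e := by simpa [letters, lettersP] using ht
    subst this
    obtain ⟨x, hx⟩ := exists_between h.1
    exact ⟨x, hx.1, hx.2, h.2 x hx.1 hx.2⟩
  | cons p L ih =>
    obtain ⟨m, a, b, c, d, f⟩ := h
    simp only [letters, lettersP, List.flatMap_cons, List.mem_cons, List.mem_append,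
        List.not_mem_nil, or_false] at ht ih
    rcases ht with rfl | (rfl | rfl) | ht
    · obtain ⟨x, hx⟩ := exists_between a
      exact ⟨x, hx.1, hx.2.trans b, c x hx.1 hx.2⟩
    · exact ⟨m, a, b, d⟩
    · obtain ⟨x, x1, x2, x3⟩ := ih f (Or.inl rfl)
      exact ⟨x, a.trans x1, x2, x3⟩
    · obtain ⟨x, x1, x2, x3⟩ := ih f (Or.inr ht)
      exact ⟨x, a.trans x1, x2, x3⟩

theorem Reads.app {β : ℝ → T} {m hi : ℝ} {L1 lo e L2 t e2} (h : Reads β m L1 lo e)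
    (hm : β m = t) (h2 : Reads β hi L2 m e2) : Reads β hi (L1 ++ (t, e2) :: L2) lo e := by
  induction L1 generalizing lo e with
  | nil => exact ⟨m, h.1, h2.lt, h.2, hm, h2⟩
  | cons p L ih =>
    obtain ⟨m', a, b, c, d, f⟩ := h
    exact ⟨m', a, b.trans h2.lt, c, d, ih f⟩

theorem Reads.ext {β : ℝ → T} {m hi : ℝ} {lo e L2} (hl : lo < m) (h : ∀ x, lo < x → x ≤ m → β x = e)
    (h2 : Reads β hi L2 m e) : Reads β hi L2 lo e := by
  cases L2 with
  | nil =>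
    refine ⟨hl.trans h2.1, fun x a b => ?_⟩
    rcases le_or_gt x m with g | g
    · exact h x a g
    · exact h2.2 x g b
  | cons p L =>
    obtain ⟨m', a, b, c, d⟩ := h2
    refine ⟨m', hl.trans a, b, fun x a b => ?_, d⟩
    rcases le_or_gt x m with g | g
    · exact h x a g
    · exact c x g b

theorem Reads.app' {β : ℝ → T} {m hi : ℝ} {L1 lo e L2} (h : Reads β m L1 lo e)
    (hm : β m = lastP e L1) (h2 : Reads β hi L2 m (lastP e L1)) : Reads β hi (L1 ++ L2) lo e := by
  induction L1 generalizing lo e with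
  | nil =>
    refine Reads.ext h.1 (fun x a b => ?_) h2
    rcases b.lt_or_eq with b | rfl
    · exact h.2 x a b
    · exact hm
  | cons p L ih =>
    obtain ⟨m', a, b, c, d, f⟩ := h
    exact ⟨m', a, b.trans h2.lt, c, d, ih f hm h2⟩

theorem Reads.rev_aux {β : ℝ → T} {lo0 hi : ℝ} {L lo e} (acc : List (T × T)) (h : Reads β hi L lo e)
    (hacc : ∀ k, lo < k → (∀ x, lo < x → x < k → β x = e) →
      Reads (fun x => β (-x)) (-lo0) acc (-k) e) :
    RdW (fun x => β (-x)) (-hi) (-lo0) (L.foldl revStep (e, acc)) := by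
  induction L generalizing lo e acc with
  | nil => exact hacc hi h.1 h.2
  | cons p L ih =>
    obtain ⟨m, a, b, c, d, f⟩ := h
    refine ih ((p.1, e) :: acc) f ?_
    intro k hk hx
    have h1 := hacc m a c
    refine ⟨-m, by linarith, h1.lt, fun x x1 x2 => hx _ (by linarith) (by linarith), by simpa using d, h1⟩

theorem RdW.rev {β : ℝ → T} {lo hi : ℝ} {w : Wd T} (h : RdW β lo hi w) :
    RdW (fun x => β (-x)) (-hi) (-lo) (revW w) := by
  refine Reads.rev_aux [] h ?_
  intro k hk hx
  exact ⟨by linarith, fun x x1 x2 => hx _ (by linarith) (by linarith)⟩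

theorem exists_reads (L : List (T × T)) (lo hi : ℝ) (e : T) (h : lo < hi) :
    ∃ β, Reads β hi L lo e := by
  induction L generalizing lo e with
  | nil => exact ⟨fun _ => e, h, fun _ _ _ => rfl⟩
  | cons p L ih =>
    obtain ⟨m, h1, h2⟩ := exists_between h
    obtain ⟨β, hβ⟩ := ih m p.2 h2
    refine ⟨fun x => if x < m then e else if x = m then p.1 else β x, m, h1, h2, ?_, ?_, ?_⟩
    · intro x _ b; simp [b]
    · simp
    · refine hβ.congr (fun x a b => ?_)
      simp [not_lt.2 a.le, ne_of_gt a]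

theorem lettersP_append (L1 L2 : List (T × T)) : lettersP (L1 ++ L2) = lettersP L1 ++ lettersP L2 := by
  simp [lettersP]

theorem mem_letters_rev_aux (L : List (T × T)) (acc : Wd T) (t : T) :
    t ∈ letters (L.foldl revStep acc) ↔ t ∈ lettersP L ∨ t ∈ letters acc := by
  induction L generalizing acc with
  | nil => simp [lettersP]
  | cons p L ih =>
    simp only [List.foldl_cons, ih]
    simp only [revStep, letters, lettersP, List.flatMap_cons, List.mem_cons, List.mem_append,
        List.not_mem_nil, or_false]
    tauto

theorem mem_letters_rev (w : Wd T) (t : T) : t ∈ letters (revW w) ↔ t ∈ letters w := by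
  simp only [revW, mem_letters_rev_aux]
  simp only [letters, lettersP, List.flatMap_nil, List.mem_cons, List.not_mem_nil, or_false]
  tauto

theorem lastP_append (e : T) (L1 L2 : List (T × T)) : lastP e (L1 ++ L2) = lastP (lastP e L1) L2 := by
  simp [lastP]

theorem rev_fst_aux (L : List (T × T)) (acc : Wd T) : (L.foldl revStep acc).1 = lastP acc.1 L := by
  induction L generalizing acc with
  | nil => rfl
  | cons p L ih => simp only [List.foldl_cons, ih]; rfl

theorem rev_fst (w : Wd T) : (revW w).1 = lastW w := rev_fst_aux _ _

theorem rev_rev_aux (L : List (T × T)) (acc : Wd T) :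
    revW (L.foldl revStep acc) = (acc.2.foldl revStep (acc.1, L)) := by
  induction L generalizing acc with
  | nil => rfl
  | cons p L ih => simp only [List.foldl_cons, ih]; rfl

theorem rev_rev (w : Wd T) : revW (revW w) = w := by
  rw [revW, revW, ← revW, rev_rev_aux]
  rfl

theorem rev_last (w : Wd T) : lastW (revW w) = w.1 := by
  rw [← rev_fst, rev_rev]

end Words

theorem iso_glue (φ ψ : ℝ ≃o ℝ) (m : ℝ) (h : φ m = ψ m) :
    ∃ χ : ℝ ≃o ℝ, (∀ x, x ≤ m → χ x = φ x) ∧ (∀ x, m ≤ x → χ x = ψ x) := by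
  let f : ℝ → ℝ := fun x => if x ≤ m then φ x else ψ x
  have f1 : ∀ x, x ≤ m → f x = φ x := fun x hx => by simp [f, hx]
  have f2 : ∀ x, m ≤ x → f x = ψ x := fun x hx => by
    rcases hx.eq_or_lt with rfl | hx
    · simp [f, h]
    · simp [f, not_le.2 hx]
  have hm : StrictMono f := by
    intro x y hxy
    rcases le_or_gt y m with g | g
    · rw [f1 y g, f1 x (hxy.le.trans g)]; exact φ.strictMono hxy
    · rcases le_or_gt m x with k | k
      · rw [f2 y g.le, f2 x k]; exact ψ.strictMono hxy
      · rw [f1 x k.le, f2 y g.le]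
        exact (φ.strictMono k).trans (h ▸ ψ.strictMono g)
  have hs : Function.Surjective f := by
    intro z
    rcases le_or_gt z (φ m) with g | g
    · refine ⟨φ.symm z, ?_⟩
      rw [f1 _ (φ.symm_apply_le.2 g)]; simp
    · refine ⟨ψ.symm z, ?_⟩
      rw [f2 _ (ψ.le_symm_apply.2 (h ▸ g.le))]; simp
  exact ⟨hm.orderIsoOfSurjective f hs, f1, f2⟩

theorem iso_affine (a b c d : ℝ) (h : a < b) (h' : c < d) : ∃ φ : ℝ ≃o ℝ, φ a = c ∧ φ b = d := by
  have hk : 0 < (d - c) / (b - a) := div_pos (by linarith) (by linarith)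
  refine ⟨(OrderIso.mulRight₀ _ hk).trans (OrderIso.addRight (c - a * ((d - c) / (b - a)))), ?_, ?_⟩
  · simp
  · simp only [OrderIso.trans_apply, OrderIso.mulRight₀_apply, OrderIso.addRight_apply]
    have : b - a ≠ 0 := by linarith
    field_simp
    ring

theorem align {T : Type} {β β' : ℝ → T} {hi hi' : ℝ} {L : List (T × T)} {lo lo' : ℝ} {e : T}
    (h : Reads β hi L lo e) (h' : Reads β' hi' L lo' e) :
    ∃ φ : ℝ ≃o ℝ, φ lo = lo' ∧ φ hi = hi' ∧ ∀ x, lo < x → x < hi → β x = β' (φ x) := by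
  induction L generalizing lo lo' e with
  | nil =>
    obtain ⟨φ, h1, h2⟩ := iso_affine lo hi lo' hi' h.1 h'.1
    refine ⟨φ, h1, h2, fun x a b => ?_⟩
    rw [h.2 x a b, h'.2 _ (h1 ▸ φ.strictMono a) (h2 ▸ φ.strictMono b)]
  | cons p L ih =>
    obtain ⟨m, a, b, c, d, f⟩ := h
    obtain ⟨m', a', b', c', d', f'⟩ := h'
    obtain ⟨φ, h1, h2⟩ := iso_affine lo m lo' m' a a'
    obtain ⟨ψ, k1, k2, k3⟩ := ih f f'
    obtain ⟨χ, x1, x2⟩ := iso_glue φ ψ m (h2.trans k1.symm)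
    refine ⟨χ, by rw [x1 _ a.le, h1], by rw [x2 _ b.le, k2], fun x u v => ?_⟩
    rcases lt_trichotomy x m with g | rfl | g
    · rw [x1 x g.le, c x u g, c' _ (h1 ▸ φ.strictMono u) (h2 ▸ φ.strictMono g)]
    · rw [d, x1 _ le_rfl, h2, d']
    · rw [x2 x g.le]; exact k3 x g v

end Temporal

namespace Temporal

variable {T : Type}

abbrev Tile (T : Type) := (T × T × T × T) × (Wd T × Wd T × Wd T × Wd T)

namespace Tile
def mk' (ll lr ul ur : T) (wl wr wb wt : Wd T) : Tile T := ((ll, lr, ul, ur), (wl, wr, wb, wt))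
def ll (τ : Tile T) : T := τ.1.1
def lr (τ : Tile T) : T := τ.1.2.1
def ul (τ : Tile T) : T := τ.1.2.2.1
def ur (τ : Tile T) : T := τ.1.2.2.2
def wl (τ : Tile T) : Wd T := τ.2.1
def wr (τ : Tile T) : Wd T := τ.2.2.1
def wb (τ : Tile T) : Wd T := τ.2.2.2.1
def wt (τ : Tile T) : Wd T := τ.2.2.2.2
def swp (τ : Tile T) : Tile T := mk' τ.ll τ.ul τ.lr τ.ur τ.wb τ.wt τ.wl τ.wr
def dual (τ : Tile T) : Tile T :=
  mk' τ.ur τ.lr τ.ul τ.ll (revW τ.wt) (revW τ.wb) (revW τ.wr) (revW τ.wl)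
end Tile

structure IsTile (f : ℝ → ℝ → T) (x0 x1 y0 y1 : ℝ) (τ : Tile T) : Prop where
  hx : x0 < x1
  hy : y0 < y1
  ll : f x0 y0 = τ.ll
  lr : f x1 y0 = τ.lr
  ul : f x0 y1 = τ.ul
  ur : f x1 y1 = τ.ur
  wl : RdW (fun y => f x0 y) y0 y1 τ.wl
  wr : RdW (fun y => f x1 y) y0 y1 τ.wr
  wb : RdW (fun x => f x y0) x0 x1 τ.wb
  wt : RdW (fun x => f x y1) x0 x1 τ.wt

def DemF (S : Sys T) (f : ℝ → ℝ → T) (x0 x1 y0 y1 : ℝ) : Prop :=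
  ∀ i < S.N, ∀ x y, x0 ≤ x → x < x1 → y0 ≤ y → y < y1 → S.nF i (f x y) →
    ∃ x' y', x ≤ x' ∧ x' ≤ x1 ∧ y ≤ y' ∧ y' ≤ y1 ∧ ¬ (x' = x ∧ y' = y) ∧
      (S.w i (f x' y') ∨ ((x' = x1 ∨ y' = y1) ∧ S.nF i (f x' y')))

def flp (f : ℝ → ℝ → T) : ℝ → ℝ → T := fun x y => f (-y) (-x)
def swf (f : ℝ → ℝ → T) : ℝ → ℝ → T := fun x y => f y x

@[simp] theorem flp_flp (f : ℝ → ℝ → T) : flp (flp f) = f := by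
  funext x y; simp [flp]

def CohH (S : Sys T) (f : ℝ → ℝ → T) (x0 x1 y0 y1 : ℝ) : Prop :=
  ∀ x x' y, x0 ≤ x → x < x' → x' ≤ x1 → y0 ≤ y → y ≤ y1 → S.le (f x y) (f x' y)

structure Good (S : Sys T) (f : ℝ → ℝ → T) (x0 x1 y0 y1 : ℝ) : Prop where
  cohH : CohH S f x0 x1 y0 y1
  cohV : CohH S (swf f) y0 y1 x0 x1
  real : ∀ x y, x0 < x → x < x1 → y0 < y → y < y1 → S.rl (f x y)
  demF : DemF S f x0 x1 y0 y1
  demP : DemF S.op (flp f) (-y1) (-y0) (-x1) (-x0)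

theorem DemF.swap {S : Sys T} {f : ℝ → ℝ → T} {x0 x1 y0 y1 : ℝ} (h : DemF S f x0 x1 y0 y1) :
    DemF S (swf f) y0 y1 x0 x1 := by
  intro i hi x y a b c d e
  obtain ⟨x', y', h1, h2, h3, h4, h5, h6⟩ := h i hi y x c d a b e
  exact ⟨y', x', h3, h4, h1, h2, fun h => h5 ⟨h.2, h.1⟩, by
    rcases h6 with h6 | h6
    · exact Or.inl h6
    · exact Or.inr ⟨h6.1.symm, h6.2⟩⟩

theorem Good.swap {S : Sys T} {f : ℝ → ℝ → T} {x0 x1 y0 y1 : ℝ} (h : Good S f x0 x1 y0 y1) :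
    Good S (swf f) y0 y1 x0 x1 :=
  ⟨h.cohV, h.cohH, fun x y a b c d => h.real y x c d a b, h.demF.swap, h.demP.swap⟩

theorem CohH.flp {S : Sys T} {f : ℝ → ℝ → T} {x0 x1 y0 y1 : ℝ} (h : CohH S f x0 x1 y0 y1) :
    CohH S.op (swf (flp f)) (-x1) (-x0) (-y1) (-y0) := by
  intro x x' y a b c d e
  exact h (-x') (-x) (-y) (by linarith) (by linarith) (by linarith) (by linarith) (by linarith)

theorem Good.dual {S : Sys T} {f : ℝ → ℝ → T} {x0 x1 y0 y1 : ℝ} (h : Good S f x0 x1 y0 y1) :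
    Good S.op (Temporal.flp f) (-y1) (-y0) (-x1) (-x0) := by
  refine ⟨h.cohV.flp, h.cohH.flp, fun x y a b c d => ?_, h.demP, ?_⟩
  · exact h.real (-y) (-x) (by linarith) (by linarith) (by linarith) (by linarith)
  · simp only [flp_flp, neg_neg]; exact h.demF

theorem IsTile.swap {f : ℝ → ℝ → T} {x0 x1 y0 y1 : ℝ} {τ : Tile T} (h : IsTile f x0 x1 y0 y1 τ) :
    IsTile (swf f) y0 y1 x0 x1 τ.swp :=
  ⟨h.hy, h.hx, h.ll, h.ul, h.lr, h.ur, h.wb, h.wt, h.wl, h.wr⟩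

@[simp] theorem dual_ll (τ : Tile T) : τ.dual.ll = τ.ur := rfl
@[simp] theorem dual_lr (τ : Tile T) : τ.dual.lr = τ.lr := rfl
@[simp] theorem dual_ul (τ : Tile T) : τ.dual.ul = τ.ul := rfl
@[simp] theorem dual_ur (τ : Tile T) : τ.dual.ur = τ.ll := rfl
@[simp] theorem dual_wl (τ : Tile T) : τ.dual.wl = revW τ.wt := rfl
@[simp] theorem dual_wr (τ : Tile T) : τ.dual.wr = revW τ.wb := rfl
@[simp] theorem dual_wb (τ : Tile T) : τ.dual.wb = revW τ.wr := rfl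
@[simp] theorem dual_wt (τ : Tile T) : τ.dual.wt = revW τ.wl := rfl

theorem IsTile.dual {f : ℝ → ℝ → T} {x0 x1 y0 y1 : ℝ} {τ : Tile T} (h : IsTile f x0 x1 y0 y1 τ) :
    IsTile (flp f) (-y1) (-y0) (-x1) (-x0) τ.dual := by
  constructor
  · have := h.hy; linarith
  · have := h.hx; linarith
  · simpa [flp] using h.ur
  · simpa [flp] using h.lr
  · simpa [flp] using h.ul
  · simpa [flp] using h.ll
  · simpa [flp] using h.wt.rev
  · simpa [flp] using h.wb.rev
  · simpa [flp] using h.wr.rev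
  · simpa [flp] using h.wl.rev

theorem swp_swp (τ : Tile T) : τ.swp.swp = τ := rfl
theorem dual_dual (τ : Tile T) : τ.dual.dual = τ := by
  simp only [Tile.dual, Tile.mk', Tile.ll, Tile.lr, Tile.ul, Tile.ur, Tile.wl, Tile.wr, Tile.wb,
    Tile.wt, rev_rev]

theorem DemF.congr {S : Sys T} {f g : ℝ → ℝ → T} {x0 x1 y0 y1 : ℝ} (h : DemF S f x0 x1 y0 y1)
    (hfg : ∀ x y, x0 ≤ x → x ≤ x1 → y0 ≤ y → y ≤ y1 → f x y = g x y) : DemF S g x0 x1 y0 y1 := by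
  intro i hi x y a b c d e
  rw [← hfg x y a b.le c d.le] at e
  obtain ⟨x', y', h1, h2, h3, h4, h5, h6⟩ := h i hi x y a b c d e
  rw [hfg x' y' (a.trans h1) h2 (c.trans h3) h4] at h6
  exact ⟨x', y', h1, h2, h3, h4, h5, h6⟩

theorem Good.congr {S : Sys T} {f g : ℝ → ℝ → T} {x0 x1 y0 y1 : ℝ} (h : Good S f x0 x1 y0 y1)
    (hfg : ∀ x y, x0 ≤ x → x ≤ x1 → y0 ≤ y → y ≤ y1 → f x y = g x y) : Good S g x0 x1 y0 y1 := by
  refine ⟨fun x x' y a b c d e => ?_, fun x x' y a b c d e => ?_, fun x y a b c d => ?_,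
    h.demF.congr hfg, h.demP.congr (fun x y a b c d => ?_)⟩
  · rw [← hfg x y a (b.le.trans c) d e, ← hfg x' y (a.trans b.le) c d e]; exact h.cohH x x' y a b c d e
  · show S.le (g y x) (g y x')
    rw [← hfg y x d e a (b.le.trans c), ← hfg y x' d e (a.trans b.le) c]; exact h.cohV x x' y a b c d e
  · rw [← hfg x y a.le b.le c.le d.le]; exact h.real x y a b c d
  · exact hfg _ _ (by linarith) (by linarith) (by linarith) (by linarith)

theorem DemF.rescale {S : Sys T} {f : ℝ → ℝ → T} {x0 x1 y0 y1 : ℝ} (φ ψ : ℝ ≃o ℝ)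
    (h : DemF S f (φ x0) (φ x1) (ψ y0) (ψ y1)) :
    DemF S (fun x y => f (φ x) (ψ y)) x0 x1 y0 y1 := by
  intro i hi x y a b c d e
  obtain ⟨x', y', h1, h2, h3, h4, h5, h6⟩ := h i hi (φ x) (ψ y) (φ.le_iff_le.2 a) (φ.lt_iff_lt.2 b)
    (ψ.le_iff_le.2 c) (ψ.lt_iff_lt.2 d) e
  obtain ⟨x', rfl⟩ := φ.surjective x'
  obtain ⟨y', rfl⟩ := ψ.surjective y'
  simp only [map_le_map_iff, EmbeddingLike.apply_eq_iff_eq] at *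
  exact ⟨x', y', h1, h2, h3, h4, h5, h6⟩

def negIso (φ : ℝ ≃o ℝ) : ℝ ≃o ℝ where
  toFun x := -φ (-x)
  invFun x := -φ.symm (-x)
  left_inv x := by simp
  right_inv x := by simp
  map_rel_iff' := by intro a b; simp

@[simp] theorem negIso_apply (φ : ℝ ≃o ℝ) (x : ℝ) : negIso φ x = -φ (-x) := rfl

theorem Good.rescale {S : Sys T} {f : ℝ → ℝ → T} {x0 x1 y0 y1 : ℝ} (φ ψ : ℝ ≃o ℝ)
    (h : Good S f (φ x0) (φ x1) (ψ y0) (ψ y1)) :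
    Good S (fun x y => f (φ x) (ψ y)) x0 x1 y0 y1 := by
  refine ⟨fun x x' y a b c d e => ?_, fun x x' y a b c d e => ?_, fun x y a b c d => ?_,
    h.demF.rescale, ?_⟩
  · exact h.cohH _ _ _ (φ.monotone a) (φ.strictMono b) (φ.monotone c) (ψ.monotone d) (ψ.monotone e)
  · exact h.cohV _ _ _ (ψ.monotone a) (ψ.strictMono b) (ψ.monotone c) (φ.monotone d) (φ.monotone e)
  · exact h.real _ _ (φ.strictMono a) (φ.strictMono b) (ψ.strictMono c) (ψ.strictMono d)
  · have h1 := h.demP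
    have h2 : DemF S.op (Temporal.flp f) (negIso ψ (-y1)) (negIso ψ (-y0)) (negIso φ (-x1)) (negIso φ (-x0)) := by
      simpa using h1
    have h3 := h2.rescale
    simp only [negIso_apply, Temporal.flp, neg_neg] at h3
    exact h3

theorem IsTile.rescale {f : ℝ → ℝ → T} {x0 x1 y0 y1 : ℝ} {τ : Tile T} (φ ψ : ℝ ≃o ℝ)
    (h : IsTile f (φ x0) (φ x1) (ψ y0) (ψ y1) τ) :
    IsTile (fun x y => f (φ x) (ψ y)) x0 x1 y0 y1 τ :=
  ⟨φ.lt_iff_lt.1 h.hx, ψ.lt_iff_lt.1 h.hy, h.ll, h.lr, h.ul, h.ur, Reads.comp ψ h.wl, Reads.comp ψ h.wr,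
    Reads.comp φ h.wb, Reads.comp φ h.wt⟩

theorem RdW.congr {β β' : ℝ → T} {lo hi : ℝ} {w : Wd T} (h : RdW β lo hi w)
    (hb : ∀ x, lo < x → x < hi → β x = β' x) : RdW β' lo hi w := Reads.congr h hb

theorem IsTile.congr {f g : ℝ → ℝ → T} {x0 x1 y0 y1 : ℝ} {τ : Tile T} (h : IsTile f x0 x1 y0 y1 τ)
    (hfg : ∀ x y, x0 ≤ x → x ≤ x1 → y0 ≤ y → y ≤ y1 → f x y = g x y) : IsTile g x0 x1 y0 y1 τ := by
  have hx := h.hx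
  have hy := h.hy
  refine ⟨hx, hy, ?_, ?_, ?_, ?_, h.wl.congr ?_, h.wr.congr ?_, h.wb.congr ?_, h.wt.congr ?_⟩
  · rw [← hfg _ _ le_rfl hx.le le_rfl hy.le]; exact h.ll
  · rw [← hfg _ _ hx.le le_rfl le_rfl hy.le]; exact h.lr
  · rw [← hfg _ _ le_rfl hx.le hy.le le_rfl]; exact h.ul
  · rw [← hfg _ _ hx.le le_rfl hy.le le_rfl]; exact h.ur
  · exact fun x a b => hfg _ _ le_rfl hx.le a.le b.le
  · exact fun x a b => hfg _ _ hx.le le_rfl a.le b.le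
  · exact fun x a b => hfg _ _ a.le b.le le_rfl hy.le
  · exact fun x a b => hfg _ _ a.le b.le hy.le le_rfl

theorem DemF.glueV {S : Sys T} {f : ℝ → ℝ → T} {x0 m x1 y0 y1 : ℝ} (hm : m < x1)
    (h1 : DemF S f x0 m y0 y1) (h2 : DemF S f m x1 y0 y1) : DemF S f x0 x1 y0 y1 := by
  intro i hi x y a b c d e
  rcases lt_or_ge x m with g | g
  · obtain ⟨x', y', k1, k2, k3, k4, k5, k6⟩ := h1 i hi x y a g c d e
    have base : (S.w i (f x' y') ∨ ((x' = x1 ∨ y' = y1) ∧ S.nF i (f x' y'))) →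
        ∃ x' y', x ≤ x' ∧ x' ≤ x1 ∧ y ≤ y' ∧ y' ≤ y1 ∧ ¬ (x' = x ∧ y' = y) ∧
      (S.w i (f x' y') ∨ ((x' = x1 ∨ y' = y1) ∧ S.nF i (f x' y'))) :=
      fun hh => ⟨x', y', k1, k2.trans hm.le, k3, k4, k5, hh⟩
    rcases k6 with k6 | ⟨k6 | k6, k7⟩
    · exact base (Or.inl k6)
    · subst k6
      rcases k4.lt_or_eq with k4 | k4
      · obtain ⟨x'', y'', l1, l2, l3, l4, l5, l6⟩ := h2 i hi x' y' le_rfl hm (c.trans k3) k4 k7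
        exact ⟨x'', y'', k1.trans l1, l2, k3.trans l3, l4, fun hh => by linarith [hh.1], l6⟩
      · exact base (Or.inr ⟨Or.inr k4, k7⟩)
    · exact base (Or.inr ⟨Or.inr k6, k7⟩)
  · exact h2 i hi x y g b c d e

theorem DemF.glueH {S : Sys T} {f : ℝ → ℝ → T} {x0 m x1 y0 y1 : ℝ} (hm : m < y1)
    (h1 : DemF S f x0 x1 y0 m) (h2 : DemF S f x0 x1 m y1) : DemF S f x0 x1 y0 y1 :=
  (DemF.glueV hm h1.swap h2.swap).swap

theorem CohH.glueV {S : Sys T} (hS : S.Lawful) {f : ℝ → ℝ → T} {x0 m x1 y0 y1 : ℝ}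
    (h1 : CohH S f x0 m y0 y1) (h2 : CohH S f m x1 y0 y1) : CohH S f x0 x1 y0 y1 := by
  intro x x' y a b c d e
  rcases le_or_gt x' m with g | g
  · exact h1 x x' y a b g d e
  · rcases lt_or_ge x m with k | k
    · exact hS.trans _ _ _ (h1 x m y a k le_rfl d e) (h2 m x' y le_rfl g c d e)
    · exact h2 x x' y k b c d e

theorem Good.glueV {S : Sys T} (hS : S.Lawful) {f : ℝ → ℝ → T} {x0 m x1 y0 y1 : ℝ} (h0 : x0 < m) (hm : m < x1)
    (h1 : Good S f x0 m y0 y1) (h2 : Good S f m x1 y0 y1)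
    (hr : ∀ y, y0 < y → y < y1 → S.rl (f m y)) : Good S f x0 x1 y0 y1 := by
  refine ⟨h1.cohH.glueV hS h2.cohH, ?_, ?_, h1.demF.glueV hm h2.demF,
    h2.demP.glueH (by linarith) h1.demP⟩
  · intro y y' x a b c d e
    rcases le_or_gt x m with g | g
    · exact h1.cohV y y' x a b c d g
    · exact h2.cohV y y' x a b c g.le e
  · intro x y a b c d
    rcases lt_trichotomy x m with g | rfl | g
    · exact h1.real x y a g c d
    · exact hr y c d
    · exact h2.real x y g b c d

def Join (w1 : Wd T) (m : T) (w2 w : Wd T) : Prop :=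
  w = (w1.1, w1.2 ++ (m, w2.1) :: w2.2) ∨ (lastW w1 = m ∧ w2.1 = m ∧ w = (w1.1, w1.2 ++ w2.2))

theorem RdW.join {β : ℝ → T} {lo m hi : ℝ} {w1 w2 w : Wd T} {t : T} (h1 : RdW β lo m w1)
    (h2 : RdW β m hi w2) (hm : β m = t) (hj : Join w1 t w2 w) : RdW β lo hi w := by
  rcases hj with rfl | ⟨h3, h4, rfl⟩
  · exact Reads.app h1 hm h2
  · refine Reads.app' h1 (hm.trans h3.symm) ?_
    have : lastP w1.1 w1.2 = w2.1 := h3.trans h4.symm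
    rw [this]; exact h2

def Suf (C : T → T → List (T × T) → Prop) : List (T × T) → Prop
  | [] => True
  | p :: L => C p.1 p.2 L ∧ Suf C L

def Chn (S : Sys T) (q : T) (L : List (T × T)) : Prop :=
  Suf (fun t e L => S.le t e ∧ S.le e e ∧ (∀ p ∈ L, S.le e p.1) ∧ S.le e q) L

def LineF (S : Sys T) (i : ℕ) (fb : Prop) (q : T) (L : List (T × T)) : Prop :=
  Suf (fun t e L => (S.nF i t ∨ S.nF i e) →
    S.w i e ∨ (∃ p ∈ L, S.w i p.1 ∨ S.w i p.2) ∨ S.w i q ∨ fb) L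

/-- lower-left half of the constant-interior rule -/
structure TrivF (S : Sys T) (τ : Tile T) (c : T) : Prop where
  chL : Chn S τ.ul ((τ.ll, τ.wl.1) :: τ.wl.2)
  chB : Chn S τ.lr ((τ.ll, τ.wb.1) :: τ.wb.2)
  leL : ∀ t ∈ letters τ.wl, S.le t c
  leB : ∀ t ∈ letters τ.wb, S.le t c
  liL : ∀ i < S.N, LineF S i (S.nF i τ.ul ∨ S.gF i c) τ.ul ((τ.wl.1, τ.wl.1) :: τ.wl.2)
  liB : ∀ i < S.N, LineF S i (S.nF i τ.lr ∨ S.gF i c) τ.lr ((τ.wb.1, τ.wb.1) :: τ.wb.2)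
  co : ∀ i < S.N, S.nF i τ.ll → (∃ t ∈ letters τ.wl, S.w i t) ∨ (∃ t ∈ letters τ.wb, S.w i t) ∨
    S.gF i τ.ul ∨ S.gF i τ.lr ∨ S.gF i c
  ce : ∀ i < S.N, S.nF i c → S.w i c ∨ S.gF i τ.ur ∨ S.gF i (lastW τ.wt) ∨ S.gF i (lastW τ.wr)

def RuleTriv (S : Sys T) (U : List T) (τ : Tile T) : Prop :=
  ∃ c ∈ U, S.rl c ∧ S.le c c ∧ TrivF S τ c ∧ TrivF S.op τ.dual c

def RuleCut (S : Sys T) (R : Tile T → Prop) (τ : Tile T) : Prop :=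
  ∃ τ1, R τ1 ∧ ∃ τ2, R τ2 ∧ τ1.wr = τ2.wl ∧ τ1.lr = τ2.ll ∧ τ1.ur = τ2.ul ∧
    τ.ll = τ1.ll ∧ τ.ul = τ1.ul ∧ τ.wl = τ1.wl ∧ τ.lr = τ2.lr ∧ τ.ur = τ2.ur ∧ τ.wr = τ2.wr ∧
    Join τ1.wb τ1.lr τ2.wb τ.wb ∧ Join τ1.wt τ1.ur τ2.wt τ.wt ∧ ∀ t ∈ letters τ1.wr, S.rl t

/-- half of the side conditions for the loop rule -/
def LoopF (S : Sys T) (τ : Tile T) : Prop :=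
  S.le τ.ll τ.ul ∧ ∀ i < S.N, S.nF i τ.ll → S.w i τ.ll ∨ S.gF i τ.ul ∨ S.gF i τ.ur ∨ S.nF i τ.wb.1

def RuleLoop (S : Sys T) (R : Tile T → Prop) (τ : Tile T) : Prop :=
  τ.wl = (τ.ll, []) ∧ τ.wt = (τ.ur, []) ∧ ∃ C, R C ∧
    R (Tile.mk' τ.ll τ.wb.1 τ.ll τ.lr (τ.ll, []) C.wl (τ.wb.1, []) τ.wb) ∧
    R (Tile.mk' τ.lr (lastW τ.wr) τ.ur τ.ur τ.wr (lastW τ.wr, []) C.wt (τ.ur, [])) ∧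
    C = Tile.mk' τ.wb.1 τ.lr τ.lr (lastW τ.wr) C.wl τ.wr τ.wb C.wt ∧
    S.rl τ.lr ∧ (∀ t ∈ letters τ.wb, S.rl t) ∧ (∀ t ∈ letters τ.wr, S.rl t) ∧
    (∀ t ∈ letters C.wl, S.rl t) ∧ (∀ t ∈ letters C.wt, S.rl t) ∧ LoopF S τ ∧ LoopF S.op τ.dual

def PtItem (S : Sys T) (a b t : T) : Prop :=
  S.le a t ∧ S.le t b ∧ S.rl t ∧ ∀ i < S.N, (S.nF i t → S.gF i b) ∧ (S.nP i t → S.gP i a)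

/-- forward condition for an edge (p, w, q) inside the `a`/`b` background -/
def EdgeF (S : Sys T) (b p : T) (w : Wd T) (q : T) : Prop :=
  ∀ i < S.N, LineF S i (S.gF i b) q ((p, w.1) :: w.2) ∧ (S.nF i q → S.gF i b)

def SegItem (S : Sys T) (a b p : T) (w : Wd T) (q : T) : Prop :=
  Chn S q ((p, w.1) :: w.2) ∧ S.le a p ∧ S.le q b ∧ S.rl p ∧ S.rl q ∧ (∀ t ∈ letters w, S.rl t) ∧
    EdgeF S b p w q ∧ EdgeF S.op a q (revW w) p

def BoxItem (S : Sys T) (R : Tile T → Prop) (a b : T) (τ : Tile T) : Prop :=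
  R τ ∧ S.le a τ.ll ∧ S.le τ.ur b ∧ S.rl τ.ll ∧ S.rl τ.lr ∧ S.rl τ.ul ∧ S.rl τ.ur ∧
    (∀ t ∈ letters τ.wl, S.rl t) ∧ (∀ t ∈ letters τ.wr, S.rl t) ∧
    (∀ t ∈ letters τ.wb, S.rl t) ∧ (∀ t ∈ letters τ.wt, S.rl t) ∧
    EdgeF S b τ.ul τ.wt τ.ur ∧ EdgeF S b τ.lr τ.wr τ.ur ∧
    EdgeF S.op a τ.ul (revW τ.wl) τ.ll ∧ EdgeF S.op a τ.lr (revW τ.wb) τ.ll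

def IsItem (S : Sys T) (W : List (Wd T)) (R : Tile T → Prop) (a b p q : T) : Prop :=
  (p = q ∧ PtItem S a b p) ∨ (∃ w ∈ W, SegItem S a b p w q) ∨
    (∃ τ, BoxItem S R a b τ ∧ p = τ.ll ∧ q = τ.ur)

def RuleShuf (S : Sys T) (U : List T) (W : List (Wd T)) (R : Tile T → Prop) (τ : Tile T) : Prop :=
  τ.wl = (τ.ll, []) ∧ τ.wb = (τ.ll, []) ∧ τ.wt = (τ.ur, []) ∧ τ.wr = (τ.ur, []) ∧
  S.rl τ.ll ∧ S.rl τ.ur ∧ S.le τ.ll τ.ll ∧ S.le τ.ur τ.ur ∧ S.le τ.ll τ.ur ∧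
  S.le τ.ll τ.ul ∧ S.le τ.ll τ.lr ∧ S.le τ.ul τ.ur ∧ S.le τ.lr τ.ur ∧
  (∃ t ∈ U, PtItem S τ.ll τ.ur t) ∧
  (∀ i < S.N, (S.nF i τ.ll → S.w i τ.ll ∨ S.gF i τ.ur ∨
      ∃ p ∈ U, ∃ q ∈ U, IsItem S W R τ.ll τ.ur p q ∧ S.gF i p) ∧
    (S.nP i τ.ur → S.w i τ.ur ∨ S.gP i τ.ll ∨
      ∃ p ∈ U, ∃ q ∈ U, IsItem S W R τ.ll τ.ur p q ∧ S.gP i q))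

def Step (S : Sys T) (U : List T) (W : List (Wd T)) (R : Tile T → Prop) (τ : Tile T) : Prop :=
  RuleTriv S U τ ∨ RuleCut S R τ ∨ R τ.swp ∨ RuleLoop S R τ ∨ RuleShuf S U W R τ

theorem Step.mono {S : Sys T} {U : List T} {W : List (Wd T)} {R R' : Tile T → Prop}
    (h : ∀ τ, R τ → R' τ) {τ : Tile T} (hs : Step S U W R τ) : Step S U W R' τ := by
  have hI : ∀ a b p q, IsItem S W R a b p q → IsItem S W R' a b p q := by
    intro a b p q hi
    rcases hi with hi | hi | ⟨σ, hi, hi'⟩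
    · exact Or.inl hi
    · exact Or.inr (Or.inl hi)
    · exact Or.inr (Or.inr ⟨σ, ⟨h _ hi.1, hi.2⟩, hi'⟩)
  rcases hs with hs | ⟨τ1, h1, τ2, h2, hs⟩ | hs | ⟨h1, h2, C, h3, h4, h5, hs⟩ | hs
  · exact Or.inl hs
  · exact Or.inr (Or.inl ⟨τ1, h _ h1, τ2, h _ h2, hs⟩)
  · exact Or.inr (Or.inr (Or.inl (h _ hs)))
  · exact Or.inr (Or.inr (Or.inr (Or.inl ⟨h1, h2, C, h _ h3, h _ h4, h _ h5, hs⟩)))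
  · refine Or.inr (Or.inr (Or.inr (Or.inr ?_)))
    obtain ⟨a1, a2, a3, a4, a5, a6, a7, a8, a9, b1, b2, b3, b4, b5, b6⟩ := hs
    refine ⟨a1, a2, a3, a4, a5, a6, a7, a8, a9, b1, b2, b3, b4, b5, fun i hi => ⟨fun hn => ?_, fun hn => ?_⟩⟩
    · rcases (b6 i hi).1 hn with c | c | ⟨p, hp, q, hq, c, d⟩
      · exact Or.inl c
      · exact Or.inr (Or.inl c)
      · exact Or.inr (Or.inr ⟨p, hp, q, hq, hI _ _ _ _ c, d⟩)
    · rcases (b6 i hi).2 hn with c | c | ⟨p, hp, q, hq, c, d⟩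
      · exact Or.inl c
      · exact Or.inr (Or.inl c)
      · exact Or.inr (Or.inr ⟨p, hp, q, hq, hI _ _ _ _ c, d⟩)

def Fill (S : Sys T) (τ : Tile T) : Prop :=
  ∃ f x0 x1 y0 y1, IsTile f x0 x1 y0 y1 τ ∧ Good S f x0 x1 y0 y1

end Temporal

namespace Temporal

variable {T : Type}

theorem Reads.attP {β : ℝ → T} {hi : ℝ} {L lo e} (h : Reads β hi L lo e) {p : T × T} (hp : p ∈ L) :
    (∃ x, lo < x ∧ x < hi ∧ β x = p.1) ∧ (∃ x, lo < x ∧ x < hi ∧ β x = p.2) := by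
  constructor <;> apply h.att <;> simp only [letters, lettersP, List.mem_cons, List.mem_flatMap] <;>
    exact Or.inr ⟨p, hp, by simp⟩

theorem LineF.start {S : Sys T} {i : ℕ} {fb : Prop} {q : T} {β : ℝ → T} {lo hi : ℝ} {L e t}
    (h : Reads β hi L lo e) (hl : LineF S i fb q ((t, e) :: L)) (hn : S.nF i t) :
    (∃ y', lo < y' ∧ y' < hi ∧ S.w i (β y')) ∨ S.w i q ∨ fb := by
  rcases hl.1 (Or.inl hn) with k | ⟨p, hp, k | k⟩ | k | k
  · obtain ⟨x, a, b, c⟩ := h.att (t := e) (by simp [letters])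
    exact Or.inl ⟨x, a, b, by rw [c]; exact k⟩
  · obtain ⟨x, a, b, c⟩ := (h.attP hp).1
    exact Or.inl ⟨x, a, b, by rw [c]; exact k⟩
  · obtain ⟨x, a, b, c⟩ := (h.attP hp).2
    exact Or.inl ⟨x, a, b, by rw [c]; exact k⟩
  · exact Or.inr (Or.inl k)
  · exact Or.inr (Or.inr k)

theorem LineF.sound {S : Sys T} {i : ℕ} {fb : Prop} {q : T} {β : ℝ → T} {lo hi : ℝ} {L e t}
    (h : Reads β hi L lo e) (hl : LineF S i fb q ((t, e) :: L)) {y : ℝ} (h1 : lo < y) (h2 : y < hi)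
    (hn : S.nF i (β y)) :
    (∃ y', y < y' ∧ y' < hi ∧ S.w i (β y')) ∨ S.w i q ∨ fb := by
  induction L generalizing lo e t with
  | nil =>
    rw [h.2 y h1 h2] at hn
    rcases hl.1 (Or.inr hn) with k | ⟨p, hp, k⟩ | k | k
    · obtain ⟨x, a, b⟩ := exists_between h2
      exact Or.inl ⟨x, a, b, by rw [h.2 x (h1.trans a) b]; exact k⟩
    · simp at hp
    · exact Or.inr (Or.inl k)
    · exact Or.inr (Or.inr k)
  | cons p L ih =>
    have h' := h
    obtain ⟨m, a, b, c, d, f⟩ := h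
    rcases lt_trichotomy y m with g | g | g
    · rw [c y h1 g] at hn
      rcases hl.1 (Or.inr hn) with k | ⟨p', hp, k⟩ | k | k
      · obtain ⟨x, x1, x2⟩ := exists_between g
        exact Or.inl ⟨x, x1, x2.trans b, by rw [c x (h1.trans x1) x2]; exact k⟩
      · have key : (∃ x, m ≤ x ∧ x < hi ∧ β x = p'.1) ∧ (∃ x, m ≤ x ∧ x < hi ∧ β x = p'.2) := by
          rcases List.mem_cons.1 hp with rfl | hp
          · obtain ⟨x, x1, x2, x3⟩ := f.att (t := p'.2) (by simp [letters])
            exact ⟨⟨m, le_rfl, b, d⟩, ⟨x, x1.le, x2, x3⟩⟩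
          · obtain ⟨⟨x, x1, x2, x3⟩, ⟨z, z1, z2, z3⟩⟩ := f.attP hp
            exact ⟨⟨x, x1.le, x2, x3⟩, ⟨z, z1.le, z2, z3⟩⟩
        rcases k with k | k
        · obtain ⟨x, x1, x2, x3⟩ := key.1
          exact Or.inl ⟨x, g.trans_le x1, x2, by rw [x3]; exact k⟩
        · obtain ⟨x, x1, x2, x3⟩ := key.2
          exact Or.inl ⟨x, g.trans_le x1, x2, by rw [x3]; exact k⟩
      · exact Or.inr (Or.inl k)
      · exact Or.inr (Or.inr k)
    · subst g
      rw [d] at hn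
      exact LineF.start f hl.2 hn
    · exact ih f hl.2 g

theorem Chn.sound {S : Sys T} (hS : S.Lawful) {q : T} {β : ℝ → T} {lo hi : ℝ} {L e t}
    (h : Reads β hi L lo e) (hl : Chn S q ((t, e) :: L)) :
    (∀ x, lo < x → x < hi → S.le t (β x) ∧ S.le (β x) q) ∧
    (∀ x x', lo < x → x < x' → x' < hi → S.le (β x) (β x')) ∧ S.le t q := by
  induction L generalizing lo e t with
  | nil =>
    obtain ⟨⟨a, b, c, d⟩, _⟩ := hl
    refine ⟨fun x u v => ?_, fun x x' u v s => ?_, hS.trans _ _ _ a d⟩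
    · rw [h.2 x u v]; exact ⟨a, d⟩
    · rw [h.2 x u (v.trans s), h.2 x' (u.trans v) s]; exact b
  | cons p L ih =>
    obtain ⟨⟨a, b, c, d⟩, hl2⟩ := hl
    obtain ⟨m, ha, hb, hc, hd, f⟩ := h
    obtain ⟨i1, i2, i3⟩ := ih f hl2
    have ep : S.le e p.1 := c p (by simp)
    have key : ∀ x, m ≤ x → x < hi → S.le p.1 (β x) ∨ β x = p.1 := by
      intro x u v
      rcases u.eq_or_lt with rfl | u
      · exact Or.inr hd
      · exact Or.inl (i1 x u v).1
    have key2 : ∀ x, m ≤ x → x < hi → S.le e (β x) := by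
      intro x u v
      rcases key x u v with k | k
      · exact hS.trans _ _ _ ep k
      · rw [k]; exact ep
    refine ⟨fun x u v => ?_, fun x x' u v s => ?_, hS.trans _ _ _ a d⟩
    · rcases lt_trichotomy x m with g | rfl | g
      · rw [hc x u g]; exact ⟨a, d⟩
      · exact ⟨hS.trans _ _ _ a (key2 x le_rfl v), by rw [hd]; exact i3⟩
      · exact ⟨hS.trans _ _ _ a (key2 x g.le v), (i1 x g v).2⟩
    · rcases lt_trichotomy x m with g | g | g
      · rw [hc x u g]
        rcases lt_or_ge x' m with k | k
        · rw [hc x' (u.trans v) k]; exact b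
        · exact key2 x' k s
      · subst g; rw [hd]; exact (i1 x' v s).1
      · exact i2 x x' g v s

theorem Chn.sound' {S : Sys T} (hS : S.Lawful) {q : T} {β : ℝ → T} {lo hi : ℝ} {w : Wd T} {t}
    (h : RdW β lo hi w) (hl : Chn S q ((t, w.1) :: w.2)) (h1 : β lo = t) (h2 : β hi = q) (x x' : ℝ)
    (a : lo ≤ x) (b : x < x') (c : x' ≤ hi) : S.le (β x) (β x') := by
  obtain ⟨k1, k2, k3⟩ := Chn.sound hS h hl
  rcases a.eq_or_lt with rfl | a
  · rw [h1]
    rcases c.eq_or_lt with rfl | c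
    · rw [h2]; exact k3
    · exact (k1 _ b c).1
  · rcases c.eq_or_lt with rfl | c
    · rw [h2]; exact (k1 _ a b).2
    · exact k2 x x' a b c

theorem TrivF.coh {S : Sys T} (hS : S.Lawful) {f : ℝ → ℝ → T} {x0 x1 y0 y1 : ℝ} {τ : Tile T} {c : T}
    (h : IsTile f x0 x1 y0 y1 τ) (ht : TrivF S τ c) :
    (∀ y y', y0 ≤ y → y < y' → y' ≤ y1 → S.le (f x0 y) (f x0 y')) ∧
    (∀ x x', x0 ≤ x → x < x' → x' ≤ x1 → S.le (f x y0) (f x' y0)) ∧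
    (∀ y, y0 < y → y < y1 → S.le (f x0 y) c) ∧ (∀ x, x0 < x → x < x1 → S.le (f x y0) c) :=
  ⟨fun y y' => Chn.sound' hS h.wl ht.chL h.ll h.ul y y', fun x x' => Chn.sound' hS h.wb ht.chB h.ll h.lr x x',
    fun _ a b => ht.leL _ (Reads.mem h.wl a b), fun _ a b => ht.leB _ (Reads.mem h.wb a b)⟩

theorem TrivF.demF {S : Sys T} {f : ℝ → ℝ → T} {x0 x1 y0 y1 : ℝ} {τ : Tile T} {c : T}
    (h : IsTile f x0 x1 y0 y1 τ) (ht : TrivF S τ c)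
    (hc : ∀ x y, x0 < x → x < x1 → y0 < y → y < y1 → f x y = c) : DemF S f x0 x1 y0 y1 := by
  have ctr : ∀ i < S.N, ∀ x y, x0 ≤ x → x < x1 → y0 ≤ y → y < y1 → S.gF i c →
      ∃ x' y', x ≤ x' ∧ x' ≤ x1 ∧ y ≤ y' ∧ y' ≤ y1 ∧ ¬ (x' = x ∧ y' = y) ∧
      (S.w i (f x' y') ∨ ((x' = x1 ∨ y' = y1) ∧ S.nF i (f x' y'))) := by
    intro i hi x y a b c' d hg
    have hw : S.w i c → ∃ x' y', x ≤ x' ∧ x' ≤ x1 ∧ y ≤ y' ∧ y' ≤ y1 ∧ ¬ (x' = x ∧ y' = y) ∧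
      (S.w i (f x' y') ∨ ((x' = x1 ∨ y' = y1) ∧ S.nF i (f x' y'))) := by
      intro k
      obtain ⟨x', u1, u2⟩ := exists_between b
      obtain ⟨y', v1, v2⟩ := exists_between d
      refine ⟨x', y', u1.le, u2.le, v1.le, v2.le, fun hh => by linarith [hh.1], Or.inl ?_⟩
      rw [hc x' y' (by linarith) u2 (by linarith) v2]; exact k
    have hb : ∀ x' y', x ≤ x' → x' ≤ x1 → y ≤ y' → y' ≤ y1 → (x' = x1 ∨ y' = y1) → S.gF i (f x' y') →
      ∃ x' y', x ≤ x' ∧ x' ≤ x1 ∧ y ≤ y' ∧ y' ≤ y1 ∧ ¬ (x' = x ∧ y' = y) ∧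
      (S.w i (f x' y') ∨ ((x' = x1 ∨ y' = y1) ∧ S.nF i (f x' y'))) := by
      intro x' y' k1 k2 k3 k4 k5 k6
      refine ⟨x', y', k1, k2, k3, k4, ?_, ?_⟩
      · rintro ⟨rfl, rfl⟩
        rcases k5 with k5 | k5 <;> linarith
      · rcases k6 with k6 | k6
        · exact Or.inr ⟨k5, k6⟩
        · exact Or.inl k6
    rcases hg with hg | hg
    · rcases ht.ce i hi hg with k | k | k | k
      · exact hw k
      · exact hb x1 y1 b.le le_rfl d.le le_rfl (Or.inl rfl) (by rw [h.ur]; exact k)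
      · obtain ⟨m, m1, m2, m3⟩ := Reads.last h.wt
        obtain ⟨x', u1, u2⟩ := exists_between (max_lt b m2)
        have := m3 x' ((le_max_right _ _).trans_lt u1) u2
        refine hb x' y1 ((le_max_left _ _).trans u1.le) u2.le d.le le_rfl (Or.inr rfl) ?_
        rw [this]; exact k
      · obtain ⟨m, m1, m2, m3⟩ := Reads.last h.wr
        obtain ⟨y', u1, u2⟩ := exists_between (max_lt d m2)
        have := m3 y' ((le_max_right _ _).trans_lt u1) u2
        refine hb x1 y' b.le le_rfl ((le_max_left _ _).trans u1.le) u2.le (Or.inl rfl) ?_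
        rw [this]; exact k
    · exact hw hg
  intro i hi x y a b c' d hn
  have hx := h.hx
  have hy := h.hy
  have w1 : S.gF i (f x0 y1) → x = x0 → ∃ x' y', x ≤ x' ∧ x' ≤ x1 ∧ y ≤ y' ∧ y' ≤ y1 ∧ ¬ (x' = x ∧ y' = y) ∧
      (S.w i (f x' y') ∨ ((x' = x1 ∨ y' = y1) ∧ S.nF i (f x' y'))) := by
    intro k e
    refine ⟨x0, y1, e.le, hx.le, d.le, le_rfl, fun hh => by linarith [hh.2], ?_⟩
    rcases k with k | k
    · exact Or.inr ⟨Or.inr rfl, k⟩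
    · exact Or.inl k
  have w2 : S.gF i (f x1 y0) → y = y0 → ∃ x' y', x ≤ x' ∧ x' ≤ x1 ∧ y ≤ y' ∧ y' ≤ y1 ∧ ¬ (x' = x ∧ y' = y) ∧
      (S.w i (f x' y') ∨ ((x' = x1 ∨ y' = y1) ∧ S.nF i (f x' y'))) := by
    intro k e
    refine ⟨x1, y0, b.le, le_rfl, e.le, hy.le, fun hh => by linarith [hh.1], ?_⟩
    rcases k with k | k
    · exact Or.inr ⟨Or.inl rfl, k⟩
    · exact Or.inl k
  rcases a.eq_or_lt with rfl | a'
  · rcases c'.eq_or_lt with rfl | c''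
    · rw [h.ll] at hn
      rcases ht.co i hi hn with ⟨t, k1, k2⟩ | ⟨t, k1, k2⟩ | k | k | k
      · obtain ⟨y', u1, u2, u3⟩ := Reads.att h.wl k1
        refine ⟨x0, y', le_rfl, hx.le, u1.le, u2.le, fun hh => by linarith [hh.2], Or.inl ?_⟩
        rw [u3]; exact k2
      · obtain ⟨x', u1, u2, u3⟩ := Reads.att h.wb k1
        refine ⟨x', y0, u1.le, u2.le, le_rfl, hy.le, fun hh => by linarith [hh.1], Or.inl ?_⟩
        rw [u3]; exact k2
      · exact w1 (by rw [h.ul]; exact k) rfl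
      · exact w2 (by rw [h.lr]; exact k) rfl
      · exact ctr i hi x0 y0 le_rfl hx le_rfl hy k
    · rcases LineF.sound h.wl (ht.liL i hi) c'' d hn with ⟨y', u1, u2, u3⟩ | k | k | k
      · exact ⟨x0, y', le_rfl, hx.le, u1.le, u2.le, fun hh => by linarith [hh.2], Or.inl u3⟩
      · exact w1 (by rw [h.ul]; exact Or.inr k) rfl
      · exact w1 (by rw [h.ul]; exact Or.inl k) rfl
      · exact ctr i hi x0 y le_rfl hx c' d k
  · rcases c'.eq_or_lt with rfl | c''
    · rcases LineF.sound h.wb (ht.liB i hi) a' b hn with ⟨y', u1, u2, u3⟩ | k | k | k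
      · exact ⟨y', y0, u1.le, u2.le, le_rfl, hy.le, fun hh => by linarith [hh.1], Or.inl u3⟩
      · exact w2 (by rw [h.lr]; exact Or.inr k) rfl
      · exact w2 (by rw [h.lr]; exact Or.inl k) rfl
      · exact ctr i hi x y0 a b le_rfl hy k
    · rw [hc x y a' b c'' d] at hn
      exact ctr i hi x y a b c' d (Or.inl hn)

theorem Triv.good {S : Sys T} (hS : S.Lawful) {f : ℝ → ℝ → T} {x0 x1 y0 y1 : ℝ} {τ : Tile T} {c : T}
    (h : IsTile f x0 x1 y0 y1 τ) (h1 : TrivF S τ c) (h2 : TrivF S.op τ.dual c) (hcc : S.le c c) (hr : S.rl c)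
    (hc : ∀ x y, x0 < x → x < x1 → y0 < y → y < y1 → f x y = c) : Good S f x0 x1 y0 y1 := by
  have hc' : ∀ x y, -y1 < x → x < -y0 → -x1 < y → y < -x0 → flp f x y = c := fun x y a b u v =>
    hc _ _ (by linarith) (by linarith) (by linarith) (by linarith)
  obtain ⟨a1, a2, a3, a4⟩ := TrivF.coh hS h h1
  obtain ⟨b1, b2, b3, b4⟩ := TrivF.coh hS.op h.dual h2
  simp only [flp, neg_neg] at b1 b2 b3 b4
  have b1' : ∀ x x', x0 ≤ x → x < x' → x' ≤ x1 → S.le (f x y1) (f x' y1) := fun x x' u v s => by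
    have := b1 (-x') (-x) (by linarith) (by linarith) (by linarith)
    simp only [neg_neg] at this
    exact this
  have b2' : ∀ y y', y0 ≤ y → y < y' → y' ≤ y1 → S.le (f x1 y) (f x1 y') := fun x x' u v s => by
    have := b2 (-x') (-x) (by linarith) (by linarith) (by linarith)
    simp only [neg_neg] at this
    exact this
  have b3' : ∀ x, x0 < x → x < x1 → S.le c (f x y1) := fun x u v => by
    have := b3 (-x) (by linarith) (by linarith)
    simp only [neg_neg] at this
    exact this
  have b4' : ∀ x, y0 < x → x < y1 → S.le c (f x1 x) := fun x u v => by
    have := b4 (-x) (by linarith) (by linarith)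
    simp only [neg_neg] at this
    exact this
  refine ⟨?_, ?_, fun x y a b u v => by rw [hc x y a b u v]; exact hr, h1.demF h hc, h2.demF h.dual hc'⟩
  · intro x x' y u v s p q
    rcases p.eq_or_lt with rfl | p
    · exact a2 x x' u v s
    rcases q.eq_or_lt with rfl | q
    · exact b1' x x' u v s
    rcases u.eq_or_lt with rfl | u
    · rcases s.eq_or_lt with rfl | s
      · exact hS.trans _ _ _ (a3 y p q) (b4' y p q)
      · rw [hc x' y v s p q]; exact a3 y p q
    · rw [hc x y u (v.trans_le s) p q]
      rcases s.eq_or_lt with rfl | s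
      · exact b4' y p q
      · rw [hc x' y (u.trans v) s p q]; exact hcc
  · intro y y' x u v s p q
    simp only [swf]
    rcases p.eq_or_lt with rfl | p
    · exact a1 y y' u v s
    rcases q.eq_or_lt with rfl | q
    · exact b2' y y' u v s
    rcases u.eq_or_lt with rfl | u
    · rcases s.eq_or_lt with rfl | s
      · exact hS.trans _ _ _ (a4 x p q) (b3' x p q)
      · rw [hc x y' p q v s]; exact a4 x p q
    · rw [hc x y p q u (v.trans_le s)]
      rcases s.eq_or_lt with rfl | s
      · exact b3' x p q
      · rw [hc x y' p q (u.trans v) s]; exact hcc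

open Classical in
theorem exists_frame (τ : Tile T) (c : T) : ∃ f : ℝ → ℝ → T, IsTile f 0 1 0 1 τ ∧
    ∀ x y, 0 < x → x < 1 → 0 < y → y < 1 → f x y = c := by
  obtain ⟨bl, hl⟩ := exists_reads τ.wl.2 0 1 τ.wl.1 one_pos
  obtain ⟨br, hr⟩ := exists_reads τ.wr.2 0 1 τ.wr.1 one_pos
  obtain ⟨bb, hb⟩ := exists_reads τ.wb.2 0 1 τ.wb.1 one_pos
  obtain ⟨bt, ht⟩ := exists_reads τ.wt.2 0 1 τ.wt.1 one_pos
  refine ⟨fun x y => if x = 0 then (if y = 0 then τ.ll else if y = 1 then τ.ul else bl y)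
    else if x = 1 then (if y = 0 then τ.lr else if y = 1 then τ.ur else br y)
    else if y = 0 then bb x else if y = 1 then bt x else c, ?_, ?_⟩
  · constructor
    · exact one_pos
    · exact one_pos
    · simp
    · simp
    · simp
    · simp
    · exact Reads.congr hl (fun x a b => by simp [a.ne', b.ne])
    · exact Reads.congr hr (fun x a b => by simp [a.ne', b.ne])
    · exact Reads.congr hb (fun x a b => by simp [a.ne', b.ne])
    · exact Reads.congr ht (fun x a b => by simp [a.ne', b.ne])
  · intro x y a b u v
    simp [a.ne', b.ne, u.ne', v.ne]

theorem sound_triv {S : Sys T} (hS : S.Lawful) {U : List T} {τ : Tile T} (h : RuleTriv S U τ) : Fill S τ := by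
  obtain ⟨c, _, h1, h2, h3, h4⟩ := h
  obtain ⟨f, hf, hc⟩ := exists_frame τ c
  exact ⟨f, 0, 1, 0, 1, hf, Triv.good hS hf h3 h4 h2 h1 hc⟩

theorem sound_swap {S : Sys T} {τ : Tile T} (h : Fill S τ.swp) : Fill S τ := by
  obtain ⟨f, x0, x1, y0, y1, h1, h2⟩ := h
  exact ⟨swf f, y0, y1, x0, x1, h1.swap, h2.swap⟩

theorem iso_shift (a c : ℝ) : ∃ φ : ℝ ≃o ℝ, φ a = c :=
  ⟨OrderIso.addRight (c - a), by simp⟩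

theorem sound_cut {S : Sys T} (hS : S.Lawful) {τ : Tile T} (h : RuleCut S (Fill S) τ) : Fill S τ := by
  obtain ⟨τ1, ⟨f, x0, m, y0, y1, hf, gf⟩, τ2, ⟨g, z0, z1, v0, v1, hg, gg⟩, e1, e2, e3, e4, e5, e6, e7, e8, e9,
    j1, j2, hr⟩ := h
  have hwr := hf.wr
  rw [e1] at hwr
  obtain ⟨ψ, p1, p2, p3⟩ := align hwr hg.wl
  obtain ⟨φ, q1⟩ := iso_shift m z0
  set x1 := φ.symm z1 with hx1
  have q2 : φ x1 = z1 := by simp [x1]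
  rw [← p1, ← p2, ← q1, ← q2] at hg gg
  have hm : m < x1 := φ.lt_iff_lt.1 hg.hx
  replace hg := hg.rescale
  replace gg := gg.rescale
  set g' : ℝ → ℝ → T := fun x y => g (φ x) (ψ y) with hg'
  have agree : ∀ y, y0 ≤ y → y ≤ y1 → f m y = g' m y := by
    intro y a b
    rcases a.eq_or_lt with rfl | a
    · rw [hf.lr, hg.ll, e2]
    rcases b.eq_or_lt with rfl | b
    · rw [hf.ur, hg.ul, e3]
    have := p3 y a b
    simp only [hg']
    rw [q1]; exact this
  classical
  let F : ℝ → ℝ → T := fun x y => if x ≤ m then f x y else g' x y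
  have hF1 : ∀ x y, x0 ≤ x → x ≤ m → y0 ≤ y → y ≤ y1 → f x y = F x y := by
    intro x y _ b _ _; simp [F, b]
  have hF2 : ∀ x y, m ≤ x → x ≤ x1 → y0 ≤ y → y ≤ y1 → g' x y = F x y := by
    intro x y b _ c d
    rcases b.eq_or_lt with rfl | b
    · simp [F, agree y c d]
    · simp [F, not_le.2 b]
  replace hf := hf.congr hF1
  replace gf := gf.congr hF1
  replace hg := hg.congr hF2
  replace gg := gg.congr hF2
  refine ⟨F, x0, x1, y0, y1, ?_, gf.glueV hS hf.hx hm gg fun y a b => hr _ (Reads.mem hf.wr a b)⟩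
  refine ⟨hf.hx.trans hm, hf.hy, hf.ll.trans e4.symm, hg.lr.trans e7.symm, hf.ul.trans e5.symm,
    hg.ur.trans e8.symm, by rw [e6]; exact hf.wl, by rw [e9]; exact hg.wr, ?_, ?_⟩
  · exact RdW.join hf.wb hg.wb hf.lr j1
  · exact RdW.join hf.wt hg.wt hf.ur j2

end Temporal

namespace Temporal

variable {T : Type}

theorem fill_at {S : Sys T} {τ : Tile T} (h : Fill S τ) (a b c d : ℝ) (hab : a < b) (hcd : c < d) :
    ∃ f, IsTile f a b c d τ ∧ Good S f a b c d := by
  obtain ⟨f, x0, x1, y0, y1, h1, h2⟩ := h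
  obtain ⟨φ, p1, p2⟩ := iso_affine a b x0 x1 hab h1.hx
  obtain ⟨ψ, q1, q2⟩ := iso_affine c d y0 y1 hcd h1.hy
  rw [← p1, ← p2, ← q1, ← q2] at h1 h2
  exact ⟨_, h1.rescale, h2.rescale⟩

theorem fill_topright {S : Sys T} {τ : Tile T} (h : Fill S τ) {a b c d : ℝ} {βx βy : ℝ → T}
    (hx : RdW βx a b τ.wt) (hy : RdW βy c d τ.wr) :
    ∃ f, IsTile f a b c d τ ∧ Good S f a b c d ∧ (∀ x, a < x → x < b → f x d = βx x) ∧
      (∀ y, c < y → y < d → f b y = βy y) := by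
  obtain ⟨f, x0, x1, y0, y1, h1, h2⟩ := h
  obtain ⟨φ, p1, p2, p3⟩ := align hx h1.wt
  obtain ⟨ψ, q1, q2, q3⟩ := align hy h1.wr
  rw [← p1, ← p2, ← q1, ← q2] at h1 h2
  refine ⟨_, h1.rescale, h2.rescale, fun x u v => ?_, fun x u v => ?_⟩
  · rw [p3 x u v, q2]
  · rw [q3 x u v, p2]

theorem fill_botleft {S : Sys T} {τ : Tile T} (h : Fill S τ) {a b c d : ℝ} {βx βy : ℝ → T}
    (hx : RdW βx a b τ.wb) (hy : RdW βy c d τ.wl) :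
    ∃ f, IsTile f a b c d τ ∧ Good S f a b c d ∧ (∀ x, a < x → x < b → f x c = βx x) ∧
      (∀ y, c < y → y < d → f a y = βy y) := by
  obtain ⟨f, x0, x1, y0, y1, h1, h2⟩ := h
  obtain ⟨φ, p1, p2, p3⟩ := align hx h1.wb
  obtain ⟨ψ, q1, q2, q3⟩ := align hy h1.wl
  rw [← p1, ← p2, ← q1, ← q2] at h1 h2
  refine ⟨_, h1.rescale, h2.rescale, fun x u v => ?_, fun x u v => ?_⟩
  · rw [p3 x u v, q1]
  · rw [q3 x u v, p1]

structure LoopStr (S : Sys T) (f : ℝ → ℝ → T) (l r z e0 f0 : T) : Prop where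
  hl : ∀ y, -1 ≤ y → y < 0 → f 0 y = l
  hr : ∀ x, 0 < x → x ≤ 1 → f x 0 = r
  hz : f 0 0 = z
  gLL : ∀ n : ℕ, Good S f 0 ((1/2)^(n+1)) (-(1/2)^n) (-(1/2)^(n+1))
  gLR : ∀ n : ℕ, Good S f ((1/2)^(n+1)) ((1/2)^n) (-(1/2)^n) (-(1/2)^(n+1))
  gUR : ∀ n : ℕ, Good S f ((1/2)^(n+1)) ((1/2)^n) (-(1/2)^(n+1)) 0
  he : ∀ n : ℕ, f ((1/2)^(n+1)) (-(1/2)^n) = e0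
  hf : ∀ n : ℕ, f ((1/2)^n) (-(1/2)^(n+1)) = f0

theorem LoopStr.dual {S : Sys T} {f : ℝ → ℝ → T} {l r z e0 f0 : T} (h : LoopStr S f l r z e0 f0) :
    LoopStr S.op (flp f) r l z f0 e0 := by
  constructor
  · intro y a b; simp only [flp, neg_zero]; exact h.hr _ (by linarith) (by linarith)
  · intro y a b; simp only [flp, neg_zero]; exact h.hl _ (by linarith) (by linarith)
  · simpa [flp] using h.hz
  · intro n; simpa using (h.gUR n).dual
  · intro n; simpa using (h.gLR n).dual
  · intro n; simpa using (h.gLL n).dual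
  · intro n; simpa [flp] using h.hf n
  · intro n; simpa [flp] using h.he n

theorem half_pow_pos (n : ℕ) : (0:ℝ) < (1/2)^n := by positivity
theorem half_pow_succ (n : ℕ) : ((1/2)^(n+1) : ℝ) = (1/2)^n / 2 := by rw [pow_succ]; ring
theorem half_pow_lt (n : ℕ) : ((1/2)^(n+1) : ℝ) < (1/2)^n := by
  rw [half_pow_succ]; have := half_pow_pos n; linarith
theorem half_pow_le_one (n : ℕ) : ((1/2)^n : ℝ) ≤ 1 := pow_le_one₀ (by norm_num) (by norm_num)

theorem exists_half_pow_lt {x : ℝ} (h : 0 < x) : ∃ n : ℕ, ((1/2)^n : ℝ) < x :=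
  exists_pow_lt_of_lt_one h (by norm_num)

theorem exists_scale {x : ℝ} (h : 0 < x) (h1 : x ≤ 1) :
    ∃ n : ℕ, ((1/2)^(n+1) : ℝ) < x ∧ x ≤ (1/2)^n := by
  classical
  obtain hex := exists_half_pow_lt h
  let n := Nat.find hex
  have hn : ((1/2)^n : ℝ) < x := Nat.find_spec hex
  have hmin : ∀ k < n, ¬ ((1/2)^k : ℝ) < x := fun k hk => Nat.find_min hex hk
  rcases Nat.eq_zero_or_pos n with h0 | h0
  · rw [h0] at hn; simp at hn; linarith
  · obtain ⟨k, hk⟩ := Nat.exists_eq_succ_of_ne_zero h0.ne'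
    refine ⟨k, ?_, ?_⟩
    · rw [hk] at hn; exact hn
    · exact not_lt.1 (hmin k (by omega))

theorem LoopStr.cohH {S : Sys T} (hS : S.Lawful) {f : ℝ → ℝ → T} {l r z e0 f0 : T}
    (h : LoopStr S f l r z e0 f0) (hzr : S.le z r) : CohH S f 0 1 (-1) 0 := by
  intro x x' y a b c d e
  rcases e.eq_or_lt with rfl | e
  · have hrr : S.le r r := by
      have h1 := (h.gUR 0).cohH (1/2) 1 0 (by norm_num) (by norm_num) (by norm_num) (by norm_num) (by norm_num)
      rwa [h.hr 1 (by norm_num) le_rfl, h.hr (1/2) (by norm_num) (by norm_num)] at h1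
    rw [h.hr x' (by linarith) c]
    rcases a.eq_or_lt with rfl | a
    · rw [h.hz]; exact hzr
    · rw [h.hr x a (by linarith)]; exact hrr
  · obtain ⟨n, n1, n2⟩ := exists_scale (x := -y) (by linarith) (by linarith)
    have key : ∀ j k, j + k = n → CohH S f 0 ((1/2)^j) (-(1/2)^n) (-(1/2)^(n+1)) := by
      intro j k
      induction k generalizing j with
      | zero =>
        intro hj
        obtain rfl : j = n := by omega
        exact (h.gLL j).cohH.glueV hS (h.gLR j).cohH
      | succ k ih =>
        intro hj
        refine (ih (j+1) (by omega)).glueV hS ?_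
        intro u u' v p q s t w
        refine (h.gUR j).cohH u u' v p q s ?_ ?_
        · have : ((1/2)^n : ℝ) ≤ (1/2)^(j+1) := pow_le_pow_of_le_one (by norm_num) (by norm_num) (by omega)
          linarith
        · have := half_pow_pos (n+1); linarith
    exact key 0 n (by omega) x x' y a b (by simpa using c) (by linarith) (by linarith)

theorem LoopStr.demF {S : Sys T} {f : ℝ → ℝ → T} {l r z e0 f0 : T}
    (h : LoopStr S f l r z e0 f0)
    (hc : ∀ i < S.N, S.nF i l → S.w i l ∨ S.gF i z ∨ S.gF i r ∨ S.nF i e0) : DemF S f 0 1 (-1) 0 := by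
  have key : ∀ k j n : ℕ, n + j = k → DemF S f ((1/2)^k) ((1/2)^n) (-(1/2)^n) 0 := by
    intro k j
    induction j with
    | zero =>
      intro n hn
      obtain rfl : n = k := by omega
      intro i hi x y a b
      linarith
    | succ j ih =>
      intro n hn
      have h1 := ih (n+1) (by omega)
      have hlt := half_pow_lt n
      refine DemF.glueV hlt ?_ (DemF.glueH (m := -(1/2)^(n+1)) (by have := half_pow_pos (n+1); linarith)
        (h.gLR n).demF (h.gUR n).demF)
      refine DemF.glueH (m := -(1/2)^(n+1)) (by have := half_pow_pos (n+1); linarith) ?_ h1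
      intro i hi x y a b
      exact (h.gLL n).demF i hi x y (by have := half_pow_pos k; linarith) b
  have key2 : ∀ i < S.N, ∀ x y, 0 < x → x < 1 → -1 ≤ y → y < 0 → S.nF i (f x y) →
    ∃ x' y', x ≤ x' ∧ x' ≤ 1 ∧ y ≤ y' ∧ y' ≤ 0 ∧ ¬ (x' = x ∧ y' = y) ∧
      (S.w i (f x' y') ∨ ((x' = 1 ∨ y' = 0) ∧ S.nF i (f x' y'))) := by
    intro i hi x y a b c d e
    obtain ⟨k, hk⟩ := exists_half_pow_lt a
    have := key k k 0 (by omega)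
    simp only [pow_zero] at this
    exact this i hi x y hk.le b c d e
  intro i hi x y a b c d e
  rcases a.eq_or_lt with rfl | a
  · rw [h.hl y c d] at e
    rcases hc i hi e with k | k | k | k
    · refine ⟨0, y/2, le_rfl, zero_le_one, by linarith, by linarith, fun hh => by linarith [hh.2], Or.inl ?_⟩
      rw [h.hl _ (by linarith) (by linarith)]; exact k
    · refine ⟨0, 0, le_rfl, zero_le_one, d.le, le_rfl, fun hh => by linarith [hh.2], ?_⟩
      rw [h.hz]
      rcases k with k | k
      · exact Or.inr ⟨Or.inr rfl, k⟩
      · exact Or.inl k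
    · refine ⟨1, 0, zero_le_one, le_rfl, d.le, le_rfl, fun hh => by linarith [hh.2], ?_⟩
      rw [h.hr 1 zero_lt_one le_rfl]
      rcases k with k | k
      · exact Or.inr ⟨Or.inr rfl, k⟩
      · exact Or.inl k
    · obtain ⟨n, hn⟩ := exists_half_pow_lt (x := -y) (by linarith)
      have h0 := half_pow_pos n
      have h1 := half_pow_pos (n+1)
      have h2 := half_pow_lt n
      have h3 := half_pow_le_one n
      obtain ⟨x', y', k1, k2, k3, k4, k5, k6⟩ := key2 i hi ((1/2)^(n+1)) (-(1/2)^n) h1 (by linarith)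
        (by linarith) (by linarith) (by rw [h.he n]; exact k)
      exact ⟨x', y', by linarith, k2, by linarith, k4, fun hh => by linarith [hh.1], k6⟩
  · exact key2 i hi x y a b c d e

theorem LoopStr.good {S : Sys T} (hS : S.Lawful) {f : ℝ → ℝ → T} {l r z e0 f0 : T}
    (h : LoopStr S f l r z e0 f0) (hzr : S.le z r) (hlz : S.le l z)
    (hc : ∀ i < S.N, S.nF i l → S.w i l ∨ S.gF i z ∨ S.gF i r ∨ S.nF i e0)
    (hc' : ∀ i < S.N, S.nP i r → S.w i r ∨ S.gP i z ∨ S.gP i l ∨ S.nP i f0)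
    (hr : ∀ x y, 0 < x → x < 1 → -1 < y → y < 0 → S.rl (f x y)) : Good S f 0 1 (-1) 0 := by
  refine ⟨h.cohH hS hzr, ?_, hr, h.demF hc, ?_⟩
  · have h1 := (h.dual.cohH hS.op hlz).flp
    simp only [neg_neg, neg_zero, flp_flp] at h1
    exact h1
  · have := h.dual.demF hc'
    simpa using this

theorem RdW.scale2 {β : ℝ → T} {lo hi : ℝ} {w : Wd T} (h : RdW β (2 * lo) (2 * hi) w) :
    RdW (fun x => β (2 * x)) lo hi w := by
  let φ : ℝ ≃o ℝ := OrderIso.mulLeft₀ 2 two_pos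
  exact Reads.comp φ h

theorem Good.scale {S : Sys T} {f : ℝ → ℝ → T} {x0 x1 y0 y1 c : ℝ} (hc : 0 < c)
    (h : Good S f (c * x0) (c * x1) (c * y0) (c * y1)) :
    Good S (fun x y => f (c * x) (c * y)) x0 x1 y0 y1 := by
  let φ : ℝ ≃o ℝ := OrderIso.mulLeft₀ c hc
  exact Good.rescale φ φ h

theorem RdW.extL {β : ℝ → T} {lo m hi : ℝ} {w : Wd T} (h : RdW β m hi w) (hl : lo < m)
    (hc : ∀ x, lo < x → x ≤ m → β x = w.1) : RdW β lo hi w := Reads.ext hl hc h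

theorem RdW.extR {β : ℝ → T} {lo m hi : ℝ} {w : Wd T} (h : RdW β lo m w) (hl : m < hi)
    (hc : ∀ x, m ≤ x → x < hi → β x = lastW w) : RdW β lo hi w := by
  have := Reads.app' (L2 := []) h (hc m le_rfl hl) (hi := hi) ⟨hl, fun x a b => hc x a.le b⟩
  rw [List.append_nil] at this; exact this

theorem sound_loop {S : Sys T} (hS : S.Lawful) {τ : Tile T} (h : RuleLoop S (Fill S) τ) : Fill S τ := by
  obtain ⟨hwl, hwt, C, fC, fA, fB, hC, rm, rwb, rwr, rv, rh, ⟨lz, lF⟩, zr, lP⟩ := h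
  set l := τ.ll with hl
  set r := τ.ur with hr
  set m := τ.lr with hm
  set e0 := τ.wb.1 with he0
  set f0 := lastW τ.wr with hf0
  have p12 : (1/2:ℝ) < 1 := by norm_num
  have m12 : (-1:ℝ) < -1/2 := by norm_num
  obtain ⟨c, tC, gC⟩ := fill_at fC (1/2) 1 (-1) (-1/2) p12 m12
  rw [hC] at tC
  have cll : c (1/2) (-1) = e0 := tC.ll
  have clr : c 1 (-1) = m := tC.lr
  have cul : c (1/2) (-1/2) = m := tC.ul
  have cur : c 1 (-1/2) = f0 := tC.ur
  have cwl : RdW (fun y => c (1/2) y) (-1) (-1/2) C.wl := tC.wl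
  have cwr : RdW (fun y => c 1 y) (-1) (-1/2) τ.wr := tC.wr
  have cwb : RdW (fun x => c x (-1)) (1/2) 1 τ.wb := tC.wb
  have cwt : RdW (fun x => c x (-1/2)) (1/2) 1 C.wt := tC.wt
  classical
  let βb : ℝ → T := fun x => if x ≤ 1/2 then e0 else c x (-1)
  let βr : ℝ → T := fun y => if y ≥ -1/2 then f0 else c 1 y
  have hβb : RdW βb 0 1 τ.wb := by
    refine RdW.extL (m := 1/2) (cwb.congr (fun x a b => ?_)) (by norm_num) (fun x a b => ?_)
    · simp only [βb, not_le.2 a, if_false]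
    · simp only [βb, b, if_true]; rfl
  have hβr : RdW βr (-1) 0 τ.wr := by
    refine RdW.extR (m := -1/2) (cwr.congr (fun x a b => ?_)) (by norm_num) (fun x a b => ?_)
    · simp only [βr, ge_iff_le, not_le.2 b, if_false]
    · simp only [βr, ge_iff_le, a, if_true]; rfl
  obtain ⟨A, tA, gA, A1, A2⟩ := fill_topright fA (a := 0) (b := 1/2) (c := -1) (d := -1/2)
    (βx := fun x => βb (2 * x)) (βy := fun y => c (1/2) y) (RdW.scale2 (by norm_num; exact hβb)) cwl
  obtain ⟨B, tB, gB, B1, B2⟩ := fill_botleft fB (a := 1/2) (b := 1) (c := -1/2) (d := 0)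
    (βx := fun x => c x (-1/2)) (βy := fun y => βr (2 * y)) cwt (RdW.scale2 (by norm_num; exact hβr))
  have All : A 0 (-1) = l := tA.ll
  have Alr : A (1/2) (-1) = e0 := tA.lr
  have Aul : A 0 (-1/2) = l := tA.ul
  have Aur : A (1/2) (-1/2) = m := tA.ur
  have Awl : ∀ y, -1 ≤ y → y ≤ -1/2 → A 0 y = l := by
    intro y a b
    rcases a.eq_or_lt with rfl | a
    · exact All
    rcases b.eq_or_lt with rfl | b
    · exact Aul
    exact (tA.wl).2 y a b
  have Awb : ∀ x, 0 < x → x ≤ 1/2 → A x (-1) = e0 := by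
    intro x a b
    rcases b.eq_or_lt with rfl | b
    · exact Alr
    exact (tA.wb).2 x a b
  have Bll : B (1/2) (-1/2) = m := tB.ll
  have Blr : B 1 (-1/2) = f0 := tB.lr
  have Bul : B (1/2) 0 = r := tB.ul
  have Bur : B 1 0 = r := tB.ur
  have Bwt : ∀ x, 1/2 ≤ x → x ≤ 1 → B x 0 = r := by
    intro y a b
    rcases a.eq_or_lt with rfl | a
    · exact Bul
    rcases b.eq_or_lt with rfl | b
    · exact Bur
    exact (tB.wt).2 y a b
  have Bwr : ∀ y, -1/2 ≤ y → y < 0 → B 1 y = f0 := by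
    intro x a b
    rcases a.eq_or_lt with rfl | a
    · exact Blr
    exact (tB.wr).2 x a b
  have AC : ∀ y, -1 ≤ y → y ≤ -1/2 → A (1/2) y = c (1/2) y := by
    intro y a b
    rcases a.eq_or_lt with rfl | a
    · rw [Alr, cll]
    rcases b.eq_or_lt with rfl | b
    · rw [Aur, cul]
    exact A2 y a b
  have BC : ∀ x, 1/2 ≤ x → x ≤ 1 → B x (-1/2) = c x (-1/2) := by
    intro y a b
    rcases a.eq_or_lt with rfl | a
    · rw [Bll, cul]
    rcases b.eq_or_lt with rfl | b
    · rw [Blr, cur]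
    exact B1 y a b
  let F : ℝ → ℝ → T := fun u v => if v ≤ -1/2 then (if u ≤ 1/2 then A u v else c u v) else B u v
  have FA : ∀ u v, 0 ≤ u → u ≤ 1/2 → -1 ≤ v → v ≤ -1/2 → A u v = F u v := by
    intro u v _ a _ b; simp only [F, a, b, if_true]
  have FC : ∀ u v, 1/2 ≤ u → u ≤ 1 → -1 ≤ v → v ≤ -1/2 → c u v = F u v := by
    intro u v a _ b d
    rcases a.eq_or_lt with rfl | a
    · simp only [F, d, if_true, le_refl]; exact (AC v b d).symm
    · simp only [F, d, not_le.2 a, if_true, if_false]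
  have FB : ∀ u v, 1/2 ≤ u → u ≤ 1 → -1/2 ≤ v → v ≤ 0 → B u v = F u v := by
    intro u v a b d e
    rcases d.eq_or_lt with rfl | d
    · rw [BC u a b]; exact FC u _ a b (by norm_num) le_rfl
    · simp only [F, not_le.2 d, if_false]
  have selfb : ∀ x, 0 < x → x ≤ 1/2 → F (2 * x) (-1) = F x (-1/2) := by
    intro x a b
    rw [← FA x (-1/2) a.le b (by norm_num) le_rfl]
    rcases b.eq_or_lt with rfl | b
    · rw [Aur, ← FC _ _ (by norm_num) (by norm_num) le_rfl (by norm_num)]; norm_num; exact clr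
    rw [A1 x a b]
    simp only [βb]
    split_ifs with g
    · rw [← FA _ _ (by linarith) g le_rfl (by norm_num)]; exact Awb _ (by linarith) g
    · rw [← FC _ _ (by linarith) (by linarith) le_rfl (by norm_num)]
  have selfr : ∀ y, -1/2 ≤ y → y < 0 → F 1 (2 * y) = F (1/2) y := by
    intro y a b
    rw [← FB (1/2) y le_rfl (by norm_num) a b.le]
    rcases a.eq_or_lt with rfl | a
    · rw [Bll, ← FC _ _ (by norm_num) (by norm_num) (by norm_num) (by norm_num)]; norm_num; exact clr
    rw [B2 y a b]
    simp only [βr]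
    split_ifs with g
    · rw [← FB _ _ (by norm_num) le_rfl g (by linarith)]; exact Bwr _ g (by linarith)
    · rw [← FC _ _ (by norm_num) le_rfl (by linarith) (by linarith)]
  have Freal : ∀ u v, 0 < u → u ≤ 1 → -1 ≤ v → v < 0 → (1/2 ≤ u ∨ v ≤ -1/2) → S.rl (F u v) := by
    intro u v a b d e g
    have memb : ∀ x, 0 < x → x ≤ 1 → S.rl (F x (-1)) := by
      intro x x1 x2
      rcases le_or_gt x (1/2) with k | k
      · rw [← FA x _ x1.le k le_rfl (by norm_num), Awb x x1 k]; exact rwb _ (by simp [letters, e0])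
      · rw [← FC x _ k.le x2 le_rfl (by norm_num)]
        rcases x2.eq_or_lt with rfl | x2
        · rw [clr]; exact rm
        · exact rwb _ (Reads.mem cwb k x2)
    have memr : ∀ y, -1 ≤ y → y < 0 → S.rl (F 1 y) := by
      intro x x1 x2
      rcases le_or_gt (-1/2) x with k | k
      · rw [← FB 1 _ p12.le le_rfl k x2.le, Bwr x k x2]
        have := Reads.att (t := f0) hβr (by
          have : f0 = (revW τ.wr).1 := (rev_fst _).symm
          rw [this]
          have h2 := (mem_letters_rev τ.wr (revW τ.wr).1).1 (by simp [letters])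
          exact h2)
        exact rwr _ (by
          obtain ⟨q, q1, q2, q3⟩ := this
          rw [← q3]; exact Reads.mem hβr q1 q2)
      · rw [← FC 1 _ p12.le le_rfl x1 k.le]
        rcases x1.eq_or_lt with rfl | x1
        · rw [clr]; exact rm
        · exact rwr _ (Reads.mem cwr x1 k)
    rcases d.eq_or_lt with rfl | d
    · exact memb u a b
    rcases b.eq_or_lt with rfl | b
    · exact memr v d.le e
    rcases lt_trichotomy u (1/2) with k | k | k
    · have hv : v ≤ -1/2 := by rcases g with g | g <;> [linarith; exact g]
      rcases hv.eq_or_lt with rfl | hv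
      · rw [← selfb u a k.le]; exact memb _ (by linarith) (by linarith)
      · rw [← FA u v a.le k.le d.le hv.le]; exact gA.real u v a k d hv
    · subst k
      rcases lt_or_ge v (-1/2) with hv | hv
      · rw [← FC _ v le_rfl b.le d.le hv.le]; exact rv _ (Reads.mem cwl d hv)
      · rw [← selfr v hv e]; exact memr _ (by linarith) (by linarith)
    · rcases lt_trichotomy v (-1/2) with hv | hv | hv
      · rw [← FC _ v k.le b.le d.le hv.le]; exact gC.real _ _ k b d hv
      · subst hv
        rw [← FC _ _ k.le b.le d.le le_rfl]; exact rh _ (Reads.mem cwt k b)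
      · rw [← FB _ v k.le b.le hv.le e.le]; exact gB.real _ _ k b hv e
  have hex : ∀ x y : ℝ, 0 < x → ∃ n : ℕ, (1/2)^(n+1) < max x (-y) := by
    intro x y hx
    obtain ⟨n, hn⟩ := exists_half_pow_lt hx
    exact ⟨n, (half_pow_lt n).trans (hn.trans_le (le_max_left _ _))⟩
  let G : ℝ → ℝ → T := fun x y => if hx : 0 < x then (if y < 0 then
    F (2^(Nat.find (hex x y hx)) * x) (2^(Nat.find (hex x y hx)) * y) else r) else if y < 0 then l else τ.ul
  have hpp : ∀ n : ℕ, (2:ℝ)^n * (1/2)^n = 1 := fun n => by rw [← mul_pow]; norm_num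
  have h2p : ∀ n : ℕ, (0:ℝ) < 2^n := fun n => by positivity
  have GF : ∀ n : ℕ, ∀ x y : ℝ, 0 < x → y < 0 → x ≤ (1/2)^n → -(1/2)^n ≤ y →
      ((1/2)^(n+1) ≤ x ∨ y ≤ -(1/2)^(n+1)) → G x y = F (2^n * x) (2^n * y) := by
    intro n x y a b hx hy hd
    have hmax : max x (-y) ≤ (1/2)^n := max_le hx (by linarith)
    have hmax' : (1/2)^(n+1) ≤ max x (-y) := by
      rcases hd with hd | hd
      · exact hd.trans (le_max_left _ _)
      · exact le_trans (by linarith) (le_max_right _ _)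
    have hG : G x y = F (2^(Nat.find (hex x y a)) * x) (2^(Nat.find (hex x y a)) * y) := by
      simp only [G, a, b, dif_pos, if_true]
    rw [hG]
    rcases hmax'.eq_or_lt with g | g
    · have : Nat.find (hex x y a) = n + 1 := by
        rw [Nat.find_eq_iff]
        refine ⟨by rw [← g]; exact half_pow_lt (n+1), fun k hk => ?_⟩
        rw [← g, not_lt]
        exact pow_le_pow_of_le_one (by norm_num) (by norm_num) (by omega)
      rw [this]
      have hx' : x ≤ (1/2)^(n+1) := by rw [g]; exact le_max_left _ _
      have hy' : -y ≤ (1/2)^(n+1) := by rw [g]; exact le_max_right _ _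
      have e1 : (2:ℝ)^n * (1/2)^(n+1) = 1/2 := by rw [pow_succ, ← mul_assoc, hpp, one_mul]
      have i1 := mul_le_mul_of_nonneg_left hx' (h2p n).le
      have i2 := mul_le_mul_of_nonneg_left hy' (h2p n).le
      have i3 := mul_pos (h2p n) a
      have i4 := mul_pos (h2p n) (neg_pos.2 b)
      rw [show (2:ℝ)^(n+1) * x = 2 * (2^n * x) by rw [pow_succ]; ring,
        show (2:ℝ)^(n+1) * y = 2 * (2^n * y) by rw [pow_succ]; ring]
      rcases max_choice x (-y) with k | k
      · have hxe : x = (1/2)^(n+1) := by rw [g, k]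
        have : 2^n * x = 1/2 := by rw [hxe, e1]
        rw [this]
        have := selfr (2^n * y) (by linarith) (by linarith)
        rw [← this]; norm_num
      · have hxe : -y = (1/2)^(n+1) := by rw [g, k]
        have : 2^n * y = -1/2 := by
          rw [show y = -(1/2)^(n+1) by linarith]
          linarith
        rw [this]
        have := selfb (2^n * x) (by linarith) (by linarith)
        rw [← this]; norm_num
    · have : Nat.find (hex x y a) = n := by
        rw [Nat.find_eq_iff]
        refine ⟨g, fun k hk => ?_⟩
        rw [not_lt]
        exact hmax.trans (pow_le_pow_of_le_one (by norm_num) (by norm_num) (by omega))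
      rw [this]
  have Gl : ∀ y, y < 0 → G 0 y = l := by intro y hy; simp [G, hy]
  have Gr : ∀ x, 0 < x → G x 0 = r := by intro y hy; simp [G, hy]
  have Gz : G 0 0 = τ.ul := by simp [G]
  have bds : ∀ (n : ℕ) (x : ℝ), (x ≤ (1/2)^n → 2^n * x ≤ 1) ∧ ((1/2)^n ≤ x → 1 ≤ 2^n * x) ∧
      (x ≤ (1/2)^(n+1) → 2^n * x ≤ 1/2) ∧ ((1/2)^(n+1) ≤ x → 1/2 ≤ 2^n * x) := by
    intro n x
    have e1 : (2:ℝ)^n * (1/2)^(n+1) = 1/2 := by rw [pow_succ, ← mul_assoc, hpp, one_mul]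
    refine ⟨fun k => ?_, fun k => ?_, fun k => ?_, fun k => ?_⟩
    · have := mul_le_mul_of_nonneg_left k (h2p n).le; rwa [hpp] at this
    · have := mul_le_mul_of_nonneg_left k (h2p n).le; rwa [hpp] at this
    · have := mul_le_mul_of_nonneg_left k (h2p n).le; rwa [e1] at this
    · have := mul_le_mul_of_nonneg_left k (h2p n).le; rwa [e1] at this
  have e1 : ∀ n : ℕ, (2:ℝ)^n * (1/2)^(n+1) = 1/2 := fun n => by rw [pow_succ, ← mul_assoc, hpp, one_mul]
  have Lstr : LoopStr S G l r τ.ul e0 f0 := by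
    refine ⟨fun y _ b => Gl y b, fun x a _ => Gr x a, Gz, fun n => ?_, fun n => ?_, fun n => ?_, fun n => ?_, fun n => ?_⟩
    · have g1 : Good S (fun x y => F (2^n * x) (2^n * y)) 0 ((1/2)^(n+1)) (-(1/2)^n) (-(1/2)^(n+1)) := by
        refine Good.scale (h2p n) ?_
        rw [mul_zero, e1, mul_neg, hpp, mul_neg, e1]
        have := gA.congr FA
        rw [show (-1/2:ℝ) = -(1/2) by norm_num] at this
        exact this
      refine g1.congr (fun x y a b u v => ?_)
      have h3 := half_pow_pos (n+1)
      rcases a.eq_or_lt with rfl | a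
      · rw [Gl y (by linarith)]
        simp only [mul_zero]
        have q1 := (bds n (-y)).1 (by linarith)
        have q2 := (bds n (-y)).2.2.2 (by linarith)
        rw [← FA 0 _ le_rfl (by norm_num) (by linarith) (by linarith)]
        exact Awl _ (by linarith) (by linarith)
      · exact (GF n x y a (by linarith) (b.trans (half_pow_lt n).le) u (Or.inr v)).symm
    · have g1 : Good S (fun x y => F (2^n * x) (2^n * y)) ((1/2)^(n+1)) ((1/2)^n) (-(1/2)^n) (-(1/2)^(n+1)) := by
        refine Good.scale (h2p n) ?_
        rw [e1, mul_neg, hpp, mul_neg, e1]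
        have := gC.congr FC
        rw [show (-1/2:ℝ) = -(1/2) by norm_num] at this
        exact this
      refine g1.congr (fun x y a b u v => ?_)
      have h3 := half_pow_pos (n+1)
      exact (GF n x y (by linarith) (by linarith) b u (Or.inr v)).symm
    · have g1 : Good S (fun x y => F (2^n * x) (2^n * y)) ((1/2)^(n+1)) ((1/2)^n) (-(1/2)^(n+1)) 0 := by
        refine Good.scale (h2p n) ?_
        rw [e1, mul_neg, hpp, mul_zero, e1]
        have := gB.congr FB
        rw [show (-1/2:ℝ) = -(1/2) by norm_num] at this
        exact this
      refine g1.congr (fun x y a b u v => ?_)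
      have h3 := half_pow_pos (n+1)
      have h4 := half_pow_lt n
      rcases v.eq_or_lt with rfl | v
      · rw [Gr x (by linarith)]
        simp only [mul_zero]
        have q1 := (bds n x).1 (by linarith)
        have q2 := (bds n x).2.2.2 (by linarith)
        rw [← FB _ 0 q2 q1 (by norm_num) le_rfl]
        exact Bwt _ (by linarith) (by linarith)
      · exact (GF n x y (by linarith) v b (by linarith) (Or.inl a)).symm
    · have h3 := half_pow_pos (n+1)
      have h4 := half_pow_lt n
      rw [GF n _ _ h3 (by linarith) h4.le le_rfl (Or.inl le_rfl), e1, mul_neg, hpp,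
        ← FA _ _ (by norm_num) le_rfl le_rfl (by norm_num)]
      exact Alr
    · have h3 := half_pow_pos (n+1)
      have h4 := half_pow_lt n
      rw [GF n _ _ (by linarith) (by linarith) le_rfl (by linarith) (Or.inr le_rfl), mul_neg, e1, hpp,
        ← FB _ _ (by norm_num) le_rfl (by norm_num) (by norm_num), show (-(1/2):ℝ) = -1/2 by norm_num]
      exact Blr
  have lP' : ∀ i < S.N, S.nP i r → S.w i r ∨ S.gP i τ.ul ∨ S.gP i l ∨ S.nP i f0 := by
    intro i hi hn
    have := lP i hi hn
    simp only [dual_ll, dual_ul, dual_ur, dual_wb, rev_fst] at this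
    exact this
  have G1 : ∀ x y, 0 < x → y < 0 → x ≤ 1 → -1 ≤ y → (1/2 ≤ x ∨ y ≤ -1/2) → G x y = F x y := by
    intro x y a b u v g
    have := GF 0 x y a b (by simpa using u) (by simpa using v) (by
      rw [zero_add, pow_one, show (-(1/2):ℝ) = -1/2 by norm_num]; exact g)
    simpa using this
  refine ⟨G, 0, 1, -1, 0, ?_, Lstr.good hS zr lz lF lP' ?_⟩
  · refine ⟨by norm_num, by norm_num, Gl _ (by norm_num), ?_, Gz, Gr _ (by norm_num), ?_, ?_, ?_, ?_⟩
    · rw [G1 _ _ (by norm_num) (by norm_num) (by norm_num) (by norm_num) (by norm_num),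
        ← FC _ _ (by norm_num) (by norm_num) (by norm_num) (by norm_num)]
      exact clr
    · rw [hwl]; exact ⟨by norm_num, fun y _ b => Gl y b⟩
    · refine hβr.congr (fun y a b => ?_)
      rw [G1 1 y (by norm_num) b le_rfl a.le (Or.inl p12.le)]
      simp only [βr]
      split_ifs with g
      · rw [← FB 1 y p12.le le_rfl g b.le]; exact (Bwr y g b).symm
      · exact FC 1 y p12.le le_rfl a.le (not_le.1 g).le
    · refine hβb.congr (fun x a b => ?_)
      rw [G1 x (-1) a (by norm_num) b.le le_rfl (Or.inr m12.le)]
      simp only [βb]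
      split_ifs with g
      · rw [← FA x _ a.le g le_rfl m12.le]; exact (Awb x a g).symm
      · exact FC x _ (not_le.1 g).le b.le le_rfl m12.le
    · rw [hwt]; exact ⟨by norm_num, fun y b _ => Gr y b⟩
  · intro x y a b u v
    obtain ⟨n, n1, n2⟩ := exists_scale (x := max x (-y)) (lt_max_of_lt_left a) (max_le b.le (by linarith))
    have hx : x ≤ (1/2)^n := (le_max_left _ _).trans n2
    have hy : -y ≤ (1/2)^n := (le_max_right _ _).trans n2
    have hor : (1/2)^(n+1) ≤ x ∨ (1/2)^(n+1) ≤ -y := by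
      rcases max_choice x (-y) with k | k
      · left; rw [← k]; exact n1.le
      · right; rw [← k]; exact n1.le
    have b1 := (bds n x)
    have b2 := (bds n (-y))
    rw [GF n x y a v hx (by linarith) (hor.imp id (fun q => by linarith))]
    have q1 := mul_pos (h2p n) a
    have q2 := mul_pos (h2p n) (neg_pos.2 v)
    refine Freal _ _ q1 (b1.1 hx) (by linarith [b2.1 hy]) (by linarith) ?_
    rcases hor with g | g
    · exact Or.inl (b1.2.2.2 g)
    · right; linarith [b2.2.2.2 g]

end Temporal

namespace Temporal

variable {T : Type}

open Classical in
theorem exists_colour : ∃ γ : ℝ → ℕ, (∀ j : ℕ, ∀ a b : ℝ, a < b → ∃ s, a < s ∧ s < b ∧ γ s = j) ∧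
    {s | γ s ≠ 0}.Countable := by
  have uniq : ∀ (j j' : ℕ) (q q' : ℚ), (q : ℝ) + j * √2 = q' + j' * √2 → j = j' := by
    intro j j' q q' h
    by_contra hne
    have hne' : ((j : ℤ) - j' : ℤ) ≠ 0 := by omega
    have h1 := irrational_sqrt_two.intCast_mul hne'
    apply h1
    refine ⟨q' - q, ?_⟩
    push_cast
    linarith
  refine ⟨fun s => if h : ∃ j : ℕ, ∃ q : ℚ, s = q + j * √2 then h.choose else 0, ?_, ?_⟩
  · intro j a b hab
    obtain ⟨q, h1, h2⟩ := exists_rat_btwn (show a - j * √2 < b - j * √2 by linarith)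
    refine ⟨q + j * √2, by linarith, by linarith, ?_⟩
    have h : ∃ j' : ℕ, ∃ q' : ℚ, (q : ℝ) + j * √2 = q' + j' * √2 := ⟨j, q, rfl⟩
    beta_reduce
    rw [dif_pos h]
    obtain ⟨q', hq⟩ := h.choose_spec
    exact (uniq _ _ _ _ hq).symm
  · refine (Set.countable_range (fun p : ℕ × ℚ => (p.2 : ℝ) + p.1 * √2)).mono ?_
    intro s hs
    simp only [Set.mem_ofPred_eq] at hs
    split_ifs at hs with h
    · obtain ⟨j, q, h⟩ := h
      exact ⟨(j, q), h.symm⟩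
    · exact absurd rfl hs

structure Stair (σ lo hi : ℝ → ℝ) : Prop where
  le : ∀ s, lo s ≤ hi s
  iff : ∀ x s, σ x = s ↔ lo s ≤ x ∧ x ≤ hi s
  mono : Monotone σ

open Filter Topology in
open Classical in
theorem exists_stair (C : Set ℝ) (hC : C.Countable) : ∃ σ lo hi : ℝ → ℝ, Stair σ lo hi ∧
    (∀ s, s ∈ C → lo s < hi s) ∧ (∀ s, s ∉ C → lo s = hi s) := by
  rcases C.eq_empty_or_nonempty with rfl | hne
  · exact ⟨id, id, id, ⟨fun s => le_rfl, fun x s => ⟨fun h => by subst h; simp, fun h => le_antisymm h.2 h.1⟩,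
      monotone_id⟩, fun s hs => absurd hs (Set.notMem_empty _), fun s hs => rfl⟩
  obtain ⟨c, hc⟩ := hC.exists_eq_range hne
  let A : ℝ → ℕ → ℝ := fun s k => if c k < s then (1/2)^k else 0
  let B : ℝ → ℕ → ℝ := fun s k => if c k ≤ s then (1/2)^k else 0
  have hg : Summable (fun k : ℕ => ((1/2)^k : ℝ)) := summable_geometric_two
  have pk : ∀ k : ℕ, (0:ℝ) < (1/2)^k := half_pow_pos
  have hA0 : ∀ s k, 0 ≤ A s k := by intro s k; simp only [A]; split_ifs <;> simp
  have hB0 : ∀ s k, 0 ≤ B s k := by intro s k; simp only [B]; split_ifs <;> simp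
  have hA1 : ∀ s k, A s k ≤ (1/2)^k := by
    intro s k; simp only [A]; split_ifs; · rfl
    · exact (pk k).le
  have hB1 : ∀ s k, B s k ≤ (1/2)^k := by
    intro s k; simp only [B]; split_ifs; · rfl
    · exact (pk k).le
  have hAs : ∀ s, Summable (A s) := fun s => Summable.of_nonneg_of_le (hA0 s) (hA1 s) hg
  have hBs : ∀ s, Summable (B s) := fun s => Summable.of_nonneg_of_le (hB0 s) (hB1 s) hg
  have hAB : ∀ s k, A s k ≤ B s k := by
    intro s k; simp only [A, B]
    by_cases h : c k < s
    · simp [h, h.le]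
    · rw [if_neg h]; exact hB0 s k
  have hBA : ∀ s s' k, s < s' → B s k ≤ A s' k := by
    intro s s' k hss; simp only [A, B]
    by_cases h : c k ≤ s
    · simp [h, h.trans_lt hss]
    · rw [if_neg h]; exact hA0 s' k
  let lo : ℝ → ℝ := fun s => s + ∑' k, A s k
  let hi : ℝ → ℝ := fun s => s + ∑' k, B s k
  have hle : ∀ s, lo s ≤ hi s := fun s => by
    have := (hAs s).tsum_le_tsum (hAB s) (hBs s)
    simp only [lo, hi]; linarith
  have hlt : ∀ s s', s < s' → hi s + (s' - s) ≤ lo s' := fun s s' h => by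
    have := (hBs s).tsum_le_tsum (fun k => hBA s s' k h) (hAs s')
    simp only [lo, hi]; linarith
  have tl : ∀ s, Tendsto lo (𝓝[<] s) (𝓝 (lo s)) := by
    intro s
    refine Tendsto.add (tendsto_id.mono_left nhdsWithin_le_nhds) ?_
    refine tendsto_tsum_of_dominated_convergence hg (fun k => ?_) (Eventually.of_forall fun s' k => ?_)
    · refine tendsto_const_nhds.congr' ?_
      by_cases h : c k < s
      · filter_upwards [Ioo_mem_nhdsLT h] with x hx
        simp [A, h, hx.1]
      · filter_upwards [self_mem_nhdsWithin] with x hx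
        have : ¬ c k < x := fun h' => h (h'.trans hx)
        simp only [A, if_neg h, if_neg this]
    · rw [Real.norm_of_nonneg (hA0 _ _)]; exact hA1 _ _
  have th : ∀ s, Tendsto hi (𝓝[>] s) (𝓝 (hi s)) := by
    intro s
    refine Tendsto.add (tendsto_id.mono_left nhdsWithin_le_nhds) ?_
    refine tendsto_tsum_of_dominated_convergence hg (fun k => ?_) (Eventually.of_forall fun s' k => ?_)
    · refine tendsto_const_nhds.congr' ?_
      by_cases h : c k ≤ s
      · filter_upwards [self_mem_nhdsWithin] with x hx
        have : c k ≤ x := h.trans (le_of_lt hx)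
        simp only [B, if_pos h, if_pos this]
      · filter_upwards [Ioo_mem_nhdsGT (not_le.1 h)] with x hx
        have : ¬ c k ≤ x := not_le.2 hx.2
        simp only [B, if_neg h, if_neg this]
    · rw [Real.norm_of_nonneg (hB0 _ _)]; exact hB1 _ _
  have ex : ∀ x, ∃ s, lo s ≤ x ∧ x ≤ hi s := by
    intro x
    let Z := {s | lo s ≤ x}
    have hlo0 : ∀ s, s ≤ lo s := fun s => by
      have : 0 ≤ ∑' k, A s k := tsum_nonneg (hA0 s)
      simp only [lo]; linarith
    have hlo2 : ∀ s, lo s ≤ s + 2 := fun s => by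
      have := (hAs s).tsum_le_tsum (hA1 s) hg
      rw [tsum_geometric_two] at this; simp only [lo]; linarith
    have hZ : BddAbove Z := ⟨x, fun s hs => (hlo0 s).trans hs⟩
    have hZn : Z.Nonempty := ⟨x - 2, by have := hlo2 (x-2); show lo (x-2) ≤ x; linarith⟩
    refine ⟨sSup Z, ?_, ?_⟩
    · refine le_of_tendsto (tl _) ?_
      filter_upwards [self_mem_nhdsWithin] with s hs
      obtain ⟨s', h1, h2⟩ := exists_lt_of_lt_csSup hZn hs
      have := hlt s s' h2
      have := hle s
      have h1' : lo s' ≤ x := h1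
      linarith
    · refine ge_of_tendsto (th _) ?_
      filter_upwards [self_mem_nhdsWithin] with s hs
      by_contra h
      have : s ∈ Z := (hle s).trans (not_le.1 h).le
      exact absurd (le_csSup hZ this) (not_le.2 hs)
  choose σ h1 h2 using ex
  have key : ∀ x s, lo s ≤ x → x ≤ hi s → σ x = s := by
    intro x s a b
    rcases lt_trichotomy (σ x) s with h | h | h
    · have := hlt _ _ h; linarith [h2 x]
    · exact h
    · have := hlt _ _ h; linarith [h1 x]
  refine ⟨σ, lo, hi, ⟨hle, fun x s => ⟨fun h => by subst h; exact ⟨h1 x, h2 x⟩, fun h => key x s h.1 h.2⟩, ?_⟩,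
    ?_, ?_⟩
  · intro x y hxy
    by_contra h
    have := hlt _ _ (not_le.1 h)
    linarith [h1 x, h2 y, not_le.1 h]
  · intro s hs
    rw [hc] at hs
    obtain ⟨k, rfl⟩ := hs
    have : ∑' j, A (c k) j < ∑' j, B (c k) j := by
      refine (hAs _).tsum_lt_tsum (i := k) (hAB _) ?_ (hBs _)
      simp [A, B]
    simp only [lo, hi]; linarith
  · intro s hs
    simp only [lo, hi]
    congr 2
    funext k
    have : c k ≠ s := fun h => hs (by rw [hc]; exact ⟨k, h⟩)
    simp only [A, B]
    by_cases h : c k < s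
    · simp [h, h.le]
    · rw [if_neg h, if_neg (fun h' => h (lt_of_le_of_ne h' this))]

end Temporal

namespace Temporal

variable {T : Type}

def ItF (S : Sys T) (b : T) (f : ℝ → ℝ → T) (x0 x1 y0 y1 : ℝ) : Prop :=
  ∀ i < S.N, ∀ x y, x0 ≤ x → x ≤ x1 → y0 ≤ y → y ≤ y1 → S.nF i (f x y) → S.gF i b ∨
    ∃ x' y', x ≤ x' ∧ x' ≤ x1 ∧ y ≤ y' ∧ y' ≤ y1 ∧ ¬ (x' = x ∧ y' = y) ∧ S.w i (f x' y')

structure SItem (S : Sys T) (a b : T) (f : ℝ → ℝ → T) (x0 x1 y0 y1 : ℝ) : Prop where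
  cohH : CohH S f x0 x1 y0 y1
  cohV : CohH S (swf f) y0 y1 x0 x1
  bd : ∀ x y, x0 ≤ x → x ≤ x1 → y0 ≤ y → y ≤ y1 → S.le a (f x y) ∧ S.le (f x y) b ∧ S.rl (f x y)
  demF : ItF S b f x0 x1 y0 y1
  demP : ItF S.op a (flp f) (-y1) (-y0) (-x1) (-x0)

theorem SItem.pt {S : Sys T} {a b t : T} (h : PtItem S a b t) (x y : ℝ) :
    SItem S a b (fun _ _ => t) x x y y := by
  obtain ⟨h1, h2, h3, h4⟩ := h
  refine ⟨fun x x' y a b c d e => by linarith, fun x x' y a b c d e => by linarith,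
    fun _ _ _ _ _ _ => ⟨h1, h2, h3⟩, ?_, ?_⟩
  · intro i hi x y _ _ _ _ hn; exact Or.inl ((h4 i hi).1 hn)
  · intro i hi x y _ _ _ _ hn; exact Or.inl ((h4 i hi).2 hn)

theorem EdgeF.sound {S : Sys T} {b p q : T} {w : Wd T} (h : EdgeF S b p w q) {β : ℝ → T} {lo hi : ℝ}
    (hr : RdW β lo hi w) (h1 : β lo = p) (h2 : β hi = q) {i : ℕ} (hi' : i < S.N) {y : ℝ} (ha : lo ≤ y) (hb : y ≤ hi)
    (hn : S.nF i (β y)) : S.gF i b ∨ ∃ y', y < y' ∧ y' ≤ hi ∧ S.w i (β y') := by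
  obtain ⟨k1, k2⟩ := h i hi'
  have fin : y < hi → ((∃ y', y < y' ∧ y' < hi ∧ S.w i (β y')) ∨ S.w i q ∨ S.gF i b) →
      S.gF i b ∨ ∃ y', y < y' ∧ y' ≤ hi ∧ S.w i (β y') := by
    rintro hb (⟨y', u, v, s⟩ | s | s)
    · exact Or.inr ⟨y', u, v.le, s⟩
    · exact Or.inr ⟨hi, hb, le_rfl, by rw [h2]; exact s⟩
    · exact Or.inl s
  rcases ha.eq_or_lt with rfl | ha
  · rw [h1] at hn
    exact fin hr.lt (LineF.start hr k1 hn)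
  · rcases hb.eq_or_lt with rfl | hb
    · rw [h2] at hn; exact Or.inl (k2 hn)
    · exact fin hb (LineF.sound hr k1 ha hb hn)

theorem SItem.seg {S : Sys T} (hS : S.Lawful) {a b p q : T} {w : Wd T} (h : SegItem S a b p w q) (x y0 y1 : ℝ) (hy : y0 < y1) :
    ∃ f, SItem S a b f x x y0 y1 ∧ f x y0 = p ∧ f x y1 = q := by
  obtain ⟨h1, h2, h3, h4, h5, h6, h7, h8⟩ := h
  obtain ⟨β0, hβ0⟩ := exists_reads w.2 y0 y1 w.1 hy
  obtain ⟨β, hβ, e0, e1⟩ : ∃ β, RdW β y0 y1 w ∧ β y0 = p ∧ β y1 = q := by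
    refine ⟨fun y => if y = y0 then p else if y = y1 then q else β0 y, ?_, by simp, by simp [hy.ne']⟩
    exact Reads.congr hβ0 (fun x u v => by simp [u.ne', v.ne])
  have hc := Chn.sound' hS hβ h1 e0 e1
  refine ⟨fun _ y => β y, ⟨fun x x' y a b c d e => by linarith, fun x x' y a b c d e => hc x x' a b c, ?_, ?_, ?_⟩, e0, e1⟩
  · intro x y _ _ u v
    refine ⟨?_, ?_, ?_⟩
    · rcases u.eq_or_lt with rfl | u
      · rw [e0]; exact h2
      · exact hS.trans _ _ _ h2 (by have := hc y0 y le_rfl u v; rwa [e0] at this)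
    · rcases v.eq_or_lt with rfl | v
      · rw [e1]; exact h3
      · exact hS.trans _ _ _ (by have := hc y y1 u v le_rfl; rwa [e1] at this) h3
    · rcases u.eq_or_lt with rfl | u
      · rw [e0]; exact h4
      · rcases v.eq_or_lt with rfl | v
        · rw [e1]; exact h5
        · exact h6 _ (Reads.mem hβ u v)
  · intro i hi x' y u v s t hn
    rcases h7.sound hβ e0 e1 hi s t hn with k | ⟨y', k1, k2, k3⟩
    · exact Or.inl k
    · exact Or.inr ⟨x', y', le_rfl, v, k1.le, k2, fun h => k1.ne' h.2, k3⟩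
  · intro i hi y x' u v s t hn
    have hr := hβ.rev
    rcases h8.sound (β := fun y => β (-y)) hr (by simpa using e1) (by simpa using e0) hi u v hn with k | ⟨y', k1, k2, k3⟩
    · exact Or.inl k
    · exact Or.inr ⟨y', x', k1.le, k2, le_rfl, t, fun h => k1.ne' h.1, k3⟩

theorem box_demF {S : Sys T} {b : T} {τ : Tile T} {f : ℝ → ℝ → T} {x0 x1 y0 y1 : ℝ}
    (ht : IsTile f x0 x1 y0 y1 τ) (hd : DemF S f x0 x1 y0 y1)
    (h1 : EdgeF S b τ.ul τ.wt τ.ur) (h2 : EdgeF S b τ.lr τ.wr τ.ur) : ItF S b f x0 x1 y0 y1 := by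
  intro i hi
  have top : ∀ x, x0 ≤ x → x ≤ x1 → S.nF i (f x y1) → S.gF i b ∨
    ∃ x' y', x ≤ x' ∧ x' ≤ x1 ∧ y1 ≤ y' ∧ y' ≤ y1 ∧ ¬ (x' = x ∧ y' = y1) ∧ S.w i (f x' y') := by
    intro x u v hn
    rcases h1.sound ht.wt ht.ul ht.ur hi u v hn with k | ⟨y', k1, k2, k3⟩
    · exact Or.inl k
    · exact Or.inr ⟨y', y1, k1.le, k2, le_rfl, le_rfl, fun h => k1.ne' h.1, k3⟩
  have rig : ∀ y, y0 ≤ y → y ≤ y1 → S.nF i (f x1 y) → S.gF i b ∨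
    ∃ x' y', x1 ≤ x' ∧ x' ≤ x1 ∧ y ≤ y' ∧ y' ≤ y1 ∧ ¬ (x' = x1 ∧ y' = y) ∧ S.w i (f x' y') := by
    intro x u v hn
    rcases h2.sound ht.wr ht.lr ht.ur hi u v hn with k | ⟨y', k1, k2, k3⟩
    · exact Or.inl k
    · exact Or.inr ⟨x1, y', le_rfl, le_rfl, k1.le, k2, fun h => k1.ne' h.2, k3⟩
  intro x y u v s t hn
  rcases v.eq_or_lt with rfl | v
  · exact rig y s t hn
  rcases t.eq_or_lt with rfl | t
  · exact top x u v.le hn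
  obtain ⟨x', y', k1, k2, k3, k4, k5, k6⟩ := hd i hi x y u v s t hn
  rcases k6 with k6 | ⟨k6 | k6, k7⟩
  · exact Or.inr ⟨x', y', k1, k2, k3, k4, k5, k6⟩
  · subst k6
    rcases rig y' (s.trans k3) k4 k7 with k | ⟨x2, y2, l1, l2, l3, l4, l5, l6⟩
    · exact Or.inl k
    · exact Or.inr ⟨x2, y2, k1.trans l1, l2, k3.trans l3, l4, fun h => by linarith [h.1], l6⟩
  · subst k6
    rcases top x' (u.trans k1) k2 k7 with k | ⟨x2, y2, l1, l2, l3, l4, l5, l6⟩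
    · exact Or.inl k
    · exact Or.inr ⟨x2, y2, k1.trans l1, l2, k3.trans l3, l4, fun h => by linarith [h.2], l6⟩

theorem SItem.box {S : Sys T} (hS : S.Lawful) {a b : T} {τ : Tile T} (h : BoxItem S (Fill S) a b τ) (x0 x1 y0 y1 : ℝ)
    (hx : x0 < x1) (hy : y0 < y1) :
    ∃ f, SItem S a b f x0 x1 y0 y1 ∧ f x0 y0 = τ.ll ∧ f x1 y1 = τ.ur := by
  obtain ⟨h1, h2, h3, r1, r2, r3, r4, r5, r6, r7, r8, e1, e2, e3, e4⟩ := h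
  obtain ⟨f, ht, hg⟩ := fill_at h1 x0 x1 y0 y1 hx hy
  refine ⟨f, ⟨hg.cohH, hg.cohV, ?_, box_demF ht hg.demF e1 e2, ?_⟩, ht.ll, ht.ur⟩
  · intro x y u v s t
    have l1 : ∀ x, x0 ≤ x → x ≤ x1 → S.le a (f x y0) := by
      intro x u v
      rcases u.eq_or_lt with rfl | u
      · rw [ht.ll]; exact h2
      · refine hS.trans _ _ _ h2 ?_; rw [← ht.ll]; exact hg.cohH _ _ _ le_rfl u v le_rfl hy.le
    have l2 : ∀ x, x0 ≤ x → x ≤ x1 → S.le (f x y1) b := by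
      intro x u v
      rcases v.eq_or_lt with rfl | v
      · rw [ht.ur]; exact h3
      · refine hS.trans _ _ _ ?_ h3; rw [← ht.ur]; exact hg.cohH _ _ _ u v le_rfl hy.le le_rfl
    refine ⟨?_, ?_, ?_⟩
    · rcases s.eq_or_lt with rfl | s
      · exact l1 x u v
      · exact hS.trans _ _ _ (l1 x u v) (hg.cohV y0 y x le_rfl s t u v)
    · rcases t.eq_or_lt with rfl | t
      · exact l2 x u v
      · exact hS.trans _ _ _ (hg.cohV y y1 x s t le_rfl u v) (l2 x u v)
    · rcases u.eq_or_lt with rfl | u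
      · rcases s.eq_or_lt with rfl | s
        · rw [ht.ll]; exact r1
        rcases t.eq_or_lt with rfl | t
        · rw [ht.ul]; exact r3
        exact r5 _ (Reads.mem ht.wl s t)
      rcases v.eq_or_lt with rfl | v
      · rcases s.eq_or_lt with rfl | s
        · rw [ht.lr]; exact r2
        rcases t.eq_or_lt with rfl | t
        · rw [ht.ur]; exact r4
        exact r6 _ (Reads.mem ht.wr s t)
      rcases s.eq_or_lt with rfl | s
      · exact r7 _ (Reads.mem ht.wb u v)
      rcases t.eq_or_lt with rfl | t
      · exact r8 _ (Reads.mem ht.wt u v)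
      exact hg.real x y u v s t
  · exact box_demF ht.dual hg.demP (by simpa using e3) (by simpa using e4)

def KEq (k : Prop) (x y : ℝ) : Prop := (k → x < y) ∧ (¬ k → x = y)

theorem SItem.of {S : Sys T} (hS : S.Lawful) {W : List (Wd T)} {a b p q : T} (h : IsItem S W (Fill S) a b p q) :
    ∃ kx ky : Prop, ∀ x0 x1 y0 y1, KEq kx x0 x1 → KEq ky y0 y1 → ∃ f, SItem S a b f x0 x1 y0 y1 ∧
      f x0 y0 = p ∧ f x1 y1 = q := by
  rcases h with ⟨rfl, h⟩ | ⟨w, _, h⟩ | ⟨τ, h, rfl, rfl⟩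
  · refine ⟨False, False, fun x0 x1 y0 y1 h1 h2 => ?_⟩
    rw [← h1.2 id, ← h2.2 id]
    exact ⟨_, SItem.pt h _ _, rfl, rfl⟩
  · refine ⟨False, True, fun x0 x1 y0 y1 h1 h2 => ?_⟩
    rw [← h1.2 id]
    exact SItem.seg hS h _ _ _ (h2.1 trivial)
  · exact ⟨True, True, fun x0 x1 y0 y1 h1 h2 => SItem.box hS h _ _ _ _ (h1.1 trivial) (h2.1 trivial)⟩

/-- Shuffle labelling. -/
structure ShufStr (S : Sys T) (f : ℝ → ℝ → T) (a b ul lr : T) (x0 x1 y0 y1 : ℝ) (σ lo hi ρ lo' hi' : ℝ → ℝ)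
    (F : ℝ → ℝ → ℝ → T) (s0 s1 : ℝ) : Prop where
  sx : Stair σ lo hi
  sy : Stair ρ lo' hi'
  hs : s0 < s1
  ex0 : x0 = hi s0
  ex1 : x1 = lo s1
  ey1 : y1 = - hi' s0
  ey0 : y0 = - lo' s1
  ful : f x0 y1 = ul
  flr : f x1 y0 = lr
  fa : ∀ x y, σ x < ρ (-y) → f x y = a
  fb : ∀ x y, ρ (-y) < σ x → f x y = b
  ff : ∀ x y, s0 < σ x → σ x < s1 → σ x = ρ (-y) → f x y = F (σ x) x y
  it : ∀ s, SItem S a b (F s) (lo s) (hi s) (-hi' s) (-lo' s)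
  aa : S.le a a
  bb : S.le b b
  ab : S.le a b
  ra : S.rl a
  rb : S.rl b
  a1 : S.le a ul
  a2 : S.le a lr
  b1 : S.le ul b
  b2 : S.le lr b
  dF : ∀ i < S.N, S.nF i a → S.w i a ∨ S.gF i b ∨ ∀ u v, u < v → ∃ s, u < s ∧ s < v ∧ S.gF i (F s (lo s) (-hi' s))
  dP : ∀ i < S.N, S.nP i b → S.w i b ∨ S.gP i a ∨ ∀ u v, u < v → ∃ s, u < s ∧ s < v ∧ S.gP i (F s (hi s) (-lo' s))

theorem SItem.dual {S : Sys T} {a b : T} {f : ℝ → ℝ → T} {x0 x1 y0 y1 : ℝ} (h : SItem S a b f x0 x1 y0 y1) :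
    SItem S.op b a (flp f) (-y1) (-y0) (-x1) (-x0) := by
  refine ⟨h.cohV.flp, h.cohH.flp, fun x y a b c d => ?_, h.demP, ?_⟩
  · have := h.bd (-y) (-x) (by linarith) (by linarith) (by linarith) (by linarith)
    exact ⟨this.2.1, this.1, this.2.2⟩
  · simp only [flp_flp, neg_neg]; exact h.demF

namespace Stair
variable {σ lo hi : ℝ → ℝ}
theorem at_lo (h : Stair σ lo hi) (s : ℝ) : σ (lo s) = s := (h.iff _ _).2 ⟨le_rfl, h.le s⟩
theorem at_hi (h : Stair σ lo hi) (s : ℝ) : σ (hi s) = s := (h.iff _ _).2 ⟨h.le s, le_rfl⟩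
theorem lt (h : Stair σ lo hi) {x y : ℝ} (hh : σ x < σ y) : x < y := by
  by_contra hc; exact absurd (h.mono (not_lt.1 hc)) (not_le.2 hh)
theorem mem (h : Stair σ lo hi) (x : ℝ) : lo (σ x) ≤ x ∧ x ≤ hi (σ x) := (h.iff _ _).1 rfl
theorem gt_hi (h : Stair σ lo hi) {x s : ℝ} (hx : hi s < x) : s < σ x := by
  have := h.mono hx.le
  rw [h.at_hi] at this
  refine lt_of_le_of_ne this fun e => ?_
  have := (h.mem x).2; rw [← e] at this; linarith
theorem lt_lo (h : Stair σ lo hi) {x s : ℝ} (hx : x < lo s) : σ x < s := by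
  have := h.mono hx.le
  rw [h.at_lo] at this
  refine lt_of_le_of_ne this fun e => ?_
  have := (h.mem x).1; rw [e] at this; linarith
end Stair

namespace ShufStr
variable {S : Sys T} {f : ℝ → ℝ → T} {a b ul lr : T} {x0 x1 y0 y1 : ℝ} {σ lo hi ρ lo' hi' : ℝ → ℝ}
    {F : ℝ → ℝ → ℝ → T} {s0 s1 : ℝ}

theorem dual (h : ShufStr S f a b ul lr x0 x1 y0 y1 σ lo hi ρ lo' hi' F s0 s1) :
    ShufStr S.op (flp f) b a ul lr (-y1) (-y0) (-x1) (-x0) ρ lo' hi' σ lo hi (fun s => flp (F s)) s0 s1 where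
  sx := h.sy
  sy := h.sx
  hs := h.hs
  ex0 := by rw [h.ey1, neg_neg]
  ex1 := by rw [h.ey0, neg_neg]
  ey1 := by rw [h.ex0]
  ey0 := by rw [h.ex1]
  ful := by simpa [flp] using h.ful
  flr := by simpa [flp] using h.flr
  fa x y hh := h.fb _ _ (by simpa using hh)
  fb x y hh := h.fa _ _ (by simpa using hh)
  ff x y h1 h2 h3 := by
    have := h.ff (-y) (-x) (h3 ▸ h1) (h3 ▸ h2) (by simpa using h3.symm)
    rw [h3]; exact this
  it s := by simpa using (h.it s).dual
  aa := h.bb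
  bb := h.aa
  ab := h.ab
  ra := h.rb
  rb := h.ra
  a1 := h.b1
  a2 := h.b2
  b1 := h.a1
  b2 := h.a2
  dF i hi hn := by simp only [flp, neg_neg]; exact h.dP i hi hn
  dP i hi hn := by simp only [flp, neg_neg]; exact h.dF i hi hn

theorem cohH (h : ShufStr S f a b ul lr x0 x1 y0 y1 σ lo hi ρ lo' hi' F s0 s1) : CohH S f x0 x1 y0 y1 := by
  have sx0 : σ x0 = s0 := by rw [h.ex0]; exact h.sx.at_hi _
  have sx1 : σ x1 = s1 := by rw [h.ex1]; exact h.sx.at_lo _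
  have sy0 : ρ (-y0) = s1 := by rw [h.ey0, neg_neg]; exact h.sy.at_lo _
  have sy1 : ρ (-y1) = s0 := by rw [h.ey1, neg_neg]; exact h.sy.at_hi _
  intro x x' y k1 k2 k3 k4 k5
  have m := h.sx.mono k2.le
  have mx : s0 ≤ σ x := by rw [← sx0]; exact h.sx.mono k1
  have mx' : σ x' ≤ s1 := by rw [← sx1]; exact h.sx.mono k3
  have gx' : s0 < σ x' := h.sx.gt_hi (by rw [← h.ex0]; linarith)
  have gx : σ x < s1 := h.sx.lt_lo (by rw [← h.ex1]; linarith)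
  have ly : y < y1 → s0 < ρ (-y) := fun hy => h.sy.gt_hi (by have := h.ey1; linarith)
  have ly' : y0 < y → ρ (-y) < s1 := fun hy => h.sy.lt_lo (by have := h.ey0; linarith)
  rcases lt_trichotomy (σ x) (ρ (-y)) with c | c | c
  · rw [h.fa _ _ c]
    rcases lt_trichotomy (σ x') (ρ (-y)) with d | d | d
    · rw [h.fa _ _ d]; exact h.aa
    · rcases k4.eq_or_lt with e | e
      · subst e
        rcases k3.eq_or_lt with e | e
        · subst e; rw [h.flr]; exact h.a2
        · exact absurd d (by rw [sy0]; exact (h.sx.lt_lo (by rw [← h.ex1]; exact e)).ne)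
      · have d' := ly' e
        rw [h.ff x' y gx' (by rw [d]; exact d') d]
        have m1 := h.sx.mem x'
        have m2 := h.sy.mem (-y)
        rw [← d] at m2
        exact ((h.it (σ x')).bd _ _ m1.1 m1.2 (by linarith) (by linarith)).1
    · rw [h.fb _ _ d]; exact h.ab
  · rcases k5.eq_or_lt with e | e
    · subst e
      have : x = x0 := by
        by_contra hne
        have : s0 < σ x := h.sx.gt_hi (by rw [← h.ex0]; exact lt_of_le_of_ne k1 (Ne.symm hne))
        linarith
      subst this
      rw [h.ful, h.fb x' y (by rw [sy1]; exact gx')]; exact h.b1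
    have gx0 : s0 < σ x := by rw [c]; exact ly e
    rw [h.ff x y gx0 gx c]
    have m1 := h.sx.mem x
    have m2 := h.sy.mem (-y)
    rw [← c] at m2
    rcases m.eq_or_lt with d | d
    · rw [h.ff x' y gx' (by rw [← d]; exact gx) (by rw [← d]; exact c)]
      have m3 := h.sx.mem x'
      rw [← d] at m3 ⊢
      exact (h.it (σ x)).cohH x x' y m1.1 k2 m3.2 (by linarith) (by linarith)
    · rw [h.fb x' y (by rw [← c]; exact d)]
      exact ((h.it (σ x)).bd _ _ m1.1 m1.2 (by linarith) (by linarith)).2.1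
  · rw [h.fb _ _ c, h.fb _ _ (c.trans_le m)]; exact h.bb

theorem cohV (h : ShufStr S f a b ul lr x0 x1 y0 y1 σ lo hi ρ lo' hi' F s0 s1) : CohH S (swf f) y0 y1 x0 x1 := by
  have := h.dual.cohH.flp
  simp only [flp_flp, neg_neg] at this
  exact this

theorem demF (h : ShufStr S f a b ul lr x0 x1 y0 y1 σ lo hi ρ lo' hi' F s0 s1) : DemF S f x0 x1 y0 y1 := by
  have sx0 : σ x0 = s0 := by rw [h.ex0]; exact h.sx.at_hi _
  have sx1 : σ x1 = s1 := by rw [h.ex1]; exact h.sx.at_lo _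
  have sy0 : ρ (-y0) = s1 := by rw [h.ey0, neg_neg]; exact h.sy.at_lo _
  have sy1 : ρ (-y1) = s0 := by rw [h.ey1, neg_neg]; exact h.sy.at_hi _
  have fur : f x1 y1 = b := h.fb _ _ (by rw [sx1, sy1]; exact h.hs)
  intro i hiN x y k1 k2 k3 k4 hn
  have gx : σ x < s1 := h.sx.lt_lo (by rw [← h.ex1]; linarith)
  have gy : s0 < ρ (-y) := h.sy.gt_hi (by have := h.ey1; linarith)
  have gx0 : s0 ≤ σ x := by rw [← sx0]; exact h.sx.mono k1
  have gy1 : ρ (-y) ≤ s1 := by rw [← sy0]; exact h.sy.mono (by linarith)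
  have cor : S.gF i b → ∃ x' y', x ≤ x' ∧ x' ≤ x1 ∧ y ≤ y' ∧ y' ≤ y1 ∧ ¬ (x' = x ∧ y' = y) ∧
      (S.w i (f x' y') ∨ ((x' = x1 ∨ y' = y1) ∧ S.nF i (f x' y'))) := by
    intro hg
    refine ⟨x1, y1, k2.le, le_rfl, k4.le, le_rfl, fun hh => by linarith [hh.1], ?_⟩
    rw [fur]
    rcases hg with hg | hg
    · exact Or.inr ⟨Or.inl rfl, hg⟩
    · exact Or.inl hg
  have box : ∀ s, s0 < s → s < s1 → ∀ u v, lo s ≤ u → u ≤ hi s → -hi' s ≤ v → v ≤ -lo' s → f u v = F s u v ∧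
      u < x1 ∧ v < y1 := by
    intro s h1 h2 u v e1 e2 e3 e4
    have c1 : σ u = s := (h.sx.iff _ _).2 ⟨e1, e2⟩
    have c2 : ρ (-v) = s := (h.sy.iff _ _).2 ⟨by linarith, by linarith⟩
    refine ⟨?_, h.sx.lt (by rw [c1, sx1]; exact h2), ?_⟩
    · rw [h.ff u v (by rw [c1]; exact h1) (by rw [c1]; exact h2) (c1.trans c2.symm), c1]
    · have := h.sy.lt (x := -y1) (y := -v) (by rw [c2, sy1]; exact h1)
      linarith
  have itm : ∀ s, s0 < s → s < s1 → ∀ u v, lo s ≤ u → u ≤ hi s → -hi' s ≤ v → v ≤ -lo' s → x ≤ u → y ≤ v →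
      S.nF i (F s u v) → ∃ x' y', x ≤ x' ∧ x' ≤ x1 ∧ y ≤ y' ∧ y' ≤ y1 ∧ ¬ (x' = x ∧ y' = y) ∧
      (S.w i (f x' y') ∨ ((x' = x1 ∨ y' = y1) ∧ S.nF i (f x' y'))) := by
    intro s h1 h2 u v e1 e2 e3 e4 e5 e6 hn
    rcases (h.it s).demF i hiN u v e1 e2 e3 e4 hn with k | ⟨x', y', l1, l2, l3, l4, l5, l6⟩
    · exact cor k
    · obtain ⟨b1, b2, b3⟩ := box s h1 h2 x' y' (e1.trans l1) l2 (e3.trans l3) l4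
      refine ⟨x', y', e5.trans l1, b2.le, e6.trans l3, b3.le, fun hh => l5 ?_, Or.inl (by rw [b1]; exact l6)⟩
      exact ⟨le_antisymm (by rw [hh.1]; exact e5) l1, le_antisymm (by rw [hh.2]; exact e6) l3⟩
  rcases lt_trichotomy (σ x) (ρ (-y)) with c | c | c
  · rw [h.fa _ _ c] at hn
    rcases h.dF i hiN hn with k | k | k
    · obtain ⟨s, e1, e2⟩ := exists_between c
      have hx : x < lo s := h.sx.lt (by rw [h.sx.at_lo]; exact e1)
      have hx1 : lo s < x1 := h.sx.lt (by rw [h.sx.at_lo, sx1]; linarith)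
      refine ⟨lo s, y, hx.le, hx1.le, le_rfl, k4.le, fun hh => hx.ne' hh.1, Or.inl ?_⟩
      rw [h.fa _ _ (by rw [h.sx.at_lo]; exact e2)]; exact k
    · exact cor k
    · obtain ⟨s, e1, e2, e3⟩ := k _ _ c
      have hx : x < lo s := h.sx.lt (by rw [h.sx.at_lo]; exact e1)
      have hy : hi' s < -y := h.sy.lt (by rw [h.sy.at_hi]; exact e2)
      have l1 := h.sx.le s
      have l2 := h.sy.le s
      obtain ⟨b1, b2, b3⟩ := box s (by linarith) (by linarith) (lo s) (-hi' s) le_rfl l1 le_rfl (by linarith)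
      rcases e3 with e3 | e3
      · exact itm s (by linarith) (by linarith) (lo s) (-hi' s) le_rfl l1 le_rfl (by linarith) hx.le (by linarith) e3
      · exact ⟨lo s, -hi' s, hx.le, b2.le, by linarith, b3.le, fun hh => hx.ne' hh.1, Or.inl (by rw [b1]; exact e3)⟩
  · have m1 := h.sx.mem x
    have m2 := h.sy.mem (-y)
    rw [← c] at m2
    rw [h.ff x y (by rw [c]; exact gy) gx c] at hn
    exact itm (σ x) (by rw [c]; exact gy) gx x y m1.1 m1.2 (by linarith) (by linarith) le_rfl le_rfl hn
  · rw [h.fb _ _ c] at hn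
    exact cor (Or.inl hn)

theorem good (h : ShufStr S f a b ul lr x0 x1 y0 y1 σ lo hi ρ lo' hi' F s0 s1) : Good S f x0 x1 y0 y1 := by
  refine ⟨h.cohH, h.cohV, ?_, h.demF, h.dual.demF⟩
  intro x y k1 k2 k3 k4
  have gx : σ x < s1 := h.sx.lt_lo (by rw [← h.ex1]; linarith)
  have gx0 : s0 < σ x := h.sx.gt_hi (by rw [← h.ex0]; linarith)
  rcases lt_trichotomy (σ x) (ρ (-y)) with c | c | c
  · rw [h.fa _ _ c]; exact h.ra
  · rw [h.ff x y gx0 gx c]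
    have m1 := h.sx.mem x
    have m2 := h.sy.mem (-y)
    rw [← c] at m2
    exact ((h.it (σ x)).bd _ _ m1.1 m1.2 (by linarith) (by linarith)).2.2
  · rw [h.fb _ _ c]; exact h.rb

theorem isTile (h : ShufStr S f a b ul lr x0 x1 y0 y1 σ lo hi ρ lo' hi' F s0 s1) :
    IsTile f x0 x1 y0 y1 (Tile.mk' a lr ul b (a, []) (b, []) (a, []) (b, [])) := by
  have sx0 : σ x0 = s0 := by rw [h.ex0]; exact h.sx.at_hi _
  have sx1 : σ x1 = s1 := by rw [h.ex1]; exact h.sx.at_lo _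
  have sy0 : ρ (-y0) = s1 := by rw [h.ey0, neg_neg]; exact h.sy.at_lo _
  have sy1 : ρ (-y1) = s0 := by rw [h.ey1, neg_neg]; exact h.sy.at_hi _
  have hx : x0 < x1 := h.sx.lt (by rw [sx0, sx1]; exact h.hs)
  have hy : y0 < y1 := by
    have := h.sy.lt (x := -y1) (y := -y0) (by rw [sy0, sy1]; exact h.hs)
    linarith
  have gx : ∀ x, x < x1 → σ x < s1 := fun x hh => h.sx.lt_lo (by rw [← h.ex1]; linarith)
  have gx0 : ∀ x, x0 < x → s0 < σ x := fun x hh => h.sx.gt_hi (by rw [← h.ex0]; linarith)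
  have gy : ∀ y, y < y1 → s0 < ρ (-y) := fun y hh => h.sy.gt_hi (by have := h.ey1; linarith)
  have gy0 : ∀ y, y0 < y → ρ (-y) < s1 := fun y hh => h.sy.lt_lo (by have := h.ey0; linarith)
  refine ⟨hx, hy, ?_, h.flr, h.ful, ?_, ?_, ?_, ?_, ?_⟩
  · exact h.fa _ _ (by rw [sx0, sy0]; exact h.hs)
  · exact h.fb _ _ (by rw [sx1, sy1]; exact h.hs)
  · exact ⟨hy, fun y u v => h.fa _ _ (by rw [sx0]; exact gy y v)⟩
  · exact ⟨hy, fun y u v => h.fb _ _ (by rw [sx1]; exact gy0 y u)⟩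
  · exact ⟨hx, fun x u v => h.fa _ _ (by rw [sy0]; exact gx x v)⟩
  · exact ⟨hx, fun x u v => h.fb _ _ (by rw [sy1]; exact gx0 x u)⟩

end ShufStr

open Classical in
theorem sound_shuf {S : Sys T} (hS : S.Lawful) {U : List T} {W : List (Wd T)} {τ : Tile T}
    (h : RuleShuf S U W (Fill S) τ) : Fill S τ := by
  obtain ⟨e1, e2, e3, e4, ra, rb, aa, bb, ab, c1, c2, c3, c4, ⟨t, _, ht⟩, hd⟩ := h
  obtain ⟨γ, hγ, hγ0⟩ := exists_colour
  -- items: index j+1 encodes (i, side)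
  have key : ∀ j : ℕ, ∃ (p q : T), IsItem S W (Fill S) τ.ll τ.ur p q ∧
      (j = 0 → p = t ∧ q = t ∧ PtItem S τ.ll τ.ur t) ∧
      (∀ i, i < S.N → j = 2 * i + 1 → S.nF i τ.ll → S.w i τ.ll ∨ S.gF i τ.ur ∨ S.gF i p) ∧
      (∀ i, i < S.N → j = 2 * i + 2 → S.nP i τ.ur → S.w i τ.ur ∨ S.gP i τ.ll ∨ S.gP i q) := by
    intro j
    have dflt : IsItem S W (Fill S) τ.ll τ.ur t t := Or.inl ⟨rfl, ht⟩
    rcases Nat.eq_zero_or_pos j with hj | hj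
    · exact ⟨t, t, dflt, fun _ => ⟨rfl, rfl, ht⟩, fun i _ h => by omega, fun i _ h => by omega⟩
    by_cases A : ∃ p q, IsItem S W (Fill S) τ.ll τ.ur p q ∧ ∃ i, i < S.N ∧
        ((j = 2 * i + 1 ∧ S.gF i p) ∨ (j = 2 * i + 2 ∧ S.gP i q))
    · obtain ⟨p, q, h1, i, hi, h2⟩ := A
      refine ⟨p, q, h1, fun h => by omega, fun i' _ h => ?_, fun i' _ h => ?_⟩
      · rcases h2 with h2 | h2
        · obtain rfl : i = i' := by omega
          exact fun _ => Or.inr (Or.inr h2.2)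
        · omega
      · rcases h2 with h2 | h2
        · omega
        · obtain rfl : i = i' := by omega
          exact fun _ => Or.inr (Or.inr h2.2)
    · refine ⟨t, t, dflt, fun h => by omega, fun i hi h hn => ?_, fun i hi h hn => ?_⟩
      · rcases (hd i hi).1 hn with k | k | ⟨p, _, q, _, k1, k2⟩
        · exact Or.inl k
        · exact Or.inr (Or.inl k)
        · exact absurd ⟨p, q, k1, i, hi, Or.inl ⟨h, k2⟩⟩ A
      · rcases (hd i hi).2 hn with k | k | ⟨p, _, q, _, k1, k2⟩
        · exact Or.inl k
        · exact Or.inr (Or.inl k)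
        · exact absurd ⟨p, q, k1, i, hi, Or.inr ⟨h, k2⟩⟩ A
  choose p q hp hp0 hpF hpP using key
  have key2 : ∀ j : ℕ, ∃ kx ky : Prop, (j = 0 → ¬ kx ∧ ¬ ky) ∧ ∀ x0 x1 y0 y1, KEq kx x0 x1 → KEq ky y0 y1 →
      ∃ f, SItem S τ.ll τ.ur f x0 x1 y0 y1 ∧ f x0 y0 = p j ∧ f x1 y1 = q j := by
    intro j
    rcases Nat.eq_zero_or_pos j with hj | hj
    · obtain ⟨h1, h2, h3⟩ := hp0 j hj
      refine ⟨False, False, fun _ => ⟨id, id⟩, fun x0 x1 y0 y1 g1 g2 => ?_⟩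
      rw [← g1.2 id, ← g2.2 id]
      exact ⟨_, SItem.pt h3 _ _, h1.symm, h2.symm⟩
    · obtain ⟨kx, ky, h⟩ := SItem.of hS (hp j)
      exact ⟨kx, ky, fun h => by omega, h⟩
  choose kx ky hk0 hk using key2
  obtain ⟨σ, lo, hi, s1, s2, s3⟩ := exists_stair {s | kx (γ s)} (hγ0.mono fun s hs h0 => (hk0 _ h0).1 hs)
  obtain ⟨ρ, lo', hi', r1, r2, r3⟩ := exists_stair {s | ky (γ s)} (hγ0.mono fun s hs h0 => (hk0 _ h0).2 hs)
  have key3 : ∀ s, ∃ f, SItem S τ.ll τ.ur f (lo s) (hi s) (-hi' s) (-lo' s) ∧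
      f (lo s) (-hi' s) = p (γ s) ∧ f (hi s) (-lo' s) = q (γ s) := by
    intro s
    refine hk (γ s) _ _ _ _ ⟨fun h => s2 s h, fun h => s3 s h⟩ ⟨fun h => ?_, fun h => ?_⟩
    · have := r2 s h; linarith
    · have := r3 s h; linarith
  choose F hF1 hF2 hF3 using key3
  let f : ℝ → ℝ → T := fun x y => if x = hi 0 ∧ y = - hi' 0 then τ.ul else if x = lo 1 ∧ y = - lo' 1 then τ.lr else
    if σ x < ρ (-y) then τ.ll else if ρ (-y) < σ x then τ.ur else F (σ x) x y
  have q1 : ∀ x y, (x = hi 0 ∧ y = - hi' 0) → σ x = 0 ∧ ρ (-y) = 0 := by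
    rintro x y ⟨rfl, rfl⟩; rw [neg_neg]; exact ⟨s1.at_hi _, r1.at_hi _⟩
  have q2 : ∀ x y, (x = lo 1 ∧ y = - lo' 1) → σ x = 1 ∧ ρ (-y) = 1 := by
    rintro x y ⟨rfl, rfl⟩; rw [neg_neg]; exact ⟨s1.at_lo _, r1.at_lo _⟩
  have hst : ShufStr S f τ.ll τ.ur τ.ul τ.lr (hi 0) (lo 1) (-lo' 1) (-hi' 0) σ lo hi ρ lo' hi' F 0 1 := by
    refine ⟨s1, r1, one_pos, rfl, rfl, rfl, rfl, ?_, ?_, ?_, ?_, ?_, hF1, aa, bb, ab, ra, rb, c1, c2, c3, c4, ?_, ?_⟩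
    · simp [f]
    · have : ¬ (lo 1 = hi 0 ∧ - lo' 1 = - hi' 0) := fun h => by
        have h1 := (q1 _ _ h).1; rw [s1.at_lo] at h1; norm_num at h1
      simp only [f, if_neg this]; simp
    · intro x y h
      have g1 : ¬ (x = hi 0 ∧ y = - hi' 0) := fun h' => by have := q1 _ _ h'; linarith
      have g2 : ¬ (x = lo 1 ∧ y = - lo' 1) := fun h' => by have := q2 _ _ h'; linarith
      simp only [f, if_neg g1, if_neg g2, if_pos h]
    · intro x y h
      have g1 : ¬ (x = hi 0 ∧ y = - hi' 0) := fun h' => by have := q1 _ _ h'; linarith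
      have g2 : ¬ (x = lo 1 ∧ y = - lo' 1) := fun h' => by have := q2 _ _ h'; linarith
      simp only [f, if_neg g1, if_neg g2, if_neg h.not_gt, if_pos h]
    · intro x y h1 h2 h
      have g1 : ¬ (x = hi 0 ∧ y = - hi' 0) := fun h' => by have := q1 _ _ h'; linarith
      have g2 : ¬ (x = lo 1 ∧ y = - lo' 1) := fun h' => by have := q2 _ _ h'; linarith
      simp only [f, if_neg g1, if_neg g2, if_neg h.not_lt, if_neg h.not_gt]
    · intro i hi hn
      rcases hpF _ i hi rfl hn with k | k | k
      · exact Or.inl k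
      · exact Or.inr (Or.inl k)
      · refine Or.inr (Or.inr fun u v huv => ?_)
        obtain ⟨s, h1, h2, h3⟩ := hγ (2 * i + 1) u v huv
        exact ⟨s, h1, h2, by rw [hF2, h3]; exact k⟩
    · intro i hi hn
      rcases hpP _ i hi rfl hn with k | k | k
      · exact Or.inl k
      · exact Or.inr (Or.inl k)
      · refine Or.inr (Or.inr fun u v huv => ?_)
        obtain ⟨s, h1, h2, h3⟩ := hγ (2 * i + 2) u v huv
        exact ⟨s, h1, h2, by rw [hF3, h3]; exact k⟩
  refine ⟨f, _, _, _, _, ?_, hst.good⟩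
  have := hst.isTile
  rwa [show Tile.mk' τ.ll τ.lr τ.ul τ.ur (τ.ll, []) (τ.ur, []) (τ.ll, []) (τ.ur, []) = τ by
    rw [← e1, ← e4]
    conv_rhs => rw [show τ = Tile.mk' τ.ll τ.lr τ.ul τ.ur τ.wl τ.wr τ.wb τ.wt from rfl]
    rw [e2, e3, e1, e4]] at this

theorem Step.sound {S : Sys T} (hS : S.Lawful) {U : List T} {W : List (Wd T)} {τ : Tile T}
    (h : Step S U W (Fill S) τ) : Fill S τ := by
  rcases h with h | h | h | h | h
  · exact sound_triv hS h
  · exact sound_cut hS h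
  · exact sound_swap h
  · exact sound_loop hS h
  · exact sound_shuf hS h

end Temporal

namespace Temporal

variable {T : Type}

abbrev Tri (T : Type) := T × Wd T × Wd T

def Tri.dual (σ : Tri T) : Tri T := (σ.1, revW σ.2.2, revW σ.2.1)

structure IsTri (f : ℝ → ℝ → T) (u v : ℝ) (σ : Tri T) : Prop where
  huv : u < v
  q : f u v = σ.1
  wl : RdW (fun y => f u y) u v σ.2.1
  wt : RdW (fun x => f x v) u v σ.2.2

def TDemF (S : Sys T) (f : ℝ → ℝ → T) (u v : ℝ) : Prop :=
  ∀ i < S.N, ∀ x y, u ≤ x → x < y → y < v → S.nF i (f x y) →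
    ∃ x' y', x ≤ x' ∧ y ≤ y' ∧ x' < y' ∧ y' ≤ v ∧ ¬ (x' = x ∧ y' = y) ∧
      (S.w i (f x' y') ∨ (y' = v ∧ S.nF i (f x' y')))

def TCohH (S : Sys T) (f : ℝ → ℝ → T) (u v : ℝ) : Prop :=
  ∀ x x' y, u ≤ x → x < x' → x' < y → y ≤ v → S.le (f x y) (f x' y)

structure TGood (S : Sys T) (f : ℝ → ℝ → T) (u v : ℝ) : Prop where
  cohH : TCohH S f u v
  cohV : TCohH S.op (flp f) (-v) (-u)
  real : ∀ x y, u < x → x < y → y < v → S.rl (f x y)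
  demF : TDemF S f u v
  demP : TDemF S.op (flp f) (-v) (-u)

def TFill (S : Sys T) (σ : Tri T) : Prop := ∃ f u v, IsTri f u v σ ∧ TGood S f u v

theorem op_op (S : Sys T) : S.op.op = S := rfl

theorem TGood.dual {S : Sys T} {f : ℝ → ℝ → T} {u v : ℝ} (h : TGood S f u v) : TGood S.op (flp f) (-v) (-u) := by
  refine ⟨h.cohV, ?_, fun x y a b c => h.real _ _ (by linarith) (by linarith) (by linarith), h.demP, ?_⟩
  · simp only [flp_flp, neg_neg, op_op]; exact h.cohH
  · simp only [flp_flp, neg_neg, op_op]; exact h.demF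

theorem TCohH.congr {S : Sys T} {f g : ℝ → ℝ → T} {u v : ℝ} (h : TCohH S f u v)
    (hfg : ∀ x y, u ≤ x → x < y → y ≤ v → f x y = g x y) : TCohH S g u v := by
  intro x x' y a b c d
  rw [← hfg x y a (b.trans c) d, ← hfg x' y (a.trans b.le) c d]; exact h x x' y a b c d

theorem TDemF.congr {S : Sys T} {f g : ℝ → ℝ → T} {u v : ℝ} (h : TDemF S f u v)
    (hfg : ∀ x y, u ≤ x → x < y → y ≤ v → f x y = g x y) : TDemF S g u v := by
  intro i hi x y a b c e
  rw [← hfg x y a b c.le] at e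
  obtain ⟨x', y', h1, h2, h3, h4, h5, h6⟩ := h i hi x y a b c e
  rw [hfg x' y' (a.trans h1) h3 h4] at h6
  exact ⟨x', y', h1, h2, h3, h4, h5, h6⟩

theorem TGood.congr {S : Sys T} {f g : ℝ → ℝ → T} {u v : ℝ} (h : TGood S f u v)
    (hfg : ∀ x y, u ≤ x → x < y → y ≤ v → f x y = g x y) : TGood S g u v := by
  have hd : ∀ x y, -v ≤ x → x < y → y ≤ -u → flp f x y = flp g x y := fun x y a b c =>
    hfg _ _ (by linarith) (by linarith) (by linarith)
  refine ⟨h.cohH.congr hfg, h.cohV.congr hd, fun x y a b c => ?_, h.demF.congr hfg, h.demP.congr hd⟩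
  rw [← hfg x y a.le b c.le]; exact h.real x y a b c

theorem TCohH.rescale {S : Sys T} {f : ℝ → ℝ → T} {u v : ℝ} (φ : ℝ ≃o ℝ) (h : TCohH S f (φ u) (φ v)) :
    TCohH S (fun x y => f (φ x) (φ y)) u v := fun _ _ _ a b c d =>
  h _ _ _ (φ.monotone a) (φ.strictMono b) (φ.strictMono c) (φ.monotone d)

theorem TDemF.rescale {S : Sys T} {f : ℝ → ℝ → T} {u v : ℝ} (φ : ℝ ≃o ℝ) (h : TDemF S f (φ u) (φ v)) :
    TDemF S (fun x y => f (φ x) (φ y)) u v := by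
  intro i hi x y a b c e
  obtain ⟨x', y', h1, h2, h3, h4, h5, h6⟩ := h i hi (φ x) (φ y) (φ.monotone a) (φ.strictMono b) (φ.strictMono c) e
  obtain ⟨x', rfl⟩ := φ.surjective x'
  obtain ⟨y', rfl⟩ := φ.surjective y'
  simp only [map_le_map_iff, map_lt_map_iff, EmbeddingLike.apply_eq_iff_eq] at *
  exact ⟨x', y', h1, h2, h3, h4, h5, h6⟩

theorem TGood.rescale {S : Sys T} {f : ℝ → ℝ → T} {u v : ℝ} (φ : ℝ ≃o ℝ) (h : TGood S f (φ u) (φ v)) :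
    TGood S (fun x y => f (φ x) (φ y)) u v := by
  have e : (fun x y => flp f (negIso φ x) (negIso φ y)) = flp (fun x y => f (φ x) (φ y)) := by
    funext x y; simp [flp]
  refine ⟨h.cohH.rescale, ?_, fun x y a b c => h.real _ _ (φ.strictMono a) (φ.strictMono b) (φ.strictMono c),
    h.demF.rescale, ?_⟩
  · rw [← e]; apply TCohH.rescale; simpa using h.cohV
  · rw [← e]; apply TDemF.rescale; simpa using h.demP

theorem IsTri.rescale {f : ℝ → ℝ → T} {u v : ℝ} {σ : Tri T} (φ : ℝ ≃o ℝ) (h : IsTri f (φ u) (φ v) σ) :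
    IsTri (fun x y => f (φ x) (φ y)) u v σ :=
  ⟨φ.lt_iff_lt.1 h.huv, h.q, Reads.comp φ h.wl, Reads.comp φ h.wt⟩

theorem tfill_at {S : Sys T} {σ : Tri T} (h : TFill S σ) (a b : ℝ) (hab : a < b) :
    ∃ f, IsTri f a b σ ∧ TGood S f a b := by
  obtain ⟨f, u, v, h1, h2⟩ := h
  obtain ⟨φ, rfl, rfl⟩ := iso_affine a b u v hab h1.huv
  exact ⟨_, h1.rescale, h2.rescale⟩

theorem fill_botright {S : Sys T} {τ : Tile T} (h : Fill S τ) {a b c d : ℝ} {βx βy : ℝ → T}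
    (hx : RdW βx a b τ.wb) (hy : RdW βy c d τ.wr) :
    ∃ f, IsTile f a b c d τ ∧ Good S f a b c d ∧ (∀ x, a < x → x < b → f x c = βx x) ∧
      (∀ y, c < y → y < d → f b y = βy y) := by
  obtain ⟨f, x0, x1, y0, y1, h1, h2⟩ := h
  obtain ⟨φ, p1, p2, p3⟩ := align hx h1.wb
  obtain ⟨ψ, q1, q2, q3⟩ := align hy h1.wr
  rw [← p1, ← p2, ← q1, ← q2] at h1 h2
  refine ⟨_, h1.rescale, h2.rescale, fun x u v => ?_, fun x u v => ?_⟩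
  · rw [p3 x u v, q1]
  · rw [q3 x u v, p2]

def Null (S : Sys T) (g : T) : Prop := ∀ i < S.N, ¬ S.nF i g ∧ ¬ S.nP i g ∧ ¬ S.w i g

def DCor (S : Sys T) (f : ℝ → ℝ → T) (w : ℝ) : Prop :=
  Null S (f w w) ∨ ((∀ v, w < v → ∃ y, w < y ∧ y < v ∧ f w y = f w w) ∧ (∀ u, u < w → ∃ x, u < x ∧ x < w ∧ f x w = f w w))

theorem DCor.flp {S : Sys T} {f : ℝ → ℝ → T} {w : ℝ} (h : DCor S f w) : DCor S.op (flp f) (-w) := by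
  unfold DCor Temporal.flp
  simp only [neg_neg]
  rcases h with h | ⟨h1, h2⟩
  · exact Or.inl fun i hi => ⟨(h i hi).2.1, (h i hi).1, (h i hi).2.2⟩
  · refine Or.inr ⟨fun v hv => ?_, fun u hu => ?_⟩
    · obtain ⟨x, a, b, c⟩ := h2 (-v) (by linarith)
      exact ⟨-x, by linarith, by linarith, by simpa using c⟩
    · obtain ⟨x, a, b, c⟩ := h1 (-u) (by linarith)
      exact ⟨-x, by linarith, by linarith, by simpa using c⟩

theorem TCohH.glue {S : Sys T} (hS : S.Lawful) {f : ℝ → ℝ → T} {u w v : ℝ} (h0 : u < w)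
    (h1 : TCohH S f u w) (h2 : TCohH S f w v) (hr : CohH S f u w w v) : TCohH S f u v := by
  intro x x' y a b c d
  rcases le_or_gt y w with g | g
  · exact h1 x x' y a b c g
  · rcases le_or_gt x' w with k | k
    · exact hr x x' y a b k g.le d
    · rcases lt_or_ge x w with l | l
      · exact hS.trans _ _ _ (hr x w y a l le_rfl g.le d) (h2 w x' y le_rfl k c d)
      · exact h2 x x' y l b c d

theorem TDemF.glue {S : Sys T} {f : ℝ → ℝ → T} {u w v : ℝ} (h0 : u < w) (hv : w < v)
    (h1 : TDemF S f u w) (h2 : TDemF S f w v) (hr : DemF S f u w w v) (hc : DCor S f w) : TDemF S f u v := by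
  have B : ∀ i < S.N, ∀ x y, u ≤ x → x < w → w ≤ y → y < v → S.nF i (f x y) →
    ∃ x' y', x ≤ x' ∧ y ≤ y' ∧ x' < y' ∧ y' ≤ v ∧ ¬ (x' = x ∧ y' = y) ∧
      (S.w i (f x' y') ∨ (y' = v ∧ S.nF i (f x' y'))) := by
    intro i hi x y a b c d e
    have C : ∀ y', y ≤ y' → w < y' → y' ≤ v → S.gF i (f w y') → 
        ∃ x' y', x ≤ x' ∧ y ≤ y' ∧ x' < y' ∧ y' ≤ v ∧ ¬ (x' = x ∧ y' = y) ∧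
      (S.w i (f x' y') ∨ (y' = v ∧ S.nF i (f x' y'))) := by
      intro y' k1 k2 k3 k4
      rcases k4 with k4 | k4
      · rcases k3.eq_or_lt with k3 | k3
        · exact ⟨w, y', b.le, k1, k2, k3.le, fun hh => b.ne' hh.1, Or.inr ⟨k3, k4⟩⟩
        · obtain ⟨x2, y2, l1, l2, l3, l4, l5, l6⟩ := h2 i hi w y' le_rfl k2 k3 k4
          exact ⟨x2, y2, b.le.trans l1, k1.trans l2, l3, l4, fun hh => by linarith [hh.1], l6⟩
      · exact ⟨w, y', b.le, k1, k2, k3, fun hh => b.ne' hh.1, Or.inl k4⟩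
    obtain ⟨x', y', k1, k2, k3, k4, k5, k6⟩ := hr i hi x y a b c d e
    by_cases hco : x' = w ∧ y' = w
    · obtain ⟨hx', hy'⟩ := hco
      rw [hx', hy'] at k6
      rw [hy'] at k3
      have hg : S.gF i (f w w) := by
        rcases k6 with k6 | k6
        · exact Or.inr k6
        · exact Or.inl k6.2
      rcases hc with hc | ⟨hc, _⟩
      · obtain ⟨n1, n2, n3⟩ := hc i hi
        rcases hg with hg | hg
        · exact absurd hg n1
        · exact absurd hg n3
      · obtain ⟨y2, l1, l2, l3⟩ := hc v hv
        exact C y2 (k3.trans l1.le) l1 l2.le (by rw [l3]; exact hg)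
    · have hlt : x' < y' := by
        rcases k2.lt_or_eq with k2 | k2
        · linarith
        · refine lt_of_le_of_ne (by linarith) fun h => hco ⟨k2, by linarith⟩
      rcases k6 with k6 | ⟨k6 | k6, k7⟩
      · exact ⟨x', y', k1, k3, hlt, k4, k5, Or.inl k6⟩
      · subst k6
        exact C y' k3 hlt k4 (Or.inl k7)
      · exact ⟨x', y', k1, k3, hlt, k4, k5, Or.inr ⟨k6, k7⟩⟩
  intro i hi x y a b c e
  rcases lt_or_ge y w with g | g
  · obtain ⟨x', y', k1, k2, k3, k4, k5, k6⟩ := h1 i hi x y a b g e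
    rcases k6 with k6 | ⟨k6, k7⟩
    · exact ⟨x', y', k1, k2, k3, k4.trans hv.le, k5, Or.inl k6⟩
    · subst k6
      obtain ⟨x2, y2, l1, l2, l3, l4, l5, l6⟩ := B i hi x' y' (a.trans k1) k3 le_rfl hv k7
      exact ⟨x2, y2, k1.trans l1, k2.trans l2, l3, l4, fun hh => by linarith [hh.2], l6⟩
  · rcases lt_or_ge x w with k | k
    · exact B i hi x y a k g c e
    · exact h2 i hi x y k b c e

theorem TGood.glue {S : Sys T} (hS : S.Lawful) {f : ℝ → ℝ → T} {u w v : ℝ} (h0 : u < w) (hv : w < v)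
    (h1 : TGood S f u w) (h2 : TGood S f w v) (hr : Good S f u w w v) (hc : DCor S f w)
    (r1 : ∀ x, u < x → x < w → S.rl (f x w)) (r2 : ∀ y, w < y → y < v → S.rl (f w y)) : TGood S f u v := by
  refine ⟨h1.cohH.glue hS h0 h2.cohH hr.cohH, h2.cohV.glue hS.op (by linarith) h1.cohV hr.dual.cohH, ?_,
    h1.demF.glue h0 hv h2.demF hr.demF hc, h2.demP.glue (by linarith) (by linarith) h1.demP hr.demP hc.flp⟩
  intro x y a b c
  rcases lt_trichotomy y w with g | rfl | g
  · exact h1.real x y a b g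
  · exact r1 x a b
  · rcases lt_trichotomy x w with k | rfl | k
    · exact hr.real x y a k g c
    · exact r2 y b c
    · exact h2.real x y k b c

structure TrF (S : Sys T) (σ : Tri T) (c : T) : Prop where
  ch : Chn S σ.1 ((σ.2.1.1, σ.2.1.1) :: σ.2.1.2)
  le : ∀ t ∈ letters σ.2.1, S.le t c
  li : ∀ i < S.N, LineF S i (S.nF i σ.1 ∨ S.gF i c) σ.1 ((σ.2.1.1, σ.2.1.1) :: σ.2.1.2)
  ce : ∀ i < S.N, S.nF i c → S.w i c ∨ S.gF i (lastW σ.2.2)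

def RuleT1 (S : Sys T) (U : List T) (σ : Tri T) : Prop :=
  ∃ c ∈ U, S.rl c ∧ S.le c c ∧ TrF S σ c ∧ TrF S.op σ.dual c

def RuleT2 (S : Sys T) (R : Tile T → Prop) (V : Tri T → Prop) (σ : Tri T) : Prop :=
  ∃ σ1, V σ1 ∧ ∃ σ2, V σ2 ∧ ∃ τ, R τ ∧ τ.ll = σ1.1 ∧ τ.ul = σ.1 ∧ τ.ur = σ2.1 ∧ τ.wr = σ2.2.1 ∧ τ.wb = σ1.2.2 ∧
    Join σ1.2.1 σ1.1 τ.wl σ.2.1 ∧ Join τ.wt σ2.1 σ2.2.2 σ.2.2 ∧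
    (∀ t ∈ letters τ.wb, S.rl t) ∧ (∀ t ∈ letters τ.wr, S.rl t) ∧
    (Null S τ.lr ∨ (τ.lr = lastW τ.wb ∧ τ.lr = τ.wr.1))

def TStep (S : Sys T) (U : List T) (R : Tile T → Prop) (V : Tri T → Prop) (σ : Tri T) : Prop :=
  RuleT1 S U σ ∨ RuleT2 S R V σ

theorem TStep.mono {S : Sys T} {U : List T} {R R' : Tile T → Prop} {V V' : Tri T → Prop} (hR : ∀ τ, R τ → R' τ)
    (hV : ∀ τ, V τ → V' τ) {σ : Tri T} (h : TStep S U R V σ) : TStep S U R' V' σ := by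
  rcases h with h | ⟨σ1, h1, σ2, h2, τ, h3, h⟩
  · exact Or.inl h
  · exact Or.inr ⟨σ1, hV _ h1, σ2, hV _ h2, τ, hR _ h3, h⟩

theorem TrF.demF {S : Sys T} {f : ℝ → ℝ → T} {u v : ℝ} {σ : Tri T} {c : T} (h : IsTri f u v σ) (ht : TrF S σ c)
    (hc : ∀ x y, u < x → x < y → y < v → f x y = c) : TDemF S f u v := by
  have cen : ∀ i < S.N, ∀ x y, u ≤ x → x < y → y < v → S.gF i c → 
    ∃ x' y', x ≤ x' ∧ y ≤ y' ∧ x' < y' ∧ y' ≤ v ∧ ¬ (x' = x ∧ y' = y) ∧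
      (S.w i (f x' y') ∨ (y' = v ∧ S.nF i (f x' y'))) := by
    intro i hi x y a b c' hg
    have hw : S.w i c → ∃ x' y', x ≤ x' ∧ y ≤ y' ∧ x' < y' ∧ y' ≤ v ∧ ¬ (x' = x ∧ y' = y) ∧
      (S.w i (f x' y') ∨ (y' = v ∧ S.nF i (f x' y'))) := by
      intro hw
      obtain ⟨x', k1, k2⟩ := exists_between b
      refine ⟨x', y, k1.le, le_rfl, k2, c'.le, fun hh => k1.ne' hh.1, Or.inl ?_⟩
      rw [hc x' y (by linarith) k2 c']; exact hw
    rcases hg with hg | hg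
    · rcases ht.ce i hi hg with k | k
      · exact hw k
      · obtain ⟨m, m1, m2, m3⟩ := Reads.last h.wt
        obtain ⟨x', k1, k2⟩ := exists_between (show max m y < v from max_lt m2 c')
        have e := m3 x' (lt_of_le_of_lt (le_max_left _ _) k1) k2
        have k1' := lt_of_le_of_lt (le_max_right _ _) k1
        refine ⟨x', v, by linarith, c'.le, k2, le_rfl, fun hh => by linarith [hh.1], ?_⟩
        change f x' v = _ at e
        rw [e]
        rcases k with k | k
        · exact Or.inr ⟨rfl, k⟩
        · exact Or.inl k
    · exact hw hg
  intro i hi x y a b c' hn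
  rcases a.eq_or_lt with rfl | a
  · rcases LineF.sound h.wl (ht.li i hi) b c' hn with ⟨y', k1, k2, k3⟩ | k | k | k
    · exact ⟨u, y', le_rfl, k1.le, b.trans k1, k2.le, fun hh => k1.ne' hh.2, Or.inl k3⟩
    · exact ⟨u, v, le_rfl, c'.le, b.trans c', le_rfl, fun hh => c'.ne' hh.2, Or.inl (by rw [h.q]; exact k)⟩
    · exact ⟨u, v, le_rfl, c'.le, b.trans c', le_rfl, fun hh => c'.ne' hh.2, Or.inr ⟨rfl, (by rw [h.q]; exact k)⟩⟩
    · exact cen i hi u y le_rfl b c' k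
  · rw [hc x y a b c'] at hn
    exact cen i hi x y a.le b c' (Or.inl hn)

theorem IsTri.dual {f : ℝ → ℝ → T} {u v : ℝ} {σ : Tri T} (h : IsTri f u v σ) : IsTri (flp f) (-v) (-u) σ.dual := by
  refine ⟨by linarith [h.huv], by simpa [flp, Tri.dual] using h.q, ?_, ?_⟩
  · simpa [flp, Tri.dual] using h.wt.rev
  · simpa [flp, Tri.dual] using h.wl.rev

theorem TrF.half {S : Sys T} (hS : S.Lawful) {f : ℝ → ℝ → T} {u v : ℝ} {σ : Tri T} {c : T} (h : IsTri f u v σ) (ht : TrF S σ c) :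
    (∀ y y', u < y → y < y' → y' ≤ v → S.le (f u y) (f u y')) ∧ (∀ y, u < y → y < v → S.le (f u y) c) := by
  obtain ⟨k1, k2, k3⟩ := Chn.sound hS h.wl ht.ch
  refine ⟨fun y y' a b e => ?_, fun y a b => ht.le _ (Reads.mem h.wl a b)⟩
  rcases e.eq_or_lt with rfl | e
  · have := (k1 y a b).2; rw [h.q]; exact this
  · exact k2 y y' a b e

theorem Tr.cohH {S : Sys T} (hS : S.Lawful) {f : ℝ → ℝ → T} {u v : ℝ} {σ : Tri T} {c : T} (h : IsTri f u v σ) (cc : S.le c c)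
    (ht : TrF S σ c) (ht' : TrF S.op σ.dual c) (hc : ∀ x y, u < x → x < y → y < v → f x y = c) : TCohH S f u v := by
  obtain ⟨-, a2⟩ := ht.half hS h
  obtain ⟨b1, b2⟩ := ht'.half hS.op h.dual
  simp only [flp, neg_neg] at b1 b2
  intro x x' y k1 k2 k3 k4
  rcases k4.eq_or_lt with rfl | k4
  · have := b1 (-x') (-x) (by linarith) (by linarith) (by linarith)
    simp only [neg_neg] at this
    exact this
  rw [hc x' y (by linarith) k3 k4]
  rcases k1.eq_or_lt with rfl | k1
  · exact a2 y (by linarith) k4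
  · rw [hc x y k1 (by linarith) k4]; exact cc

theorem sound_T1 {S : Sys T} (hS : S.Lawful) {U : List T} {σ : Tri T} (h : RuleT1 S U σ) : TFill S σ := by
  obtain ⟨c, _, rc, cc, h1, h2⟩ := h
  classical
  obtain ⟨βl, hl⟩ := exists_reads σ.2.1.2 0 1 σ.2.1.1 one_pos
  obtain ⟨βt, ht⟩ := exists_reads σ.2.2.2 0 1 σ.2.2.1 one_pos
  let f : ℝ → ℝ → T := fun x y => if x = 0 then (if y = 1 then σ.1 else βl y) else if y = 1 then βt x else c
  have hT : IsTri f 0 1 σ := by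
    refine ⟨one_pos, by simp [f], ?_, ?_⟩
    · exact Reads.congr hl (fun x a b => by simp [f, b.ne])
    · exact Reads.congr ht (fun x a b => by simp [f, a.ne'])
  have hc : ∀ x y, 0 < x → x < y → y < 1 → f x y = c := by
    intro x y a b d; simp [f, a.ne', d.ne]
  have hc' : ∀ x y, -1 < x → x < y → y < -0 → flp f x y = c := by
    intro x y a b d; exact hc _ _ (by linarith) (by linarith) (by linarith)
  have h1' : TrF S.op.op σ.dual.dual c := by
    rw [op_op]; unfold Tri.dual; simp only [rev_rev]; exact h1
  refine ⟨f, 0, 1, hT, Tr.cohH hS hT cc h1 h2 hc, ?_, ?_, h1.demF hT hc, h2.demF hT.dual hc'⟩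
  · exact Tr.cohH hS.op hT.dual cc h2 h1' hc'
  · intro x y a b d; rw [hc x y a b d]; exact rc

theorem sound_T2 {S : Sys T} (hS : S.Lawful) {σ : Tri T} (h : RuleT2 S (Fill S) (TFill S) σ) : TFill S σ := by
  obtain ⟨σ1, h1, σ2, h2, τ, h3, e1, e2, e3, e4, e5, j1, j2, r1, r2, hg⟩ := h
  classical
  obtain ⟨f1, t1, g1⟩ := tfill_at h1 0 1 one_pos
  obtain ⟨f2, t2, g2⟩ := tfill_at h2 1 2 one_lt_two
  obtain ⟨fr, t3, g3, b1, b2⟩ := fill_botright h3 (a := 0) (b := 1) (c := 1) (d := 2) (by rw [e5]; exact t1.wt) (by rw [e4]; exact t2.wl)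
  let f : ℝ → ℝ → T := fun x y => if y < 1 then f1 x y else if 1 < x then f2 x y else fr x y
  have F1 : ∀ x y, 0 ≤ x → x < y → y ≤ 1 → f1 x y = f x y := by
    intro x y a b c
    rcases c.lt_or_eq with c | rfl
    · simp [f, c]
    · have : ¬ (1:ℝ) < x := by linarith
      simp only [f, lt_irrefl, if_false, this]
      rcases a.eq_or_lt with rfl | a
      · rw [t1.q, t3.ll, e1]
      · exact (b1 x a b).symm
  have F2 : ∀ x y, 1 ≤ x → x < y → y ≤ 2 → f2 x y = f x y := by
    intro x y a b c
    have : ¬ y < 1 := by linarith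
    rcases a.lt_or_eq with a | rfl
    · simp [f, a, this]
    · simp only [f, lt_irrefl, if_false, this]
      rcases c.eq_or_lt with rfl | c
      · rw [t2.q, t3.ur, e3]
      · exact (b2 y b c).symm
  have F3 : ∀ x y, 0 ≤ x → x ≤ 1 → 1 ≤ y → y ≤ 2 → fr x y = f x y := by
    intro x y a b c d
    have h1 : ¬ y < 1 := by linarith
    have h2 : ¬ 1 < x := by linarith
    simp [f, h1, h2]
  have t3' := t3.congr F3
  refine ⟨f, 0, 2, ⟨two_pos, ?_, ?_, ?_⟩, TGood.glue hS one_pos one_lt_two (g1.congr F1) (g2.congr F2) (g3.congr F3) ?_ ?_ ?_⟩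
  · rw [t3'.ul, e2]
  · refine RdW.join (w1 := σ1.2.1) (m := 1) ?_ t3'.wl ?_ j1
    · exact t1.wl.congr (fun y a b => F1 0 y le_rfl a b.le)
    · show f 0 1 = _; rw [t3'.ll, e1]
  · refine RdW.join (w2 := σ2.2.2) (m := 1) t3'.wt ?_ ?_ j2
    · exact t2.wt.congr (fun y a b => F2 y 2 a.le b le_rfl)
    · show f 1 2 = _; rw [t3'.ur, e3]
  · unfold DCor
    rw [t3'.lr]
    rcases hg with hg | ⟨hg1, hg2⟩
    · exact Or.inl hg
    · refine Or.inr ⟨fun v hv => ?_, fun u hu => ?_⟩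
      · obtain ⟨m, m1, m2, m3⟩ := Reads.first t3'.wr
        obtain ⟨y, y1, y2⟩ := exists_between (lt_min m1 hv)
        exact ⟨y, y1, y2.trans_le (min_le_right _ _), (m3 y y1 (y2.trans_le (min_le_left _ _))).trans hg2.symm⟩
      · obtain ⟨m, m1, m2, m3⟩ := Reads.last t3'.wb
        obtain ⟨y, y1, y2⟩ := exists_between (max_lt m2 hu)
        exact ⟨y, lt_of_le_of_lt (le_max_right _ _) y1, y2, (m3 y (lt_of_le_of_lt (le_max_left _ _) y1) y2).trans hg1.symm⟩
  · intro x a b; exact r1 _ (Reads.mem t3'.wb a b)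
  · intro x a b; exact r2 _ (Reads.mem t3'.wr a b)

theorem TStep.sound {S : Sys T} (hS : S.Lawful) {U : List T} {σ : Tri T} (h : TStep S U (Fill S) (TFill S) σ) :
    TFill S σ := by
  rcases h with h | h
  · exact sound_T1 hS h
  · exact sound_T2 hS h

end Temporal

namespace Temporal

variable {T : Type}

/-- Antisymmetry of the order on a list of labels. -/
def Anti (S : Sys T) (U : List T) : Prop := ∀ s ∈ U, ∀ t ∈ U, S.le s t → S.le t s → s = t

/-- A line labelled monotonically with labels in `U`. -/
def MonoL (S : Sys T) (U : List T) (β : ℝ → T) (lo hi : ℝ) : Prop :=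
  (∀ x, lo < x → x < hi → β x ∈ U) ∧ ∀ x x', lo < x → x < x' → x' < hi → S.le (β x) (β x')

def CanW (U : List T) (w : Wd T) : Prop :=
  (∀ t ∈ letters w, t ∈ U) ∧ (w.1 :: w.2.map Prod.snd).Nodup

theorem MonoL.sub {S : Sys T} {U : List T} {β : ℝ → T} {lo hi lo' hi' : ℝ} (h : MonoL S U β lo hi)
    (h1 : lo ≤ lo') (h2 : hi' ≤ hi) : MonoL S U β lo' hi' :=
  ⟨fun x a b => h.1 x (h1.trans_lt a) (b.trans_le h2),
   fun x x' a b c => h.2 x x' (h1.trans_lt a) b (c.trans_le h2)⟩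

theorem MonoL.eq_between {S : Sys T} {U : List T} (hU : Anti S U) {β : ℝ → T} {lo hi : ℝ} (h : MonoL S U β lo hi)
    {x y z : ℝ} (h1 : lo < x) (h2 : x < y) (h3 : y < z) (h4 : z < hi) (he : β x = β z) : β y = β x := by
  refine hU _ (h.1 y (by linarith) (by linarith)) _ (h.1 x h1 (by linarith)) ?_ (h.2 x y h1 h2 (by linarith))
  rw [he]; exact h.2 y z (by linarith) h3 h4

theorem exists_germ {S : Sys T} {U : List T} (hU : Anti S U) {β : ℝ → T} {lo hi : ℝ} (hl : lo < hi)
    (h : MonoL S U β lo hi) : ∃ m, lo < m ∧ m ≤ hi ∧ ∃ e ∈ U, ∀ x, lo < x → x < m → β x = e := by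
  classical
  have hfin : ∀ x, x ≤ hi → (β '' Set.Ioo lo x).Finite := fun x hx =>
    (List.finite_toSet U).subset (by rintro _ ⟨y, hy, rfl⟩; exact h.1 y hy.1 (hy.2.trans_le hx))
  obtain ⟨x0, ⟨h1, h2⟩, hmin⟩ := WellFounded.has_min (measure (fun x : ℝ => (β '' Set.Ioo lo x).ncard)).wf
    {x | lo < x ∧ x ≤ hi} ⟨hi, hl, le_rfl⟩
  have key : ∀ y, lo < y → y ≤ x0 → β '' Set.Ioo lo y = β '' Set.Ioo lo x0 := by
    intro y a b
    refine Set.eq_of_subset_of_ncard_le (Set.image_mono (Set.Ioo_subset_Ioo_right b)) ?_ (hfin x0 h2)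
    exact not_lt.1 (hmin y ⟨a, b.trans h2⟩)
  obtain ⟨y1, a1, b1⟩ := exists_between h1
  refine ⟨x0, h1, h2, β y1, h.1 y1 a1 (b1.trans_le h2), fun x hx hx0 => ?_⟩
  have : β x ∈ β '' Set.Ioo lo y1 := by rw [key y1 a1 b1.le]; exact ⟨x, ⟨hx, hx0⟩, rfl⟩
  obtain ⟨y2, ⟨a2, b2⟩, e2⟩ := this
  have : β y1 ∈ β '' Set.Ioo lo y2 := by rw [key y2 a2 (b2.trans b1).le]; exact ⟨y1, ⟨a1, b1⟩, rfl⟩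
  obtain ⟨y3, ⟨a3, b3⟩, e3⟩ := this
  rw [← e2, ← e3]
  exact h.eq_between hU a3 b3 b2 (b1.trans_le h2) e3

theorem exists_canon {S : Sys T} {U : List T} (hU : Anti S U) {β : ℝ → T} {lo hi : ℝ} (hl : lo < hi)
    (h : MonoL S U β lo hi) : ∃ w, CanW U w ∧ RdW β lo hi w := by
  classical
  obtain ⟨n, hn⟩ : ∃ n, (β '' Set.Ioo lo hi).ncard ≤ n := ⟨_, le_rfl⟩
  have hfin : ∀ lo', lo ≤ lo' → (β '' Set.Ioo lo' hi).Finite := fun x hx =>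
    (List.finite_toSet U).subset (by rintro _ ⟨y, hy, rfl⟩; exact h.1 y (hx.trans_lt hy.1) hy.2)
  induction n generalizing lo with
  | zero =>
    exfalso
    have h0 : (β '' Set.Ioo lo hi).ncard = 0 := by omega
    rw [Set.ncard_eq_zero (hfin lo le_rfl), Set.image_eq_empty] at h0
    obtain ⟨y, a, b⟩ := exists_between hl
    exact (h0 ▸ (⟨a, b⟩ : y ∈ Set.Ioo lo hi) : y ∈ (∅ : Set ℝ))
  | succ n ih =>
    obtain ⟨m0, h1, h2, e, he, hm0⟩ := exists_germ hU hl h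
    set A : Set ℝ := {x | lo < x ∧ x ≤ hi ∧ ∀ y, lo < y → y < x → β y = e} with hA
    have hAm : m0 ∈ A := ⟨h1, h2, hm0⟩
    have hAb : BddAbove A := ⟨hi, fun x hx => hx.2.1⟩
    set m := sSup A with hm
    have hm1 : m0 ≤ m := le_csSup hAb hAm
    have hm2 : m ≤ hi := csSup_le ⟨m0, hAm⟩ (fun x hx => hx.2.1)
    have hm3 : ∀ y, lo < y → y < m → β y = e := by
      intro y a b
      obtain ⟨x, hx, hx'⟩ := exists_lt_of_lt_csSup ⟨m0, hAm⟩ b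
      exact hx.2.2 y a hx'
    rcases hm2.eq_or_lt with hmh | hmh
    · refine ⟨(e, []), ⟨by simpa [letters, lettersP] using he, by simp⟩, hl, fun x a b => hm3 x a (by rwa [hmh])⟩
    · have hne : ∀ x, m < x → x < hi → β x ≠ e := by
        intro x a b hxe
        obtain ⟨y0, c, d⟩ := exists_between h1
        have : x ∈ A := ⟨by linarith, b.le, fun y hy hyx => by
          rcases lt_or_ge y m with g | g
          · exact hm3 y hy g
          · have := h.eq_between hU c (by linarith : y0 < y) hyx b (by rw [hxe, hm0 y0 c d])
            rw [this, hm0 y0 c d]⟩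
        exact absurd (le_csSup hAb this) (not_le.2 a)
      obtain ⟨w, hw, hr⟩ := ih hmh (h.sub (by linarith) le_rfl) (by
        have : (β '' Set.Ioo m hi) ⊂ (β '' Set.Ioo lo hi) := by
          refine Set.ssubset_iff_subset_ne.2 ⟨Set.image_mono (Set.Ioo_subset_Ioo_left (by linarith)), fun hh => ?_⟩
          obtain ⟨y0, c, d⟩ := exists_between h1
          have : e ∈ β '' Set.Ioo m hi := by rw [hh]; exact ⟨y0, ⟨c, by linarith⟩, hm0 y0 c d⟩
          obtain ⟨x, hx, hx'⟩ := this
          exact hne x hx.1 hx.2 hx'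
        have := Set.ncard_lt_ncard this (hfin lo le_rfl)
        omega) (fun lo' h' => hfin lo' (by linarith))
      refine ⟨(e, (β m, w.1) :: w.2), ⟨?_, ?_⟩, m, by linarith, hmh, hm3, rfl, hr⟩
      · intro t ht
        simp only [letters, lettersP, List.flatMap_cons, List.mem_cons, List.mem_append,
          List.not_mem_nil, or_false] at ht
        rcases ht with rfl | (rfl | rfl) | ht
        · exact he
        · exact h.1 m (by linarith) hmh
        · exact hw.1 _ (by simp [letters])
        · exact hw.1 _ (by simp only [letters, List.mem_cons, lettersP]; exact Or.inr ht)
      · simp only [List.map_cons]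
        refine List.nodup_cons.2 ⟨fun hin => ?_, hw.2⟩
        have : e ∈ letters w := by
          simp only [List.mem_cons, List.mem_map] at hin
          simp only [letters, lettersP, List.mem_cons, List.mem_flatMap]
          rcases hin with hin | ⟨p, hp, hp'⟩
          · exact Or.inl hin
          · exact Or.inr ⟨p, hp, by simp [hp']⟩
        obtain ⟨x, x1, x2, x3⟩ := Reads.att hr this
        exact hne x x1 x2 x3

theorem Reads.suf {β : ℝ → T} {hi : ℝ} {C : T → T → List (T × T) → Prop} {L lo e} (h : Reads β hi L lo e)
    (hC : ∀ m t e L, lo < m → m < hi → β m = t → Reads β hi L m e → C t e L) : Suf C L := by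
  induction L generalizing lo e with
  | nil => trivial
  | cons p L ih =>
    obtain ⟨m, a, b, c, d, f⟩ := h
    exact ⟨hC m _ _ _ a b d f, ih f (fun m' t e L k1 => hC m' t e L (a.trans k1))⟩

theorem Reads.split {β : ℝ → T} {hi m : ℝ} {L lo e} (h : Reads β hi L lo e) (h1 : lo < m) (h2 : m < hi) :
    ∃ w1 w2, RdW β lo m w1 ∧ RdW β m hi w2 ∧ Join w1 (β m) w2 (e, L) ∧
      ((w1.1 :: w1.2.map Prod.snd).Sublist (e :: L.map Prod.snd)) ∧
      ((w2.1 :: w2.2.map Prod.snd).Sublist (e :: L.map Prod.snd)) ∧ w1.1 = e := by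
  induction L generalizing lo e with
  | nil =>
    refine ⟨(e, []), (e, []), ⟨h1, fun x a b => h.2 x a (b.trans h2)⟩, ⟨h2, fun x a b => h.2 x (h1.trans a) b⟩,
      Or.inr ⟨(h.2 m h1 h2).symm, (h.2 m h1 h2).symm, rfl⟩, by simp, by simp, rfl⟩
  | cons p L ih =>
    obtain ⟨m', a, b, c, d, f⟩ := h
    rcases lt_trichotomy m m' with g | g | g
    · refine ⟨(e, []), (e, p :: L), ⟨h1, fun x a b => c x a (b.trans g)⟩, ⟨m', g, b, fun x a b => c x (h1.trans a) b, d, f⟩,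
        Or.inr ⟨(c m h1 g).symm, (c m h1 g).symm, rfl⟩, by simp, by simp, rfl⟩
    · subst g
      refine ⟨(e, []), (p.2, L), ⟨h1, c⟩, f, Or.inl ?_, by simp, by simp, rfl⟩
      rw [d]; rfl
    · obtain ⟨w1, w2, k1, k2, k3, k4, k5, k6⟩ := ih f g
      refine ⟨(e, (p.1, w1.1) :: w1.2), w2, ⟨m', a, g, c, d, k1⟩, k2, ?_, ?_, ?_, rfl⟩
      · rcases k3 with k3 | ⟨j1, j2, k3⟩
        · left
          have e1 := congrArg Prod.fst k3
          have e2 := congrArg Prod.snd k3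
          simp only at e1 e2
          simp [e2, k6]
        · right
          refine ⟨j1, j2, ?_⟩
          have e2 := congrArg Prod.snd k3
          simp only at e2
          simp [e2, k6]
      · simpa using k4
      · exact k5.trans (by simp)

theorem CanW.letters_mem {S : Sys T} {U : List T} {β : ℝ → T} {lo hi : ℝ} (hm : MonoL S U β lo hi) {w : Wd T}
    (h : RdW β lo hi w) : ∀ t ∈ letters w, t ∈ U := by
  intro t ht
  obtain ⟨x, x1, x2, rfl⟩ := Reads.att h ht
  exact hm.1 x x1 x2

theorem RdW.split {S : Sys T} {U : List T} {β : ℝ → T} {lo hi m : ℝ} (hm : MonoL S U β lo hi) {w : Wd T}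
    (h : RdW β lo hi w) (hc : CanW U w) (h1 : lo < m) (h2 : m < hi) :
    ∃ w1 w2, RdW β lo m w1 ∧ RdW β m hi w2 ∧ Join w1 (β m) w2 w ∧ CanW U w1 ∧ CanW U w2 := by
  obtain ⟨w1, w2, k1, k2, k3, k4, k5, k6⟩ := Reads.split h h1 h2
  exact ⟨w1, w2, k1, k2, k3, ⟨CanW.letters_mem (hm.sub le_rfl h2.le) k1, hc.2.sublist k4⟩,
    ⟨CanW.letters_mem (hm.sub h1.le le_rfl) k2, hc.2.sublist k5⟩⟩

theorem Reads.firstlt {β : ℝ → T} {hi : ℝ} {L lo e} (h : Reads β hi L lo e) {x : ℝ} (hx : lo < x) :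
    ∃ y, lo < y ∧ y < x ∧ y < hi ∧ β y = e := by
  obtain ⟨k, k1, k2, k3⟩ := Reads.first h
  obtain ⟨y, a, b⟩ := exists_between (lt_min hx k1)
  exact ⟨y, a, b.trans_le (min_le_left _ _), (b.trans_le (min_le_right _ _)).trans_le k2,
    k3 y a (b.trans_le (min_le_right _ _))⟩

theorem Chn.head {S : Sys T} {β : ℝ → T} {m hi : ℝ} {L e}
    (hm : ∀ x x', m ≤ x → x < x' → x' ≤ hi → S.le (β x) (β x')) (h4 : Reads β hi L m e) :
    S.le (β m) e ∧ S.le e e ∧ (∀ p ∈ L, S.le e p.1) ∧ S.le e (β hi) := by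
  obtain ⟨y1, a1, b1, c1, e1⟩ := h4.firstlt h4.lt
  obtain ⟨y2, a2, b2, c2, e2⟩ := h4.firstlt a1
  refine ⟨?_, ?_, fun p hp => ?_, ?_⟩
  · rw [← e1]; exact hm _ _ le_rfl a1 (by linarith)
  · nth_rewrite 1 [← e2]; rw [← e1]; exact hm _ _ (by linarith) b2 (by linarith)
  · obtain ⟨x, x1, x2, x3⟩ := (h4.attP hp).1
    obtain ⟨y, a, b, c, d⟩ := h4.firstlt x1
    rw [← x3, ← d]; exact hm _ _ a.le b x2.le
  · rw [← e1]; exact hm _ _ (by linarith) (by linarith) le_rfl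

theorem Chn.complete {S : Sys T} {β : ℝ → T} {lo hi : ℝ} {L e}
    (hm : ∀ x x', lo ≤ x → x < x' → x' ≤ hi → S.le (β x) (β x')) (h : Reads β hi L lo e) :
    Chn S (β hi) ((β lo, e) :: L) := by
  refine ⟨Chn.head hm h, Reads.suf h (fun m t e L h1 h2 h3 h4 => ?_)⟩
  rw [← h3]
  exact Chn.head (fun x x' a b c => hm x x' (h1.le.trans a) b c) h4

theorem LineF.head {S : Sys T} {i : ℕ} {β : ℝ → T} {m hi : ℝ} {L e} {q : T} {fb : Prop}
    (H : ∀ y, m < y → y < hi → S.nF i (β y) → (∃ y', y < y' ∧ y' < hi ∧ S.w i (β y')) ∨ S.w i q ∨ fb)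
    (h : Reads β hi L m e) {t : T} (Hm : S.nF i t → (∃ y', m < y' ∧ y' < hi ∧ S.w i (β y')) ∨ S.w i q ∨ fb) :
    (S.nF i t ∨ S.nF i e) → S.w i e ∨ (∃ p ∈ L, S.w i p.1 ∨ S.w i p.2) ∨ S.w i q ∨ fb := by
  have key : (∃ y', m < y' ∧ y' < hi ∧ S.w i (β y')) → S.w i e ∨ (∃ p ∈ L, S.w i p.1 ∨ S.w i p.2) := by
    rintro ⟨y, a, b, c⟩
    have := h.mem a b
    simp only [letters, lettersP, List.mem_cons, List.mem_flatMap, List.not_mem_nil, or_false] at this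
    rcases this with k | ⟨p, hp, k | k⟩
    · exact Or.inl (by rw [← k]; exact c)
    · exact Or.inr ⟨p, hp, Or.inl (by rw [← k]; exact c)⟩
    · exact Or.inr ⟨p, hp, Or.inr (by rw [← k]; exact c)⟩
  rintro (hn | hn)
  · rcases Hm hn with k | k
    · exact (key k).elim Or.inl (fun k => Or.inr (Or.inl k))
    · exact Or.inr (Or.inr k)
  · obtain ⟨y1, a1, b1, c1, e1⟩ := h.firstlt h.lt
    rcases H y1 a1 c1 (by rw [e1]; exact hn) with ⟨y', k1, k2, k3⟩ | k
    · exact (key ⟨y', a1.trans k1, k2, k3⟩).elim Or.inl (fun k => Or.inr (Or.inl k))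
    · exact Or.inr (Or.inr k)

theorem LineF.complete {S : Sys T} {i : ℕ} {β : ℝ → T} {lo hi : ℝ} {L e} {q : T} {fb : Prop}
    (H : ∀ y, lo < y → y < hi → S.nF i (β y) → (∃ y', y < y' ∧ y' < hi ∧ S.w i (β y')) ∨ S.w i q ∨ fb)
    (h : Reads β hi L lo e) {t : T} (Hm : S.nF i t → (∃ y', lo < y' ∧ y' < hi ∧ S.w i (β y')) ∨ S.w i q ∨ fb) :
    LineF S i fb q ((t, e) :: L) := by
  refine ⟨LineF.head H h Hm, Reads.suf h (fun m t e L h1 h2 h3 h4 => ?_)⟩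
  refine LineF.head (fun y a => H y (h1.trans a)) h4 ?_
  rw [← h3]
  exact H m h1 h2

/-- Variant where the first letter is repeated. -/
theorem LineF.complete' {S : Sys T} {i : ℕ} {β : ℝ → T} {lo hi : ℝ} {L e} {q : T} {fb : Prop}
    (H : ∀ y, lo < y → y < hi → S.nF i (β y) → (∃ y', y < y' ∧ y' < hi ∧ S.w i (β y')) ∨ S.w i q ∨ fb)
    (h : Reads β hi L lo e) : LineF S i fb q ((e, e) :: L) := by
  refine LineF.complete H h (fun hn => ?_)
  obtain ⟨y1, a1, b1, c1, e1⟩ := h.firstlt h.lt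
  rcases H y1 a1 c1 (by rw [e1]; exact hn) with ⟨y', k1, k2, k3⟩ | k
  · exact Or.inl ⟨y', a1.trans k1, k2, k3⟩
  · exact Or.inr k

/-- Ambient labelled rectangle. -/
structure Amb (S : Sys T) (U : List T) (f : ℝ → ℝ → T) (X0 X1 Y0 Y1 : ℝ) : Prop where
  law : S.Lawful
  anti : Anti S U
  mem : ∀ x y, X0 ≤ x → x ≤ X1 → Y0 ≤ y → y ≤ Y1 → f x y ∈ U
  cohH : CohH S f X0 X1 Y0 Y1
  cohV : CohH S (swf f) Y0 Y1 X0 X1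
  real : ∀ x y, X0 < x → x < X1 → Y0 < y → y < Y1 → S.rl (f x y)
  demF : ∀ x0 x1 y0 y1, X0 ≤ x0 → x1 ≤ X1 → Y0 ≤ y0 → y1 ≤ Y1 → DemF S f x0 x1 y0 y1
  demP : ∀ x0 x1 y0 y1, X0 ≤ x0 → x1 ≤ X1 → Y0 ≤ y0 → y1 ≤ Y1 → DemF S.op (flp f) (-y1) (-y0) (-x1) (-x0)

section
variable {S : Sys T} {U : List T} {f : ℝ → ℝ → T} {X0 X1 Y0 Y1 : ℝ}

theorem Amb.swap (h : Amb S U f X0 X1 Y0 Y1) : Amb S U (swf f) Y0 Y1 X0 X1 :=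
  ⟨h.law, h.anti, fun x y a b c d => h.mem y x c d a b, h.cohV, h.cohH,
   fun x y a b c d => h.real y x c d a b, fun x0 x1 y0 y1 a b c d => (h.demF y0 y1 x0 x1 c d a b).swap,
   fun x0 x1 y0 y1 a b c d => (h.demP y0 y1 x0 x1 c d a b).swap⟩

theorem Amb.dual (h : Amb S U f X0 X1 Y0 Y1) : Amb S.op U (flp f) (-Y1) (-Y0) (-X1) (-X0) := by
  refine ⟨h.law.op, fun s hs t ht a b => h.anti s hs t ht b a, fun x y a b c d => ?_, h.cohV.flp, h.cohH.flp,
    fun x y a b c d => ?_, fun x0 x1 y0 y1 a b c d => ?_, fun x0 x1 y0 y1 a b c d => ?_⟩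
  · exact h.mem _ _ (by linarith) (by linarith) (by linarith) (by linarith)
  · exact h.real _ _ (by linarith) (by linarith) (by linarith) (by linarith)
  · have := h.demP (-y1) (-y0) (-x1) (-x0) (by linarith) (by linarith) (by linarith) (by linarith)
    simpa using this
  · have := h.demF (-y1) (-y0) (-x1) (-x0) (by linarith) (by linarith) (by linarith) (by linarith)
    rw [flp_flp]; exact this

theorem Amb.le (h : Amb S U f X0 X1 Y0 Y1) {x x' y y' : ℝ} (a : X0 ≤ x) (b : x ≤ x') (c : x' ≤ X1)
    (a' : Y0 ≤ y) (b' : y ≤ y') (c' : y' ≤ Y1) (hne : x < x' ∨ y < y') : S.le (f x y) (f x' y') := by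
  have V : ∀ x, X0 ≤ x → x ≤ X1 → y < y' → S.le (f x y) (f x y') := fun x e1 e2 e3 =>
    h.cohV y y' x a' e3 c' e1 e2
  rcases b.eq_or_lt with rfl | b
  · exact V x a c (by simpa using hne)
  · have h1 := h.cohH x x' y a b c a' (b'.trans c')
    rcases b'.eq_or_lt with rfl | b'
    · exact h1
    · exact h.law.trans _ _ _ h1 (V x' (a.trans b.le) c b')

theorem Amb.monoH (h : Amb S U f X0 X1 Y0 Y1) {y : ℝ} (a : Y0 ≤ y) (b : y ≤ Y1) :
    MonoL S U (fun x => f x y) X0 X1 :=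
  ⟨fun x c d => h.mem x y c.le d.le a b, fun x x' c d e => h.le c.le d.le e.le a le_rfl b (Or.inl d)⟩

theorem Amb.monoV (h : Amb S U f X0 X1 Y0 Y1) {x : ℝ} (a : X0 ≤ x) (b : x ≤ X1) :
    MonoL S U (fun y => f x y) Y0 Y1 := h.swap.monoH a b

def CanT (U : List T) (τ : Tile T) : Prop :=
  (τ.ll ∈ U ∧ τ.lr ∈ U ∧ τ.ul ∈ U ∧ τ.ur ∈ U) ∧ CanW U τ.wl ∧ CanW U τ.wr ∧ CanW U τ.wb ∧ CanW U τ.wt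

/-- Every canonical tile of the rectangle is derivable. -/
def RQ (U : List T) (R : Tile T → Prop) (f : ℝ → ℝ → T) (x0 x1 y0 y1 : ℝ) : Prop :=
  ∀ τ, IsTile f x0 x1 y0 y1 τ → CanT U τ → R τ

/-- `R` is closed under the rules, restricted to canonical tiles. -/
def Clo (S : Sys T) (U : List T) (R : Tile T → Prop) : Prop :=
  ∃ W : List (Wd T), (∀ w, CanW U w → w ∈ W) ∧ ∀ τ, CanT U τ → Step S U W R τ → R τ

theorem CanT.swp {τ : Tile T} (h : CanT U τ) : CanT U τ.swp :=
  ⟨⟨h.1.1, h.1.2.2.1, h.1.2.1, h.1.2.2.2⟩, h.2.2.2.1, h.2.2.2.2, h.2.1, h.2.2.1⟩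

theorem RQ.swap {R : Tile T → Prop} (hR : Clo S U R) {x0 x1 y0 y1 : ℝ} (h : RQ U R f x0 x1 y0 y1) :
    RQ U R (swf f) y0 y1 x0 x1 := by
  obtain ⟨W, _, hR⟩ := hR
  intro τ h1 h2
  have h3 := h τ.swp h1.swap h2.swp
  exact hR τ h2 (Or.inr (Or.inr (Or.inl h3)))

theorem Amb.canL (h : Amb S U f X0 X1 Y0 Y1) {x y0 y1 : ℝ} (a : X0 ≤ x) (b : x ≤ X1) (c : Y0 ≤ y0) (d : y1 ≤ Y1)
    (e : y0 < y1) : ∃ w, CanW U w ∧ RdW (fun y => f x y) y0 y1 w :=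
  exists_canon h.anti e ((h.monoV a b).sub c d)

theorem Amb.canH (h : Amb S U f X0 X1 Y0 Y1) {y x0 x1 : ℝ} (a : Y0 ≤ y) (b : y ≤ Y1) (c : X0 ≤ x0) (d : x1 ≤ X1)
    (e : x0 < x1) : ∃ w, CanW U w ∧ RdW (fun x => f x y) x0 x1 w :=
  exists_canon h.anti e ((h.monoH a b).sub c d)

theorem RQ.glueV {R : Tile T → Prop} (hR : Clo S U R) (hA : Amb S U f X0 X1 Y0 Y1) {x0 m x1 y0 y1 : ℝ}
    (h1 : RQ U R f x0 m y0 y1) (h2 : RQ U R f m x1 y0 y1) (a : X0 ≤ x0) (b : x0 ≤ m) (c : m ≤ x1) (d : x1 ≤ X1)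
    (e : Y0 ≤ y0) (g : y1 ≤ Y1) : RQ U R f x0 x1 y0 y1 := by
  rcases b.eq_or_lt with rfl | b
  · exact h2
  rcases c.eq_or_lt with rfl | c
  · exact h1
  obtain ⟨W, hW, hR⟩ := hR
  intro τ ht hc
  have hy := ht.hy
  obtain ⟨w, hw, hw'⟩ := hA.canL (x := m) (by linarith) (by linarith) e g hy
  obtain ⟨b1, b2, b3, b4, b5, b6, b7⟩ := RdW.split ((hA.monoH (y := y0) e (by linarith)).sub a d) ht.wb hc.2.2.2.1 b c
  obtain ⟨t1, t2, t3, t4, t5, t6, t7⟩ := RdW.split ((hA.monoH (y := y1) (by linarith) g).sub a d) ht.wt hc.2.2.2.2 b c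
  have m0 : f m y0 ∈ U := hA.mem _ _ (by linarith) (by linarith) (by linarith) (by linarith)
  have m1 : f m y1 ∈ U := hA.mem _ _ (by linarith) (by linarith) (by linarith) (by linarith)
  refine hR τ hc (Or.inr (Or.inl ⟨Tile.mk' τ.ll (f m y0) τ.ul (f m y1) τ.wl w b1 t1, ?_,
    Tile.mk' (f m y0) τ.lr (f m y1) τ.ur w τ.wr b2 t2, ?_, rfl, rfl, rfl, rfl, rfl, rfl, rfl, rfl, rfl, b5, t5, ?_⟩))
  · exact h1 _ ⟨b, hy, ht.ll, rfl, ht.ul, rfl, ht.wl, hw', b3, t3⟩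
      ⟨⟨hc.1.1, m0, hc.1.2.2.1, m1⟩, hc.2.1, hw, b6, t6⟩
  · exact h2 _ ⟨c, hy, rfl, ht.lr, rfl, ht.ur, hw', ht.wr, b4, t4⟩
      ⟨⟨m0, hc.1.2.1, m1, hc.1.2.2.2⟩, hw, hc.2.2.1, b7, t7⟩
  · intro t ht
    obtain ⟨y, y1, y2, rfl⟩ := Reads.att hw' ht
    exact hA.real _ _ (by linarith) (by linarith) (by linarith) (by linarith)

theorem RQ.glueH {R : Tile T → Prop} (hR : Clo S U R) (hA : Amb S U f X0 X1 Y0 Y1) {x0 m x1 y0 y1 : ℝ}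
    (h1 : RQ U R f x0 x1 y0 m) (h2 : RQ U R f x0 x1 m y1) (a : Y0 ≤ y0) (b : y0 ≤ m) (c : m ≤ y1) (d : y1 ≤ Y1)
    (e : X0 ≤ x0) (g : x1 ≤ X1) : RQ U R f x0 x1 y0 y1 :=
  RQ.swap (f := swf f) hR (RQ.glueV hR hA.swap (h1.swap hR) (h2.swap hR) a b c d e g)

end

end Temporal

namespace Temporal

variable {T : Type} {S : Sys T} {U : List T} {f : ℝ → ℝ → T} {X0 X1 Y0 Y1 : ℝ}

theorem left_complete (hA : Amb S U f X0 X1 Y0 Y1) {x0 x1 y0 y1 : ℝ} {τ : Tile T} {c : T}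
    (ht : IsTile f x0 x1 y0 y1 τ) (a : X0 ≤ x0) (b : x1 ≤ X1) (a' : Y0 ≤ y0) (b' : y1 ≤ Y1)
    (hr : S.rl c)
    (hc : ∀ x y, x0 < x → x < x1 → y0 < y → y < y1 → f x y = c) :
    Chn S τ.ul ((τ.ll, τ.wl.1) :: τ.wl.2) ∧ (∀ t ∈ letters τ.wl, S.le t c) ∧
    (∀ i < S.N, LineF S i (S.nF i τ.ul ∨ S.gF i c) τ.ul ((τ.wl.1, τ.wl.1) :: τ.wl.2)) := by
  have hx := ht.hx
  have hy := ht.hy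
  obtain ⟨xm, xm1, xm2⟩ := exists_between hx
  refine ⟨?_, fun t h => ?_, fun i hi => ?_⟩
  · rw [← ht.ll, ← ht.ul]
    exact Chn.complete (β := fun y => f x0 y) (fun y y' k1 k2 k3 => hA.le a le_rfl (by linarith) (by linarith) k2.le
      (by linarith) (Or.inr k2)) ht.wl
  · obtain ⟨y, k1, k2, rfl⟩ := Reads.att ht.wl h
    rw [← hc xm y xm1 xm2 k1 k2]
    exact hA.le a xm1.le (by linarith) (by linarith) le_rfl (by linarith) (Or.inl xm1)
  · refine LineF.complete' (β := fun y => f x0 y) (fun y k1 k2 hn => ?_) ht.wl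
    obtain ⟨x', y', l1, l2, l3, l4, l5, l6⟩ := hA.demF x0 x1 y0 y1 a b a' b' i hi x0 y le_rfl hx k1.le k2 hn
    have hg : S.gF i (f x' y') := by
      rcases l6 with l6 | l6
      · exact Or.inr l6
      · exact Or.inl l6.2
    rcases l1.eq_or_lt with rfl | l1
    · have l3' : y < y' := lt_of_le_of_ne l3 (fun hh => l5 ⟨rfl, hh.symm⟩)
      rcases l4.eq_or_lt with rfl | l4
      · rw [ht.ul] at hg
        rcases hg with hg | hg
        · exact Or.inr (Or.inr (Or.inl hg))
        · exact Or.inr (Or.inl hg)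
      · rcases l6 with l6 | ⟨l6, _⟩
        · exact Or.inl ⟨y', l3', l4, l6⟩
        · rcases l6 with l6 | l6 <;> linarith
    · right; right; right
      by_cases hin : x' < x1 ∧ y' < y1
      · rw [← hc x' y' l1 hin.1 (by linarith) hin.2]; exact hg
      · obtain ⟨u, u1, u2⟩ := exists_between l1
        left
        refine hA.law.axF i c (f x' y') hi hr ?_ hg
        rw [← hc u y u1 (by linarith) k1 k2]
        exact hA.le (by linarith) u2.le (by linarith) (by linarith) l3 (by linarith) (Or.inl u2)

theorem TrivF.complete (hA : Amb S U f X0 X1 Y0 Y1) {x0 x1 y0 y1 : ℝ} {τ : Tile T} {c : T}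
    (ht : IsTile f x0 x1 y0 y1 τ) (a : X0 ≤ x0) (b : x1 ≤ X1) (a' : Y0 ≤ y0) (b' : y1 ≤ Y1)
    (hr : S.rl c)
    (hc : ∀ x y, x0 < x → x < x1 → y0 < y → y < y1 → f x y = c) : TrivF S τ c := by
  have hx := ht.hx
  have hy := ht.hy
  obtain ⟨A1, A2, A3⟩ := left_complete hA ht a b a' b' hr hc
  obtain ⟨B1, B2, B3⟩ := left_complete hA.swap ht.swap a' b' a b hr (fun x y k1 k2 k3 k4 => hc y x k3 k4 k1 k2)
  refine ⟨A1, B1, A2, B2, A3, B3, fun i hi hn => ?_, fun i hi hn => ?_⟩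
  · rw [← ht.ll] at hn
    obtain ⟨x', y', l1, l2, l3, l4, l5, l6⟩ := hA.demF x0 x1 y0 y1 a b a' b' i hi x0 y0 le_rfl hx le_rfl hy hn
    have hg : S.gF i (f x' y') := by
      rcases l6 with l6 | l6
      · exact Or.inr l6
      · exact Or.inl l6.2
    rcases l1.eq_or_lt with rfl | l1
    · have l3' : y0 < y' := lt_of_le_of_ne l3 (fun hh => l5 ⟨rfl, hh.symm⟩)
      rcases l4.eq_or_lt with rfl | l4
      · rw [ht.ul] at hg
        exact Or.inr (Or.inr (Or.inl hg))
      · rcases l6 with l6 | ⟨l6, _⟩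
        · exact Or.inl ⟨_, Reads.mem ht.wl l3' l4, l6⟩
        · rcases l6 with l6 | l6 <;> linarith
    · rcases l3.eq_or_lt with rfl | l3
      · rcases l2.eq_or_lt with rfl | l2
        · rw [ht.lr] at hg
          exact Or.inr (Or.inr (Or.inr (Or.inl hg)))
        · rcases l6 with l6 | ⟨l6, _⟩
          · exact Or.inr (Or.inl ⟨_, Reads.mem ht.wb l1 l2, l6⟩)
          · rcases l6 with l6 | l6 <;> linarith
      · right; right; right; right
        by_cases hin : x' < x1 ∧ y' < y1
        · rw [← hc x' y' l1 hin.1 l3 hin.2]; exact hg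
        · obtain ⟨u, u1, u2⟩ := exists_between l1
          obtain ⟨v, v1, v2⟩ := exists_between l3
          left
          refine hA.law.axF i c (f x' y') hi hr ?_ hg
          rw [← hc u v u1 (by linarith) v1 (by linarith)]
          exact hA.le (by linarith) u2.le (by linarith) (by linarith) v2.le (by linarith) (Or.inl u2)
  · obtain ⟨m, m1, m2, m3⟩ := Reads.last ht.wt
    obtain ⟨n, n1, n2, n3⟩ := Reads.last ht.wr
    obtain ⟨u, u1, u2⟩ := exists_between m2
    obtain ⟨v, v1, v2⟩ := exists_between n2
    have hn' : S.nF i (f u v) := by rw [hc u v (by linarith) u2 (by linarith) v2]; exact hn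
    obtain ⟨x', y', l1, l2, l3, l4, l5, l6⟩ := hA.demF x0 x1 y0 y1 a b a' b' i hi u v (by linarith) u2 (by linarith) v2 hn'
    have hg : S.gF i (f x' y') := by
      rcases l6 with l6 | l6
      · exact Or.inr l6
      · exact Or.inl l6.2
    rcases l2.eq_or_lt with rfl | l2
    · rcases l4.eq_or_lt with rfl | l4
      · rw [ht.ur] at hg; exact Or.inr (Or.inl hg)
      · have e : f x' y' = lastW τ.wr := n3 y' (by linarith) l4
        rw [e] at hg; exact Or.inr (Or.inr (Or.inr hg))
    · rcases l4.eq_or_lt with rfl | l4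
      · have e : f x' y' = lastW τ.wt := m3 x' (by linarith) l2
        rw [e] at hg; exact Or.inr (Or.inr (Or.inl hg))
      · rcases l6 with l6 | ⟨l6, _⟩
        · rw [hc x' y' (by linarith) l2 (by linarith) l4] at l6
          exact Or.inl l6
        · rcases l6 with l6 | l6 <;> linarith

theorem RQ.triv {R : Tile T → Prop} (hR : Clo S U R) (hA : Amb S U f X0 X1 Y0 Y1) {x0 x1 y0 y1 : ℝ} {c : T}
    (a : X0 ≤ x0) (b : x1 ≤ X1) (a' : Y0 ≤ y0) (b' : y1 ≤ Y1)
    (hc : ∀ x y, x0 < x → x < x1 → y0 < y → y < y1 → f x y = c) : RQ U R f x0 x1 y0 y1 := by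
  obtain ⟨W, hW, hR⟩ := hR
  intro τ ht hcan
  obtain ⟨u, u1, u2⟩ := exists_between ht.hx
  obtain ⟨u', u1', u2'⟩ := exists_between u1
  obtain ⟨v, v1, v2⟩ := exists_between ht.hy
  have e := hc u v u1 u2 v1 v2
  have e' := hc u' v u1' (by linarith) v1 v2
  have hr : S.rl c := by rw [← e]; exact hA.real _ _ (by linarith) (by linarith) (by linarith) (by linarith)
  refine hR τ hcan (Or.inl ⟨c, ?_, hr, ?_, TrivF.complete hA ht a b a' b' hr hc, ?_⟩)
  · rw [← e]; exact hA.mem _ _ (by linarith) (by linarith) (by linarith) (by linarith)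
  · nth_rewrite 1 [← e']; rw [← e]
    exact hA.le (by linarith) u2'.le (by linarith) (by linarith) le_rfl (by linarith) (Or.inl u2')
  · exact TrivF.complete hA.dual ht.dual (by linarith) (by linarith) (by linarith) (by linarith) hr
      (fun x y k1 k2 k3 k4 => hc _ _ (by linarith) (by linarith) (by linarith) (by linarith))

/-- One-dimensional compactness. -/
theorem compact1 {P : ℝ → ℝ → Prop} {lo hi : ℝ} (hl : lo < hi)
    (glue : ∀ u v w, lo ≤ u → u < v → v < w → w ≤ hi → P u v → P v w → P u w)
    (loc : ∀ x, lo ≤ x → x ≤ hi → ∃ ε > 0, ∀ u v, u < v → lo ≤ u → v ≤ hi → x - ε < u → v < x + ε → P u v) : P lo hi := by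
  set A : Set ℝ := {x | lo < x ∧ x ≤ hi ∧ P lo x} with hA
  have hAb : BddAbove A := ⟨hi, fun x hx => hx.2.1⟩
  obtain ⟨ε, e0, h0⟩ := loc lo le_rfl hl.le
  have hAn : A.Nonempty := by
    refine ⟨min hi (lo + ε / 2), lt_min hl (by linarith), min_le_left _ _, h0 _ _ (lt_min hl (by linarith)) le_rfl
      (min_le_left _ _) (by linarith) ?_⟩
    exact (min_le_right _ _).trans_lt (by linarith)
  obtain ⟨z, hz⟩ := hAn
  have h1 : z ≤ sSup A := le_csSup hAb hz
  have h2 : sSup A ≤ hi := csSup_le ⟨z, hz⟩ (fun x hx => hx.2.1)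
  obtain ⟨δ, d0, h3⟩ := loc (sSup A) (by linarith [hz.1]) h2
  obtain ⟨y, hy, hy'⟩ := exists_lt_of_lt_csSup ⟨z, hz⟩ (show sSup A - δ < sSup A by linarith)
  have hys := le_csSup hAb hy
  set v := min hi (sSup A + δ / 2) with hv
  have v1 : v ≤ hi := min_le_left _ _
  have v2 : v ≤ sSup A + δ / 2 := min_le_right _ _
  have key : y < v → P lo v := fun g => glue lo y v le_rfl hy.1 g v1 hy.2.2
    (h3 y v g hy.1.le v1 hy' (by linarith))
  rcases hy.2.1.eq_or_lt with g | g
  · rw [← g]; exact hy.2.2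
  · have hyv : y < v := lt_min g (by linarith)
    have : v ∈ A := ⟨hy.1.trans hyv, v1, key hyv⟩
    have h4 := le_csSup hAb this
    have : v = hi := by
      rcases min_choice hi (sSup A + δ / 2) with k | k
      · exact k
      · rw [hv, k] at h4; linarith
    rw [← this]; exact key hyv

/-- Rectangles all of whose points have small derivable neighbourhoods are derivable. -/
theorem RQ.compact {R : Tile T → Prop} (hR : Clo S U R) (hA : Amb S U f X0 X1 Y0 Y1) {x0 x1 y0 y1 : ℝ}
    (a : X0 ≤ x0) (b : x1 ≤ X1) (a' : Y0 ≤ y0) (b' : y1 ≤ Y1)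
    (h : ∀ x y, x0 ≤ x → x ≤ x1 → y0 ≤ y → y ≤ y1 → ∃ ε > 0, ∀ u u' v v', x0 ≤ u → u < u' → u' ≤ x1 → y0 ≤ v → v < v' →
      v' ≤ y1 → x - ε < u → u' < x + ε → y - ε < v → v' < y + ε → RQ U R f u u' v v') : RQ U R f x0 x1 y0 y1 := by
  intro τ ht
  have hx := ht.hx
  have hy := ht.hy
  suffices RQ U R f x0 x1 y0 y1 from this τ ht
  refine compact1 (P := fun u u' => RQ U R f u u' y0 y1) hx
    (fun u v w k1 k2 k3 k4 p q => RQ.glueV hR hA p q (by linarith) k2.le k3.le (by linarith) a' b') ?_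
  intro x k1 k2
  have := compact1 (P := fun v v' => ∃ ε > 0, ∀ u u', x0 ≤ u → u < u' → u' ≤ x1 → x - ε < u → u' < x + ε →
    RQ U R f u u' v v') hy ?_ ?_
  · obtain ⟨ε, e0, he⟩ := this
    exact ⟨ε, e0, fun u v l1 l2 l3 l4 l5 => he u v l2 l1 l3 l4 l5⟩
  · rintro u v w l1 l2 l3 l4 ⟨ε, e0, he⟩ ⟨δ, d0, hd⟩
    refine ⟨min ε δ, lt_min e0 d0, fun p p' q1 q2 q3 q4 q5 => ?_⟩
    have m1 := min_le_left ε δ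
    have m2 := min_le_right ε δ
    exact RQ.glueH hR hA (he p p' q1 q2 q3 (by linarith) (by linarith)) (hd p p' q1 q2 q3 (by linarith) (by linarith))
      (by linarith) l2.le l3.le (by linarith) (by linarith) (by linarith)
  · intro y l1 l2
    obtain ⟨ε, e0, he⟩ := h x y k1 k2 l1 l2
    exact ⟨ε, e0, fun v v' p1 p2 p3 p4 p5 => ⟨ε, e0, fun u u' q1 q2 q3 q4 q5 =>
      he u u' v v' q1 q2 q3 p2 p1 p3 q4 q5 p4 p5⟩⟩

end Temporal

namespace Temporal

variable {T : Type} {S : Sys T} {U : List T} {f : ℝ → ℝ → T} {X0 X1 Y0 Y1 : ℝ} {R : Tile T → Prop}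

theorem Amb.germ (hA : Amb S U f X0 X1 Y0 Y1) {x y : ℝ} (a : X0 ≤ x) (b : x < X1) (c : Y0 ≤ y) (d : y < Y1) :
    ∃ δ > 0, x + δ ≤ X1 ∧ y + δ ≤ Y1 ∧ ∃ e, ∀ x' y', x < x' → x' < x + δ → y < y' → y' < y + δ → f x' y' = e := by
  have hm : MonoL S U (fun t => f (x + t) (y + t)) 0 (min (X1 - x) (Y1 - y)) := by
    have m1 := min_le_left (X1 - x) (Y1 - y)
    have m2 := min_le_right (X1 - x) (Y1 - y)
    exact ⟨fun t k1 k2 => hA.mem _ _ (by linarith) (by linarith) (by linarith) (by linarith),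
      fun t t' k1 k2 k3 => hA.le (by linarith) (by linarith) (by linarith) (by linarith) (by linarith) (by linarith)
        (Or.inl (by linarith))⟩
  obtain ⟨δ, d0, d1, e, he, h⟩ := exists_germ hA.anti (lt_min (by linarith) (by linarith)) hm
  have m1 := d1.trans (min_le_left (X1 - x) (Y1 - y))
  have m2 := d1.trans (min_le_right (X1 - x) (Y1 - y))
  refine ⟨δ, d0, by linarith, by linarith, e, fun x' y' k1 k2 k3 k4 => ?_⟩
  obtain ⟨s, s1, s2⟩ := exists_between (lt_min (sub_pos.2 k1) (sub_pos.2 k3))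
  have s3 := s2.trans_le (min_le_left _ _)
  have s4 := s2.trans_le (min_le_right _ _)
  obtain ⟨t, t1, t2⟩ := exists_between (max_lt (show x' - x < δ by linarith) (show y' - y < δ by linarith))
  have t3 := (le_max_left _ _).trans_lt t1
  have t4 := (le_max_right _ _).trans_lt t1
  have es := h s s1 (by linarith)
  have et := h t (by linarith) t2
  refine hA.anti _ (hA.mem _ _ (by linarith) (by linarith) (by linarith) (by linarith)) _ he ?_ ?_
  · rw [← et]; exact hA.le (by linarith) (by linarith) (by linarith) (by linarith) (by linarith) (by linarith) (Or.inl (by linarith))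
  · rw [← es]; exact hA.le (by linarith) (by linarith) (by linarith) (by linarith) (by linarith) (by linarith) (Or.inl (by linarith))

theorem RQ.degenX {u u' v v' : ℝ} (h : u' ≤ u) : RQ U R f u u' v v' := fun _ ht => absurd ht.hx (not_lt.2 h)
theorem RQ.degenY {u u' v v' : ℝ} (h : v' ≤ v) : RQ U R f u u' v v' := fun _ ht => absurd ht.hy (not_lt.2 h)

theorem RQ.germNE (hR : Clo S U R) (hA : Amb S U f X0 X1 Y0 Y1) {x y : ℝ} (a : X0 ≤ x) (c : Y0 ≤ y) :
    ∃ δ > 0, ∀ u u' v v', x ≤ u → u' < x + δ → u' ≤ X1 → y ≤ v → v' < y + δ → v' ≤ Y1 → RQ U R f u u' v v' := by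
  by_cases h : x < X1 ∧ y < Y1
  · obtain ⟨δ, d0, -, -, e, he⟩ := hA.germ a h.1 c h.2
    exact ⟨δ, d0, fun u u' v v' h1 h2 h3 h4 h5 h6 => RQ.triv hR hA (by linarith) h3 (by linarith) h6 (c := e)
      (fun x' y' k1 k2 k3 k4 => he x' y' (by linarith) (by linarith) (by linarith) (by linarith))⟩
  · refine ⟨1, one_pos, fun u u' v v' h1 h2 h3 h4 h5 h6 => ?_⟩
    rcases not_and_or.1 h with g | g
    · exact RQ.degenX (by linarith)
    · exact RQ.degenY (by linarith)

theorem RQ.germSW (hR : Clo S U R) (hA : Amb S U f X0 X1 Y0 Y1) {x y : ℝ} (a : x ≤ X1) (c : y ≤ Y1) :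
    ∃ δ > 0, ∀ u u' v v', X0 ≤ u → x - δ < u → u' ≤ x → Y0 ≤ v → y - δ < v → v' ≤ y → RQ U R f u u' v v' := by
  by_cases h : X0 < x ∧ Y0 < y
  · obtain ⟨δ, d0, -, -, e, he⟩ := hA.dual.germ (x := -y) (y := -x) (by linarith) (by linarith) (by linarith) (by linarith)
    refine ⟨δ, d0, fun u u' v v' h1 h2 h3 h4 h5 h6 => RQ.triv hR hA h1 (by linarith) h4 (by linarith) (c := e)
      (fun x' y' k1 k2 k3 k4 => ?_)⟩
    have := he (-y') (-x') (by linarith) (by linarith) (by linarith) (by linarith)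
    simpa [flp] using this
  · refine ⟨1, one_pos, fun u u' v v' h1 h2 h3 h4 h5 h6 => ?_⟩
    rcases not_and_or.1 h with g | g
    · exact RQ.degenX (by linarith)
    · exact RQ.degenY (by linarith)

/-- splitting an interval at a point -/
theorem clamp (u u' x : ℝ) (h : u < u') : ∃ c, u ≤ c ∧ c ≤ u' ∧ (c ≤ x ∨ c = u) ∧ (x ≤ c ∨ c = u') := by
  rcases le_or_gt x u with g | g
  · exact ⟨u, le_rfl, h.le, Or.inr rfl, Or.inl g⟩
  · rcases le_or_gt u' x with g' | g'
    · exact ⟨u', h.le, le_rfl, Or.inl g', Or.inr rfl⟩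
    · exact ⟨x, g.le, g'.le, Or.inl le_rfl, Or.inl le_rfl⟩

/-- `z` is a limit of bad subrectangles from the lower right -/
def LRb (U : List T) (R : Tile T → Prop) (f : ℝ → ℝ → T) (p0 p1 q0 q1 x y : ℝ) : Prop :=
  p0 ≤ x ∧ y ≤ q1 ∧ ∀ ε > 0, ∃ u u' v v', x ≤ u ∧ u < u' ∧ u' ≤ p1 ∧ q0 ≤ v ∧ v < v' ∧ v' ≤ y ∧ u' < x + ε ∧ y - ε < v ∧
    ¬ RQ U R f u u' v v'

def ULb (U : List T) (R : Tile T → Prop) (f : ℝ → ℝ → T) (p0 p1 q0 q1 x y : ℝ) : Prop :=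
  LRb U R (swf f) q0 q1 p0 p1 y x

theorem LRb.mono {p0 p1 q0 q1 x y r0 r1 s0 s1 : ℝ} (h : LRb U R f r0 r1 s0 s1 x y) (h1 : p0 ≤ r0) (h2 : r1 ≤ p1)
    (h3 : q0 ≤ s0) (h4 : s1 ≤ q1) : LRb U R f p0 p1 q0 q1 x y := by
  obtain ⟨a, b, c⟩ := h
  refine ⟨by linarith, by linarith, fun ε he => ?_⟩
  obtain ⟨u, u', v, v', k1, k2, k3, k4, k5, k6, k7, k8, k9⟩ := c ε he
  exact ⟨u, u', v, v', k1, k2, by linarith, by linarith, k5, k6, k7, k8, k9⟩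

theorem LRb.lt {p0 p1 q0 q1 x y : ℝ} (h : LRb U R f p0 p1 q0 q1 x y) : x < p1 ∧ q0 < y := by
  obtain ⟨a, b, c⟩ := h
  obtain ⟨u, u', v, v', k1, k2, k3, k4, k5, k6, k7, k8, k9⟩ := c 1 one_pos
  exact ⟨by linarith, by linarith⟩

theorem swf_swf (f : ℝ → ℝ → T) : swf (swf f) = f := rfl

theorem RQ.swap_iff (hR : Clo S U R) {u u' v v' : ℝ} : RQ U R (swf f) v v' u u' ↔ RQ U R f u u' v v' :=
  ⟨fun h => RQ.swap hR h, fun h => RQ.swap hR h⟩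

/-- Near a point which is not bad, everything is derivable. -/
theorem near_good (hR : Clo S U R) (hA : Amb S U f X0 X1 Y0 Y1) {p0 p1 q0 q1 : ℝ}
    (a : X0 ≤ p0) (b : p1 ≤ X1) (a' : Y0 ≤ q0) (b' : q1 ≤ Y1) {x y : ℝ} (h1 : p0 ≤ x) (h2 : x ≤ p1) (h3 : q0 ≤ y) (h4 : y ≤ q1)
    (n1 : ¬ LRb U R f p0 p1 q0 q1 x y) (n2 : ¬ ULb U R f p0 p1 q0 q1 x y) :
    ∃ ε > 0, ∀ u u' v v', p0 ≤ u → u < u' → u' ≤ p1 → q0 ≤ v → v < v' →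
      v' ≤ q1 → x - ε < u → u' < x + ε → y - ε < v → v' < y + ε → RQ U R f u u' v v' := by
  obtain ⟨δ1, d1, e1⟩ := RQ.germNE hR hA (x := x) (y := y) (by linarith) (by linarith)
  obtain ⟨δ2, d2, e2⟩ := RQ.germSW hR hA (x := x) (y := y) (by linarith) (by linarith)
  have n1' : ∃ ε > 0, ∀ u u' v v', x ≤ u → u' ≤ p1 → q0 ≤ v → v' ≤ y → u' < x + ε → y - ε < v → RQ U R f u u' v v' := by
    by_contra hc
    apply n1
    refine ⟨h1, h4, fun ε he => ?_⟩
    by_contra hc'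
    push Not at hc'
    refine hc ⟨ε, he, fun u u' v v' k1 k2 k3 k4 k5 k6 => ?_⟩
    rcases le_or_gt u' u with g | g
    · exact RQ.degenX g
    rcases le_or_gt v' v with g' | g'
    · exact RQ.degenY g'
    exact hc' u u' v v' k1 g k2 k3 g' k4 k5 k6
  have n2' : ∃ ε > 0, ∀ u u' v v', p0 ≤ u → u' ≤ x → y ≤ v → v' ≤ q1 → x - ε < u → v' < y + ε → RQ U R f u u' v v' := by
    by_contra hc
    apply n2
    refine ⟨h3, h2, fun ε he => ?_⟩
    by_contra hc'
    push Not at hc'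
    refine hc ⟨ε, he, fun u u' v v' k1 k2 k3 k4 k5 k6 => ?_⟩
    rcases le_or_gt u' u with g | g
    · exact RQ.degenX g
    rcases le_or_gt v' v with g' | g'
    · exact RQ.degenY g'
    exact (RQ.swap_iff hR).1 (hc' v v' u u' k3 g' k4 k1 g k2 k6 k5)
  obtain ⟨δ3, d3, e3⟩ := n1'
  obtain ⟨δ4, d4, e4⟩ := n2'
  obtain ⟨ε, e0, hε⟩ : ∃ ε > 0, ε ≤ δ1 ∧ ε ≤ δ2 ∧ ε ≤ δ3 ∧ ε ≤ δ4 :=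
    ⟨min (min δ1 δ2) (min δ3 δ4), lt_min (lt_min d1 d2) (lt_min d3 d4), by simp, by simp, by simp, by simp⟩
  refine ⟨ε, e0, fun u u' v v' k1 k2 k3 k4 k5 k6 k7 k8 k9 k10 => ?_⟩
  obtain ⟨c, c1, c2, c3, c4⟩ := clamp u u' x k2
  obtain ⟨d, g1, g2, g3, g4⟩ := clamp v v' y k5
  have A : RQ U R f u c v d := by
    rcases c3 with c3 | c3
    · rcases g3 with g3 | g3
      · exact e2 _ _ _ _ (by linarith) (by linarith) (by linarith) (by linarith) (by linarith) (by linarith)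
      · exact RQ.degenY g3.le
    · exact RQ.degenX c3.le
  have B : RQ U R f u c d v' := by
    rcases c3 with c3 | c3
    · rcases g4 with g4 | g4
      · exact e4 _ _ _ _ (by linarith) (by linarith) (by linarith) (by linarith) (by linarith) (by linarith)
      · exact RQ.degenY g4.ge
    · exact RQ.degenX c3.le
  have C : RQ U R f c u' v d := by
    rcases c4 with c4 | c4
    · rcases g3 with g3 | g3
      · exact e3 _ _ _ _ (by linarith) (by linarith) (by linarith) (by linarith) (by linarith) (by linarith)
      · exact RQ.degenY g3.le
    · exact RQ.degenX c4.ge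
  have D : RQ U R f c u' d v' := by
    rcases c4 with c4 | c4
    · rcases g4 with g4 | g4
      · exact e1 _ _ _ _ (by linarith) (by linarith) (by linarith) (by linarith) (by linarith) (by linarith)
      · exact RQ.degenY g4.ge
    · exact RQ.degenX c4.ge
  exact RQ.glueV hR hA (RQ.glueH hR hA A B (by linarith) g1 g2 (by linarith) (by linarith) (by linarith))
    (RQ.glueH hR hA C D (by linarith) g1 g2 (by linarith) (by linarith) (by linarith))
    (by linarith) c1 c2 (by linarith) (by linarith) (by linarith)

/-- A non-derivable rectangle contains a bad point. -/
theorem exists_bad (hR : Clo S U R) (hA : Amb S U f X0 X1 Y0 Y1) {p0 p1 q0 q1 : ℝ}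
    (a : X0 ≤ p0) (b : p1 ≤ X1) (a' : Y0 ≤ q0) (b' : q1 ≤ Y1) (hn : ¬ RQ U R f p0 p1 q0 q1) :
    ∃ x y, p0 ≤ x ∧ x ≤ p1 ∧ q0 ≤ y ∧ y ≤ q1 ∧ (LRb U R f p0 p1 q0 q1 x y ∨ ULb U R f p0 p1 q0 q1 x y) := by
  by_contra hcon
  push Not at hcon
  apply hn
  refine RQ.compact hR hA a b a' b' (fun x y h1 h2 h3 h4 => ?_)
  obtain ⟨n1, n2⟩ := hcon x y h1 h2 h3 h4
  exact near_good hR hA a b a' b' h1 h2 h3 h4 n1 n2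

/-- Context for the main induction. -/
structure Ctx (S : Sys T) (U : List T) (R : Tile T → Prop) (f : ℝ → ℝ → T) (X0 X1 Y0 Y1 p0 p1 q0 q1 : ℝ) (a b : T) : Prop where
  clo : Clo S U R
  amb : Amb S U f X0 X1 Y0 Y1
  hX0 : X0 ≤ p0
  hX1 : p1 ≤ X1
  hY0 : Y0 ≤ q0
  hY1 : q1 ≤ Y1
  ne : a ≠ b
  aU : a ∈ U
  bU : b ∈ U
  ha : ∀ x y, p0 < x → x < p1 → q0 < y → y < q1 → S.le a (f x y)
  hb : ∀ x y, p0 < x → x < p1 → q0 < y → y < q1 → S.le (f x y) b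
  nr : ∀ u u' v v', p0 ≤ u → u' ≤ p1 → q0 ≤ v → v' ≤ q1 → ¬ RQ U R f u u' v v' →
    (∃ x y, u < x ∧ x < u' ∧ v < y ∧ y < v' ∧ f x y = a) ∧ (∃ x y, u < x ∧ x < u' ∧ v < y ∧ y < v' ∧ f x y = b)

section
variable {p0 p1 q0 q1 : ℝ} {a b : T}

theorem Ctx.swap (h : Ctx S U R f X0 X1 Y0 Y1 p0 p1 q0 q1 a b) : Ctx S U R (swf f) Y0 Y1 X0 X1 q0 q1 p0 p1 a b := by
  refine ⟨h.clo, h.amb.swap, h.hY0, h.hY1, h.hX0, h.hX1, h.ne, h.aU, h.bU, fun x y k1 k2 k3 k4 => h.ha y x k3 k4 k1 k2,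
    fun x y k1 k2 k3 k4 => h.hb y x k3 k4 k1 k2, fun u u' v v' k1 k2 k3 k4 hn => ?_⟩
  rw [RQ.swap_iff h.clo] at hn
  obtain ⟨⟨x, y, a1, a2, a3, a4, a5⟩, ⟨x', y', b1, b2, b3, b4, b5⟩⟩ := h.nr v v' u u' k3 k4 k1 k2 hn
  exact ⟨⟨y, x, a3, a4, a1, a2, a5⟩, ⟨y', x', b3, b4, b1, b2, b5⟩⟩

theorem Ctx.eq_a (h : Ctx S U R f X0 X1 Y0 Y1 p0 p1 q0 q1 a b) {x y x' y' : ℝ} (h1 : p0 < x) (h2 : x ≤ x') (h3 : x' < p1)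
    (h4 : q0 < y) (h5 : y ≤ y') (h6 : y' < q1) (he : f x' y' = a) : f x y = a := by
  by_cases hh : x = x' ∧ y = y'
  · rw [hh.1, hh.2, he]
  · have := h.hX0; have := h.hX1; have := h.hY0; have := h.hY1
    refine h.amb.anti _ (h.amb.mem _ _ (by linarith) (by linarith) (by linarith) (by linarith)) _ h.aU ?_
      (h.ha x y h1 (by linarith) h4 (by linarith))
    rw [← he]
    refine h.amb.le (by linarith) h2 (by linarith) (by linarith) h5 (by linarith) ?_
    by_contra hc
    push Not at hc
    exact hh ⟨le_antisymm h2 hc.1, le_antisymm h5 hc.2⟩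

theorem Ctx.eq_b (h : Ctx S U R f X0 X1 Y0 Y1 p0 p1 q0 q1 a b) {x y x' y' : ℝ} (h1 : p0 < x) (h2 : x ≤ x') (h3 : x' < p1)
    (h4 : q0 < y) (h5 : y ≤ y') (h6 : y' < q1) (he : f x y = b) : f x' y' = b := by
  by_cases hh : x = x' ∧ y = y'
  · rw [← hh.1, ← hh.2, he]
  · have := h.hX0; have := h.hX1; have := h.hY0; have := h.hY1
    refine h.amb.anti _ (h.amb.mem _ _ (by linarith) (by linarith) (by linarith) (by linarith)) _ h.bU 
      (h.hb x' y' (by linarith) (by linarith) (by linarith) (by linarith)) ?_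
    rw [← he]
    refine h.amb.le (by linarith) h2 (by linarith) (by linarith) h5 (by linarith) ?_
    by_contra hc
    push Not at hc
    exact hh ⟨le_antisymm h2 hc.1, le_antisymm h5 hc.2⟩

theorem Ctx.pts (h : Ctx S U R f X0 X1 Y0 Y1 p0 p1 q0 q1 a b) {x y : ℝ} (hz : LRb U R f p0 p1 q0 q1 x y) {ε : ℝ} (he : 0 < ε) :
    (∃ u v, x < u ∧ u < x + ε ∧ u < p1 ∧ q0 < v ∧ v < y ∧ y - ε < v ∧ f u v = a) ∧
    (∃ u v, x < u ∧ u < x + ε ∧ u < p1 ∧ q0 < v ∧ v < y ∧ y - ε < v ∧ f u v = b) := by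
  obtain ⟨k1, k2, k3⟩ := hz
  obtain ⟨u, u', v, v', l1, l2, l3, l4, l5, l6, l7, l8, l9⟩ := k3 ε he
  obtain ⟨⟨x1, y1, a1, a2, a3, a4, a5⟩, ⟨x2, y2, b1, b2, b3, b4, b5⟩⟩ := h.nr u u' v v' (by linarith) l3 l4 (by linarith) l9
  exact ⟨⟨x1, y1, by linarith, by linarith, by linarith, by linarith, by linarith, by linarith, a5⟩,
    ⟨x2, y2, by linarith, by linarith, by linarith, by linarith, by linarith, by linarith, b5⟩⟩

theorem Ctx.lra (h : Ctx S U R f X0 X1 Y0 Y1 p0 p1 q0 q1 a b) {x y : ℝ} (hz : LRb U R f p0 p1 q0 q1 x y) {u v : ℝ}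
    (h1 : p0 < u) (h2 : u ≤ x) (h3 : q0 < v) (h4 : v < y) : f u v = a := by
  obtain ⟨⟨u', v', k1, k2, k3, k4, k5, k6, k7⟩, _⟩ := h.pts hz (sub_pos.2 h4)
  have := hz.2.1
  exact h.eq_a h1 (by linarith) k3 h3 (by linarith) (by linarith) k7

theorem Ctx.lrb (h : Ctx S U R f X0 X1 Y0 Y1 p0 p1 q0 q1 a b) {x y : ℝ} (hz : LRb U R f p0 p1 q0 q1 x y) {u v : ℝ}
    (h1 : x < u) (h2 : u < p1) (h3 : y ≤ v) (h4 : v < q1) : f u v = b := by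
  obtain ⟨_, ⟨u', v', k1, k2, k3, k4, k5, k6, k7⟩⟩ := h.pts hz (sub_pos.2 h1)
  have := hz.1
  exact h.eq_b (by linarith) (by linarith) h2 k4 (by linarith) h4 k7

theorem Ctx.ula (h : Ctx S U R f X0 X1 Y0 Y1 p0 p1 q0 q1 a b) {x y : ℝ} (hz : ULb U R f p0 p1 q0 q1 x y) {u v : ℝ}
    (h1 : p0 < u) (h2 : u < x) (h3 : q0 < v) (h4 : v ≤ y) : f u v = a := h.swap.lra hz h3 h4 h1 h2

theorem Ctx.ulb (h : Ctx S U R f X0 X1 Y0 Y1 p0 p1 q0 q1 a b) {x y : ℝ} (hz : ULb U R f p0 p1 q0 q1 x y) {u v : ℝ}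
    (h1 : x ≤ u) (h2 : u < p1) (h3 : y < v) (h4 : v < q1) : f u v = b := h.swap.lrb hz h3 h4 h1 h2

end

end Temporal

namespace Temporal

variable {T : Type} {S : Sys T} {U : List T} {f : ℝ → ℝ → T} {X0 X1 Y0 Y1 : ℝ} {R : Tile T → Prop}

theorem Reads.shrinkL {β : ℝ → T} {hi : ℝ} {L lo e} (h : Reads β hi L lo e) :
    ∃ k, lo < k ∧ k ≤ hi ∧ (∀ x, lo < x → x < k → β x = e) ∧ ∀ m, lo < m → m < k → Reads β hi L m e := by
  cases L with
  | nil => exact ⟨hi, h.1, le_rfl, h.2, fun m a b => ⟨b, fun x c d => h.2 x (a.trans c) d⟩⟩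
  | cons p L =>
    obtain ⟨m0, h1, h2, h3, h4, h5⟩ := h
    exact ⟨m0, h1, h2.le, h3, fun m a b => ⟨m0, b, h2, fun x c d => h3 x (a.trans c) d, h4, h5⟩⟩

theorem Reads.shrinkR {β : ℝ → T} {hi : ℝ} {L lo e} (h : Reads β hi L lo e) :
    ∃ k, lo ≤ k ∧ k < hi ∧ (∀ x, k < x → x < hi → β x = lastP e L) ∧ ∀ m, k < m → m < hi → Reads β m L lo e := by
  induction L generalizing lo e with
  | nil => exact ⟨lo, le_rfl, h.1, h.2, fun m a b => ⟨a, fun x c d => h.2 x c (d.trans b)⟩⟩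
  | cons p L ih =>
    obtain ⟨m0, h1, h2, h3, h4, h5⟩ := h
    obtain ⟨k, a, b, c, d⟩ := ih h5
    exact ⟨k, h1.le.trans a, b, c, fun m e1 e2 => ⟨m0, h1, a.trans_lt e1, h3, h4, d m e1 e2⟩⟩

theorem CanW.const {β : ℝ → T} {lo hi : ℝ} {w : Wd T} (h : RdW β lo hi w) (hc : CanW U w) {e : T}
    (he : ∀ x, lo < x → x < hi → β x = e) : w = (e, []) := by
  have h1 : ∀ t ∈ letters w, t = e := fun t ht => by
    obtain ⟨x, a, b, c⟩ := Reads.att h ht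
    rw [← c, he x a b]
  obtain ⟨w1, L⟩ := w
  have h2 : w1 = e := h1 _ (by simp [letters])
  cases L with
  | nil => rw [h2]
  | cons p L =>
    have h3 : p.2 = e := h1 _ (by simp [letters, lettersP])
    have := hc.2
    simp [h2, h3] at this

theorem CanW.single {e : T} (h : e ∈ U) : CanW U (e, []) := by
  refine ⟨fun t ht => ?_, by simp⟩
  simp only [letters, lettersP, List.flatMap_nil, List.mem_cons, List.not_mem_nil, or_false] at ht
  rw [ht]; exact h

theorem Clo.finite (hR : Clo S U R) : {τ : Tile T | CanT U τ}.Finite := by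
  obtain ⟨W, hW, _⟩ := hR
  have hU := List.finite_toSet U
  have hW' := List.finite_toSet W
  refine ((hU.prod (hU.prod (hU.prod hU))).prod (hW'.prod (hW'.prod (hW'.prod hW')))).subset ?_
  rintro τ ⟨⟨a, b, c, d⟩, e, f, g, h⟩
  exact ⟨⟨a, b, c, d⟩, hW _ e, hW _ f, hW _ g, hW _ h⟩

theorem pigeon {α : Type} {F : Set α} (hF : F.Finite) {P : α → ℝ → Prop} (hP : ∀ τ δ δ', δ ≤ δ' → P τ δ → P τ δ')
    (h : ∀ δ > 0, ∃ τ ∈ F, P τ δ) : ∃ τ ∈ F, ∀ δ > 0, P τ δ := by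
  by_contra hc
  push Not at hc
  have key : ∃ δ > 0, ∀ τ ∈ F, ¬ P τ δ := by
    clear h
    induction F, hF using Set.Finite.induction_on with
    | empty => exact ⟨1, one_pos, by simp⟩
    | @insert a F _ _ ih =>
      obtain ⟨δ, d0, d⟩ := ih (fun τ ht => hc τ (Set.mem_insert_of_mem _ ht))
      obtain ⟨δ', d0', d'⟩ := hc a (Set.mem_insert _ _)
      refine ⟨min δ δ', lt_min d0 d0', fun τ ht => ?_⟩
      rcases ht with rfl | ht
      · exact fun hh => d' (hP _ _ _ (min_le_right _ _) hh)
      · exact fun hh => d τ ht (hP _ _ _ (min_le_left _ _) hh)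
  obtain ⟨δ, d0, d⟩ := key
  obtain ⟨τ, ht, hp⟩ := h δ d0
  exact d τ ht hp

theorem LoopF.complete (hA : Amb S U f X0 X1 Y0 Y1) {x y mx my : ℝ} {τ : Tile T} (ht : IsTile f x mx my y τ)
    (a : X0 ≤ x) (b : mx < X1) (c : Y0 < my) (d : y ≤ Y1) (hl : ∀ t, my ≤ t → t < y → f x t = τ.ll)
    (hu : ∀ t, x < t → t ≤ mx → f t y = τ.ur) : LoopF S τ := by
  have hx := ht.hx
  have hy := ht.hy
  refine ⟨?_, fun i hi hn => ?_⟩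
  · rw [← ht.ll, ← ht.ul]
    exact hA.le a le_rfl (by linarith) c.le hy.le d (Or.inr hy)
  · rw [← ht.ll] at hn
    obtain ⟨x', y', k1, k2, k3, k4, k5, k6⟩ := hA.demF x mx my y a b.le c.le d i hi x my le_rfl hx le_rfl hy hn
    have hg : S.gF i (f x' y') := by
      rcases k6 with k6 | k6
      · exact Or.inr k6
      · exact Or.inl k6.2
    rcases k1.eq_or_lt with e1 | e1
    · subst e1
      rcases k4.eq_or_lt with e2 | e2
      · subst e2; rw [ht.ul] at hg; exact Or.inr (Or.inl hg)
      · rcases k6 with k6 | ⟨k6 | k6, k7⟩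
        · rw [hl _ k3 e2] at k6; exact Or.inl k6
        · exact absurd k6 hx.ne
        · exact absurd k6 e2.ne
    · rcases k4.eq_or_lt with e2 | e2
      · subst e2; rw [hu _ e1 k2] at hg; exact Or.inr (Or.inr (Or.inl hg))
      · obtain ⟨t, t1, t2, t3, t4⟩ := Reads.firstlt ht.wb e1
        refine Or.inr (Or.inr (Or.inr ?_))
        have hh : f t my = τ.wb.1 := t4
        rw [← hh]
        exact hA.law.axF i _ _ hi (hA.real t my (by linarith) (by linarith) (by linarith) (by linarith))
          (hA.le (by linarith) t2.le (by linarith) c.le k3 (by linarith) (Or.inl t2)) hg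

theorem loop_lemma (hR : Clo S U R) (hA : Amb S U f X0 X1 Y0 Y1) {x y : ℝ} (M : Set (ℝ × ℝ))
    (a : X0 ≤ x) (d : y ≤ Y1)
    (hM1 : ∀ m ∈ M, x < m.1 ∧ m.1 < X1 ∧ Y0 < m.2 ∧ m.2 < y)
    (hM2 : ∀ ε > 0, ∃ m ∈ M, m.1 < x + ε ∧ y - ε < m.2)
    (hM3 : ∀ m ∈ M, ∀ m' ∈ M, m'.1 < m.1 → m.2 < m'.2 → RQ U R f x m'.1 m.2 m'.2 ∧ RQ U R f m'.1 m.1 m'.2 y ∧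
      RQ U R f m'.1 m.1 m.2 m'.2) :
    ∀ ε > 0, ∃ m ∈ M, m.1 < x + ε ∧ y - ε < m.2 ∧ RQ U R f x m.1 m.2 y := by
  intro ε he
  by_contra hcon
  push Not at hcon
  obtain ⟨m0, hm0, -⟩ := hM2 1 one_pos
  obtain ⟨b1, b2, b3, b4⟩ := hM1 m0 hm0
  -- constancy near the corner
  obtain ⟨wv, -, rv⟩ := hA.canL a (by linarith) le_rfl d (show Y0 < y by linarith)
  obtain ⟨kv, v1, v2, v3⟩ := Reads.last rv
  obtain ⟨wh, -, rh⟩ := hA.canH (show Y0 ≤ y by linarith) d a le_rfl (show x < X1 by linarith)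
  obtain ⟨kh, h1, h2, h3⟩ := Reads.first rh
  set ε0 := min ε (min (y - kv) (kh - x)) with hε0
  have e0 : 0 < ε0 := lt_min he (lt_min (by linarith) (by linarith))
  have e1 : ε0 ≤ ε := min_le_left _ _
  have e2 : ε0 ≤ y - kv := (min_le_right _ _).trans (min_le_left _ _)
  have e3 : ε0 ≤ kh - x := (min_le_right _ _).trans (min_le_right _ _)
  obtain ⟨τ, hτ, hP⟩ := pigeon hR.finite (P := fun τ δ => ∃ m ∈ M, m.1 < x + δ ∧ y - δ < m.2 ∧ m.1 < x + ε0 ∧ y - ε0 < m.2 ∧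
      IsTile f x m.1 m.2 y τ ∧ ¬ R τ)
    (by
      rintro τ δ δ' h ⟨m, hm, k1, k2, k3⟩
      exact ⟨m, hm, by linarith, by linarith, k3⟩)
    (by
      intro δ hδ
      obtain ⟨m, hm, k1, k2⟩ := hM2 (min δ ε0) (lt_min hδ e0)
      have l1 := min_le_left δ ε0
      have l2 := min_le_right δ ε0
      have := hcon m hm (by linarith) (by linarith)
      unfold RQ at this
      push Not at this
      obtain ⟨τ, ht, hc, hn⟩ := this
      exact ⟨τ, hc, m, hm, by linarith, by linarith, by linarith, by linarith, ht, hn⟩)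
  obtain ⟨m, hm, -, -, g1, g2, ht, hn⟩ := hP 1 one_pos
  obtain ⟨c1, c2, c3, c4⟩ := hM1 m hm
  have hcT : CanT U τ := hτ
  obtain ⟨kb, kb1, kb2, kb3, kb4⟩ := Reads.shrinkL ht.wb
  obtain ⟨kr, kr1, kr2, kr3, kr4⟩ := Reads.shrinkR ht.wr
  obtain ⟨m', hm', -, -, -, -, ht', -⟩ := hP 1 one_pos
  obtain ⟨m', hm', f1, f2, f3, f4, ht', -⟩ := hP (min (kb - x) (y - kr)) (lt_min (by linarith) (by linarith))
  obtain ⟨c1', c2', c3', c4'⟩ := hM1 m' hm'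
  have l1 := min_le_left (kb - x) (y - kr)
  have l2 := min_le_right (kb - x) (y - kr)
  have q1 : m'.1 < kb := by linarith
  have q2 : kr < m'.2 := by linarith
  have q3 : m'.1 < m.1 := by linarith
  have q4 : m.2 < m'.2 := by linarith
  -- edges of the outer tile
  have ell : ∀ t, m.2 ≤ t → t < y → f x t = τ.ll := fun t t1 t2 => by
    rw [← ht.ll]
    exact (v3 t (by linarith) t2).trans (v3 m.2 (by linarith) c4).symm
  have eur : ∀ t, x < t → t ≤ m.1 → f t y = τ.ur := fun t t1 t2 => by
    rw [← ht.ur]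
    exact (h3 t t1 (by linarith)).trans (h3 m.1 c1 (by linarith)).symm
  have ewl : τ.wl = (τ.ll, []) := CanW.const ht.wl hcT.2.1 (fun t t1 t2 => ell t t1.le t2)
  have ewt : τ.wt = (τ.ur, []) := CanW.const ht.wt hcT.2.2.2.2 (fun t t1 t2 => eur t t1 t2.le)
  have ea : f m'.1 m.2 = τ.wb.1 := kb3 _ c1' q1
  have eb : f m.1 m'.2 = lastW τ.wr := kr3 _ q2 c4'
  obtain ⟨cl, hcl, rcl⟩ := hA.canL (show X0 ≤ m'.1 by linarith) (by linarith) c3.le (show m'.2 ≤ Y1 by linarith) q4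
  obtain ⟨ct, hct, rct⟩ := hA.canH (show Y0 ≤ m'.2 by linarith) (by linarith) (show X0 ≤ m'.1 by linarith) c2.le q3
  obtain ⟨k1, k2, k3⟩ := hM3 m hm m' hm' q3 q4
  have mU : ∀ u v, x ≤ u → u ≤ m.1 → m.2 ≤ v → v ≤ y → f u v ∈ U := fun u v z1 z2 z3 z4 =>
    hA.mem u v (by linarith) (by linarith) (by linarith) (by linarith)
  have ua : τ.wb.1 ∈ U := hcT.2.2.2.1.1 _ (by simp [letters])
  have ub : lastW τ.wr ∈ U := by rw [← eb]; exact mU _ _ (by linarith) (by linarith) (by linarith) (by linarith)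
  have rl : ∀ u v, x < u → u ≤ m.1 → m.2 ≤ v → v < y → S.rl (f u v) := fun u v z1 z2 z3 z4 =>
    hA.real u v (by linarith) (by linarith) (by linarith) (by linarith)
  apply hn
  obtain ⟨W, hW, hst⟩ := hR
  refine hst τ hτ (Or.inr (Or.inr (Or.inr (Or.inl ⟨ewl, ewt, Tile.mk' τ.wb.1 τ.lr τ.lr (lastW τ.wr) cl τ.wr τ.wb ct, ?_, ?_, ?_, rfl, ?_, ?_, ?_, ?_, ?_, ?_, ?_⟩))))
  · exact k3 _ ⟨q3, q4, ea, ht.lr, ht'.lr, eb, rcl, kr4 _ q2 c4', kb4 _ c1' q1, rct⟩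
      ⟨⟨ua, hcT.1.2.1, hcT.1.2.1, ub⟩, hcl, hcT.2.2.1, hcT.2.2.2.1, hct⟩
  · refine k1 _ ⟨c1', q4, ht.ll, ea, ell _ q4.le c4', ht'.lr, ⟨q4, fun t t1 t2 => ell t t1.le (by linarith)⟩, rcl,
      ⟨c1', fun t t1 t2 => kb3 t t1 (by linarith)⟩, ht'.wb⟩
      ⟨⟨hcT.1.1, ua, hcT.1.1, hcT.1.2.1⟩, CanW.single hcT.1.1, hcl, CanW.single ua, hcT.2.2.2.1⟩
  · refine k2 _ ⟨q3, c4', ht'.lr, eb, eur _ c1' q3.le, ht.ur, ht'.wr, ⟨c4', fun t t1 t2 => kr3 t (by linarith) t2⟩,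
      rct, ⟨q3, fun t t1 t2 => eur t (by linarith) t2.le⟩⟩
      ⟨⟨hcT.1.2.1, ub, hcT.1.2.2.2, hcT.1.2.2.2⟩, hcT.2.2.1, CanW.single ub, hct, CanW.single hcT.1.2.2.2⟩
  · rw [← ht.lr]; exact rl _ _ c1 le_rfl le_rfl c4
  · intro t h
    obtain ⟨s, s1, s2, rfl⟩ := Reads.att ht.wb h
    exact rl _ _ s1 s2.le le_rfl c4
  · intro t h
    obtain ⟨s, s1, s2, rfl⟩ := Reads.att ht.wr h
    exact rl _ _ c1 le_rfl s1.le s2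
  · intro t h
    obtain ⟨s, s1, s2, rfl⟩ := Reads.att rcl h
    exact rl _ _ c1' q3.le s1.le (by linarith)
  · intro t h
    obtain ⟨s, s1, s2, rfl⟩ := Reads.att rct h
    exact rl _ _ (by linarith) s2.le q4.le c4'
  · exact LoopF.complete hA ht a c2 c3 d ell eur
  · refine LoopF.complete hA.dual ht.dual (by linarith) (by linarith) (by linarith) (by linarith) (fun t t1 t2 => ?_) (fun t t1 t2 => ?_)
    · simp only [flp, neg_neg, dual_ll]; exact eur _ (by linarith) (by linarith)
    · simp only [flp, neg_neg, dual_ur]; exact ell _ (by linarith) (by linarith)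

end Temporal

namespace Temporal

variable {T : Type} {S : Sys T} {U : List T} {f : ℝ → ℝ → T} {X0 X1 Y0 Y1 : ℝ} {R : Tile T → Prop}

theorem two_sided {K : Set ℝ} (hc : IsClosed K) (hp : ∀ x ∈ K, ∀ ε > 0, ∃ y ∈ K, y ≠ x ∧ |y - x| < ε) {u v k : ℝ}
    (hk : k ∈ K) (h1 : u < k) (h2 : k < v) : ∃ k ∈ K, u < k ∧ k < v ∧ (∀ ε > 0, ∃ y ∈ K, k < y ∧ y < k + ε) ∧
      (∀ ε > 0, ∃ y ∈ K, k - ε < y ∧ y < k) := by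
  have hpre : Preperfect K := by
    rw [preperfect_iff_nhds]
    intro x hx N hN
    obtain ⟨ε, he, hb⟩ := Metric.mem_nhds_iff.1 hN
    obtain ⟨y, hy, hne, hd⟩ := hp x hx ε he
    exact ⟨y, ⟨hb (by rw [Metric.mem_ball, Real.dist_eq]; exact hd), hy⟩, hne⟩
  obtain ⟨hP, hne⟩ := Perfect.closure_nhds_inter (C := K) ⟨hc, hpre⟩ k hk (show k ∈ Set.Ioo u v from ⟨h1, h2⟩) isOpen_Ioo
  have hsub : closure (Set.Ioo u v ∩ K) ⊆ K := closure_minimal Set.inter_subset_right hc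
  have hsub' : closure (Set.Ioo u v ∩ K) ⊆ Set.Icc u v :=
    closure_minimal (fun x hx => ⟨hx.1.1.le, hx.1.2.le⟩) isClosed_Icc
  have hunc : ¬ (closure (Set.Ioo u v ∩ K)).Countable := by
    obtain ⟨g, g1, g2, g3⟩ := hP.exists_nat_bool_injection hne
    intro hcnt
    have : (Set.range g).Countable := hcnt.mono g1
    have h3 : (Set.univ : Set (ℕ → Bool)).Countable := by
      rw [← Set.image_univ] at this
      exact (Set.countable_of_injective_of_countable_image (g3.injOn) this)
    rw [Set.countable_univ_iff] at h3
    have h4 := Cardinal.mk_le_aleph0 (α := ℕ → Bool)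
    rw [← Cardinal.power_def, Cardinal.mk_bool, Cardinal.mk_nat] at h4
    exact absurd h4 (not_le.2 (Cardinal.cantor _))
  by_contra hcon
  push Not at hcon
  apply hunc
  refine (((countable_image_lt_image_Ioi_within K (id : ℝ → ℝ)).union
    (countable_image_lt_image_Iio_within K (id : ℝ → ℝ))).union (Set.toFinite ({u, v} : Set ℝ)).countable).mono ?_
  intro x hx
  have hxK := hsub hx
  have hxI := hsub' hx
  by_cases e1 : x = u
  · right; simp [e1]
  by_cases e2 : x = v
  · right; simp [e2]
  left
  by_cases h3 : ∀ ε > 0, ∃ y ∈ K, x < y ∧ y < x + ε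
  · obtain ⟨ε, he, h4⟩ := hcon x hxK (lt_of_le_of_ne hxI.1 (Ne.symm e1)) (lt_of_le_of_ne hxI.2 e2) h3
    right
    refine ⟨hxK, x - ε, by simpa using he, fun y hy hyx => ?_⟩
    by_contra hlt
    simp only [id, not_le] at hlt
    exact absurd hyx (not_lt.2 (h4 y hy hlt))
  · push Not at h3
    obtain ⟨ε, he, h4⟩ := h3
    left
    exact ⟨hxK, x + ε, by simpa using he, fun y hy hyx => h4 y hy hyx⟩

section
variable {p0 p1 q0 q1 : ℝ} {a b : T}

theorem Ctx.lrlr (h : Ctx S U R f X0 X1 Y0 Y1 p0 p1 q0 q1 a b) {x y x' y' : ℝ} (hz : LRb U R f p0 p1 q0 q1 x y)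
    (hz' : LRb U R f p0 p1 q0 q1 x' y') (h1 : x ≤ x') (h2 : y ≤ y') : x = x' ∧ y = y' := by
  rcases h1.eq_or_lt with rfl | h1
  · refine ⟨rfl, h2.eq_of_not_lt (fun h2 => ?_)⟩
    obtain ⟨⟨u, v, k1, k2, k3, k4, k5, k6, k7⟩, _⟩ := h.pts hz' (sub_pos.2 h2)
    have := hz'.2.1
    exact h.ne (k7.symm.trans (h.lrb hz k1 k3 (by linarith) (by linarith)))
  · exfalso
    obtain ⟨_, ⟨u, v, k1, k2, k3, k4, k5, k6, k7⟩⟩ := h.pts hz (sub_pos.2 h1)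
    have := hz.1
    exact h.ne ((h.lra hz' (by linarith) (by linarith) k4 (by linarith)).symm.trans k7)

theorem Ctx.lrul (h : Ctx S U R f X0 X1 Y0 Y1 p0 p1 q0 q1 a b) {x y x' y' : ℝ} (hz : LRb U R f p0 p1 q0 q1 x y)
    (hz' : ULb U R f p0 p1 q0 q1 x' y') (h1 : x < x') (h2 : y ≤ y') : False := by
  obtain ⟨_, ⟨u, v, k1, k2, k3, k4, k5, k6, k7⟩⟩ := h.pts hz (sub_pos.2 h1)
  have := hz.1
  exact h.ne ((h.ula hz' (by linarith) (by linarith) k4 (by linarith)).symm.trans k7)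

theorem Ctx.ullr (h : Ctx S U R f X0 X1 Y0 Y1 p0 p1 q0 q1 a b) {x y x' y' : ℝ} (hz : ULb U R f p0 p1 q0 q1 x y)
    (hz' : LRb U R f p0 p1 q0 q1 x' y') (h1 : x ≤ x') (h2 : y < y') : False := h.swap.lrul hz hz' h2 h1

theorem Ctx.ulul (h : Ctx S U R f X0 X1 Y0 Y1 p0 p1 q0 q1 a b) {x y x' y' : ℝ} (hz : ULb U R f p0 p1 q0 q1 x y)
    (hz' : ULb U R f p0 p1 q0 q1 x' y') (h1 : x ≤ x') (h2 : y ≤ y') : x = x' ∧ y = y' := by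
  have := h.swap.lrlr hz hz' h2 h1
  exact ⟨this.2, this.1⟩

def Bad (U : List T) (R : Tile T → Prop) (f : ℝ → ℝ → T) (p0 p1 q0 q1 x y : ℝ) : Prop :=
  LRb U R f p0 p1 q0 q1 x y ∨ ULb U R f p0 p1 q0 q1 x y

theorem Bad.swap {x y : ℝ} (h : Bad U R f p0 p1 q0 q1 x y) : Bad U R (swf f) q0 q1 p0 p1 y x := h.symm

theorem Bad.mem {x y : ℝ} (h : Bad U R f p0 p1 q0 q1 x y) : p0 ≤ x ∧ x ≤ p1 ∧ q0 ≤ y ∧ y ≤ q1 := by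
  rcases h with h | h
  · exact ⟨h.1, h.lt.1.le, h.lt.2.le, h.2.1⟩
  · exact ⟨h.lt.2.le, h.2.1, h.1, h.lt.1.le⟩

theorem Bad.mono {x y r0 r1 s0 s1 : ℝ} (h : Bad U R f r0 r1 s0 s1 x y) (h1 : p0 ≤ r0) (h2 : r1 ≤ p1)
    (h3 : q0 ≤ s0) (h4 : s1 ≤ q1) : Bad U R f p0 p1 q0 q1 x y :=
  h.imp (fun h => h.mono h1 h2 h3 h4) (fun h => LRb.mono h h3 h4 h1 h2)

/-- bad points form a weak antichain -/
theorem Ctx.anti (h : Ctx S U R f X0 X1 Y0 Y1 p0 p1 q0 q1 a b) {x y x' y' : ℝ} (hz : Bad U R f p0 p1 q0 q1 x y)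
    (hz' : Bad U R f p0 p1 q0 q1 x' y') (hs : x - y ≤ x' - y') : x ≤ x' ∧ y' ≤ y := by
  have main : ∀ x y x' y' : ℝ, Bad U R f p0 p1 q0 q1 x y → Bad U R f p0 p1 q0 q1 x' y' → x < x' → y < y' → False := by
    intro x y x' y' hz hz' h1 h2
    rcases hz with hz | hz <;> rcases hz' with hz' | hz'
    · exact h1.ne (h.lrlr hz hz' h1.le h2.le).1
    · exact h.lrul hz hz' h1 h2.le
    · exact h.ullr hz hz' h1.le h2
    · exact h1.ne (h.ulul hz hz' h1.le h2.le).1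
  by_contra hc
  rcases not_and_or.1 hc with hc | hc
  · exact main x' y' x y hz' hz (by linarith) (by linarith)
  · exact main x y x' y' hz hz' (by linarith) (by linarith)

theorem Ctx.inj (h : Ctx S U R f X0 X1 Y0 Y1 p0 p1 q0 q1 a b) {x y x' y' : ℝ} (hz : Bad U R f p0 p1 q0 q1 x y)
    (hz' : Bad U R f p0 p1 q0 q1 x' y') (hs : x - y = x' - y') : x = x' ∧ y = y' := by
  have h1 := h.anti hz hz' hs.le
  have h2 := h.anti hz' hz hs.ge
  exact ⟨by linarith, by linarith⟩

theorem Ctx.bad_of (h : Ctx S U R f X0 X1 Y0 Y1 p0 p1 q0 q1 a b) {u u' v v' : ℝ} (h1 : p0 ≤ u) (h2 : u' ≤ p1)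
    (h3 : q0 ≤ v) (h4 : v' ≤ q1) (hn : ¬ RQ U R f u u' v v') :
    ∃ x y, u ≤ x ∧ x ≤ u' ∧ v ≤ y ∧ y ≤ v' ∧ Bad U R f u u' v v' x y ∧ Bad U R f p0 p1 q0 q1 x y := by
  obtain ⟨x, y, k1, k2, k3, k4, k5⟩ := exists_bad h.clo h.amb (h.hX0.trans h1) (h2.trans h.hX1) (h.hY0.trans h3) (h4.trans h.hY1) hn
  exact ⟨x, y, k1, k2, k3, k4, k5, Bad.mono k5 h1 h2 h3 h4⟩

theorem Ctx.claim2 (h : Ctx S U R f X0 X1 Y0 Y1 p0 p1 q0 q1 a b) {x y : ℝ} (hz : LRb U R f p0 p1 q0 q1 x y) :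
    ∀ ε > 0, ∃ x' y', x < x' ∧ x' < x + ε ∧ y' < y ∧ y - ε < y' ∧ Bad U R f p0 p1 q0 q1 x' y' := by
  intro ε he
  by_contra hcon
  push Not at hcon
  have g1 := hz.1
  have g2 := hz.2.1
  have only : ∀ x' y', x ≤ x' → x' < x + ε → y' ≤ y → y - ε < y' → Bad U R f p0 p1 q0 q1 x' y' → x' = x ∧ y' = y := by
    intro x' y' k1 k2 k3 k4 k5
    rcases k1.eq_or_lt with e1 | e1
    · subst e1
      refine ⟨rfl, k3.eq_of_not_lt (fun k3 => ?_)⟩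
      rcases k5 with k5 | k5
      · exact k3.ne (h.lrlr k5 hz le_rfl k3.le).2
      · exact h.ullr k5 hz le_rfl k3
    · exfalso
      rcases k3.eq_or_lt with e2 | e2
      · subst e2
        rcases k5 with k5 | k5
        · exact e1.ne (h.lrlr hz k5 e1.le le_rfl).1
        · exact h.lrul hz k5 e1 le_rfl
      · exact hcon x' y' e1 k2 e2 k4 k5
  have good : ∀ u u' v v', x ≤ u → u' < x + ε → u' ≤ p1 → q0 ≤ v → y - ε < v → v' ≤ y → (x < u ∨ v' < y) → RQ U R f u u' v v' := by
    intro u u' v v' k1 k2 k3 k4 k5 k6 k7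
    by_contra hn
    obtain ⟨x', y', l1, l2, l3, l4, -, l5⟩ := h.bad_of (by linarith) k3 k4 (by linarith) hn
    obtain ⟨rfl, rfl⟩ := only x' y' (by linarith) (by linarith) (by linarith) (by linarith) l5
    rcases k7 with k7 | k7 <;> linarith
  obtain ⟨u, u', v, v', k1, k2, k3, k4, k5, k6, k7, k8, k9⟩ := hz.2.2 ε he
  have e1 : u = x := by
    by_contra hne
    exact k9 (good u u' v v' k1 k7 k3 k4 k8 k6 (Or.inl (lt_of_le_of_ne k1 (Ne.symm hne))))
  have e2 : v' = y := by
    by_contra hne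
    exact k9 (good u u' v v' k1 k7 k3 k4 k8 k6 (Or.inr (lt_of_le_of_ne k6 hne)))
  subst e1 e2
  have hX0 := h.hX0; have hX1 := h.hX1; have hY0 := h.hY0; have hY1 := h.hY1
  obtain ⟨m, ⟨m1, m2, m3, m4⟩, -, -, m5⟩ := loop_lemma h.clo h.amb (x := u) (y := v') {m | u < m.1 ∧ m.1 < u' ∧ v < m.2 ∧ m.2 < v'}
    (by linarith) (by linarith)
    (fun m hm => ⟨hm.1, by linarith [hm.2.1], by linarith [hm.2.2.1], hm.2.2.2⟩)
    (fun δ hδ => by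
      obtain ⟨s, s1, s2⟩ := exists_between (show u < min u' (u + δ) from lt_min k2 (by linarith))
      obtain ⟨t, t1, t2⟩ := exists_between (show max v (v' - δ) < v' from max_lt k5 (by linarith))
      exact ⟨(s, t), ⟨s1, s2.trans_le (min_le_left _ _), (le_max_left _ _).trans_lt t1, t2⟩,
        s2.trans_le (min_le_right _ _), (le_max_right _ _).trans_lt t1⟩)
    (by
      rintro m ⟨m1, m2, m3, m4⟩ m' ⟨m1', m2', m3', m4'⟩ l1 l2
      refine ⟨good _ _ _ _ le_rfl (by linarith) (by linarith) (by linarith) (by linarith) (by linarith) (Or.inr m4'),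
        good _ _ _ _ (by linarith) (by linarith) (by linarith) (by linarith) (by linarith) (by linarith) (Or.inl m1'),
        good _ _ _ _ (by linarith) (by linarith) (by linarith) (by linarith) (by linarith) (by linarith) (Or.inl m1')⟩)
    1 one_pos
  refine k9 (RQ.glueV h.clo h.amb (m := m.1) (RQ.glueH h.clo h.amb (m := m.2)
    (good _ _ _ _ le_rfl (by linarith) (by linarith) (by linarith) (by linarith) (by linarith) (Or.inr m4)) m5 ?_ ?_ ?_ ?_ ?_ ?_)
    (good _ _ _ _ (by linarith) (by linarith) (by linarith) (by linarith) (by linarith) (by linarith) (Or.inl m1)) ?_ ?_ ?_ ?_ ?_ ?_) <;> linarith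

/-- projections of bad points -/
def KS (U : List T) (R : Tile T → Prop) (f : ℝ → ℝ → T) (p0 p1 q0 q1 : ℝ) : Set ℝ :=
  {s | ∃ x y, s = x - y ∧ Bad U R f p0 p1 q0 q1 x y}

theorem Ctx.closedB (h : Ctx S U R f X0 X1 Y0 Y1 p0 p1 q0 q1 a b) : IsClosed {z : ℝ × ℝ | Bad U R f p0 p1 q0 q1 z.1 z.2} := by
  rw [← isOpen_compl_iff, Metric.isOpen_iff]
  rintro ⟨x, y⟩ hz
  simp only [Set.mem_compl_iff, Set.mem_setOf_eq] at hz
  by_cases hP : p0 ≤ x ∧ x ≤ p1 ∧ q0 ≤ y ∧ y ≤ q1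
  · obtain ⟨ε, he, hg⟩ := near_good h.clo h.amb h.hX0 h.hX1 h.hY0 h.hY1 hP.1 hP.2.1 hP.2.2.1 hP.2.2.2
      (fun k => hz (Or.inl k)) (fun k => hz (Or.inr k))
    refine ⟨ε / 2, by linarith, ?_⟩
    rintro ⟨x', y'⟩ hb hbad
    rw [Metric.mem_ball, Prod.dist_eq, max_lt_iff, Real.dist_eq, Real.dist_eq, abs_lt, abs_lt] at hb
    simp only [Set.mem_setOf_eq] at hbad
    simp only at hb
    rcases hbad with hbad | hbad
    · obtain ⟨u, u', v, v', k1, k2, k3, k4, k5, k6, k7, k8, k9⟩ := hbad.2.2 (ε / 2) (by linarith)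
      have := hbad.1
      have := hbad.2.1
      exact k9 (hg _ _ _ _ (by linarith) k2 k3 k4 k5 (by linarith) (by linarith) (by linarith) (by linarith) (by linarith))
    · obtain ⟨u, u', v, v', k1, k2, k3, k4, k5, k6, k7, k8, k9⟩ := hbad.2.2 (ε / 2) (by linarith)
      have := hbad.1
      have := hbad.2.1
      rw [RQ.swap_iff h.clo] at k9
      exact k9 (hg _ _ _ _ (by linarith) k5 (by linarith) (by linarith) k2 (by linarith) (by linarith) (by linarith) (by linarith) (by linarith))
  · have : (Set.Icc p0 p1 ×ˢ Set.Icc q0 q1)ᶜ ∈ nhds (x, y) :=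
      (isClosed_Icc.prod isClosed_Icc).isOpen_compl.mem_nhds (fun hh => hP ⟨hh.1.1, hh.1.2, hh.2.1, hh.2.2⟩)
    obtain ⟨ε, he, hb⟩ := Metric.mem_nhds_iff.1 this
    exact ⟨ε, he, fun z hz hbad => hb hz (by
      have := Bad.mem hbad
      exact ⟨⟨this.1, this.2.1⟩, this.2.2⟩)⟩

theorem Ctx.compactK (h : Ctx S U R f X0 X1 Y0 Y1 p0 p1 q0 q1 a b) : IsCompact (KS U R f p0 p1 q0 q1) := by
  have h1 : IsCompact {z : ℝ × ℝ | Bad U R f p0 p1 q0 q1 z.1 z.2} := by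
    refine (isCompact_Icc.prod isCompact_Icc : IsCompact (Set.Icc p0 p1 ×ˢ Set.Icc q0 q1)).of_isClosed_subset h.closedB ?_
    intro z hz
    have := Bad.mem hz
    exact ⟨⟨this.1, this.2.1⟩, this.2.2⟩
  have h2 := h1.image (f := fun z : ℝ × ℝ => z.1 - z.2) (by fun_prop)
  convert h2 using 1
  ext s
  constructor
  · rintro ⟨x, y, rfl, hb⟩; exact ⟨(x, y), hb, rfl⟩
  · rintro ⟨⟨x, y⟩, hb, rfl⟩; exact ⟨x, y, rfl, hb⟩

/-- a right limit of `K` is `LRb` -/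
theorem Ctx.lr_of (h : Ctx S U R f X0 X1 Y0 Y1 p0 p1 q0 q1 a b) {x y : ℝ} (hz : Bad U R f p0 p1 q0 q1 x y)
    (hk : ∀ ε > 0, ∃ s ∈ KS U R f p0 p1 q0 q1, x - y < s ∧ s < x - y + ε) : LRb U R f p0 p1 q0 q1 x y := by
  obtain ⟨hm1, hm2, hm3, hm4⟩ := hz.mem
  -- strict points
  have key : ∀ ε > 0, ∃ x' y', x < x' ∧ x' < x + ε ∧ y' < y ∧ y - ε < y' ∧ Bad U R f p0 p1 q0 q1 x' y' := by
    intro ε he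
    obtain ⟨_, ⟨x1, y1, rfl, b1⟩, g1, g1'⟩ := hk ε he
    obtain ⟨_, ⟨x2, y2, rfl, b2⟩, g2, g2'⟩ := hk (x1 - y1 - (x - y)) (by linarith)
    obtain ⟨_, ⟨x3, y3, rfl, b3⟩, g3, g3'⟩ := hk (x2 - y2 - (x - y)) (by linarith)
    have a1 := h.anti hz b3 g3.le
    have a2 := h.anti b3 b2 (by linarith)
    have a3 := h.anti b2 b1 (by linarith)
    -- three points on a vertical line are impossible
    have vert : ¬ (x = x2 ∧ x3 = x2) := by
      rintro ⟨e1, e2⟩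
      have e3 : y2 < y3 := by linarith
      have e4 : y3 < y := by linarith
      subst e2
      subst e1
      rcases b3 with b3 | b3
      · rcases b2 with b2 | b2
        · exact e3.ne (h.lrlr b2 b3 le_rfl e3.le).2
        · exact h.ullr b2 b3 le_rfl e3
      · rcases hz with hz | hz
        · exact h.ullr b3 hz le_rfl e4
        · exact e4.ne (h.ulul b3 hz le_rfl e4.le).2
    have hori : ¬ (y = y2 ∧ y3 = y2) := by
      rintro ⟨e1, e2⟩
      have e3 : x3 < x2 := by linarith
      have e4 : x < x3 := by linarith
      subst e2
      subst e1
      rcases b3 with b3 | b3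
      · rcases hz with hz | hz
        · exact e4.ne (h.lrlr hz b3 e4.le le_rfl).1
        · rcases b2 with b2 | b2
          · exact e3.ne (h.lrlr b3 b2 e3.le le_rfl).1
          · exact h.lrul b3 b2 e3 le_rfl
      · rcases hz with hz | hz
        · exact h.lrul hz b3 e4 le_rfl
        · exact e4.ne (h.ulul hz b3 e4.le le_rfl).1
    refine ⟨x2, y2, ?_, by linarith, ?_, by linarith, b2⟩
    · refine lt_of_le_of_ne (by linarith) (fun e => vert ⟨e, ?_⟩); linarith
    · refine lt_of_le_of_ne (by linarith) (fun e => hori ⟨e.symm, ?_⟩); linarith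
  refine ⟨hm1, hm4, fun ε he => ?_⟩
  obtain ⟨x', y', k1, k2, k3, k4, k5⟩ := key ε he
  set δ := min (min (x' - x) (x + ε - x')) (min (y - y') (y' - (y - ε))) with hδ
  have d0 : 0 < δ := lt_min (lt_min (by linarith) (by linarith)) (lt_min (by linarith) (by linarith))
  have d1 : δ ≤ x' - x := (min_le_left _ _).trans (min_le_left _ _)
  have d2 : δ ≤ x + ε - x' := (min_le_left _ _).trans (min_le_right _ _)
  have d3 : δ ≤ y - y' := (min_le_right _ _).trans (min_le_left _ _)
  have d4 : δ ≤ y' - (y - ε) := (min_le_right _ _).trans (min_le_right _ _)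
  rcases k5 with k5 | k5
  · obtain ⟨u, u', v, v', l1, l2, l3, l4, l5, l6, l7, l8, l9⟩ := k5.2.2 δ d0
    exact ⟨u, u', v, v', by linarith, l2, l3, l4, l5, by linarith, by linarith, by linarith, l9⟩
  · obtain ⟨v, v', u, u', l1, l2, l3, l4, l5, l6, l7, l8, l9⟩ := k5.2.2 δ d0
    rw [RQ.swap_iff h.clo] at l9
    exact ⟨u, u', v, v', by linarith, l5, by linarith [k5.2.1], by linarith [k5.1], l2, by linarith, by linarith, by linarith, l9⟩

theorem KS_swap {s : ℝ} (h : s ∈ KS U R f p0 p1 q0 q1) : -s ∈ KS U R (swf f) q0 q1 p0 p1 := by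
  obtain ⟨x, y, rfl, hb⟩ := h
  exact ⟨y, x, by ring, hb.swap⟩

theorem Ctx.ul_of (h : Ctx S U R f X0 X1 Y0 Y1 p0 p1 q0 q1 a b) {x y : ℝ} (hz : Bad U R f p0 p1 q0 q1 x y)
    (hk : ∀ ε > 0, ∃ s ∈ KS U R f p0 p1 q0 q1, x - y - ε < s ∧ s < x - y) : ULb U R f p0 p1 q0 q1 x y := by
  refine h.swap.lr_of hz.swap (fun ε he => ?_)
  obtain ⟨s, h1, h2, h3⟩ := hk ε he
  exact ⟨-s, KS_swap h1, by linarith, by linarith⟩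

theorem Ctx.rlim (h : Ctx S U R f X0 X1 Y0 Y1 p0 p1 q0 q1 a b) {x y : ℝ} (hz : LRb U R f p0 p1 q0 q1 x y) :
    ∀ ε > 0, ∃ s ∈ KS U R f p0 p1 q0 q1, x - y < s ∧ s < x - y + ε := by
  intro ε he
  obtain ⟨x', y', k1, k2, k3, k4, k5⟩ := h.claim2 hz (ε / 2) (by linarith)
  exact ⟨_, ⟨x', y', rfl, k5⟩, by linarith, by linarith⟩

theorem Ctx.llim (h : Ctx S U R f X0 X1 Y0 Y1 p0 p1 q0 q1 a b) {x y : ℝ} (hz : ULb U R f p0 p1 q0 q1 x y) :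
    ∀ ε > 0, ∃ s ∈ KS U R f p0 p1 q0 q1, x - y - ε < s ∧ s < x - y := by
  intro ε he
  obtain ⟨s, h1, h2, h3⟩ := h.swap.rlim hz ε he
  exact ⟨-s, KS_swap h1, by linarith, by linarith⟩

/-- two-sided bad points -/
def TS (U : List T) (R : Tile T → Prop) (f : ℝ → ℝ → T) (p0 p1 q0 q1 x y : ℝ) : Prop :=
  LRb U R f p0 p1 q0 q1 x y ∧ ULb U R f p0 p1 q0 q1 x y

theorem TS.swap {x y : ℝ} (h : TS U R f p0 p1 q0 q1 x y) : TS U R (swf f) q0 q1 p0 p1 y x := ⟨h.2, h.1⟩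

theorem TS.inP {x y : ℝ} (h : TS U R f p0 p1 q0 q1 x y) : p0 < x ∧ x < p1 ∧ q0 < y ∧ y < q1 :=
  ⟨h.2.lt.2, h.1.lt.1, h.1.lt.2, h.2.lt.1⟩

theorem Ctx.ts_strict (h : Ctx S U R f X0 X1 Y0 Y1 p0 p1 q0 q1 a b) {x y x' y' : ℝ} (hz : Bad U R f p0 p1 q0 q1 x y)
    (hz' : TS U R f p0 p1 q0 q1 x' y') (hs : x - y < x' - y') : x < x' ∧ y' < y := by
  have h1 := h.anti hz (Or.inl hz'.1) hs.le
  refine ⟨lt_of_le_of_ne h1.1 (fun e => ?_), lt_of_le_of_ne h1.2 (fun e => ?_)⟩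
  · subst e
    rcases hz with hz | hz
    · have := h.lrlr hz'.1 hz le_rfl h1.2; linarith
    · have := h.ulul hz'.2 hz le_rfl h1.2; linarith
  · subst e
    rcases hz with hz | hz
    · have := h.lrlr hz hz'.1 h1.1 le_rfl; linarith
    · have := h.ulul hz hz'.2 h1.1 le_rfl; linarith

theorem Ctx.ts_near (h : Ctx S U R f X0 X1 Y0 Y1 p0 p1 q0 q1 a b) {x y : ℝ} (hz : LRb U R f p0 p1 q0 q1 x y) :
    ∀ ε > 0, ∃ x' y', TS U R f p0 p1 q0 q1 x' y' ∧ x < x' ∧ y' < y ∧ x' < x + ε ∧ y - ε < y' ∧ x' - y' < x - y + ε := by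
  intro ε he
  obtain ⟨s, hs, s1, s2⟩ := h.rlim hz ε he
  obtain ⟨_, ⟨x', y', rfl, hb⟩, k1, k2, k3, k4⟩ := two_sided h.compactK.isClosed (by
    rintro _ ⟨u, v, rfl, hb⟩ δ hδ
    rcases hb with hb | hb
    · obtain ⟨t, ht, t1, t2⟩ := h.rlim hb δ hδ
      exact ⟨t, ht, by linarith [t1] |> fun (_ : u - v < t) => (by linarith : u - v < t).ne', by rw [abs_lt]; constructor <;> linarith⟩
    · obtain ⟨t, ht, t1, t2⟩ := h.llim hb δ hδ
      exact ⟨t, ht, t2.ne, by rw [abs_lt]; constructor <;> linarith⟩) hs s1 s2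
  have hts : TS U R f p0 p1 q0 q1 x' y' := ⟨h.lr_of hb k3, h.ul_of hb k4⟩
  have := h.ts_strict (Or.inl hz) hts k1
  exact ⟨x', y', hts, this.1, this.2, by linarith, by linarith, k2⟩

end
end Temporal

namespace Temporal

variable {T : Type} {S : Sys T} {U : List T} {f : ℝ → ℝ → T} {X0 X1 Y0 Y1 : ℝ} {R : Tile T → Prop}

theorem Amb.dP (hA : Amb S U f X0 X1 Y0 Y1) {x0 x1 y0 y1 : ℝ} (a : X0 ≤ x0) (b : x1 ≤ X1) (c : Y0 ≤ y0) (d : y1 ≤ Y1)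
    {i : ℕ} (hi : i < S.N) {x y : ℝ} (h1 : x0 < x) (h2 : x ≤ x1) (h3 : y0 < y) (h4 : y ≤ y1) (hn : S.nP i (f x y)) :
    ∃ x' y', x0 ≤ x' ∧ x' ≤ x ∧ y0 ≤ y' ∧ y' ≤ y ∧ ¬ (x' = x ∧ y' = y) ∧
      (S.w i (f x' y') ∨ ((x' = x0 ∨ y' = y0) ∧ S.nP i (f x' y'))) := by
  obtain ⟨u, v, k1, k2, k3, k4, k5, k6⟩ := hA.demP x0 x1 y0 y1 a b c d i hi (-y) (-x) (by linarith) (by linarith)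
    (by linarith) (by linarith) (by simpa [flp, Sys.op] using hn)
  refine ⟨-v, -u, by linarith, by linarith, by linarith, by linarith, fun h => k5 ⟨by linarith [h.2], by linarith [h.1]⟩, ?_⟩
  rcases k6 with k | ⟨k, k'⟩
  · exact Or.inl k
  · refine Or.inr ⟨?_, k'⟩
    rcases k with k | k
    · right; linarith
    · left; linarith

theorem edge_core (hA : Amb S U f X0 X1 Y0 Y1) {x0 x1 y c d : ℝ} {b : T} (h0 : X0 ≤ x0) (h1 : x1 < c) (h2 : c ≤ X1)
    (h3 : Y0 ≤ y) (h4 : y < d) (h5 : d ≤ Y1)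
    (hb : ∀ u v, x0 ≤ u → u < c → y ≤ v → v < d → (y < v ∨ x1 < u) → f u v = b) {i : ℕ} (hi : i < S.N) {x : ℝ}
    (k0 : x0 ≤ x) (k1 : x ≤ x1) (hn : S.nF i (f x y)) :
    (∃ x', x < x' ∧ x' < x1 ∧ S.w i (f x' y)) ∨ (x < x1 ∧ S.w i (f x1 y)) ∨ S.gF i b := by
  obtain ⟨x', y', l1, l2, l3, l4, l5, l6⟩ := hA.demF x0 ((x1 + c) / 2) y ((y + d) / 2) h0 (by linarith) h3 (by linarith) i hi
    x y k0 (by linarith) le_rfl (by linarith) hn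
  by_cases hh : y < y' ∨ x1 < x'
  · right; right
    rw [← hb x' y' (by linarith) (by linarith) l3 (by linarith) hh]
    rcases l6 with l | ⟨_, l⟩
    · exact Or.inr l
    · exact Or.inl l
  · push Not at hh
    have ey : y' = y := le_antisymm hh.1 l3
    subst ey
    have hx : x < x' := lt_of_le_of_ne l1 (fun h => l5 ⟨h.symm, rfl⟩)
    have hw : S.w i (f x' y') := by
      rcases l6 with l | ⟨l | l, _⟩
      · exact l
      · linarith [hh.2]
      · linarith
    rcases hh.2.eq_or_lt with e | e
    · subst e
      exact Or.inr (Or.inl ⟨hx, hw⟩)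
    · exact Or.inl ⟨x', hx, e, hw⟩

theorem edgeT (hA : Amb S U f X0 X1 Y0 Y1) {x0 x1 y c d : ℝ} {b : T} (h0 : X0 ≤ x0) (h1 : x1 < c) (h2 : c ≤ X1)
    (h3 : Y0 ≤ y) (h4 : y < d) (h5 : d ≤ Y1)
    (hb : ∀ u v, x0 ≤ u → u < c → y ≤ v → v < d → (y < v ∨ x1 < u) → f u v = b) {w : Wd T}
    (hw : RdW (fun x => f x y) x0 x1 w) : EdgeF S b (f x0 y) w (f x1 y) := by
  have hlt : x0 < x1 := Reads.lt hw
  have core := fun i hi => @edge_core _ _ _ _ _ _ _ _ hA x0 x1 y c d b h0 h1 h2 h3 h4 h5 hb i hi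
  intro i hi
  refine ⟨LineF.complete (β := fun x => f x y) (fun x k1 k2 hn => ?_) hw (fun hn => ?_), fun hn => ?_⟩
  · rcases core i hi k1.le k2.le hn with k | k | k
    · exact Or.inl k
    · exact Or.inr (Or.inl k.2)
    · exact Or.inr (Or.inr k)
  · rcases core i hi le_rfl hlt.le hn with k | k | k
    · exact Or.inl k
    · exact Or.inr (Or.inl k.2)
    · exact Or.inr (Or.inr k)
  · rcases core i hi hlt.le le_rfl hn with ⟨x', k, k', _⟩ | k | k
    · linarith
    · linarith [k.1]
    · exact k

theorem edgeR (hA : Amb S U f X0 X1 Y0 Y1) {y0 y1 x c d : ℝ} {b : T} (h0 : Y0 ≤ y0) (h1 : y1 < d) (h2 : d ≤ Y1)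
    (h3 : X0 ≤ x) (h4 : x < c) (h5 : c ≤ X1)
    (hb : ∀ u v, y0 ≤ v → v < d → x ≤ u → u < c → (x < u ∨ y1 < v) → f u v = b) {w : Wd T}
    (hw : RdW (fun y => f x y) y0 y1 w) : EdgeF S b (f x y0) w (f x y1) :=
  edgeT (f := swf f) hA.swap h0 h1 h2 h3 h4 h5 (fun u v => hb v u) hw

theorem edgeL (hA : Amb S U f X0 X1 Y0 Y1) {y0 y1 x c d : ℝ} {a : T} (h0 : y1 ≤ Y1) (h1 : d < y0) (h2 : Y0 ≤ d)
    (h3 : x ≤ X1) (h4 : c < x) (h5 : X0 ≤ c)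
    (hb : ∀ u v, v ≤ y1 → d < v → u ≤ x → c < u → (u < x ∨ v < y0) → f u v = a) {w : Wd T}
    (hw : RdW (fun y => f x y) y0 y1 w) : EdgeF S.op a (f x y1) (revW w) (f x y0) := by
  have := edgeT (S := S.op) (f := flp f) hA.dual (x0 := -y1) (x1 := -y0) (y := -x) (c := -d) (d := -c) (b := a) (w := revW w)
    (by linarith) (by linarith) (by linarith) (by linarith) (by linarith) (by linarith)
    (fun u v k1 k2 k3 k4 k5 => hb (-v) (-u) (by linarith) (by linarith) (by linarith) (by linarith)
      (by rcases k5 with k | k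
          · left; linarith
          · right; linarith)) (by simpa [flp] using hw.rev)
  simpa [flp] using this

theorem edgeB (hA : Amb S U f X0 X1 Y0 Y1) {x0 x1 y c d : ℝ} {a : T} (h0 : x1 ≤ X1) (h1 : c < x0) (h2 : X0 ≤ c)
    (h3 : y ≤ Y1) (h4 : d < y) (h5 : Y0 ≤ d)
    (hb : ∀ u v, u ≤ x1 → c < u → v ≤ y → d < v → (v < y ∨ u < x0) → f u v = a) {w : Wd T}
    (hw : RdW (fun x => f x y) x0 x1 w) : EdgeF S.op a (f x1 y) (revW w) (f x0 y) :=
  edgeL (f := swf f) hA.swap h0 h1 h2 h3 h4 h5 (fun u v => hb v u) hw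

section
variable {p0 p1 q0 q1 : ℝ} {a b : T}

theorem Ctx.ptItem (h : Ctx S U R f X0 X1 Y0 Y1 p0 p1 q0 q1 a b) {x y : ℝ} (hz : TS U R f p0 p1 q0 q1 x y) :
    PtItem S a b (f x y) := by
  have := h.hX0; have := h.hX1; have := h.hY0; have := h.hY1
  obtain ⟨i1, i2, i3, i4⟩ := hz.inP
  refine ⟨h.ha _ _ i1 i2 i3 i4, h.hb _ _ i1 i2 i3 i4, h.amb.real _ _ (by linarith) (by linarith) (by linarith) (by linarith),
    fun i hi => ⟨fun hn => ?_, fun hn => ?_⟩⟩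
  · rcases edge_core h.amb (x0 := x) (x1 := x) (y := y) (c := p1) (d := q1) (b := b) (by linarith) i2 h.hX1 (by linarith) i4 h.hY1
      (fun u v k1 k2 k3 k4 k5 => by
        rcases k5 with k | k
        · exact h.ulb hz.2 k1 k2 k k4
        · exact h.lrb hz.1 k k2 k3 k4) hi le_rfl le_rfl hn with ⟨x', k, k', _⟩ | k | k
    · linarith
    · linarith [k.1]
    · exact k
  · rcases edge_core h.amb.dual (x0 := -y) (x1 := -y) (y := -x) (c := -q0) (d := -p0) (b := a) (by linarith) (by linarith)
      (by linarith) (by linarith) (by linarith) (by linarith)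
      (fun u v k1 k2 k3 k4 k5 => by
        rcases k5 with k | k
        · exact h.ula hz.2 (by linarith) (by linarith) (by linarith) (by linarith)
        · exact h.lra hz.1 (by linarith) (by linarith) (by linarith) (by linarith)) hi le_rfl le_rfl
        (by simpa [flp, Sys.op] using hn) with ⟨x', k, k', _⟩ | k | k
    · linarith
    · linarith [k.1]
    · exact k

theorem Ctx.gapH (h : Ctx S U R f X0 X1 Y0 Y1 p0 p1 q0 q1 a b) {W : List (Wd T)} (hW : ∀ w, CanW U w → w ∈ W)
    {xl xr y : ℝ} (hl : ULb U R f p0 p1 q0 q1 xl y) (hr : LRb U R f p0 p1 q0 q1 xr y) (hx : xl < xr)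
    (i1 : p0 < xl) (i2 : xr < p1) (i3 : q0 < y) (i4 : y < q1) : IsItem S W R a b (f xl y) (f xr y) := by
  have := h.hX0; have := h.hX1; have := h.hY0; have := h.hY1
  obtain ⟨w, c, hw⟩ := h.amb.canH (y := y) (x0 := xl) (x1 := xr) (by linarith) (by linarith) (by linarith) (by linarith) hx
  refine Or.inr (Or.inl ⟨w, hW w c, Chn.complete (β := fun x => f x y) (fun x x' k1 k2 k3 => ?_) hw, ?_, ?_, ?_, ?_, ?_, ?_, ?_⟩)
  · exact h.amb.le (by linarith) k2.le (by linarith) (by linarith) le_rfl (by linarith) (Or.inl k2)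
  · exact h.ha _ _ i1 (by linarith) i3 i4
  · exact h.hb _ _ (by linarith) i2 i3 i4
  · exact h.amb.real _ _ (by linarith) (by linarith) (by linarith) (by linarith)
  · exact h.amb.real _ _ (by linarith) (by linarith) (by linarith) (by linarith)
  · intro t ht
    obtain ⟨x, k1, k2, rfl⟩ := Reads.att hw ht
    exact h.amb.real _ _ (by linarith) (by linarith) (by linarith) (by linarith)
  · refine edgeT h.amb (c := p1) (d := q1) (by linarith) i2 h.hX1 (by linarith) i4 h.hY1 (fun u v k1 k2 k3 k4 k5 => ?_) hw
    rcases k5 with k | k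
    · exact h.ulb hl k1 k2 k k4
    · exact h.lrb hr k k2 k3 k4
  · refine edgeB h.amb (c := p0) (d := q0) (by linarith) i1 h.hX0 (by linarith) i3 h.hY0 (fun u v k1 k2 k3 k4 k5 => ?_) hw
    rcases k5 with k | k
    · exact h.lra hr k2 k1 k4 k
    · exact h.ula hl k2 k k4 k3

theorem Ctx.gap (h : Ctx S U R f X0 X1 Y0 Y1 p0 p1 q0 q1 a b) {W : List (Wd T)} (hW : ∀ w, CanW U w → w ∈ W)
    {xl xr yl yr : ℝ} (hl : ULb U R f p0 p1 q0 q1 xl yl) (hr : LRb U R f p0 p1 q0 q1 xr yr) (hs : xl - yl < xr - yr)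
    (hK : ∀ s ∈ KS U R f p0 p1 q0 q1, ¬ (xl - yl < s ∧ s < xr - yr))
    (i1 : p0 < xl) (i2 : xr < p1) (i3 : q0 < yr) (i4 : yl < q1) : IsItem S W R a b (f xl yr) (f xr yl) := by
  have g1 := h.hX0; have g2 := h.hX1; have g3 := h.hY0; have g4 := h.hY1
  obtain ⟨hx, hy⟩ := h.anti (Or.inr hl) (Or.inl hr) hs.le
  rcases hy.eq_or_lt with rfl | hy'
  · exact h.gapH hW hl hr (by linarith) i1 i2 i3 i4
  rcases hx.eq_or_lt with rfl | hx'
  · exact h.swap.gapH hW hr hl (by linarith) i3 i4 i1 i2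
  have hRQ : RQ U R f xl xr yr yl := by
    by_contra hn
    obtain ⟨x, y, k1, k2, k3, k4, k5, k6⟩ := h.bad_of i1.le i2.le i3.le i4.le hn
    have hk := hK (x - y) ⟨x, y, rfl, k6⟩
    rcases lt_or_ge (xl - yl) (x - y) with e | e
    · have e' : x - y = xr - yr := by
        rcases lt_or_ge (x - y) (xr - yr) with e' | e'
        · exact absurd ⟨e, e'⟩ hk
        · linarith
      obtain ⟨rfl, rfl⟩ := h.inj k6 (Or.inl hr) e'
      rcases k5 with k | k
      · exact absurd k.lt.1 (lt_irrefl _)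
      · obtain ⟨s, hs1, hs2, hs3⟩ := h.llim (LRb.mono k i3.le i4.le i1.le i2.le) _ (sub_pos.2 hs)
        exact hK s hs1 ⟨by linarith, hs3⟩
    · obtain ⟨rfl, rfl⟩ := h.inj k6 (Or.inr hl) (by linarith)
      rcases k5 with k | k
      · obtain ⟨s, hs1, hs2, hs3⟩ := h.rlim (LRb.mono k i1.le i2.le i3.le i4.le) _ (sub_pos.2 hs)
        exact hK s hs1 ⟨hs2, by linarith⟩
      · exact absurd (LRb.lt k).1 (lt_irrefl _)
  obtain ⟨wl, cl, rl⟩ := h.amb.canL (x := xl) (y0 := yr) (y1 := yl) (by linarith) (by linarith) (by linarith) (by linarith) hy'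
  obtain ⟨wr, cr, rr⟩ := h.amb.canL (x := xr) (y0 := yr) (y1 := yl) (by linarith) (by linarith) (by linarith) (by linarith) hy'
  obtain ⟨wb, cb, rb⟩ := h.amb.canH (y := yr) (x0 := xl) (x1 := xr) (by linarith) (by linarith) (by linarith) (by linarith) hx'
  obtain ⟨wt, ct, rt⟩ := h.amb.canH (y := yl) (x0 := xl) (x1 := xr) (by linarith) (by linarith) (by linarith) (by linarith) hx'
  have hmem : ∀ x y, p0 < x → x < p1 → q0 < y → y < q1 → f x y ∈ U ∧ S.rl (f x y) := fun x y k1 k2 k3 k4 =>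
    ⟨h.amb.mem _ _ (by linarith) (by linarith) (by linarith) (by linarith),
     h.amb.real _ _ (by linarith) (by linarith) (by linarith) (by linarith)⟩
  have m1 := hmem xl yr i1 (by linarith) i3 (by linarith)
  have m2 := hmem xr yr (by linarith) i2 i3 (by linarith)
  have m3 := hmem xl yl i1 (by linarith) (by linarith) i4
  have m4 := hmem xr yl (by linarith) i2 (by linarith) i4
  refine Or.inr (Or.inr ⟨Tile.mk' (f xl yr) (f xr yr) (f xl yl) (f xr yl) wl wr wb wt,
    ⟨hRQ _ ⟨hx', hy', rfl, rfl, rfl, rfl, rl, rr, rb, rt⟩ ⟨⟨m1.1, m2.1, m3.1, m4.1⟩, cl, cr, cb, ct⟩,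
      h.ha _ _ i1 (by linarith) i3 (by linarith), h.hb _ _ (by linarith) i2 (by linarith) i4, m1.2, m2.2, m3.2, m4.2,
      ?_, ?_, ?_, ?_, ?_, ?_, ?_, ?_⟩, rfl, rfl⟩)
  · intro t ht
    obtain ⟨y, k1, k2, rfl⟩ := Reads.att rl ht
    exact (hmem _ _ i1 (by linarith) (by linarith) (by linarith)).2
  · intro t ht
    obtain ⟨y, k1, k2, rfl⟩ := Reads.att rr ht
    exact (hmem _ _ (by linarith) i2 (by linarith) (by linarith)).2
  · intro t ht
    obtain ⟨y, k1, k2, rfl⟩ := Reads.att rb ht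
    exact (hmem _ _ (by linarith) (by linarith) i3 (by linarith)).2
  · intro t ht
    obtain ⟨y, k1, k2, rfl⟩ := Reads.att rt ht
    exact (hmem _ _ (by linarith) (by linarith) (by linarith) i4).2
  · refine edgeT h.amb (c := p1) (d := q1) (by linarith) i2 h.hX1 (by linarith) i4 h.hY1 (fun u v k1 k2 k3 k4 k5 => ?_) rt
    rcases k5 with k | k
    · exact h.ulb hl k1 k2 k k4
    · exact h.lrb hr k k2 (by linarith) k4
  · refine edgeR h.amb (c := p1) (d := q1) (by linarith) i4 h.hY1 (by linarith) i2 h.hX1 (fun u v k1 k2 k3 k4 k5 => ?_) rr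
    rcases k5 with k | k
    · exact h.lrb hr k k4 k1 k2
    · exact h.ulb hl (by linarith) k4 k k2
  · refine edgeL h.amb (c := p0) (d := q0) (by linarith) i3 h.hY0 (by linarith) i1 h.hX0 (fun u v k1 k2 k3 k4 k5 => ?_) rl
    rcases k5 with k | k
    · exact h.ula hl k4 k k2 k1
    · exact h.lra hr k4 (by linarith) k2 k
  · refine edgeB h.amb (c := p0) (d := q0) (by linarith) i1 h.hX0 (by linarith) i3 h.hY0 (fun u v k1 k2 k3 k4 k5 => ?_) rb
    rcases k5 with k | k
    · exact h.lra hr k2 k1 k4 k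
    · exact h.ula hl k2 k k4 (by linarith)

/-- either a two-sided point on the diagonal of `u`, or a gap of `K` around it -/
theorem Ctx.gap_or (h : Ctx S U R f X0 X1 Y0 Y1 p0 p1 q0 q1 a b) {sa sb s : ℝ} (ha : sa ∈ KS U R f p0 p1 q0 q1)
    (hb : sb ∈ KS U R f p0 p1 q0 q1) (h1 : sa ≤ s) (h2 : s ≤ sb)
    (ka : ∀ ε > 0, ∃ t ∈ KS U R f p0 p1 q0 q1, sa - ε < t ∧ t < sa)
    (kb : ∀ ε > 0, ∃ t ∈ KS U R f p0 p1 q0 q1, sb < t ∧ t < sb + ε) :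
    (∃ x y, TS U R f p0 p1 q0 q1 x y ∧ s = x - y) ∨
    ∃ l ∈ KS U R f p0 p1 q0 q1, ∃ r ∈ KS U R f p0 p1 q0 q1, sa ≤ l ∧ l ≤ s ∧ s ≤ r ∧ r ≤ sb ∧ l < r ∧
      ∀ t ∈ KS U R f p0 p1 q0 q1, ¬ (l < t ∧ t < r) := by
  have hc := h.compactK.isClosed
  have hsup : ∀ m, sa ≤ m → ∃ l ∈ KS U R f p0 p1 q0 q1, sa ≤ l ∧ l ≤ m ∧ ∀ t ∈ KS U R f p0 p1 q0 q1, t ≤ m → t ≤ l := by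
    intro m hm
    have := (isCompact_Icc (a := sa) (b := m)).inter_right hc
    obtain ⟨l, hl1, hl2⟩ := this.exists_isGreatest ⟨sa, ⟨le_rfl, hm⟩, ha⟩
    refine ⟨l, hl1.2, hl1.1.1, hl1.1.2, fun t ht1 ht2 => ?_⟩
    rcases le_total sa t with e | e
    · exact hl2 ⟨⟨e, ht2⟩, ht1⟩
    · exact e.trans hl1.1.1
  have hinf : ∀ m, m ≤ sb → ∃ l ∈ KS U R f p0 p1 q0 q1, l ≤ sb ∧ m ≤ l ∧ ∀ t ∈ KS U R f p0 p1 q0 q1, m ≤ t → l ≤ t := by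
    intro m hm
    have := (isCompact_Icc (a := m) (b := sb)).inter_right hc
    obtain ⟨l, hl1, hl2⟩ := this.exists_isLeast ⟨sb, ⟨hm, le_rfl⟩, hb⟩
    refine ⟨l, hl1.2, hl1.1.2, hl1.1.1, fun t ht1 ht2 => ?_⟩
    rcases le_total t sb with e | e
    · exact hl2 ⟨⟨ht2, e⟩, ht1⟩
    · exact hl1.1.2.trans e
  by_cases hs : s ∈ KS U R f p0 p1 q0 q1
  · by_cases c1 : ∀ ε > 0, ∃ t ∈ KS U R f p0 p1 q0 q1, s < t ∧ t < s + ε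
    · by_cases c2 : ∀ ε > 0, ∃ t ∈ KS U R f p0 p1 q0 q1, s - ε < t ∧ t < s
      · left
        obtain ⟨x, y, rfl, hz⟩ := hs
        exact ⟨x, y, ⟨h.lr_of hz c1, h.ul_of hz c2⟩, rfl⟩
      · right
        have hlt : sa < s := lt_of_le_of_ne h1 (by rintro rfl; exact c2 ka)
        push Not at c2
        obtain ⟨ε, he, c2⟩ := c2
        have hgap : ∀ t ∈ KS U R f p0 p1 q0 q1, t < s → t ≤ s - ε := fun t ht h3 => by
          by_contra h4
          exact absurd h3 (not_lt.2 (c2 t ht (not_le.1 h4)))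
        obtain ⟨l, l1, l2, l3, l4⟩ := hsup (s - ε) (hgap sa ha hlt)
        exact ⟨l, l1, s, hs, l2, by linarith, le_rfl, h2, by linarith, fun t ht k => by
          linarith [l4 t ht (hgap t ht k.2), k.1]⟩
    · right
      have hlt : s < sb := lt_of_le_of_ne h2 (by rintro rfl; exact c1 kb)
      push Not at c1
      obtain ⟨ε, he, c2⟩ := c1
      obtain ⟨r, l1, l2, l3, l4⟩ := hinf (s + ε) (c2 sb hb hlt)
      exact ⟨s, hs, r, l1, h1, le_rfl, by linarith, l2, by linarith, fun t ht k => by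
        linarith [l4 t ht (c2 t ht k.1), k.2]⟩
  · right
    obtain ⟨l, l1, l2, l3, l4⟩ := hsup s h1
    obtain ⟨r, r1, r2, r3, r4⟩ := hinf s h2
    have e1 : l < s := lt_of_le_of_ne l3 (by rintro rfl; exact hs l1)
    have e2 : s < r := lt_of_le_of_ne r3 (by rintro rfl; exact hs r1)
    refine ⟨l, l1, r, r1, l2, l3, r3, r2, by linarith, fun t ht k => ?_⟩
    rcases le_total t s with e | e
    · linarith [l4 t ht e, k.1]
    · linarith [r4 t ht e, k.2]

theorem Ctx.find (h : Ctx S U R f X0 X1 Y0 Y1 p0 p1 q0 q1 a b) {W : List (Wd T)} (hW : ∀ w, CanW U w → w ∈ W)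
    {xa ya xb yb u v : ℝ} (hza : TS U R f p0 p1 q0 q1 xa ya) (hzb : TS U R f p0 p1 q0 q1 xb yb)
    (h1 : xa ≤ u) (h2 : u ≤ xb) (h3 : yb ≤ v) (h4 : v ≤ ya) :
    f u v = a ∨ f u v = b ∨ ∃ p ∈ U, ∃ q ∈ U, IsItem S W R a b p q ∧ (p = f u v ∨ S.le p (f u v) ∧ S.rl p) ∧
      (q = f u v ∨ S.le (f u v) q ∧ S.rl q) := by
  have g1 := h.hX0; have g2 := h.hX1; have g3 := h.hY0; have g4 := h.hY1
  obtain ⟨a1, a2, a3, a4⟩ := hza.inP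
  obtain ⟨b1, b2, b3, b4⟩ := hzb.inP
  have hmem : ∀ x y, p0 < x → x < p1 → q0 < y → y < q1 → f x y ∈ U ∧ S.rl (f x y) := fun x y k1 k2 k3 k4 =>
    ⟨h.amb.mem _ _ (by linarith) (by linarith) (by linarith) (by linarith),
     h.amb.real _ _ (by linarith) (by linarith) (by linarith) (by linarith)⟩
  rcases h.gap_or (s := u - v) ⟨xa, ya, rfl, Or.inl hza.1⟩ ⟨xb, yb, rfl, Or.inl hzb.1⟩ (by linarith) (by linarith)
    (h.llim hza.2) (h.rlim hzb.1) with ⟨x, y, hz, e⟩ | ⟨l, ⟨xl, yl, rfl, hl⟩, r, ⟨xr, yr, rfl, hr⟩, k1, k2, k3, k4, k5, k6⟩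
  · obtain ⟨c1, c2, c3, c4⟩ := hz.inP
    rcases lt_trichotomy u x with e1 | e1 | e1
    · left; exact h.lra hz.1 (by linarith) e1.le (by linarith) (by linarith)
    · have : v = y := by linarith
      subst e1 this
      exact Or.inr (Or.inr ⟨_, (hmem _ _ c1 c2 c3 c4).1, _, (hmem _ _ c1 c2 c3 c4).1, Or.inl ⟨rfl, h.ptItem hz⟩, Or.inl rfl, Or.inl rfl⟩)
    · right; left; exact h.lrb hz.1 e1 (by linarith) (by linarith) (by linarith)
  · have hl' : ULb U R f p0 p1 q0 q1 xl yl := by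
      rcases hl with hl | hl
      · obtain ⟨s, s1, s2, s3⟩ := h.rlim hl _ (sub_pos.2 k5)
        exact absurd ⟨s2, by linarith⟩ (k6 s s1)
      · exact hl
    have hr' : LRb U R f p0 p1 q0 q1 xr yr := by
      rcases hr with hr | hr
      · exact hr
      · obtain ⟨s, s1, s2, s3⟩ := h.llim hr _ (sub_pos.2 k5)
        exact absurd ⟨by linarith, s3⟩ (k6 s s1)
    obtain ⟨m1, m2⟩ := h.anti (Or.inl hza.1) hl k1
    obtain ⟨m3, m4⟩ := h.anti hr (Or.inl hzb.1) k4
    obtain ⟨m5, m6⟩ := h.anti hl hr k5.le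
    rcases lt_or_ge u xl with e1 | e1
    · left; exact h.ula hl' (by linarith) e1 (by linarith) (by linarith)
    rcases lt_or_ge xr u with e2 | e2
    · right; left; exact h.lrb hr' e2 (by linarith) (by linarith) (by linarith)
    rcases lt_or_ge v yr with e3 | e3
    · left; exact h.lra hr' (by linarith) (by linarith) (by linarith) e3
    rcases lt_or_ge yl v with e4 | e4
    · right; left; exact h.ulb hl' (by linarith) (by linarith) e4 (by linarith)
    have n1 := hmem xl yr (by linarith) (by linarith) (by linarith) (by linarith)
    have n2 := hmem xr yl (by linarith) (by linarith) (by linarith) (by linarith)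
    refine Or.inr (Or.inr ⟨_, n1.1, _, n2.1, h.gap hW hl' hr' k5 k6 (by linarith) (by linarith) (by linarith) (by linarith), ?_, ?_⟩)
    · by_cases hh : xl < u ∨ yr < v
      · exact Or.inr ⟨h.amb.le (by linarith) e1 (by linarith) (by linarith) e3 (by linarith) hh, n1.2⟩
      · push Not at hh
        rw [le_antisymm hh.1 e1, le_antisymm hh.2 e3]; exact Or.inl rfl
    · by_cases hh : u < xr ∨ v < yl
      · exact Or.inr ⟨h.amb.le (by linarith) e2 (by linarith) (by linarith) e4 (by linarith) hh, n2.2⟩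
      · push Not at hh
        rw [le_antisymm e2 hh.1, le_antisymm e4 hh.2]; exact Or.inl rfl

theorem Ctx.shuf (h : Ctx S U R f X0 X1 Y0 Y1 p0 p1 q0 q1 a b) {xa ya xb yb : ℝ} (hza : TS U R f p0 p1 q0 q1 xa ya)
    (hzb : TS U R f p0 p1 q0 q1 xb yb) (hx : xa < xb) (hy : yb < ya) : RQ U R f xa xb yb ya := by
  obtain ⟨W, hW, hR⟩ := h.clo
  have g1 := h.hX0; have g2 := h.hX1; have g3 := h.hY0; have g4 := h.hY1
  obtain ⟨a1, a2, a3, a4⟩ := hza.inP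
  obtain ⟨b1, b2, b3, b4⟩ := hzb.inP
  intro τ ht hc
  refine hR τ hc (Or.inr (Or.inr (Or.inr (Or.inr ?_))))
  have hmem : ∀ x y, p0 < x → x < p1 → q0 < y → y < q1 → f x y ∈ U ∧ S.rl (f x y) := fun x y k1 k2 k3 k4 =>
    ⟨h.amb.mem _ _ (by linarith) (by linarith) (by linarith) (by linarith),
     h.amb.real _ _ (by linarith) (by linarith) (by linarith) (by linarith)⟩
  have L : ∀ v, yb ≤ v → v < ya → f xa v = a := fun v k1 k2 => h.lra hza.1 a1 le_rfl (by linarith) k2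
  have B : ∀ u, xa ≤ u → u < xb → f u yb = a := fun u k1 k2 => h.ula hzb.2 (by linarith) k2 b3 le_rfl
  have Tp : ∀ u, xa < u → u ≤ xb → f u ya = b := fun u k1 k2 => h.lrb hza.1 k1 (by linarith) le_rfl a4
  have Rt : ∀ v, yb < v → v ≤ ya → f xb v = b := fun v k1 k2 => h.ulb hzb.2 le_rfl b2 k1 (by linarith)
  have ll : τ.ll = a := by rw [← ht.ll]; exact L _ le_rfl hy
  have ur : τ.ur = b := by rw [← ht.ur]; exact Tp _ hx le_rfl
  have le := fun {x x' y y'} k1 k2 k3 k4 k5 k6 k7 => h.amb.le (x := x) (x' := x') (y := y) (y' := y') (g1.trans (le_of_lt k1)) k2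
    ((le_of_lt k3).trans g2) (g3.trans (le_of_lt k4)) k5 ((le_of_lt k6).trans g4) k7
  refine ⟨?_, ?_, ?_, ?_, ?_, ?_, ?_, ?_, ?_, ?_, ?_, ?_, ?_, ?_, ?_⟩
  · rw [ll]; exact CanW.const ht.wl hc.2.1 (fun y k1 k2 => L y k1.le k2)
  · rw [ll]; exact CanW.const ht.wb hc.2.2.2.1 (fun y k1 k2 => B y k1.le k2)
  · rw [ur]; exact CanW.const ht.wt hc.2.2.2.2 (fun y k1 k2 => Tp y k1 k2.le)
  · rw [ur]; exact CanW.const ht.wr hc.2.2.1 (fun y k1 k2 => Rt y k1 k2.le)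
  · rw [← ht.ll]; exact (hmem _ _ a1 a2 b3 b4).2
  · rw [← ht.ur]; exact (hmem _ _ b1 b2 a3 a4).2
  · have := le a1 le_rfl a2 b3 (show yb ≤ (yb + ya) / 2 by linarith) (by linarith) (Or.inr (by linarith))
    rw [L _ le_rfl hy, L _ (by linarith) (by linarith)] at this
    rw [ll]; exact this
  · have := le b1 le_rfl b2 (by linarith) (show (yb + ya) / 2 ≤ ya by linarith) a4 (Or.inr (by linarith))
    rw [Rt _ hy le_rfl, Rt _ (by linarith) (by linarith)] at this
    rw [ur]; exact this
  · rw [← ht.ll, ← ht.ur]; exact le a1 hx.le b2 b3 hy.le a4 (Or.inl hx)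
  · rw [← ht.ll, ← ht.ul]; exact le a1 le_rfl a2 b3 hy.le a4 (Or.inr hy)
  · rw [← ht.ll, ← ht.lr]; exact le a1 hx.le b2 b3 le_rfl b4 (Or.inl hx)
  · rw [← ht.ul, ← ht.ur]; exact le a1 hx.le b2 a3 le_rfl a4 (Or.inl hx)
  · rw [← ht.lr, ← ht.ur]; exact le b1 le_rfl b2 b3 hy.le a4 (Or.inr hy)
  · exact ⟨f xa ya, (hmem _ _ a1 a2 a3 a4).1, by rw [ll, ur]; exact h.ptItem hza⟩
  · rw [ll, ur]
    have ma := (hmem _ _ a1 a2 a3 a4).1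
    have mb := (hmem _ _ b1 b2 b3 b4).1
    refine fun i hi => ⟨fun hn => ?_, fun hn => ?_⟩
    · rw [← ll, ← ht.ll] at hn
      obtain ⟨x', y', k1, k2, k3, k4, k5, k6⟩ := h.amb.demF xa xb yb ya (by linarith) (by linarith) (by linarith) (by linarith)
        i hi xa yb le_rfl hx le_rfl hy hn
      rcases k6 with k | ⟨k | k, k'⟩
      · rcases h.find hW hza hzb k1 k2 k3 k4 with e | e | ⟨p, hp, q, hq, e1, e2, e3⟩
        · left; rw [← e]; exact k
        · right; left; rw [← e]; exact Or.inr k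
        · refine Or.inr (Or.inr ⟨p, hp, q, hq, e1, ?_⟩)
          rcases e2 with rfl | e2
          · exact Or.inr k
          · exact Or.inl (h.amb.law.axF i _ _ hi e2.2 e2.1 (Or.inr k))
      · subst k
        rcases k3.eq_or_lt with rfl | k3
        · exact Or.inr (Or.inr ⟨_, mb, _, mb, Or.inl ⟨rfl, h.ptItem hzb⟩, Or.inl k'⟩)
        · rw [Rt _ k3 k4] at k'
          exact Or.inr (Or.inl (Or.inl k'))
      · subst k
        rcases k1.eq_or_lt with rfl | k1
        · exact Or.inr (Or.inr ⟨_, ma, _, ma, Or.inl ⟨rfl, h.ptItem hza⟩, Or.inl k'⟩)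
        · rw [Tp _ k1 k2] at k'
          exact Or.inr (Or.inl (Or.inl k'))
    · rw [← ur, ← ht.ur] at hn
      obtain ⟨x', y', k1, k2, k3, k4, k5, k6⟩ := h.amb.dP (x0 := xa) (x1 := xb) (y0 := yb) (y1 := ya) (by linarith) (by linarith)
        (by linarith) (by linarith) hi hx le_rfl hy le_rfl hn
      rcases k6 with k | ⟨k | k, k'⟩
      · rcases h.find hW hza hzb k1 k2 k3 k4 with e | e | ⟨p, hp, q, hq, e1, e2, e3⟩
        · right; left; rw [← e]; exact Or.inr k
        · left; rw [← e]; exact k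
        · refine Or.inr (Or.inr ⟨p, hp, q, hq, e1, ?_⟩)
          rcases e3 with rfl | e3
          · exact Or.inr k
          · exact Or.inl (h.amb.law.axP i _ _ hi e3.2 e3.1 (Or.inr k))
      · subst k
        rcases k4.eq_or_lt with rfl | k4
        · exact Or.inr (Or.inr ⟨_, ma, _, ma, Or.inl ⟨rfl, h.ptItem hza⟩, Or.inl k'⟩)
        · rw [L _ k3 k4] at k'
          exact Or.inr (Or.inl (Or.inl k'))
      · subst k
        rcases k2.eq_or_lt with rfl | k2
        · exact Or.inr (Or.inr ⟨_, mb, _, mb, Or.inl ⟨rfl, h.ptItem hzb⟩, Or.inl k'⟩)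
        · rw [B _ k1 k2] at k'
          exact Or.inr (Or.inl (Or.inl k'))

end

end Temporal

namespace Temporal

variable {T : Type} {S : Sys T} {U : List T} {f : ℝ → ℝ → T} {X0 X1 Y0 Y1 : ℝ} {R : Tile T → Prop}

section
variable {p0 p1 q0 q1 : ℝ} {a b : T}

theorem Ctx.glueTS (h : Ctx S U R f X0 X1 Y0 Y1 p0 p1 q0 q1 a b) {x y x' y' mx my : ℝ} (hm : TS U R f p0 p1 q0 q1 mx my)
    (h1 : p0 ≤ x) (h2 : x ≤ mx) (h3 : mx ≤ x') (h4 : x' ≤ p1) (h5 : q0 ≤ y') (h6 : y' ≤ my) (h7 : my ≤ y) (h8 : y ≤ q1)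
    (k1 : RQ U R f x mx my y) (k2 : RQ U R f mx x' y' my) : RQ U R f x x' y' y := by
  have g1 := h.hX0; have g2 := h.hX1; have g3 := h.hY0; have g4 := h.hY1
  have c1 : RQ U R f x mx y' my := RQ.triv h.clo h.amb (by linarith) (by linarith) (by linarith) (by linarith) (c := a)
    (fun u v e1 e2 e3 e4 => h.lra hm.1 (by linarith) e2.le (by linarith) e4)
  have c2 : RQ U R f mx x' my y := RQ.triv h.clo h.amb (by linarith) (by linarith) (by linarith) (by linarith) (c := b)
    (fun u v e1 e2 e3 e4 => h.lrb hm.1 e1 (by linarith) e3.le (by linarith))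
  exact RQ.glueV h.clo h.amb (RQ.glueH h.clo h.amb c1 k1 (by linarith) h6 h7 (by linarith) (by linarith) (by linarith))
    (RQ.glueH h.clo h.amb k2 c2 (by linarith) h6 h7 (by linarith) (by linarith) (by linarith))
    (by linarith) h2 h3 (by linarith) (by linarith) (by linarith)

theorem Ctx.loopz (h : Ctx S U R f X0 X1 Y0 Y1 p0 p1 q0 q1 a b) {x y : ℝ} (hz : LRb U R f p0 p1 q0 q1 x y) :
    ∀ ε > 0, ∃ mx my, TS U R f p0 p1 q0 q1 mx my ∧ x < mx ∧ my < y ∧ mx < x + ε ∧ y - ε < my ∧ RQ U R f x mx my y := by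
  have g1 := h.hX0; have g2 := h.hX1; have g3 := h.hY0; have g4 := h.hY1
  have i1 := hz.1; have i2 := hz.2.1
  intro ε he
  obtain ⟨m, ⟨m1, m2, m3⟩, m4, m5, m6⟩ := loop_lemma h.clo h.amb (x := x) (y := y)
    {m : ℝ × ℝ | TS U R f p0 p1 q0 q1 m.1 m.2 ∧ x < m.1 ∧ m.2 < y} (by linarith) (by linarith)
    (fun m hm => by
      obtain ⟨a1, a2, a3, a4⟩ := hm.1.inP
      exact ⟨hm.2.1, by linarith, by linarith, hm.2.2⟩)
    (fun ε he => by
      obtain ⟨x', y', k1, k2, k3, k4, k5, k6⟩ := h.ts_near hz ε he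
      exact ⟨(x', y'), ⟨k1, k2, k3⟩, k4, k5⟩)
    (fun m hm m' hm' h1 h2 => by
      obtain ⟨a1, a2, a3, a4⟩ := hm.1.inP
      obtain ⟨b1, b2, b3, b4⟩ := hm'.1.inP
      refine ⟨RQ.triv h.clo h.amb (by linarith) (by linarith) (by linarith) (by linarith) (c := a)
          (fun u v e1 e2 e3 e4 => h.lra hm'.1.1 (by linarith) e2.le (by linarith) e4),
        RQ.triv h.clo h.amb (by linarith) (by linarith) (by linarith) (by linarith) (c := b)
          (fun u v e1 e2 e3 e4 => h.lrb hm'.1.1 e1 (by linarith) e3.le (by linarith)), h.shuf hm'.1 hm.1 h1 h2⟩) ε he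
  exact ⟨m.1, m.2, m1, m2, m3, m4, m5, m6⟩

theorem Ctx.rq (h : Ctx S U R f X0 X1 Y0 Y1 p0 p1 q0 q1 a b) (hp : p0 ≤ p1) (hq : q0 ≤ q1) : RQ U R f p0 p1 q0 q1 := by
  have g1 := h.hX0; have g2 := h.hX1; have g3 := h.hY0; have g4 := h.hY1
  by_contra hn
  obtain ⟨x, y, -, -, -, -, -, hbad⟩ := h.bad_of le_rfl le_rfl le_rfl le_rfl hn
  have hne : (KS U R f p0 p1 q0 q1).Nonempty := ⟨_, x, y, rfl, hbad⟩
  obtain ⟨s1, ⟨x1, y1, rfl, hz1⟩, hmin⟩ := h.compactK.exists_isLeast hne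
  obtain ⟨s2, ⟨x2, y2, rfl, hz2⟩, hmax⟩ := h.compactK.exists_isGreatest hne
  have nu1 : ¬ ULb U R f p0 p1 q0 q1 x1 y1 := fun hu => by
    obtain ⟨s, k1, k2, k3⟩ := h.llim hu 1 one_pos
    linarith [hmin k1]
  have nl2 : ¬ LRb U R f p0 p1 q0 q1 x2 y2 := fun hu => by
    obtain ⟨s, k1, k2, k3⟩ := h.rlim hu 1 one_pos
    linarith [hmax k1]
  have l1 : LRb U R f p0 p1 q0 q1 x1 y1 := hz1.resolve_right nu1
  have u2 : ULb U R f p0 p1 q0 q1 x2 y2 := hz2.resolve_left nl2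
  have hs : x1 - y1 < x2 - y2 := by
    obtain ⟨s, k1, k2, k3⟩ := h.rlim l1 1 one_pos
    linarith [hmax k1]
  obtain ⟨hx, hy⟩ := h.anti hz1 hz2 hs.le
  obtain ⟨i1, i2, i3, i4⟩ := hz1.mem
  obtain ⟨j1, j2, j3, j4⟩ := hz2.mem
  have hmn : ∀ x y, Bad U R f p0 p1 q0 q1 x y → x1 ≤ x ∧ y ≤ y1 ∧ x ≤ x2 ∧ y2 ≤ y := fun x y hb => by
    obtain ⟨e1, e2⟩ := h.anti hz1 hb (hmin ⟨x, y, rfl, hb⟩)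
    obtain ⟨e3, e4⟩ := h.anti hb hz2 (hmax ⟨x, y, rfl, hb⟩)
    exact ⟨e1, e2, e3, e4⟩
  -- strips
  have c1 : RQ U R f p0 x1 q0 q1 := by
    by_contra hn
    obtain ⟨x, y, k1, k2, k3, k4, k5, k6⟩ := h.bad_of le_rfl i2 le_rfl le_rfl hn
    obtain ⟨e1, e2, e3, e4⟩ := hmn x y k6
    obtain rfl : x = x1 := le_antisymm k2 e1
    rcases k5 with k | k
    · exact lt_irrefl _ k.lt.1
    · have k' : ULb U R f p0 p1 q0 q1 x y := LRb.mono k le_rfl le_rfl le_rfl i2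
      rcases e2.eq_or_lt with rfl | e
      · exact nu1 k'
      · exact h.ullr k' l1 le_rfl e
  have c2 : RQ U R f x2 p1 q0 q1 := by
    by_contra hn
    obtain ⟨x, y, k1, k2, k3, k4, k5, k6⟩ := h.bad_of j1 le_rfl le_rfl le_rfl hn
    obtain ⟨e1, e2, e3, e4⟩ := hmn x y k6
    obtain rfl : x = x2 := le_antisymm e3 k1
    rcases k5 with k | k
    · have k' : LRb U R f p0 p1 q0 q1 x y := LRb.mono k j1 le_rfl le_rfl le_rfl
      rcases e4.eq_or_lt with rfl | e
      · exact nl2 k'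
      · exact h.ullr u2 k' le_rfl e
    · exact lt_irrefl _ (LRb.lt k).2
  have c3 : RQ U R f x1 x2 q0 y2 := by
    by_contra hn
    obtain ⟨x, y, k1, k2, k3, k4, k5, k6⟩ := h.bad_of i1 j2 le_rfl j4 hn
    obtain ⟨e1, e2, e3, e4⟩ := hmn x y k6
    obtain rfl : y = y2 := le_antisymm k4 e4
    rcases k5 with k | k
    · have k' : LRb U R f p0 p1 q0 q1 x y := LRb.mono k i1 j2 le_rfl j4
      rcases e3.eq_or_lt with rfl | e
      · exact nl2 k'
      · exact h.lrul k' u2 e le_rfl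
    · exact lt_irrefl _ (LRb.lt k).1
  have c4 : RQ U R f x1 x2 y1 q1 := by
    by_contra hn
    obtain ⟨x, y, k1, k2, k3, k4, k5, k6⟩ := h.bad_of i1 j2 i3 le_rfl hn
    obtain ⟨e1, e2, e3, e4⟩ := hmn x y k6
    obtain rfl : y = y1 := le_antisymm e2 k3
    rcases k5 with k | k
    · exact lt_irrefl _ k.lt.2
    · have k' : ULb U R f p0 p1 q0 q1 x y := LRb.mono k i3 le_rfl i1 j2
      rcases e1.eq_or_lt with rfl | e
      · exact nu1 k'
      · exact h.lrul l1 k' e le_rfl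
  have he : 0 < (x2 - y2 - (x1 - y1)) / 4 := by linarith
  obtain ⟨mx, my, t1, t2, t3, t4, t5, t6⟩ := h.loopz l1 _ he
  obtain ⟨ny, nx, r1, r2, r3, r4, r5, r6⟩ := h.swap.loopz u2 _ he
  have r1' : TS U R f p0 p1 q0 q1 nx ny := r1.swap
  have r6' : RQ U R f nx x2 y2 ny := (RQ.swap_iff h.clo).1 r6
  obtain ⟨w1, w2⟩ := h.ts_strict (Or.inl t1.1) r1' (by linarith)
  have c5 : RQ U R f x1 nx ny y1 := h.glueTS t1 i1 t2.le w1.le (by linarith) (by linarith) w2.le t3.le i4 t6 (h.shuf t1 r1' w1 w2)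
  have c6 : RQ U R f x1 x2 y2 y1 := h.glueTS r1' i1 (by linarith) r3.le j2 j3 r2.le (by linarith) i4 c5 r6'
  have c7 : RQ U R f x1 x2 q0 y1 := RQ.glueH h.clo h.amb c3 c6 (by linarith) j3 hy (by linarith) (by linarith) (by linarith)
  have c8 : RQ U R f x1 x2 q0 q1 := RQ.glueH h.clo h.amb c7 c4 (by linarith) i3 i4 (by linarith) (by linarith) (by linarith)
  have c9 : RQ U R f p0 x2 q0 q1 := RQ.glueV h.clo h.amb c1 c8 (by linarith) i1 hx (by linarith) (by linarith) (by linarith)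
  exact hn (RQ.glueV h.clo h.amb c9 c2 (by linarith) j1 j2 (by linarith) (by linarith) (by linarith))
end

theorem Amb.leA (hA : Amb S U f X0 X1 Y0 Y1) {u v : ℝ} (h1 : X0 ≤ u) (h2 : u < X1) (h3 : Y0 ≤ v) (h4 : v < Y1) :
    ∃ a ∈ U, (∀ x y, u < x → x ≤ X1 → v < y → y ≤ Y1 → S.le a (f x y)) ∧
      ∀ ε > 0, ∃ x y, u < x ∧ x < u + ε ∧ v < y ∧ y < v + ε ∧ f x y = a := by
  obtain ⟨δ, d0, d1, d2, e, he⟩ := hA.germ h1 h2 h3 h4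
  refine ⟨e, ?_, fun x y k1 k2 k3 k4 => ?_, fun ε h => ?_⟩
  · rw [← he (u + δ / 2) (v + δ / 2) (by linarith) (by linarith) (by linarith) (by linarith)]
    exact hA.mem _ _ (by linarith) (by linarith) (by linarith) (by linarith)
  · obtain ⟨x', a1, a2⟩ := exists_between (lt_min k1 (show u < u + δ by linarith))
    obtain ⟨y', b1, b2⟩ := exists_between (lt_min k3 (show v < v + δ by linarith))
    rw [lt_min_iff] at a2 b2
    rw [← he x' y' a1 a2.2 b1 b2.2]
    exact hA.le (by linarith) a2.1.le k2 (by linarith) b2.1.le k4 (Or.inl a2.1)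
  · have m1 := min_le_left δ ε
    have m2 := min_le_right δ ε
    have m3 : 0 < min δ ε := lt_min d0 h
    exact ⟨u + min δ ε / 2, v + min δ ε / 2, by linarith, by linarith, by linarith, by linarith,
      he _ _ (by linarith) (by linarith) (by linarith) (by linarith)⟩

theorem Amb.sub (hA : Amb S U f X0 X1 Y0 Y1) {u u' v v' : ℝ} (h1 : X0 ≤ u) (h2 : u' ≤ X1) (h3 : Y0 ≤ v) (h4 : v' ≤ Y1) :
    Amb S U f u u' v v' :=
  ⟨hA.law, hA.anti, fun x y a b c d => hA.mem x y (by linarith) (by linarith) (by linarith) (by linarith),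
    fun x x' y a b c d e => hA.cohH x x' y (by linarith) b (by linarith) (by linarith) (by linarith),
    fun x x' y a b c d e => hA.cohV x x' y (by linarith) b (by linarith) (by linarith) (by linarith),
    fun x y a b c d => hA.real x y (by linarith) (by linarith) (by linarith) (by linarith),
    fun x0 x1 y0 y1 a b c d => hA.demF _ _ _ _ (by linarith) (by linarith) (by linarith) (by linarith),
    fun x0 x1 y0 y1 a b c d => hA.demP _ _ _ _ (by linarith) (by linarith) (by linarith) (by linarith)⟩

/-- Completeness of the rectangle rules. -/
theorem RC (hR : Clo S U R) (hA : Amb S U f X0 X1 Y0 Y1) : ∀ n : ℕ, ∀ u u' v v', X0 ≤ u → u' ≤ X1 → Y0 ≤ v → v' ≤ Y1 →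
    {t | ∃ x y, u < x ∧ x < u' ∧ v < y ∧ y < v' ∧ f x y = t}.ncard ≤ n → RQ U R f u u' v v' := by
  intro n
  induction n using Nat.strong_induction_on with
  | _ n ih =>
    intro u u' v v' h1 h2 h3 h4 hn
    rcases le_or_gt u' u with e | e
    · exact RQ.degenX e
    rcases le_or_gt v' v with e' | e'
    · exact RQ.degenY e'
    have hfin : ∀ u u' v v', X0 ≤ u → u' ≤ X1 → Y0 ≤ v → v' ≤ Y1 →
        {t | ∃ x y, u < x ∧ x < u' ∧ v < y ∧ y < v' ∧ f x y = t}.Finite := fun u u' v v' h1 h2 h3 h4 => by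
      refine (List.finite_toSet U).subset ?_
      rintro t ⟨x, y, k1, k2, k3, k4, rfl⟩
      exact hA.mem _ _ (by linarith) (by linarith) (by linarith) (by linarith)
    have hB := hA.sub h1 h2 h3 h4
    obtain ⟨a, aU, ha, ha'⟩ := hB.leA le_rfl e le_rfl e'
    obtain ⟨b, bU, hb, hb'⟩ := hB.dual.leA le_rfl (by linarith) le_rfl (by linarith)
    have hb2 : ∀ x y, u ≤ x → x < u' → v ≤ y → y < v' → S.le (f x y) b := fun x y k1 k2 k3 k4 => by
      have := hb (-y) (-x) (by linarith) (by linarith) (by linarith) (by linarith)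
      simpa [flp, Sys.op] using this
    by_cases hab : a = b
    · subst hab
      exact RQ.triv hR hA h1 h2 h3 h4 (c := a) (fun x y k1 k2 k3 k4 => hA.anti _
        (hA.mem _ _ (by linarith) (by linarith) (by linarith) (by linarith)) _ aU
        (hb2 x y k1.le k2 k3.le k4) (ha x y k1 k2.le k3 k4.le))
    have hI : ∀ c, (∃ x y, u < x ∧ x < u' ∧ v < y ∧ y < v' ∧ f x y = c) → ∀ r r' s s', u ≤ r → r' ≤ u' → v ≤ s → s' ≤ v' →
        ¬ RQ U R f r r' s s' → ∃ x y, r < x ∧ x < r' ∧ s < y ∧ y < s' ∧ f x y = c := by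
      intro c hc r r' s s' k1 k2 k3 k4 hnr
      by_contra hcon
      refine hnr (ih _ (lt_of_lt_of_le (Set.ncard_lt_ncard ?_ (hfin u u' v v' h1 h2 h3 h4)) hn) r r' s s' (by linarith) (by linarith)
        (by linarith) (by linarith) le_rfl)
      refine ⟨?_, fun hsub => hcon (hsub hc)⟩
      rintro t ⟨x, y, l1, l2, l3, l4, l5⟩
      exact ⟨x, y, by linarith, by linarith, by linarith, by linarith, l5⟩
    have ea : ∃ x y, u < x ∧ x < u' ∧ v < y ∧ y < v' ∧ f x y = a := by
      obtain ⟨x, y, k1, k2, k3, k4, k5⟩ := ha' (min (u' - u) (v' - v)) (lt_min (by linarith) (by linarith))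
      have m1 := min_le_left (u' - u) (v' - v)
      have m2 := min_le_right (u' - u) (v' - v)
      exact ⟨x, y, k1, by linarith, k3, by linarith, k5⟩
    have eb : ∃ x y, u < x ∧ x < u' ∧ v < y ∧ y < v' ∧ f x y = b := by
      obtain ⟨x, y, k1, k2, k3, k4, k5⟩ := hb' (min (u' - u) (v' - v)) (lt_min (by linarith) (by linarith))
      have m1 := min_le_left (u' - u) (v' - v)
      have m2 := min_le_right (u' - u) (v' - v)
      exact ⟨-y, -x, by linarith, by linarith, by linarith, by linarith, k5⟩
    have hC : Ctx S U R f X0 X1 Y0 Y1 u u' v v' a b :=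
      ⟨hR, hA, h1, h2, h3, h4, hab, aU, bU, fun x y k1 k2 k3 k4 => ha x y k1 k2.le k3 k4.le,
        fun x y k1 k2 k3 k4 => hb2 x y k1.le k2 k3.le k4, fun r r' s s' k1 k2 k3 k4 hnr =>
          ⟨hI a ea r r' s s' k1 k2 k3 k4 hnr, hI b eb r r' s s' k1 k2 k3 k4 hnr⟩⟩
    exact hC.rq e.le e'.le

theorem Amb.rq (hR : Clo S U R) (hA : Amb S U f X0 X1 Y0 Y1) : RQ U R f X0 X1 Y0 Y1 :=
  RC hR hA _ _ _ _ _ le_rfl le_rfl le_rfl le_rfl le_rfl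

end Temporal

namespace Temporal

variable {T : Type} {S : Sys T} {U : List T} {f : ℝ → ℝ → T} {A B : ℝ} {R : Tile T → Prop} {V : Tri T → Prop}

/-- Ambient labelled triangle. -/
structure TAmb (S : Sys T) (U : List T) (f : ℝ → ℝ → T) (A B : ℝ) : Prop where
  law : S.Lawful
  anti : Anti S U
  mem : ∀ x y, A ≤ x → x ≤ y → y ≤ B → A < y → x < B → f x y ∈ U
  cohH : ∀ x x' y, A ≤ x → x < x' → x' ≤ y → y ≤ B → x' < B → S.le (f x y) (f x' y)
  cohV : ∀ x y y', A ≤ x → x ≤ y → y < y' → y' ≤ B → A < y → S.le (f x y) (f x y')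
  real : ∀ x y, A < x → x < y → y < B → S.rl (f x y)
  nullL : ∀ y, Null S (f A y)
  nullT : ∀ x, Null S (f x B)
  demF : ∀ i < S.N, ∀ x y, A ≤ x → x < y → y ≤ B → S.nF i (f x y) →
    ∃ x' y', x ≤ x' ∧ y ≤ y' ∧ x' < y' ∧ y' ≤ B ∧ ¬ (x' = x ∧ y' = y) ∧ S.w i (f x' y')
  demP : ∀ i < S.N, ∀ x y, A ≤ x → x < y → y ≤ B → S.nP i (f x y) →
    ∃ x' y', x' ≤ x ∧ y' ≤ y ∧ x' < y' ∧ A ≤ x' ∧ ¬ (x' = x ∧ y' = y) ∧ S.w i (f x' y')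
  dcor : ∀ w, A < w → w < B → DCor S f w

theorem TAmb.dual (h : TAmb S U f A B) : TAmb S.op U (flp f) (-B) (-A) := by
  refine ⟨h.law.op, fun s hs t ht a b => h.anti s hs t ht b a, fun x y a b c d e => ?_, fun x x' y a b c d e => ?_,
    fun x y y' a b c d e => ?_, fun x y a b c => ?_, fun y => ?_, fun y => ?_, fun i hi x y a b c e => ?_,
    fun i hi x y a b c e => ?_, fun w a b => ?_⟩
  · exact h.mem _ _ (by linarith) (by linarith) (by linarith) (by linarith) (by linarith)
  · exact h.cohV _ _ _ (by linarith) (by linarith) (by linarith) (by linarith) (by linarith)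
  · exact h.cohH _ _ _ (by linarith) (by linarith) (by linarith) (by linarith) (by linarith)
  · exact h.real _ _ (by linarith) (by linarith) (by linarith)
  · simp only [flp, neg_neg]
    intro i hi; exact ⟨(h.nullT _ i hi).2.1, (h.nullT _ i hi).1, (h.nullT _ i hi).2.2⟩
  · simp only [flp, neg_neg]
    intro i hi; exact ⟨(h.nullL _ i hi).2.1, (h.nullL _ i hi).1, (h.nullL _ i hi).2.2⟩
  · obtain ⟨x', y', k1, k2, k3, k4, k5, k6⟩ := h.demP i hi (-y) (-x) (by linarith) (by linarith) (by linarith) e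
    exact ⟨-y', -x', by linarith, by linarith, by linarith, by linarith,
      fun hh => k5 ⟨by linarith [hh.2], by linarith [hh.1]⟩, by simpa [flp, Sys.op] using k6⟩
  · obtain ⟨x', y', k1, k2, k3, k4, k5, k6⟩ := h.demF i hi (-y) (-x) (by linarith) (by linarith) (by linarith) e
    exact ⟨-y', -x', by linarith, by linarith, by linarith, by linarith,
      fun hh => k5 ⟨by linarith [hh.2], by linarith [hh.1]⟩, by simpa [flp, Sys.op] using k6⟩
  · have := (h.dcor (-w) (by linarith) (by linarith)).flp
    simpa using this

/-- Monotonicity between distinct comparable points. -/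
theorem TAmb.le (h : TAmb S U f A B) {x y x' y' : ℝ} (a : A ≤ x) (b : x < y) (c : x ≤ x') (d : y ≤ y')
    (e : x' < y') (g : y' ≤ B) (hn : ¬ (x' = x ∧ y' = y)) : S.le (f x y) (f x' y') := by
  rcases d.eq_or_lt with rfl | d
  · rcases c.eq_or_lt with rfl | c
    · exact absurd ⟨rfl, rfl⟩ hn
    · exact h.cohH _ _ _ a c e.le g (by linarith)
  · rcases c.eq_or_lt with rfl | c
    · exact h.cohV _ _ _ a b.le d g (by linarith)
    · exact h.law.trans _ _ _ (h.cohV _ _ _ a b.le d g (by linarith)) (h.cohH _ _ _ a c e.le g (by linarith))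

theorem TAmb.push (h : TAmb S U f A B) {i : ℕ} (hi : i < S.N) {x y x' y' : ℝ} (a : A < x) (b : x < y) (c : x ≤ x')
    (d : y ≤ y') (e : x' < y') (g : y' ≤ B) (hn : ¬ (x' = x ∧ y' = y)) (hw : S.w i (f x' y')) : S.nF i (f x y) := by
  have hB : y' < B := lt_of_le_of_ne g (by rintro rfl; exact (h.nullT _ i hi).2.2 hw)
  exact h.law.axF i _ _ hi (h.real x y a b (by linarith)) (h.le a.le b c d e g hn) (Or.inr hw)

theorem TAmb.rdemF (h : TAmb S U f A B) {x0 x1 y0 y1 : ℝ} (h1 : A ≤ x0) (h2 : x1 ≤ y0) (h3 : y1 ≤ B) :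
    DemF S f x0 x1 y0 y1 := by
  intro i hi x y a b c d e
  have hA : A < x := lt_of_le_of_ne (h1.trans a) (by rintro rfl; exact (h.nullL _ i hi).1 e)
  obtain ⟨x', y', k1, k2, k3, k4, k5, k6⟩ := h.demF i hi x y hA.le (by linarith) (by linarith) e
  rcases le_or_gt x' x1 with g1 | g1
  · rcases le_or_gt y' y1 with g2 | g2
    · exact ⟨x', y', k1, g1, k2, g2, k5, Or.inl k6⟩
    · exact ⟨x', y1, k1, g1, d.le, le_rfl, fun hh => by linarith [hh.2], Or.inr ⟨Or.inr rfl,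
        h.push hi (by linarith) (by linarith) le_rfl g2.le k3 k4 (fun hh => by linarith [hh.2]) k6⟩⟩
  · have hlt : x1 < min y' y1 := lt_min (by linarith) (by linarith)
    exact ⟨x1, min y' y1, b.le, le_rfl, le_min k2 d.le, min_le_right _ _, fun hh => by linarith [hh.1], Or.inr ⟨Or.inl rfl,
      h.push hi (by linarith) hlt g1.le (min_le_left _ _) k3 k4 (fun hh => by linarith [hh.1]) k6⟩⟩

theorem TAmb.amb (h : TAmb S U f A B) {x0 x1 y0 y1 : ℝ} (h1 : A ≤ x0) (h2 : x1 ≤ y0) (h3 : y1 ≤ B)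
    (h4 : x0 < x1) (h5 : y0 < y1) : Amb S U f x0 x1 y0 y1 := by
  refine ⟨h.law, h.anti, fun x y a b c d => h.mem _ _ (by linarith) (by linarith) (by linarith) (by linarith) (by linarith),
    fun x x' y a b c d e => h.cohH _ _ _ (by linarith) b (by linarith) (by linarith) (by linarith),
    fun y y' x a b c d e => h.cohV _ _ _ (by linarith) (by linarith) b (by linarith) (by linarith),
    fun x y a b c d => h.real _ _ (by linarith) (by linarith) (by linarith),
    fun a0 a1 b0 b1 g1 g2 g3 g4 => h.rdemF (by linarith) (by linarith) (by linarith),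
    fun a0 a1 b0 b1 g1 g2 g3 g4 => h.dual.rdemF (by linarith) (by linarith) (by linarith)⟩

def CanTri (U : List T) (σ : Tri T) : Prop := σ.1 ∈ U ∧ CanW U σ.2.1 ∧ CanW U σ.2.2

def TClo (S : Sys T) (U : List T) (R : Tile T → Prop) (V : Tri T → Prop) : Prop :=
  ∀ σ, CanTri U σ → TStep S U R V σ → V σ

def TRQ (U : List T) (V : Tri T → Prop) (f : ℝ → ℝ → T) (u v : ℝ) : Prop :=
  ∀ σ, IsTri f u v σ → CanTri U σ → V σ

theorem TAmb.monoV (h : TAmb S U f A B) {u v : ℝ} (a : A ≤ u) (b : v ≤ B) (c : u < v) :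
    MonoL S U (fun y => f u y) u v :=
  ⟨fun x k1 k2 => h.mem _ _ a k1.le (by linarith) (by linarith) (by linarith),
   fun x x' k1 k2 k3 => h.cohV _ _ _ a k1.le k2 (by linarith) (by linarith)⟩

theorem TAmb.monoH (h : TAmb S U f A B) {u v : ℝ} (a : A ≤ u) (b : v ≤ B) (c : u < v) :
    MonoL S U (fun x => f x v) u v :=
  ⟨fun x k1 k2 => h.mem _ _ (by linarith) k2.le b (by linarith) (by linarith),
   fun x x' k1 k2 k3 => h.cohH _ _ _ (by linarith) k2 k3.le b (by linarith)⟩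

theorem TAmb.trF (h : TAmb S U f A B) {u v : ℝ} (a : A ≤ u) (b : v ≤ B) {σ : Tri T} (hσ : IsTri f u v σ) {c : T}
    (hc : ∀ x y, u < x → x < y → y < v → f x y = c) : TrF S σ c := by
  classical
  have huv := hσ.huv
  refine ⟨?_, ?_, ?_, ?_⟩
  · have hr : Reads (fun y => if y = u then σ.2.1.1 else f u y) v σ.2.1.2 u σ.2.1.1 :=
      Reads.congr hσ.wl (fun x k1 k2 => by simp [k1.ne'])
    have := Chn.complete (S := S) (β := fun y => if y = u then σ.2.1.1 else f u y) (lo := u) (hi := v) ?_ hr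
    · simpa [huv.ne', hσ.q] using this
    · intro x x' k1 k2 k3
      have hx' : x' ≠ u := by intro hh; linarith
      rcases k1.eq_or_lt with rfl | k1
      · simp only [if_true, hx', if_false]
        obtain ⟨y, l1, l2, l3, l4⟩ := Reads.firstlt hσ.wl k2
        rw [← l4]
        exact h.cohV _ _ _ a l1.le l2 (by linarith) (by linarith)
      · simp only [hx', if_false, k1.ne']
        exact h.cohV _ _ _ a k1.le k2 (by linarith) (by linarith)
  · intro t ht
    obtain ⟨y, k1, k2, rfl⟩ := Reads.att hσ.wl ht
    obtain ⟨x, l1, l2⟩ := exists_between k1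
    rw [← hc x y l1 l2 k2]
    exact h.cohH _ _ _ a l1 l2.le (by linarith) (by linarith)
  · intro i hi
    refine LineF.complete' (fun y k1 k2 hn => ?_) hσ.wl
    have hA : A < u := lt_of_le_of_ne a (by rintro rfl; exact (h.nullL _ i hi).1 hn)
    obtain ⟨x', y', l1, l2, l3, l4, l5, l6⟩ := h.demF i hi u y a k1 (by linarith) hn
    rcases l1.eq_or_lt with rfl | l1
    · have l2 : y < y' := lt_of_le_of_ne l2 (fun hh => l5 ⟨rfl, hh.symm⟩)
      rcases lt_trichotomy y' v with g | rfl | g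
      · exact Or.inl ⟨y', l2, g, l6⟩
      · exact Or.inr (Or.inl (by rw [← hσ.q]; exact l6))
      · refine Or.inr (Or.inr (Or.inl ?_))
        rw [← hσ.q]
        exact h.push hi hA huv le_rfl g.le l3 l4 (fun hh => by linarith [hh.2]) l6
    · obtain ⟨x0, m1, m2⟩ := exists_between (lt_min l1 k1)
      have m3 := m2.trans_le (min_le_left _ _)
      have m4 := m2.trans_le (min_le_right _ _)
      refine Or.inr (Or.inr (Or.inr (Or.inl ?_)))
      rw [← hc x0 y m1 m4 k2]
      exact h.push hi (by linarith) m4 m3.le l2 l3 l4 (fun hh => by linarith [hh.1]) l6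
  · intro i hi hn
    obtain ⟨m, m1, m2, m3⟩ := Reads.last hσ.wt
    obtain ⟨x0, n1, n2⟩ := exists_between m2
    obtain ⟨y0, o1, o2⟩ := exists_between n2
    rw [← hc x0 y0 (by linarith) o1 o2] at hn
    obtain ⟨x', y', l1, l2, l3, l4, l5, l6⟩ := h.demF i hi x0 y0 (by linarith) o1 (by linarith) hn
    rcases lt_or_ge y' v with g | g
    · left; rw [← hc x' y' (by linarith) l3 g]; exact l6
    right
    rcases g.eq_or_lt with rfl | g
    · have := m3 x' (by linarith) l3
      change f x' v = lastW _ at this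
      rw [← this]; exact Or.inr l6
    · have := m3 x0 (by linarith) n2
      change f x0 v = lastW _ at this
      rw [← this]; exact Or.inl (h.push hi (by linarith) n2 l1 g.le l3 l4 (fun hh => by linarith [hh.2]) l6)

theorem TAmb.const (hV : TClo S U R V) (h : TAmb S U f A B) {u v : ℝ} (a : A ≤ u) (b : v ≤ B) (c : u < v) {e : T}
    (hc : ∀ x y, u < x → x < y → y < v → f x y = e) : TRQ U V f u v := by
  intro σ h1 h2
  obtain ⟨x, x1, x2⟩ := exists_between c
  obtain ⟨y, y1, y2⟩ := exists_between x2
  obtain ⟨z, z1, z2⟩ := exists_between y2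
  refine hV σ h2 (Or.inl ⟨e, ?_, ?_, ?_, h.trF a b h1 hc, ?_⟩)
  · rw [← hc x y x1 y1 y2]; exact h.mem _ _ (by linarith) y1.le (by linarith) (by linarith) (by linarith)
  · rw [← hc x y x1 y1 y2]; exact h.real _ _ (by linarith) y1 (by linarith)
  · have := h.cohV x y z (by linarith) y1.le z1 (by linarith) (by linarith)
    rwa [hc x y x1 y1 y2, hc x z x1 (by linarith) z2] at this
  · exact h.dual.trF (u := -v) (v := -u) (by linarith) (by linarith) h1.dual
      (fun x y k1 k2 k3 => hc _ _ (by linarith) (by linarith) (by linarith))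

/-- Gluing at a diagonal point. -/
theorem TAmb.glue (hR : Clo S U R) (hV : TClo S U R V) (h : TAmb S U f A B) {u w v : ℝ} (a : A ≤ u) (b : v ≤ B)
    (c : u < w) (d : w < v) (h1 : TRQ U V f u w) (h2 : TRQ U V f w v) : TRQ U V f u v := by
  intro σ hσ hσ'
  have hr := (h.amb a le_rfl b c d).rq hR
  obtain ⟨l1, l2, a1, a2, a3, a4, a5⟩ := RdW.split (h.monoV a b (c.trans d)) hσ.wl hσ'.2.1 c d
  obtain ⟨t1, t2, b1, b2, b3, b4, b5⟩ := RdW.split (h.monoH a b (c.trans d)) hσ.wt hσ'.2.2 c d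
  obtain ⟨wb, c1, c2⟩ := exists_canon h.anti c (h.monoH (v := w) a (by linarith) c)
  obtain ⟨wr, d1, d2⟩ := exists_canon h.anti d (h.monoV (u := w) (by linarith) b d)
  have m1 : f u w ∈ U := h.mem _ _ a c.le (by linarith) (by linarith) (by linarith)
  have m2 : f w v ∈ U := h.mem _ _ (by linarith) d.le (by linarith) (by linarith) (by linarith)
  refine hV σ hσ' (Or.inr ⟨(f u w, l1, wb), h1 _ ⟨c, rfl, a1, c2⟩ ⟨m1, a4, c1⟩, (f w v, wr, t2),
    h2 _ ⟨d, rfl, d2, b2⟩ ⟨m2, d1, b5⟩, Tile.mk' (f u w) (f w w) (f u v) (f w v) l2 wr wb t1,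
    hr _ ⟨c, d, rfl, rfl, rfl, rfl, a2, d2, c2, b1⟩ ⟨⟨m1, ?_, ?_, m2⟩, a5, d1, c1, b4⟩,
    rfl, hσ.q, rfl, rfl, rfl, a3, b3, ?_, ?_, ?_⟩)
  · exact h.mem _ _ (by linarith) le_rfl (by linarith) (by linarith) (by linarith)
  · exact h.mem _ _ (by linarith) (by linarith) (by linarith) (by linarith) (by linarith)
  · intro t ht
    obtain ⟨x, k1, k2, rfl⟩ := Reads.att c2 ht
    exact h.real _ _ (by linarith) k2 (by linarith)
  · intro t ht
    obtain ⟨x, k1, k2, rfl⟩ := Reads.att d2 ht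
    exact h.real _ _ (by linarith) k1 (by linarith)
  · rcases h.dcor w (by linarith) (by linarith) with k | ⟨k1, k2⟩
    · exact Or.inl k
    · refine Or.inr ⟨?_, ?_⟩
      · obtain ⟨m, n1, n2, n3⟩ := Reads.last c2
        obtain ⟨x, o1, o2, o3⟩ := k2 m n2
        have := n3 x o1 o2
        change f w w = lastW wb
        rw [← o3]; exact this
      · obtain ⟨m, n1, n2, n3⟩ := Reads.first d2
        obtain ⟨x, o1, o2, o3⟩ := k1 m n1
        have := n3 x o1 o2
        change f w w = wr.1
        rw [← o3]; exact this

def triVals (f : ℝ → ℝ → T) (u v : ℝ) : Set T := {t | ∃ x y, u < x ∧ x < y ∧ y < v ∧ f x y = t}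

theorem TAmb.vals_fin (h : TAmb S U f A B) {u v : ℝ} (a : A ≤ u) (b : v ≤ B) : (triVals f u v).Finite :=
  (List.finite_toSet U).subset (by
    rintro _ ⟨x, y, k1, k2, k3, rfl⟩
    exact h.mem _ _ (by linarith) k2.le (by linarith) (by linarith) (by linarith))

theorem triVals_mono {u v u' v' : ℝ} (h1 : u' ≤ u) (h2 : v ≤ v') : triVals f u v ⊆ triVals f u' v' := by
  rintro _ ⟨x, y, k1, k2, k3, rfl⟩
  exact ⟨x, y, by linarith, k2, by linarith, rfl⟩

theorem TAmb.germ (h : TAmb S U f A B) {u v : ℝ} (a : A ≤ u) (b : v ≤ B) (c : u < v) :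
    ∃ w, u < w ∧ w ≤ v ∧ ∃ e, ∀ x y, u < x → x < y → y < w → f x y = e := by
  classical
  obtain ⟨w, ⟨h1, h2⟩, hmin⟩ := WellFounded.has_min (measure (fun x : ℝ => (triVals f u x).ncard)).wf
    {x | u < x ∧ x ≤ v} ⟨v, c, le_rfl⟩
  have key : ∀ z, u < z → z ≤ w → triVals f u z = triVals f u w := by
    intro z k1 k2
    refine Set.eq_of_subset_of_ncard_le (triVals_mono le_rfl k2) ?_ (h.vals_fin a (h2.trans b))
    exact not_lt.1 (hmin z ⟨k1, k2.trans h2⟩)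
  have half : ∀ x y x' y', u < x → x < y → y < w → u < x' → x' < y' → y' < w → S.le (f x y) (f x' y') := by
    intro x y x' y' k1 k2 k3 k4 k5 k6
    have : f x y ∈ triVals f u x' := by rw [key x' k4 (by linarith)]; exact ⟨x, y, k1, k2, k3, rfl⟩
    obtain ⟨x'', y'', l1, l2, l3, l4⟩ := this
    rw [← l4]
    exact h.le (by linarith) l2 (by linarith) (by linarith) k5 (by linarith) (fun hh => by linarith [hh.1])
  obtain ⟨x, x1, x2⟩ := exists_between h1
  obtain ⟨y, y1, y2⟩ := exists_between x2
  refine ⟨w, h1, h2, f x y, fun x' y' k1 k2 k3 => h.anti _ ?_ _ ?_ (half _ _ _ _ k1 k2 k3 x1 y1 y2) (half _ _ _ _ x1 y1 y2 k1 k2 k3)⟩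
  · exact h.mem _ _ (by linarith) k2.le (by linarith) (by linarith) (by linarith)
  · exact h.mem _ _ (by linarith) y1.le (by linarith) (by linarith) (by linarith)

theorem TAmb.trq (hR : Clo S U R) (hV : TClo S U R V) (h : TAmb S U f A B) {u v : ℝ} (a : A ≤ u) (b : v ≤ B)
    (c : u < v) : TRQ U V f u v := by
  classical
  obtain ⟨n, hn⟩ : ∃ n, (triVals f u v).ncard ≤ n := ⟨_, le_rfl⟩
  induction n generalizing u with
  | zero =>
    exfalso
    have h0 : (triVals f u v).ncard = 0 := by omega
    rw [Set.ncard_eq_zero (h.vals_fin a b)] at h0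
    obtain ⟨x, x1, x2⟩ := exists_between c
    obtain ⟨y, y1, y2⟩ := exists_between x2
    exact (h0 ▸ (⟨x, y, x1, y1, y2, rfl⟩ : f x y ∈ triVals f u v) : f x y ∈ (∅ : Set T))
  | succ n ih =>
    obtain ⟨w0, p1, p2, e, pe⟩ := h.germ a b c
    let K : Set ℝ := {w | w ≤ v ∧ ∀ x y, u < x → x < y → y < w → f x y = e}
    have hne : K.Nonempty := ⟨w0, p2, pe⟩
    have hbd : BddAbove K := ⟨v, fun w hw => hw.1⟩
    have q1 : w0 ≤ sSup K := le_csSup hbd ⟨p2, pe⟩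
    have q2 : sSup K ≤ v := csSup_le hne (fun w hw => hw.1)
    have q3 : ∀ x y, u < x → x < y → y < sSup K → f x y = e := by
      intro x y k1 k2 k3
      obtain ⟨w, hw, k4⟩ := exists_lt_of_lt_csSup hne k3
      exact hw.2 x y k1 k2 k4
    rcases q2.eq_or_lt with q2 | q2
    · rw [q2] at q3
      exact h.const hV a b c q3
    have q0 : u < sSup K := p1.trans_le q1
    refine h.glue hR hV a b q0 q2 (h.const hV a (by linarith) q0 q3) (ih (by linarith) q2 ?_)
    have hmem : e ∈ triVals f u v := by
      obtain ⟨x, x1, x2⟩ := exists_between p1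
      obtain ⟨y, y1, y2⟩ := exists_between x2
      exact ⟨x, y, x1, y1, by linarith, pe x y x1 y1 y2⟩
    have hnot : e ∉ triVals f (sSup K) v := by
      rintro ⟨x, y, k1, k2, k3, k4⟩
      have : x ∈ K := by
        refine ⟨by linarith, fun x0 y0 l1 l2 l3 => ?_⟩
        obtain ⟨y1, m1, m2⟩ := exists_between (lt_min l1 q0)
        obtain ⟨x1, m3, m4⟩ := exists_between m1
        have m5 := m2.trans_le (min_le_left _ _)
        have m6 := m2.trans_le (min_le_right _ _)
        have e1 := q3 x1 y1 m3 m4 m6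
        refine h.anti _ (h.mem _ _ (by linarith) l2.le (by linarith) (by linarith) (by linarith)) _ ?_ ?_ ?_
        · rw [← k4]; exact h.mem _ _ (by linarith) k2.le (by linarith) (by linarith) (by linarith)
        · rw [← k4]; exact h.le (by linarith) l2 (by linarith) (by linarith) k2 (by linarith) (fun hh => by linarith [hh.1])
        · rw [← e1]; exact h.le (by linarith) m4 (by linarith) (by linarith) l2 (by linarith) (fun hh => by linarith [hh.1])
      linarith [le_csSup hbd this]
    have hss : triVals f (sSup K) v ⊂ triVals f u v :=
      ⟨triVals_mono q0.le le_rfl, fun hh => hnot (hh hmem)⟩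
    have := Set.ncard_lt_ncard hss (h.vals_fin a b)
    omega

end Temporal

namespace Temporal

/-- All sublists. -/
def subl {α : Type} (L : List α) : List (List α) := L.foldr (fun a acc => acc ++ acc.map (List.cons a)) [[]]

theorem filter_mem_subl {α : Type} (L : List α) (p : α → Bool) : L.filter p ∈ subl L := by
  induction L with
  | nil => simp [subl]
  | cons a L ih =>
    change _ ∈ subl L ++ (subl L).map (List.cons a)
    rw [List.filter_cons]
    split
    · exact List.mem_append_right _ (List.mem_map_of_mem ih)
    · exact List.mem_append_left _ ih

def OKt (n : ℕ) (t : List ℕ) : Prop :=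
  n ∈ t ∧ ∀ i < n + 1, (5 * i + 1 ∈ t ↔ i ∉ t) ∧ (5 * i + 2 ∈ t ↔ ((Nat.unpair i).1 ∈ t ∨ (Nat.unpair i).2 ∈ t))

def tle (n : ℕ) (t s : List ℕ) : Prop :=
  ∀ i < n + 1, ((i ∈ s ∨ 5 * i + 3 ∈ s) → 5 * i + 3 ∈ t) ∧ ((i ∈ t ∨ 5 * i + 4 ∈ t) → 5 * i + 4 ∈ s)

instance (n : ℕ) (t : List ℕ) : Decidable (OKt n t) := by unfold OKt; infer_instance
instance (n : ℕ) (t s : List ℕ) : Decidable (tle n t s) := by unfold tle; infer_instance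

def TY (n : ℕ) : List (List ℕ) := (subl (List.range (5 * (n + 1)))).filter (fun t => decide (OKt n t))

def rep (n : ℕ) (t : List ℕ) : List ℕ :=
  if tle n t t then (List.range (5 * (n + 1))).filter (fun k => decide (3 ≤ k % 5 ∧ k ∈ t)) else t

def U0 (n : ℕ) : List (List ℕ) := (TY n).map (rep n)

abbrev Lb := ℕ × List ℕ × List ℕ

def gok (n : ℕ) (a : Lb) : Prop := (a.1 = 0 ∧ a.2.1 = a.2.2) ∨ (a.1 = 1 ∧ tle n a.2.1 a.2.2)

def Sy (n : ℕ) : Sys Lb where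
  N := n + 1
  le a b := a.1 = 2 ∨ b.1 = 3 ∨ (gok n a ∧ gok n b ∧ tle n a.2.2 b.2.1)
  rl a := a.1 = 0 ∧ a.2.1 = a.2.2 ∧ a.2.1 ∈ U0 n
  nF i a := a.1 = 0 ∧ 5 * i + 3 ∈ a.2.1
  nP i a := a.1 = 0 ∧ 5 * i + 4 ∈ a.2.1
  w i a := a.1 = 0 ∧ ∃ t ∈ TY n, rep n t = a.2.1 ∧ i ∈ t

def UL (n : ℕ) : List Lb :=
  (U0 n).map (fun t => (0, t, t)) ++
    (((U0 n).flatMap fun s => (U0 n).map fun t => ((1, s, t) : Lb)).filter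
      (fun a => decide (a.2.1 ≠ a.2.2 ∧ tle n a.2.1 a.2.2)) ++ [(2, [], []), (3, [], [])])

theorem tle.trans {n : ℕ} {a b c : List ℕ} (h1 : tle n a b) (h2 : tle n b c) : tle n a c := fun i hi =>
  ⟨fun h => (h1 i hi).1 (Or.inr ((h2 i hi).1 h)), fun h => (h2 i hi).2 (Or.inr ((h1 i hi).2 h))⟩

theorem rep3 {n : ℕ} {t : List ℕ} {i : ℕ} (hi : i < n + 1) : 5 * i + 3 ∈ rep n t ↔ 5 * i + 3 ∈ t := by
  unfold rep
  split
  · rw [List.mem_filter, List.mem_range, decide_eq_true_iff]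
    exact ⟨fun h => h.2.2, fun h => ⟨by omega, by omega, h⟩⟩
  · rfl

theorem rep4 {n : ℕ} {t : List ℕ} {i : ℕ} (hi : i < n + 1) : 5 * i + 4 ∈ rep n t ↔ 5 * i + 4 ∈ t := by
  unfold rep
  split
  · rw [List.mem_filter, List.mem_range, decide_eq_true_iff]
    exact ⟨fun h => h.2.2, fun h => ⟨by omega, by omega, h⟩⟩
  · rfl

theorem rep_sub {n : ℕ} {t : List ℕ} {i : ℕ} (h : i ∈ rep n t) : i ∈ t := by
  unfold rep at h
  split at h
  · rw [List.mem_filter, decide_eq_true_iff] at h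
    exact h.2.2
  · exact h

theorem rep_irr {n : ℕ} {t : List ℕ} (h : ¬ tle n t t) : rep n t = t := by
  unfold rep; rw [if_neg h]

theorem tle_rep {n : ℕ} {t s : List ℕ} : tle n (rep n t) (rep n s) ↔ tle n t s := by
  constructor
  · intro h i hi
    have h1 := h i hi
    simp only [rep3 hi, rep4 hi] at h1
    refine ⟨fun k => ?_, fun k => ?_⟩
    · rcases k with k | k
      · by_cases hs : tle n s s
        · exact h1.1 (Or.inr ((hs i hi).1 (Or.inl k)))
        · rw [rep_irr hs] at h1; exact h1.1 (Or.inl k)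
      · exact h1.1 (Or.inr k)
    · rcases k with k | k
      · by_cases hs : tle n t t
        · exact h1.2 (Or.inr ((hs i hi).2 (Or.inl k)))
        · rw [rep_irr hs] at h1; exact h1.2 (Or.inl k)
      · exact h1.2 (Or.inr k)
  · intro h i hi
    have h1 := h i hi
    simp only [rep3 hi, rep4 hi]
    exact ⟨fun k => h1.1 (k.imp_left rep_sub), fun k => h1.2 (k.imp_left rep_sub)⟩

theorem U0_anti {n : ℕ} {a b : List ℕ} (ha : a ∈ U0 n) (hb : b ∈ U0 n) (h1 : tle n a b) (h2 : tle n b a) : a = b := by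
  obtain ⟨t, _, rfl⟩ := List.mem_map.1 ha
  obtain ⟨s, _, rfl⟩ := List.mem_map.1 hb
  rw [tle_rep] at h1 h2
  have ht := h1.trans h2
  have hs := h2.trans h1
  unfold rep
  rw [if_pos ht, if_pos hs]
  refine List.filter_congr (fun k hk => ?_)
  rw [List.mem_range] at hk
  rw [decide_eq_decide]
  refine and_congr_right fun h3 => ?_
  have : k = 5 * (k / 5) + 3 ∨ k = 5 * (k / 5) + 4 := by omega
  have hi : k / 5 < n + 1 := by omega
  generalize k / 5 = i at *
  rcases this with rfl | rfl
  · exact ⟨fun k => (h2 _ hi).1 (Or.inr k), fun k => (h1 _ hi).1 (Or.inr k)⟩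
  · exact ⟨fun k => (h1 _ hi).2 (Or.inr k), fun k => (h2 _ hi).2 (Or.inr k)⟩

theorem Sy_law (n : ℕ) : (Sy n).Lawful := by
  refine ⟨?_, ?_, ?_⟩
  · intro a b c h1 h2
    rcases h1 with h1 | h1 | ⟨h1, h1', h1''⟩
    · exact Or.inl h1
    · rcases h2 with h2 | h2 | ⟨h2 | h2, _⟩
      · omega
      · exact Or.inr (Or.inl h2)
      · omega
      · omega
    · rcases h2 with h2 | h2 | ⟨h2, h2', h2''⟩
      · rcases h1' with h | h <;> omega
      · exact Or.inr (Or.inl h2)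
      · refine Or.inr (Or.inr ⟨h1, h2', ?_⟩)
        rcases h2 with ⟨_, e⟩ | ⟨_, e⟩
        · rw [← e] at h2''; exact h1''.trans h2''
        · exact (h1''.trans e).trans h2''
  · intro i t s hi hr hl hg
    change i < n + 1 at hi
    obtain ⟨r1, r2, r3⟩ := hr
    refine ⟨r1, ?_⟩
    rcases hl with hl | hl | ⟨_, _, hl⟩
    · omega
    · rcases hg with ⟨hg, _⟩ | ⟨hg, _⟩ <;> omega
    · rw [← r2] at hl
      rcases hg with ⟨_, hg⟩ | ⟨_, t', _, e, hg⟩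
      · exact (hl i hi).1 (Or.inr hg)
      · rw [← e] at hl
        by_cases hs : tle n t' t'
        · exact (hl i hi).1 (Or.inr ((rep3 hi).2 ((hs i hi).1 (Or.inl hg))))
        · rw [rep_irr hs] at hl; exact (hl i hi).1 (Or.inl hg)
  · intro i t s hi hr hl hg
    change i < n + 1 at hi
    obtain ⟨r1, r2, r3⟩ := hr
    refine ⟨r1, ?_⟩
    rcases hl with hl | hl | ⟨_, hk, hl⟩
    · rcases hg with ⟨hg, _⟩ | ⟨hg, _⟩ <;> omega
    · omega
    · have ht : t.1 = 0 := by rcases hg with ⟨hg, _⟩ | ⟨hg, _⟩ <;> exact hg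
      rename_i hk0
      have e0 : t.2.1 = t.2.2 := by
        rcases hk0 with h | h
        · exact h.2
        · omega
      rw [← e0] at hl
      rcases hg with ⟨_, hg⟩ | ⟨_, t', _, e, hg⟩
      · exact (hl i hi).2 (Or.inr hg)
      · rw [← e] at hl
        by_cases hs : tle n t' t'
        · exact (hl i hi).2 (Or.inr ((rep4 hi).2 ((hs i hi).2 (Or.inl hg))))
        · rw [rep_irr hs] at hl; exact (hl i hi).2 (Or.inl hg)

theorem mem_UL {n : ℕ} {a : Lb} : a ∈ UL n ↔ (∃ t ∈ U0 n, a = (0, t, t)) ∨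
    (∃ s ∈ U0 n, ∃ t ∈ U0 n, a = (1, s, t) ∧ s ≠ t ∧ tle n s t) ∨ a = (2, [], []) ∨ a = (3, [], []) := by
  unfold UL
  simp only [List.mem_append, List.mem_map, List.mem_filter, List.mem_flatMap, List.mem_cons, List.not_mem_nil, or_false,
    decide_eq_true_iff]
  refine or_congr ⟨fun ⟨t, h, e⟩ => ⟨t, h, e.symm⟩, fun ⟨t, h, e⟩ => ⟨t, h, e.symm⟩⟩ (or_congr_left ⟨?_, ?_⟩)
  · rintro ⟨⟨s, hs, t, ht, rfl⟩, h1, h2⟩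
    exact ⟨s, hs, t, ht, rfl, h1, h2⟩
  · rintro ⟨s, hs, t, ht, rfl, h1, h2⟩
    exact ⟨⟨s, hs, t, ht, rfl⟩, h1, h2⟩

theorem UL_anti (n : ℕ) : Anti (Sy n) (UL n) := by
  have key : ∀ a ∈ UL n, ∀ b ∈ UL n, a.1 ≤ 1 → b.1 ≤ 1 → (Sy n).le a b → (Sy n).le b a → a = b := by
    intro a ha b hb h1 h2 h3 h4
    have d : ∀ c ∈ UL n, c.1 ≤ 1 → c.2.1 ∈ U0 n ∧ c.2.2 ∈ U0 n ∧ (c.2.1 = c.2.2 ∧ c.1 = 0 ∨ tle n c.2.1 c.2.2 ∧ c.2.1 ≠ c.2.2) := by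
      intro c hc h
      rcases mem_UL.1 hc with ⟨t, ht, rfl⟩ | ⟨s, hs, t, ht, rfl, h1, h2⟩ | rfl | rfl
      · exact ⟨ht, ht, Or.inl ⟨rfl, rfl⟩⟩
      · exact ⟨hs, ht, Or.inr ⟨h2, h1⟩⟩
      · simp at h
      · simp at h
    obtain ⟨a1, a2, a3⟩ := d a ha h1
    obtain ⟨b1, b2, b3⟩ := d b hb h2
    have k1 : tle n a.2.2 b.2.1 := by
      rcases h3 with h | h | ⟨_, _, h⟩
      · omega
      · omega
      · exact h
    have k2 : tle n b.2.2 a.2.1 := by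
      rcases h4 with h | h | ⟨_, _, h⟩
      · omega
      · omega
      · exact h
    obtain ⟨ka, la, ra⟩ := a
    obtain ⟨kb, lb, rb⟩ := b
    simp only at *
    rcases a3 with ⟨rfl, rfl⟩ | ⟨a3, a4⟩
    · rcases b3 with ⟨rfl, rfl⟩ | ⟨b3, b4⟩
      · rw [U0_anti a1 b1 k1 k2]
      · exact absurd (U0_anti b1 b2 b3 (k2.trans k1)) b4
    · rcases b3 with ⟨rfl, rfl⟩ | ⟨b3, b4⟩
      · exact absurd (U0_anti a1 a2 a3 (k1.trans k2)) a4
      · exact absurd (U0_anti a1 a2 a3 ((k1.trans b3).trans k2)) a4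
  intro a ha b hb h1 h2
  have kk : ∀ c ∈ UL n, c.1 ≤ 1 ∨ c = (2, [], []) ∨ c = (3, [], []) := by
    intro c hc
    rcases mem_UL.1 hc with ⟨t, ht, rfl⟩ | ⟨s, hs, t, ht, rfl, _, _⟩ | rfl | rfl
    · exact Or.inl (by simp)
    · exact Or.inl (by simp)
    · exact Or.inr (Or.inl rfl)
    · exact Or.inr (Or.inr rfl)
  have g : ∀ c : Lb, gok n c → c.1 ≤ 1 := by
    intro c hc; rcases hc with h | h <;> omega
  have two : ∀ c ∈ UL n, (Sy n).le c (2, [], []) → c = (2, [], []) := by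
    intro c hc h
    rcases h with h | h | ⟨_, h, _⟩
    · rcases kk c hc with k | k | k
      · omega
      · exact k
      · rw [k] at h; simp at h
    · simp at h
    · have := g _ h; simp at this
  have three : ∀ c ∈ UL n, (Sy n).le (3, [], []) c → c = (3, [], []) := by
    intro c hc h
    rcases h with h | h | ⟨h, _⟩
    · simp at h
    · rcases kk c hc with k | k | k
      · omega
      · rw [k] at h; simp at h
      · exact k
    · have := g _ h; simp at this
  rcases kk a ha with k | rfl | rfl
  · rcases kk b hb with l | rfl | rfl
    · exact key a ha b hb k l h1 h2
    · exact two a ha h1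
    · exact three a ha h2
  · exact (two b hb h2).symm
  · exact (three b hb h1).symm

end Temporal

namespace Temporal

/-- A coarse labelling of the pairs `x < y` in `I`. -/
structure CoarseOn (n : ℕ) (I : Set ℝ) (l : ℝ → ℝ → List ℕ) : Prop where
  mem : ∀ x ∈ I, ∀ y ∈ I, x < y → l x y ∈ U0 n
  le : ∀ x ∈ I, ∀ y ∈ I, ∀ x' ∈ I, ∀ y' ∈ I, x < y → x' < y' → x ≤ x' → y ≤ y' → ¬ (x' = x ∧ y' = y) →
    tle n (l x y) (l x' y')
  demF : ∀ i < n + 1, ∀ x ∈ I, ∀ y ∈ I, x < y → 5 * i + 3 ∈ l x y → ∃ x' ∈ I, ∃ y' ∈ I, x' < y' ∧ x ≤ x' ∧ y ≤ y' ∧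
    ¬ (x' = x ∧ y' = y) ∧ ∃ t ∈ TY n, rep n t = l x' y' ∧ i ∈ t
  demP : ∀ i < n + 1, ∀ x ∈ I, ∀ y ∈ I, x < y → 5 * i + 4 ∈ l x y → ∃ x' ∈ I, ∃ y' ∈ I, x' < y' ∧ x' ≤ x ∧ y' ≤ y ∧
    ¬ (x' = x ∧ y' = y) ∧ ∃ t ∈ TY n, rep n t = l x' y' ∧ i ∈ t

theorem CoarseOn.transport {n : ℕ} {I J : Set ℝ} (e : J ≃o I) {l : ℝ → ℝ → List ℕ} (h : CoarseOn n I l) :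
    ∃ l', CoarseOn n J l' := by
  classical
  let g : ℝ → ℝ := fun x => if hx : x ∈ J then (e ⟨x, hx⟩ : ℝ) else 0
  have gI : ∀ x ∈ J, g x ∈ I := by intro x hx; simp only [g, hx, dif_pos]; exact (e ⟨x, hx⟩).2
  have glt : ∀ x ∈ J, ∀ y ∈ J, (g x < g y ↔ x < y) := by
    intro x hx y hy
    simp only [g, hx, hy, dif_pos, Subtype.coe_lt_coe, e.lt_iff_lt, Subtype.mk_lt_mk]
  have gle : ∀ x ∈ J, ∀ y ∈ J, (g x ≤ g y ↔ x ≤ y) := by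
    intro x hx y hy
    simp only [g, hx, hy, dif_pos, Subtype.coe_le_coe, e.le_iff_le, Subtype.mk_le_mk]
  have geq : ∀ x ∈ J, ∀ y ∈ J, (g x = g y ↔ x = y) := by
    intro x hx y hy
    rw [le_antisymm_iff, le_antisymm_iff, gle x hx y hy, gle y hy x hx]
  have gs : ∀ z ∈ I, ∃ x ∈ J, g x = z := by
    intro z hz
    refine ⟨e.symm ⟨z, hz⟩, (e.symm ⟨z, hz⟩).2, ?_⟩
    simp [g]
  refine ⟨fun x y => l (g x) (g y), fun x hx y hy k => h.mem _ (gI x hx) _ (gI y hy) ((glt x hx y hy).2 k), ?_, ?_, ?_⟩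
  · intro x hx y hy x' hx' y' hy' k1 k2 k3 k4 k5
    exact h.le _ (gI x hx) _ (gI y hy) _ (gI x' hx') _ (gI y' hy') ((glt x hx y hy).2 k1) ((glt x' hx' y' hy').2 k2)
      ((gle x hx x' hx').2 k3) ((gle y hy y' hy').2 k4) (by rw [geq x' hx' x hx, geq y' hy' y hy]; exact k5)
  · intro i hi x hx y hy k1 k2
    obtain ⟨a, ha, b, hb, k3, k4, k5, k6, k7⟩ := h.demF i hi _ (gI x hx) _ (gI y hy) ((glt x hx y hy).2 k1) k2
    obtain ⟨a, ha', rfl⟩ := gs a ha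
    obtain ⟨b, hb', rfl⟩ := gs b hb
    exact ⟨a, ha', b, hb', (glt _ ha' _ hb').1 k3, (gle _ hx _ ha').1 k4, (gle _ hy _ hb').1 k5,
      (by rw [geq _ ha' _ hx, geq _ hb' _ hy] at k6; exact k6), k7⟩
  · intro i hi x hx y hy k1 k2
    obtain ⟨a, ha, b, hb, k3, k4, k5, k6, k7⟩ := h.demP i hi _ (gI x hx) _ (gI y hy) ((glt x hx y hy).2 k1) k2
    obtain ⟨a, ha', rfl⟩ := gs a ha
    obtain ⟨b, hb', rfl⟩ := gs b hb
    exact ⟨a, ha', b, hb', (glt _ ha' _ hb').1 k3, (gle _ ha' _ hx).1 k4, (gle _ hb' _ hy).1 k5,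
      (by rw [geq _ ha' _ hx, geq _ hb' _ hy] at k6; exact k6), k7⟩

def sig0 : Tri Lb := ((2, [], []), ((2, [], []), []), ((3, [], []), []))

/-- Realisations of the target triangle give coarse labellings. -/
theorem TFill.coarse {n : ℕ} (h : TFill (Sy n) sig0) : ∃ l, CoarseOn n (Set.Ioo (-1) 1) l := by
  obtain ⟨f, hT, hG⟩ := tfill_at h (-1) 1 (by norm_num)
  have hL : ∀ y, -1 < y → y < 1 → f (-1) y = (2, [], []) := hT.wl.2
  have hU : ∀ x, -1 < x → x < 1 → f x 1 = (3, [], []) := hT.wt.2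
  have hn : ∀ i, ∀ a : Lb, a.1 ≠ 0 → ¬ (Sy n).nF i a ∧ ¬ (Sy n).nP i a ∧ ¬ (Sy n).w i a := fun i a ha =>
    ⟨fun h => ha h.1, fun h => ha h.1, fun h => ha h.1⟩
  refine ⟨fun x y => (f x y).2.1, ?_, ?_, ?_, ?_⟩
  · intro x hx y hy k
    exact (hG.real x y hx.1 k hy.2).2.2
  · intro x hx y hy x' hx' y' hy' k1 k2 k3 k4 k5
    have r1 := hG.real x y hx.1 k1 hy.2
    have r2 := hG.real x' y' hx'.1 k2 hy'.2
    have hle : (Sy n).le (f x y) (f x' y') := by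
      have hv : ∀ y', y < y' → y' < 1 → (Sy n).le (f x y) (f x y') := by
        intro y' l1 l2
        have := hG.cohV (-y') (-y) (-x) (by linarith) (by linarith) (by linarith) (by linarith [hx.1])
        simp only [flp, neg_neg] at this
        exact this
      rcases k4.eq_or_lt with rfl | k4
      · rcases k3.eq_or_lt with rfl | k3
        · exact absurd ⟨rfl, rfl⟩ k5
        · exact hG.cohH x x' y hx.1.le k3 k2 hy.2.le
      · rcases k3.eq_or_lt with rfl | k3
        · exact hv y' k4 hy'.2
        · exact (Sy_law n).trans _ _ _ (hv y' k4 hy'.2) (hG.cohH x x' y' hx.1.le k3 k2 hy'.2.le)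
    rcases hle with h | h | ⟨_, _, h⟩
    · have := r1.1; omega
    · have := r2.1; omega
    · rw [← r1.2.1] at h; exact h
  · intro i hi x hx y hy k1 k2
    have r1 := hG.real x y hx.1 k1 hy.2
    obtain ⟨x', y', l1, l2, l3, l4, l5, l6⟩ := hG.demF i hi x y hx.1.le k1 hy.2 ⟨r1.1, k2⟩
    have hx' : -1 < x' := hx.1.trans_le l1
    rcases l4.eq_or_lt with rfl | l4
    · rw [hU x' hx' l3] at l6
      have := hn i (3, [], []) (by simp)
      rcases l6 with l6 | l6
      · exact absurd l6 this.2.2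
      · exact absurd l6.2 this.1
    · rcases l6 with l6 | l6
      · exact ⟨x', ⟨hx', l3.trans l4⟩, y', ⟨hx'.trans l3, l4⟩, l3, l1, l2, l5, l6.2⟩
      · exact absurd l6.1 l4.ne
  · intro i hi x hx y hy k1 k2
    have r1 := hG.real x y hx.1 k1 hy.2
    obtain ⟨a, b, l1, l2, l3, l4, l5, l6⟩ := hG.demP i hi (-y) (-x) (by linarith [hy.2]) (by linarith) (by linarith [hx.1])
      (by simp only [flp, neg_neg]; exact ⟨r1.1, k2⟩)
    have hy' : -a < 1 := by linarith [hy.2]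
    have l5' : ¬ (-b = x ∧ -a = y) := fun hh => l5 ⟨by linarith [hh.2], by linarith [hh.1]⟩
    simp only [flp] at l6
    rcases l4.eq_or_lt with l4 | l4
    · rw [show -b = -1 by linarith, hL (-a) (by linarith) hy'] at l6
      have := hn i (2, [], []) (by simp)
      rcases l6 with l6 | l6
      · exact absurd l6 this.2.2
      · exact absurd l6.2 this.2.1
    · rcases l6 with l6 | l6
      · exact ⟨-b, ⟨by linarith, by linarith⟩, -a, ⟨by linarith, hy'⟩, by linarith, by linarith, by linarith, l5', l6.2⟩
      · exact absurd l6.1 (by intro hh; linarith)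

noncomputable def lam0 (l : ℝ → ℝ → List ℕ) (d : ℝ → Lb) (x y : ℝ) : Lb :=
  open Classical in
  if x ≤ -1 then (2, [], []) else if 1 ≤ y then (3, [], []) else if x < y then (0, l x y, l x y) else d x

theorem le_real {n : ℕ} {a b : List ℕ} : (Sy n).le (0, a, a) (0, b, b) ↔ tle n a b := by
  constructor
  · rintro (h | h | ⟨_, _, h⟩)
    · simp at h
    · simp at h
    · exact h
  · intro h; exact Or.inr (Or.inr ⟨Or.inl ⟨rfl, rfl⟩, Or.inl ⟨rfl, rfl⟩, h⟩)

theorem CoarseOn.diag {n : ℕ} {l : ℝ → ℝ → List ℕ} (h : CoarseOn n (Set.Ioo (-1) 1) l) {w : ℝ} (h1 : -1 < w) (h2 : w < 1) :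
    ∃ d : Lb, d ∈ UL n ∧ (∀ x, -1 < x → x < w → (Sy n).le (0, l x w, l x w) d) ∧
      (∀ y, w < y → y < 1 → (Sy n).le d (0, l w y, l w y)) ∧
      (Null (Sy n) d ∨ ((∀ v, w < v → ∃ y, w < y ∧ y < v ∧ y < 1 ∧ (0, l w y, l w y) = d) ∧
        (∀ u, u < w → ∃ x, u < x ∧ x < w ∧ -1 < x ∧ (0, l x w, l x w) = d))) := by
  have m1 : MonoL (Sy n) (UL n) (fun x => ((0, l x w, l x w) : Lb)) (-1) w :=
    ⟨fun x a b => mem_UL.2 (Or.inl ⟨_, h.mem x ⟨a, by linarith⟩ w ⟨h1, h2⟩ b, rfl⟩),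
     fun x x' a b c => le_real.2 (h.le x ⟨a, by linarith⟩ w ⟨h1, h2⟩ x' ⟨by linarith, by linarith⟩ w ⟨h1, h2⟩ (by linarith) c
       b.le le_rfl (fun hh => by linarith [hh.1]))⟩
  have m2 : MonoL (Sy n) (UL n) (fun y => ((0, l w y, l w y) : Lb)) w 1 :=
    ⟨fun x a b => mem_UL.2 (Or.inl ⟨_, h.mem w ⟨h1, h2⟩ x ⟨by linarith, b⟩ a, rfl⟩),
     fun x x' a b c => le_real.2 (h.le w ⟨h1, h2⟩ x ⟨by linarith, by linarith⟩ w ⟨h1, h2⟩ x' ⟨by linarith, by linarith⟩ a (by linarith)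
       le_rfl b.le (fun hh => by linarith [hh.2]))⟩
  obtain ⟨w1, _, r1⟩ := exists_canon (UL_anti n) h1 m1
  obtain ⟨p, p1, p2, p3⟩ := Reads.last r1
  obtain ⟨q, q1, q2, e', q3, q4⟩ := exists_germ (UL_anti n) h2 m2
  obtain ⟨x0, x1, x2⟩ := exists_between p2
  obtain ⟨y0, y1, y2⟩ := exists_between q1
  have hx : ∀ x, p < x → x < w → l x w = l x0 w := by
    intro x k1 k2
    have := (p3 x k1 k2).trans (p3 x0 x1 x2).symm
    simp only [Prod.mk.injEq] at this; exact this.2.1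
  have hy : ∀ y, w < y → y < q → l w y = l w y0 := by
    intro y k1 k2
    have := (q4 y k1 k2).trans (q4 y0 y1 y2).symm
    simp only [Prod.mk.injEq] at this; exact this.2.1
  have ma : l x0 w ∈ U0 n := h.mem _ ⟨by linarith, by linarith⟩ _ ⟨h1, h2⟩ x2
  have mb : l w y0 ∈ U0 n := h.mem _ ⟨h1, h2⟩ _ ⟨by linarith, by linarith⟩ y1
  have hab : tle n (l x0 w) (l w y0) := h.le _ ⟨by linarith, by linarith⟩ _ ⟨h1, h2⟩ _ ⟨h1, h2⟩ _ ⟨by linarith, by linarith⟩ x2 y1 x2.le y1.le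
    (fun hh => by linarith [hh.1])
  have ha : ∀ x, -1 < x → x < w → tle n (l x w) (l x0 w) := by
    intro x k1 k2
    obtain ⟨z, z1, z2⟩ := exists_between (max_lt k2 p2)
    have z3 := lt_of_le_of_lt (le_max_left _ _) z1
    rw [← hx z (lt_of_le_of_lt (le_max_right _ _) z1) z2]
    exact h.le _ ⟨k1, by linarith⟩ _ ⟨h1, h2⟩ _ ⟨by linarith, by linarith⟩ _ ⟨h1, h2⟩ k2 z2 z3.le le_rfl (fun hh => by linarith [hh.1])
  have hb : ∀ y, w < y → y < 1 → tle n (l w y0) (l w y) := by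
    intro y k1 k2
    obtain ⟨z, z1, z2⟩ := exists_between (lt_min k1 q1)
    have z3 := z2.trans_le (min_le_left _ _)
    rw [← hy z z1 (z2.trans_le (min_le_right _ _))]
    exact h.le _ ⟨h1, h2⟩ _ ⟨by linarith, by linarith⟩ _ ⟨h1, h2⟩ _ ⟨by linarith, by linarith⟩ z1 k1 le_rfl z3.le (fun hh => by linarith [hh.2])
  by_cases hE : l x0 w = l w y0
  · refine ⟨(0, l x0 w, l x0 w), mem_UL.2 (Or.inl ⟨_, ma, rfl⟩), fun x k1 k2 => le_real.2 (ha x k1 k2),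
      fun y k1 k2 => le_real.2 (hE ▸ hb y k1 k2), Or.inr ⟨fun v hv => ?_, fun u hu => ?_⟩⟩
    · obtain ⟨z, z1, z2⟩ := exists_between (lt_min hv q1)
      have := z2.trans_le (min_le_right _ _)
      exact ⟨z, z1, z2.trans_le (min_le_left _ _), by linarith, by rw [hy z z1 this, hE]⟩
    · obtain ⟨z, z1, z2⟩ := exists_between (max_lt hu p2)
      have := lt_of_le_of_lt (le_max_right _ _) z1
      exact ⟨z, lt_of_le_of_lt (le_max_left _ _) z1, z2, by linarith, by rw [hx z this z2]⟩
  · refine ⟨(1, l x0 w, l w y0), mem_UL.2 (Or.inr (Or.inl ⟨_, ma, _, mb, rfl, hE, hab⟩)), fun x k1 k2 => ?_, fun y k1 k2 => ?_, Or.inl ?_⟩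
    · exact Or.inr (Or.inr ⟨Or.inl ⟨rfl, rfl⟩, Or.inr ⟨rfl, hab⟩, ha x k1 k2⟩)
    · exact Or.inr (Or.inr ⟨Or.inr ⟨rfl, hab⟩, Or.inl ⟨rfl, rfl⟩, hb y k1 k2⟩)
    · intro i _
      exact ⟨fun h => absurd h.1 one_ne_zero, fun h => absurd h.1 one_ne_zero, fun h => absurd h.1 one_ne_zero⟩

/-- Coarse labellings give ambient triangles. -/
theorem CoarseOn.tamb {n : ℕ} {l : ℝ → ℝ → List ℕ} (h : CoarseOn n (Set.Ioo (-1) 1) l) :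
    ∃ f, TAmb (Sy n) (UL n) f (-1) 1 ∧ IsTri f (-1) 1 sig0 := by
  have hd : ∀ w, ∃ d : Lb, -1 < w → w < 1 → d ∈ UL n ∧ (∀ x, -1 < x → x < w → (Sy n).le (0, l x w, l x w) d) ∧
      (∀ y, w < y → y < 1 → (Sy n).le d (0, l w y, l w y)) ∧
      (Null (Sy n) d ∨ ((∀ v, w < v → ∃ y, w < y ∧ y < v ∧ y < 1 ∧ (0, l w y, l w y) = d) ∧
        (∀ u, u < w → ∃ x, u < x ∧ x < w ∧ -1 < x ∧ (0, l x w, l x w) = d))) := by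
    intro w
    by_cases hw : -1 < w ∧ w < 1
    · obtain ⟨d, k⟩ := h.diag hw.1 hw.2
      exact ⟨d, fun _ _ => k⟩
    · exact ⟨(2, [], []), fun a b => absurd ⟨a, b⟩ hw⟩
  choose d hd using hd
  have fL : ∀ y, lam0 l d (-1) y = (2, [], []) := fun y => by simp [lam0]
  have fT : ∀ x, -1 < x → lam0 l d x 1 = (3, [], []) := fun x hx => by simp [lam0, hx]
  have fI : ∀ x y, -1 < x → x < y → y < 1 → lam0 l d x y = (0, l x y, l x y) := fun x y a b c => by
    simp [lam0, not_le.2 a, not_le.2 c, b]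
  have fD : ∀ x, -1 < x → x < 1 → lam0 l d x x = d x := fun x a b => by
    simp [lam0, not_le.2 a, not_le.2 b]
  have null : ∀ k, k ≠ 0 → Null (Sy n) (k, [], []) := fun k hk i _ =>
    ⟨fun h => absurd h.1 hk, fun h => absurd h.1 hk, fun h => absurd h.1 hk⟩
  have botle : ∀ a, (Sy n).le (2, [], []) a := fun a => Or.inl rfl
  have letop : ∀ a, (Sy n).le a (3, [], []) := fun a => Or.inr (Or.inl rfl)
  refine ⟨lam0 l d, ⟨Sy_law n, UL_anti n, ?_, ?_, ?_, ?_, ?_, ?_, ?_, ?_, ?_⟩, ?_⟩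
  · intro x y k1 k2 k3 k4 k5
    rcases k1.eq_or_lt with rfl | k1
    · rw [fL]; exact mem_UL.2 (Or.inr (Or.inr (Or.inl rfl)))
    rcases k3.eq_or_lt with rfl | k3
    · rw [fT x k1]; exact mem_UL.2 (Or.inr (Or.inr (Or.inr rfl)))
    rcases k2.eq_or_lt with rfl | k2
    · rw [fD x k1 k3]; exact (hd x k1 k3).1
    · rw [fI x y k1 k2 k3]; exact mem_UL.2 (Or.inl ⟨_, h.mem x ⟨k1, k5⟩ y ⟨k4, k3⟩ k2, rfl⟩)
  · intro x x' y k1 k2 k3 k4 k5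
    rcases k1.eq_or_lt with rfl | k1
    · rw [fL]; exact botle _
    rcases k4.eq_or_lt with rfl | k4
    · rw [fT x' (k1.trans k2)]; exact letop _
    rw [fI x y k1 (by linarith) k4]
    rcases k3.eq_or_lt with rfl | k3
    · rw [fD x' (by linarith) k4]; exact (hd x' (by linarith) k4).2.1 x k1 k2
    · rw [fI x' y (by linarith) k3 k4, le_real]
      exact h.le _ ⟨by linarith, by linarith⟩ _ ⟨by linarith, by linarith⟩ _ ⟨by linarith, by linarith⟩ _ ⟨by linarith, by linarith⟩
        (by linarith) k3 k2.le le_rfl (fun hh => by linarith [hh.1])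
  · intro x y y' k1 k2 k3 k4 k5
    rcases k1.eq_or_lt with rfl | k1
    · rw [fL]; exact botle _
    rcases k4.eq_or_lt with rfl | k4
    · rw [fT x k1]; exact letop _
    rw [fI x y' k1 (by linarith) k4]
    rcases k2.eq_or_lt with rfl | k2
    · rw [fD x k1 (by linarith)]; exact (hd x (by linarith) (by linarith)).2.2.1 y' k3 k4
    · rw [fI x y (by linarith) k2 (by linarith), le_real]
      exact h.le _ ⟨by linarith, by linarith⟩ _ ⟨by linarith, by linarith⟩ _ ⟨by linarith, by linarith⟩ _ ⟨by linarith, by linarith⟩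
        (by linarith) (by linarith) le_rfl k3.le (fun hh => by linarith [hh.2])
  · intro x y k1 k2 k3
    rw [fI x y k1 k2 k3]
    exact ⟨rfl, rfl, h.mem _ ⟨by linarith, by linarith⟩ _ ⟨by linarith, by linarith⟩ k2⟩
  · intro y; rw [fL]; exact null 2 (by norm_num)
  · intro x
    rcases le_or_gt x (-1) with k | k
    · rw [show lam0 l d x 1 = (2, [], []) by simp [lam0, k]]; exact null 2 (by norm_num)
    · rw [fT x k]; exact null 3 (by norm_num)
  · intro i hi x y k1 k2 k3 k4
    rcases k1.eq_or_lt with rfl | k1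
    · rw [fL] at k4; exact absurd k4 (null 2 (by norm_num) i hi).1
    rcases k3.eq_or_lt with rfl | k3
    · rw [fT x k1] at k4; exact absurd k4 (null 3 (by norm_num) i hi).1
    rw [fI x y k1 k2 k3] at k4
    obtain ⟨x', hx', y', hy', a1, a2, a3, a4, a5⟩ := h.demF i hi x ⟨k1, by linarith⟩ y ⟨by linarith, k3⟩ k2 k4.2
    exact ⟨x', y', a2, a3, a1, hy'.2.le, a4, by rw [fI x' y' hx'.1 a1 hy'.2]; exact ⟨rfl, a5⟩⟩
  · intro i hi x y k1 k2 k3 k4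
    rcases k1.eq_or_lt with rfl | k1
    · rw [fL] at k4; exact absurd k4 (null 2 (by norm_num) i hi).2.1
    rcases k3.eq_or_lt with rfl | k3
    · rw [fT x k1] at k4; exact absurd k4 (null 3 (by norm_num) i hi).2.1
    rw [fI x y k1 k2 k3] at k4
    obtain ⟨x', hx', y', hy', a1, a2, a3, a4, a5⟩ := h.demP i hi x ⟨k1, by linarith⟩ y ⟨by linarith, k3⟩ k2 k4.2
    exact ⟨x', y', a2, a3, a1, hx'.1.le, a4, by rw [fI x' y' hx'.1 a1 hy'.2]; exact ⟨rfl, a5⟩⟩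
  · intro w k1 k2
    unfold DCor
    rw [fD w k1 k2]
    rcases (hd w k1 k2).2.2.2 with k | ⟨k3, k4⟩
    · exact Or.inl k
    · refine Or.inr ⟨fun v hv => ?_, fun u hu => ?_⟩
      · obtain ⟨y, a1, a2, a3, a4⟩ := k3 v hv
        exact ⟨y, a1, a2, by rw [fI w y k1 a1 a3]; exact a4⟩
      · obtain ⟨y, a1, a2, a3, a4⟩ := k4 u hu
        exact ⟨y, a1, a2, by rw [fI y w a3 a2 k2]; exact a4⟩
  · refine ⟨by norm_num, fL 1, ⟨by norm_num, fun y _ _ => fL y⟩, ⟨by norm_num, fun x a _ => fT x a⟩⟩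

end Temporal

namespace Temporal

theorem decodeT_of {k : ℕ} {φ : TForm} (h : encodeT φ = k) : decodeT k = φ := by
  rw [← h, decodeT_encodeT]

theorem decodeT0 (i : ℕ) : decodeT (5 * i) = .prop i := decodeT_of rfl
theorem decodeT1 (i : ℕ) : decodeT (5 * i + 1) = .neg (decodeT i) :=
  decodeT_of (by rw [encodeT, encodeT_decodeT])
theorem decodeT2 (i : ℕ) : decodeT (5 * i + 2) = .or (decodeT i.unpair.1) (decodeT i.unpair.2) :=
  decodeT_of (by rw [encodeT, encodeT_decodeT, encodeT_decodeT, Nat.pair_unpair])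
theorem decodeT3 (i : ℕ) : decodeT (5 * i + 3) = .fut (decodeT i) :=
  decodeT_of (by rw [encodeT, encodeT_decodeT])
theorem decodeT4 (i : ℕ) : decodeT (5 * i + 4) = .past (decodeT i) :=
  decodeT_of (by rw [encodeT, encodeT_decodeT])

/-- The strict order of the half-plane. -/
def HR (p q : HalfPlane) : Prop := p.val ≤ q.val ∧ p.val ≠ q.val

theorem HR.trans {p q r : HalfPlane} (h1 : HR p q) (h2 : HR q r) : HR p r := by
  refine ⟨h1.1.trans h2.1, fun e => h1.2 (le_antisymm h1.1 ?_)⟩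
  rw [e]; exact h2.1

theorem HR_iff {x y x' y' : ℝ} (h : x < y) (h' : x' < y') :
    HR ⟨(x, y), h⟩ ⟨(x', y'), h'⟩ ↔ x ≤ x' ∧ y ≤ y' ∧ ¬ (x' = x ∧ y' = y) := by
  unfold HR
  simp only [Prod.mk_le_mk, ne_eq, Prod.mk.injEq, and_assoc]
  constructor
  · rintro ⟨a, b, c⟩; exact ⟨a, b, fun k => c ⟨k.1.symm, k.2.symm⟩⟩
  · rintro ⟨a, b, c⟩; exact ⟨a, b, fun k => c ⟨k.1.symm, k.2.symm⟩⟩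

/-- Coarse labellings of the half-plane. -/
structure HCoarse (n : ℕ) (L : HalfPlane → List ℕ) : Prop where
  mem : ∀ p, L p ∈ U0 n
  le : ∀ p q, HR p q → tle n (L p) (L q)
  demF : ∀ i < n + 1, ∀ p, 5 * i + 3 ∈ L p → ∃ q, HR p q ∧ ∃ t ∈ TY n, rep n t = L q ∧ i ∈ t
  demP : ∀ i < n + 1, ∀ p, 5 * i + 4 ∈ L p → ∃ q, HR q p ∧ ∃ t ∈ TY n, rep n t = L q ∧ i ∈ t

theorem HCoarse.of {n : ℕ} {l : ℝ → ℝ → List ℕ} (h : CoarseOn n Set.univ l) :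
    HCoarse n (fun p => l p.1.1 p.1.2) := by
  refine ⟨fun p => h.mem _ trivial _ trivial p.2, ?_, ?_, ?_⟩
  · rintro ⟨⟨x, y⟩, hp⟩ ⟨⟨x', y'⟩, hq⟩ k
    rw [HR_iff] at k
    exact h.le _ trivial _ trivial _ trivial _ trivial hp hq k.1 k.2.1 k.2.2
  · rintro i hi ⟨⟨x, y⟩, hp⟩ k
    obtain ⟨x', _, y', _, k1, k2, k3, k4, k5⟩ := h.demF i hi x trivial y trivial hp k
    exact ⟨⟨(x', y'), k1⟩, (HR_iff hp k1).2 ⟨k2, k3, k4⟩, k5⟩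
  · rintro i hi ⟨⟨x, y⟩, hp⟩ k
    obtain ⟨x', _, y', _, k1, k2, k3, k4, k5⟩ := h.demP i hi x trivial y trivial hp k
    exact ⟨⟨(x', y'), k1⟩, (HR_iff k1 hp).2 ⟨k2, k3, fun e => k4 ⟨e.1.symm, e.2.symm⟩⟩, k5⟩

theorem HCoarse.to {n : ℕ} {L : HalfPlane → List ℕ} (h : HCoarse n L) :
    ∃ l, CoarseOn n Set.univ l := by
  classical
  obtain ⟨g, e⟩ : ∃ g : ℝ → ℝ → List ℕ, ∀ x y (k : x < y), g x y = L ⟨(x, y), k⟩ :=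
    ⟨fun x y => if k : x < y then L ⟨(x, y), k⟩ else [], fun x y k => dif_pos k⟩
  refine ⟨g, ?_, ?_, ?_, ?_⟩
  · intro x _ y _ k; rw [e x y k]; exact h.mem _
  · intro x _ y _ x' _ y' _ k k' k1 k2 k3
    rw [e x y k, e x' y' k']
    exact h.le _ _ ((HR_iff k k').2 ⟨k1, k2, k3⟩)
  · intro i hi x _ y _ k k1
    rw [e x y k] at k1
    obtain ⟨⟨⟨x', y'⟩, k'⟩, k2, t, k3⟩ := h.demF i hi _ k1
    rw [HR_iff] at k2
    refine ⟨x', trivial, y', trivial, k', k2.1, k2.2.1, k2.2.2, t, ?_⟩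
    rw [e x' y' k']; exact k3
  · intro i hi x _ y _ k k1
    rw [e x y k] at k1
    obtain ⟨⟨⟨x', y'⟩, k'⟩, k2, t, k3⟩ := h.demP i hi _ k1
    rw [HR_iff] at k2
    refine ⟨x', trivial, y', trivial, k', k2.1, k2.2.1, fun e => k2.2.2 ⟨e.1.symm, e.2.symm⟩, t, ?_⟩
    rw [e x' y' k']; exact k3

theorem mem_TY {n : ℕ} {t : List ℕ} (h : t ∈ TY n) : OKt n t := by
  rw [TY, List.mem_filter, decide_eq_true_iff] at h; exact h.2

/-- Satisfying a formula everywhere gives a coarse labelling. -/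
theorem HCoarse.of_sat {n : ℕ} (v : ℕ → Set HalfPlane) (hv : ∀ p, TSat HR v (decodeT n) p) :
    ∃ L, HCoarse n L := by
  classical
  let ts : HalfPlane → List ℕ := fun p =>
    (List.range (5 * (n + 1))).filter (fun k => decide (TSat HR v (decodeT k) p))
  have hts : ∀ p k, k < 5 * (n + 1) → (k ∈ ts p ↔ TSat HR v (decodeT k) p) := by
    intro p k hk
    simp only [ts, List.mem_filter, List.mem_range, decide_eq_true_iff]
    exact and_iff_right hk
  have hTY : ∀ p, ts p ∈ TY n := by
    intro p
    rw [TY, List.mem_filter, decide_eq_true_iff]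
    refine ⟨filter_mem_subl _ _, (hts p n (by omega)).2 (hv p), fun i hi => ?_⟩
    have h1 := Nat.unpair_left_le i
    have h2 := Nat.unpair_right_le i
    rw [hts p _ (by omega), hts p _ (by omega), hts p _ (by omega), hts p _ (by omega), hts p _ (by omega),
      decodeT1, decodeT2]
    exact ⟨Iff.rfl, Iff.rfl⟩
  refine ⟨fun p => rep n (ts p), fun p => List.mem_map_of_mem (hTY p), ?_, ?_, ?_⟩
  · intro p q h
    rw [tle_rep]
    intro i hi
    rw [hts p _ (by omega), hts p _ (by omega), hts p _ (by omega), hts q _ (by omega), hts q _ (by omega),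
      hts q _ (by omega), decodeT3, decodeT4]
    refine ⟨?_, ?_⟩
    · rintro (k | ⟨r, k1, k2⟩)
      · exact ⟨q, h, k⟩
      · exact ⟨r, h.trans k1, k2⟩
    · rintro (k | ⟨r, k1, k2⟩)
      · exact ⟨p, h, k⟩
      · exact ⟨r, k1.trans h, k2⟩
  · intro i hi p h
    rw [rep3 hi, hts p _ (by omega), decodeT3] at h
    obtain ⟨q, h1, h2⟩ := h
    exact ⟨q, h1, ts q, hTY q, rfl, (hts q i (by omega)).2 h2⟩
  · intro i hi p h
    rw [rep4 hi, hts p _ (by omega), decodeT4] at h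
    obtain ⟨q, h1, h2⟩ := h
    exact ⟨q, h1, ts q, hTY q, rfl, (hts q i (by omega)).2 h2⟩

theorem demand {X α : Type} [DecidableEq α] (lt : X → X → Prop) (L : X → α) (U : List α) (le : α → α → Prop)
    (mem : ∀ p, L p ∈ U) (anti : ∀ a ∈ U, ∀ b ∈ U, le a b → le b a → a = b)
    (tr : ∀ a b c, le a b → le b c → le a c)
    (mono : ∀ p q, lt p q → le (L p) (L q)) (trans : ∀ p q r, lt p q → lt q r → lt p r) (Wt Gd : X → Prop)
    (step : ∀ q, Wt q → Gd q ∨ ∃ q', lt q q' ∧ Wt q')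
    (fin : ∀ q q', Wt q → lt q q' → L q' = L q → ∃ r, lt q r ∧ Gd r) :
    ∀ q, Wt q → ∃ r, (r = q ∨ lt q r) ∧ Gd r := by
  classical
  have key : ∀ m : ℕ, ∀ q, (U.toFinset.filter (fun a => le (L q) a ∧ a ≠ L q)).card < m → Wt q →
      ∃ r, (r = q ∨ lt q r) ∧ Gd r := by
    intro m
    induction m with
    | zero => intro q h; omega
    | succ m ih =>
      intro q hm hq
      rcases step q hq with h | ⟨q', h1, h2⟩
      · exact ⟨q, Or.inl rfl, h⟩
      by_cases e : L q' = L q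
      · obtain ⟨r, k1, k2⟩ := fin q q' hq h1 e
        exact ⟨r, Or.inr k1, k2⟩
      have hlt : (U.toFinset.filter (fun a => le (L q') a ∧ a ≠ L q')).card <
          (U.toFinset.filter (fun a => le (L q) a ∧ a ≠ L q)).card := by
        apply Finset.card_lt_card
        rw [Finset.ssubset_iff_of_subset]
        · refine ⟨L q', ?_, ?_⟩
          · simp only [Finset.mem_filter, List.mem_toFinset]
            exact ⟨mem _, mono _ _ h1, e⟩
          · simp
        · intro a
          simp only [Finset.mem_filter, List.mem_toFinset]
          rintro ⟨k1, k2, k3⟩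
          refine ⟨k1, tr _ _ _ (mono _ _ h1) k2, ?_⟩
          rintro rfl
          exact e (anti _ (mem _) _ (mem _) k2 (mono _ _ h1))
      obtain ⟨r, k1, k2⟩ := ih q' (by omega) h2
      refine ⟨r, Or.inr ?_, k2⟩
      rcases k1 with rfl | k1
      · exact h1
      · exact trans _ _ _ h1 k1
  exact fun q hq => key _ q (Nat.lt_succ_self _) hq

theorem HR.between {γ : ℝ → ℕ} (hγ : ∀ j a b, a < b → ∃ s, a < s ∧ s < b ∧ γ s = j) {p q : HalfPlane} (h : HR p q)
    (j : ℕ) : ∃ r, HR p r ∧ HR r q ∧ γ (r.1.1 + r.1.2) = j := by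
  obtain ⟨⟨x, y⟩, hp⟩ := p
  obtain ⟨⟨x', y'⟩, hq⟩ := q
  rw [HR_iff] at h
  obtain ⟨h1, h2, h3⟩ := h
  have hp' : x < y := hp
  have hq' : x' < y' := hq
  have hlt : x + y < x' + y' := by
    rcases h1.lt_or_eq with k | k
    · linarith
    · rcases h2.lt_or_eq with k2 | k2
      · linarith
      · exact absurd ⟨k.symm, k2.symm⟩ h3
  obtain ⟨s, s1, s2, s3⟩ := hγ j _ _ hlt
  obtain ⟨c, hc⟩ : ∃ c, c = (s - (x + y)) / (x' + y' - (x + y)) := ⟨_, rfl⟩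
  have hd : 0 < x' + y' - (x + y) := by linarith
  have c0 : 0 < c := by rw [hc]; apply div_pos <;> linarith
  have c1 : c < 1 := by rw [hc, div_lt_one hd]; linarith
  have cs : c * (x' + y' - (x + y)) = s - (x + y) := by rw [hc]; field_simp
  have e1 : x + c * (x' - x) < y + c * (y' - y) := by nlinarith
  have a1 : 0 ≤ c * (x' - x) := mul_nonneg c0.le (by linarith)
  have a2 : 0 ≤ c * (y' - y) := mul_nonneg c0.le (by linarith)
  have a3 : 0 ≤ (1 - c) * (x' - x) := mul_nonneg (by linarith) (by linarith)
  have a4 : 0 ≤ (1 - c) * (y' - y) := mul_nonneg (by linarith) (by linarith)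
  have es : x + c * (x' - x) + (y + c * (y' - y)) = s := by linarith
  refine ⟨⟨(x + c * (x' - x), y + c * (y' - y)), e1⟩, ?_, ?_, ?_⟩
  · rw [HR_iff]; exact ⟨by linarith, by linarith, fun e => by linarith [e.1, e.2]⟩
  · rw [HR_iff]; exact ⟨by linarith, by linarith, fun e => by linarith [e.1, e.2]⟩
  · change γ (x + c * (x' - x) + (y + c * (y' - y))) = j
    rw [es]; exact s3

/-- A coarse labelling yields a valuation satisfying the formula everywhere. -/
theorem HCoarse.sat {n : ℕ} {L : HalfPlane → List ℕ} (h : HCoarse n L) :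
    ∃ v : ℕ → Set HalfPlane, ∀ p, TSat HR v (decodeT n) p := by
  classical
  obtain ⟨γ, hγ, _⟩ := exists_colour
  have hex : ∀ p : HalfPlane, ∃ t, t ∈ TY n ∧ rep n t = L p ∧
      ∀ s, (TY n)[γ (p.1.1 + p.1.2)]? = some s → rep n s = L p → t = s := by
    intro p
    by_cases k : ∃ s, (TY n)[γ (p.1.1 + p.1.2)]? = some s ∧ rep n s = L p
    · obtain ⟨s, k1, k2⟩ := k
      refine ⟨s, List.mem_of_getElem? k1, k2, fun s' k3 _ => ?_⟩
      rw [k1] at k3; exact Option.some.inj k3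
    · obtain ⟨t, k1, k2⟩ := List.mem_map.1 (h.mem p)
      exact ⟨t, k1, k2, fun s k3 k4 => absurd ⟨s, k3, k4⟩ k⟩
  choose τ hT hL hc using hex
  have irr : ∀ q t, t ∈ TY n → rep n t = L q → ¬ tle n t t → τ q = t := by
    intro q t _ e k
    have : ¬ tle n (τ q) (τ q) := by
      rw [← tle_rep, hL, ← e, tle_rep]; exact k
    rw [← rep_irr this, hL, ← e, rep_irr k]
  have fin : ∀ q q' t, t ∈ TY n → rep n t = L q → (HR q q' ∨ HR q' q) → L q' = L q →
      ∃ r, (HR q q' → HR q r) ∧ (HR q' q → HR r q) ∧ τ r = t := by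
    intro q q' t ht e hq eL
    obtain ⟨j, hj⟩ := List.mem_iff_getElem?.1 ht
    have main : ∀ q1 q2, HR q1 q2 → L q1 = L q → L q2 = L q → ∃ r, HR q1 r ∧ HR r q2 ∧ τ r = t := by
      intro q1 q2 h12 e1 e2
      obtain ⟨r, r1, r2, r3⟩ := h12.between hγ j
      refine ⟨r, r1, r2, hc r t (by rw [r3]; exact hj) ?_⟩
      rw [e]
      refine U0_anti (h.mem _) (h.mem _) ?_ ?_
      · rw [← e1]; exact h.le _ _ r1
      · rw [← e2]; exact h.le _ _ r2
    have ns : ∀ a b, HR a b → ¬ HR b a := fun a b k1 k2 => k1.2 (le_antisymm k1.1 k2.1)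
    rcases hq with hq | hq
    · obtain ⟨r, r1, r2, r3⟩ := main q q' hq rfl eL
      exact ⟨r, fun _ => r1, fun k => absurd k (ns _ _ hq), r3⟩
    · obtain ⟨r, r1, r2, r3⟩ := main q' q hq eL rfl
      exact ⟨r, fun k => absurd k (ns _ _ hq), fun _ => r2, r3⟩
  have dF : ∀ i < n + 1, ∀ q, (∃ t ∈ TY n, rep n t = L q ∧ i ∈ t) → ∃ r, (r = q ∨ HR q r) ∧ i ∈ τ r := by
    intro i hi
    refine demand HR L (U0 n) (tle n) h.mem (fun a ha b hb => U0_anti ha hb) (fun _ _ _ => tle.trans) h.le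
      (fun _ _ _ => HR.trans) _ _ ?_ ?_
    · rintro q ⟨t, h1, h2, h3⟩
      by_cases k : tle n t t
      · right
        refine h.demF i hi q ?_
        rw [← h2, rep3 hi]
        exact (k i hi).1 (Or.inl h3)
      · left; rw [irr q t h1 h2 k]; exact h3
    · rintro q q' ⟨t, h1, h2, h3⟩ h4 h5
      obtain ⟨r, k1, _, k3⟩ := fin q q' t h1 h2 (Or.inl h4) h5
      exact ⟨r, k1 h4, by rw [k3]; exact h3⟩
  have dP : ∀ i < n + 1, ∀ q, (∃ t ∈ TY n, rep n t = L q ∧ i ∈ t) → ∃ r, (r = q ∨ HR r q) ∧ i ∈ τ r := by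
    intro i hi
    refine demand (fun p q => HR q p) L (U0 n) (fun a b => tle n b a) h.mem
      (fun a ha b hb k1 k2 => U0_anti ha hb k2 k1) (fun _ _ _ k1 k2 => tle.trans k2 k1) (fun p q k => h.le q p k)
      (fun _ _ _ k1 k2 => HR.trans k2 k1) _ _ ?_ ?_
    · rintro q ⟨t, h1, h2, h3⟩
      by_cases k : tle n t t
      · right
        refine h.demP i hi q ?_
        rw [← h2, rep4 hi]
        exact (k i hi).2 (Or.inl h3)
      · left; rw [irr q t h1 h2 k]; exact h3
    · rintro q q' ⟨t, h1, h2, h3⟩ h4 h5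
      obtain ⟨r, _, k2, k3⟩ := fin q q' t h1 h2 (Or.inr h4) h5
      exact ⟨r, k2 h4, by rw [k3]; exact h3⟩
  have ltτ : ∀ p q, HR p q → tle n (τ p) (τ q) := by
    intro p q k
    rw [← tle_rep, hL, hL]; exact h.le _ _ k
  refine ⟨fun j => {p | 5 * j ∈ τ p}, ?_⟩
  have truth : ∀ k, k < 5 * (n + 1) → ∀ p, TSat HR (fun j => {p | 5 * j ∈ τ p}) (decodeT k) p ↔ k ∈ τ p := by
    intro k
    induction k using Nat.strong_induction_on with
    | _ k ih =>
      intro hk p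
      obtain ⟨i, e⟩ : ∃ i, i = k / 5 := ⟨_, rfl⟩
      have hi : i < n + 1 := by omega
      have hcase : k = 5 * i ∨ k = 5 * i + 1 ∨ k = 5 * i + 2 ∨ k = 5 * i + 3 ∨ k = 5 * i + 4 := by omega
      clear e
      have ok := (mem_TY (hT p)).2 i hi
      rcases hcase with rfl | rfl | rfl | rfl | rfl
      · rw [decodeT0]; exact Iff.rfl
      · rw [decodeT1, ok.1, ← ih i (by omega) (by omega) p]; exact Iff.rfl
      · have h1 := Nat.unpair_left_le i
        have h2 := Nat.unpair_right_le i
        rw [decodeT2, ok.2, ← ih _ (by omega) (by omega) p, ← ih (Nat.unpair i).2 (by omega) (by omega) p]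
        exact Iff.rfl
      · rw [decodeT3]
        constructor
        · rintro ⟨q, h1, h2⟩
          rw [ih i (by omega) (by omega)] at h2
          exact (ltτ _ _ h1 i hi).1 (Or.inl h2)
        · intro h1
          rw [← rep3 hi, hL] at h1
          obtain ⟨q, k1, k2⟩ := h.demF i hi p h1
          obtain ⟨r, k3, k4⟩ := dF i hi q k2
          refine ⟨r, ?_, (ih i (by omega) (by omega) r).2 k4⟩
          rcases k3 with rfl | k3
          · exact k1
          · exact k1.trans k3
      · rw [decodeT4]
        constructor
        · rintro ⟨q, h1, h2⟩
          rw [ih i (by omega) (by omega)] at h2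
          exact (ltτ _ _ h1 i hi).2 (Or.inl h2)
        · intro h1
          rw [← rep4 hi, hL] at h1
          obtain ⟨q, k1, k2⟩ := h.demP i hi p h1
          obtain ⟨r, k3, k4⟩ := dP i hi q k2
          refine ⟨r, ?_, (ih i (by omega) (by omega) r).2 k4⟩
          rcases k3 with rfl | k3
          · exact k1
          · exact k3.trans k1
  exact fun p => (truth n (by omega) p).2 (mem_TY (hT p)).1

theorem coarse_iff (n : ℕ) : (∃ l, CoarseOn n (Set.Ioo (-1) 1) l) ↔
    ∃ v : ℕ → Set HalfPlane, ∀ p, TSat HR v (decodeT n) p := by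
  have e : (Set.univ : Set ℝ) ≃o (Set.Ioo (-1 : ℝ) 1) := (OrderIso.Set.univ).trans (orderIsoIooNegOneOne ℝ)
  constructor
  · rintro ⟨l, h⟩
    obtain ⟨l', h'⟩ := h.transport e
    exact (HCoarse.of h').sat
  · rintro ⟨v, h⟩
    obtain ⟨L, hL⟩ := HCoarse.of_sat v h
    obtain ⟨l, hl⟩ := hL.to
    exact hl.transport e.symm

theorem valid_iff (φ : TForm) : TValid HR φ ↔
    ¬ ∃ l, CoarseOn (5 * (5 * (5 * encodeT φ + 1) + 4) + 3) (Set.Ioo (-1) 1) l := by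
  rw [coarse_iff, decodeT3, decodeT4, decodeT1, decodeT_encodeT]
  unfold TValid
  constructor
  · rintro h ⟨v, hv⟩
    obtain ⟨q, _, r, _, h3⟩ := hv ⟨(0, 1), by norm_num⟩
    exact h3 (h v r)
  · intro h v x
    by_contra hx
    refine h ⟨v, fun p => ?_⟩
    obtain ⟨⟨a, b⟩, hp⟩ := p
    obtain ⟨⟨c, d⟩, hq⟩ := x
    have hp' : a < b := hp
    have hq' : c < d := hq
    have e1 := le_max_left a c
    have e2 := le_max_right a c
    have e3 := le_max_left b d
    have e4 := le_max_right b d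
    have hlt : max a c < max b d + 1 := by
      rcases max_choice a c with k | k <;> rw [k] <;> linarith
    refine ⟨⟨(max a c, max b d + 1), hlt⟩, ?_, ⟨(c, d), hq⟩, ?_, hx⟩
    · rw [HR_iff]; exact ⟨e1, by linarith, fun k => by linarith [k.2]⟩
    · rw [HR_iff]; exact ⟨e2, by linarith, fun k => by linarith [k.2]⟩

end Temporal

namespace Temporal

section Prim
variable {α β σ T : Type} [Primcodable α] [Primcodable β] [Primcodable σ] [Primcodable T]

theorem pAnd {p q : α → Prop} (hp : PrimrecPred p) (hq : PrimrecPred q) : PrimrecPred fun a => p a ∧ q a := hp.and hq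
theorem pOr {p q : α → Prop} (hp : PrimrecPred p) (hq : PrimrecPred q) : PrimrecPred fun a => p a ∨ q a := hp.or hq
theorem pNot {p : α → Prop} (hp : PrimrecPred p) : PrimrecPred fun a => ¬ p a := hp.not
theorem pImp {p q : α → Prop} (hp : PrimrecPred p) (hq : PrimrecPred q) : PrimrecPred fun a => p a → q a :=
  (pOr (pNot hp) hq).of_eq fun _ => imp_iff_not_or.symm
theorem pIff {p q : α → Prop} (hp : PrimrecPred p) (hq : PrimrecPred q) : PrimrecPred fun a => (p a ↔ q a) :=
  (pAnd (pImp hp hq) (pImp hq hp)).of_eq fun _ => iff_iff_implies_and_implies.symm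
theorem pAll {L : α → List β} {p : α → β → Prop} (hL : Primrec L) (hp : PrimrecPred fun q : α × β => p q.1 q.2) :
    PrimrecPred fun a => ∀ b ∈ L a, p a b := by
  have : PrimrecRel fun (b : β) (a : α) => p a b := hp.comp (Primrec.snd.pair Primrec.fst)
  exact this.forall_mem_list.comp hL Primrec.id
theorem pEx {L : α → List β} {p : α → β → Prop} (hL : Primrec L) (hp : PrimrecPred fun q : α × β => p q.1 q.2) :
    PrimrecPred fun a => ∃ b ∈ L a, p a b := by
  have : PrimrecRel fun (b : β) (a : α) => p a b := hp.comp (Primrec.snd.pair Primrec.fst)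
  exact this.exists_mem_list.comp hL Primrec.id
theorem pLt {N : α → ℕ} {p : α → ℕ → Prop} (hL : Primrec N) (hp : PrimrecPred fun q : α × ℕ => p q.1 q.2) :
    PrimrecPred fun a => ∀ b < N a, p a b :=
  (pAll (Primrec.list_range.comp hL) hp).of_eq fun a => by simp only [List.mem_range]
theorem pEq {f g : α → β} (hf : Primrec f) (hg : Primrec g) : PrimrecPred fun a => f a = g a := by
  classical
  exact Primrec.eq.comp hf hg
theorem pMem {L : α → List β} {g : α → β} (hL : Primrec L) (hg : Primrec g) : PrimrecPred fun a => g a ∈ L a :=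
  (pEx (p := fun a b => b = g a) hL (pEq Primrec.snd (hg.comp Primrec.fst))).of_eq fun a => by simp
theorem fFst {f : α → β × σ} (hf : Primrec f) : Primrec fun a => (f a).1 := Primrec.fst.comp hf
theorem fSnd {f : α → β × σ} (hf : Primrec f) : Primrec fun a => (f a).2 := Primrec.snd.comp hf
theorem fPair {f : α → β} {g : α → σ} (hf : Primrec f) (hg : Primrec g) : Primrec fun a => (f a, g a) := hf.pair hg
theorem fNil : Primrec fun _ : α => ([] : List β) := Primrec.const _
theorem fCons {f : α → β} {g : α → List β} (hf : Primrec f) (hg : Primrec g) : Primrec fun a => f a :: g a :=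
  Primrec.list_cons.comp hf hg
theorem fApp {f g : α → List β} (hf : Primrec f) (hg : Primrec g) : Primrec fun a => f a ++ g a :=
  Primrec.list_append.comp hf hg
theorem fAdd {f : α → ℕ} (hf : Primrec f) (k : ℕ) : Primrec fun a => f a + k :=
  Primrec.nat_add.comp hf (Primrec.const k)
theorem fMul {f : α → ℕ} (hf : Primrec f) (k : ℕ) : Primrec fun a => k * f a :=
  Primrec.nat_mul.comp (Primrec.const k) hf
theorem fMap {L : α → List β} {f : α → β → σ} (hL : Primrec L) (hf : Primrec fun q : α × β => f q.1 q.2) :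
    Primrec fun a => (L a).map (f a) := Primrec.list_map hL hf
theorem fFlat {L : α → List β} {f : α → β → List σ} (hL : Primrec L) (hf : Primrec fun q : α × β => f q.1 q.2) :
    Primrec fun a => (L a).flatMap (f a) := Primrec.list_flatMap hL hf
theorem fFilter {L : α → List β} {p : α → β → Prop} [∀ a b, Decidable (p a b)] (hL : Primrec L)
    (hp : PrimrecPred fun q : α × β => p q.1 q.2) :
    Primrec fun a => (L a).filter fun b => decide (p a b) := by
  classical
  have : PrimrecRel fun (b : β) (a : α) => p a b := hp.comp (Primrec.snd.pair Primrec.fst)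
  exact (this.listFilter.comp hL Primrec.id).of_eq fun a => by simp only [id]
theorem fIte {p : α → Prop} [∀ a, Decidable (p a)] {f g : α → β} (hp : PrimrecPred p) (hf : Primrec f) (hg : Primrec g) :
    Primrec fun a => if p a then f a else g a := Primrec.ite hp hf hg
theorem fSubl {L : α → List β} (hL : Primrec L) : Primrec fun a => subl (L a) := by
  refine Primrec.list_foldr (h := fun _ q => q.2 ++ q.2.map (List.cons q.1)) hL (Primrec.const [[]]) ?_
  refine fApp (fSnd Primrec.snd) (fMap (fSnd Primrec.snd) (fCons ?_ Primrec.snd))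
  exact fFst (fSnd Primrec.fst)

/-- A uniformly primitive recursive family of label systems. -/
structure PSys (Sf : α → Sys T) : Prop where
  N : Primrec fun a => (Sf a).N
  le' : PrimrecPred fun q : α × T × T => (Sf q.1).le q.2.1 q.2.2
  rl' : PrimrecPred fun q : α × T => (Sf q.1).rl q.2
  nF' : PrimrecPred fun q : α × ℕ × T => (Sf q.1).nF q.2.1 q.2.2
  nP' : PrimrecPred fun q : α × ℕ × T => (Sf q.1).nP q.2.1 q.2.2
  w' : PrimrecPred fun q : α × ℕ × T => (Sf q.1).w q.2.1 q.2.2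

theorem PSys.comp {Sf : α → Sys T} (h : PSys Sf) {f : β → α} (hf : Primrec f) : PSys fun b => Sf (f b) :=
  ⟨h.N.comp hf, h.le'.comp (fPair (hf.comp Primrec.fst) Primrec.snd), h.rl'.comp (fPair (hf.comp Primrec.fst) Primrec.snd),
    h.nF'.comp (fPair (hf.comp Primrec.fst) Primrec.snd), h.nP'.comp (fPair (hf.comp Primrec.fst) Primrec.snd),
    h.w'.comp (fPair (hf.comp Primrec.fst) Primrec.snd)⟩

theorem PSys.up {Sf : α → Sys T} (h : PSys Sf) : PSys fun b : α × β => Sf b.1 := h.comp Primrec.fst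

theorem PSys.op {Sf : α → Sys T} (h : PSys Sf) : PSys fun b => (Sf b).op :=
  ⟨h.N, h.le'.comp (fPair Primrec.fst (fPair (fSnd Primrec.snd) (fFst Primrec.snd))), h.rl', h.nP', h.nF', h.w'⟩

theorem PSys.le {Sf : α → Sys T} (h : PSys Sf) {s t : α → T} (hs : Primrec s) (ht : Primrec t) :
    PrimrecPred fun a => (Sf a).le (s a) (t a) := h.le'.comp (fPair Primrec.id (fPair hs ht))
theorem PSys.rl {Sf : α → Sys T} (h : PSys Sf) {s : α → T} (hs : Primrec s) :
    PrimrecPred fun a => (Sf a).rl (s a) := h.rl'.comp (fPair Primrec.id hs)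
theorem PSys.nF {Sf : α → Sys T} (h : PSys Sf) {s : α → ℕ} {t : α → T} (hs : Primrec s) (ht : Primrec t) :
    PrimrecPred fun a => (Sf a).nF (s a) (t a) := h.nF'.comp (fPair Primrec.id (fPair hs ht))
theorem PSys.nP {Sf : α → Sys T} (h : PSys Sf) {s : α → ℕ} {t : α → T} (hs : Primrec s) (ht : Primrec t) :
    PrimrecPred fun a => (Sf a).nP (s a) (t a) := h.nP'.comp (fPair Primrec.id (fPair hs ht))
theorem PSys.w {Sf : α → Sys T} (h : PSys Sf) {s : α → ℕ} {t : α → T} (hs : Primrec s) (ht : Primrec t) :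
    PrimrecPred fun a => (Sf a).w (s a) (t a) := h.w'.comp (fPair Primrec.id (fPair hs ht))
theorem PSys.gF {Sf : α → Sys T} (h : PSys Sf) {s : α → ℕ} {t : α → T} (hs : Primrec s) (ht : Primrec t) :
    PrimrecPred fun a => (Sf a).gF (s a) (t a) := pOr (h.nF hs ht) (h.w hs ht)
theorem PSys.gP {Sf : α → Sys T} (h : PSys Sf) {s : α → ℕ} {t : α → T} (hs : Primrec s) (ht : Primrec t) :
    PrimrecPred fun a => (Sf a).gP (s a) (t a) := pOr (h.nP hs ht) (h.w hs ht)

theorem fLetters {f : α → Wd T} (hf : Primrec f) : Primrec fun a => letters (f a) := by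
  refine fCons (fFst hf) ?_
  exact fFlat (fSnd hf) (fCons (fFst Primrec.snd) (fCons (fSnd Primrec.snd) fNil))
theorem fLast {f : α → Wd T} (hf : Primrec f) : Primrec fun a => lastW (f a) := by
  exact Primrec.list_foldl (h := fun _ (q : T × (T × T)) => q.2.2) (fSnd hf) (fFst hf) (fSnd (fSnd Primrec.snd))
theorem fRev {f : α → Wd T} (hf : Primrec f) : Primrec fun a => revW (f a) := by
  refine Primrec.list_foldl (h := fun _ q => revStep q.1 q.2) (fSnd hf) (fPair (fFst hf) fNil) ?_
  have h1 : Primrec fun q : α × (Wd T × (T × T)) => q.2.1 := fFst Primrec.snd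
  have h2 : Primrec fun q : α × (Wd T × (T × T)) => q.2.2 := fSnd Primrec.snd
  exact fPair (fSnd h2) (fCons (fPair (fFst h2) (fFst h1)) (fSnd h1))

theorem suf_iff (C : T → T → List (T × T) → Prop) (L : List (T × T)) :
    Suf C L ↔ ∀ k < L.length, ∀ p ∈ (L.drop k).take 1, C p.1 p.2 (L.drop (k + 1)) := by
  induction L with
  | nil => simp [Suf]
  | cons p L ih =>
    rw [Suf, ih]
    constructor
    · rintro ⟨h1, h2⟩ k hk p' hp
      cases k with
      | zero => simp at hp; subst hp; simpa using h1
      | succ k => exact h2 k (by simpa using hk) p' (by simpa using hp)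
    · intro h
      refine ⟨by simpa using h 0 (by simp) p (by simp), fun k hk p' hp => ?_⟩
      have := h (k + 1) (by simpa using hk) p' (by simpa using hp)
      simpa using this

theorem pSuf {C : α → T → T → List (T × T) → Prop} {L : α → List (T × T)} (hL : Primrec L)
    (hC : PrimrecPred fun q : α × T × T × List (T × T) => C q.1 q.2.1 q.2.2.1 q.2.2.2) :
    PrimrecPred fun a => Suf (C a) (L a) := by
  refine PrimrecPred.of_eq ?_ fun a => (suf_iff (C a) (L a)).symm
  refine pLt (Primrec.list_length.comp hL) ?_
  refine pAll (Primrec.list_take.comp (Primrec.const 1) (Primrec.list_drop.comp Primrec.snd (hL.comp Primrec.fst))) ?_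
  refine hC.comp (f := fun q : (α × ℕ) × T × T => (q.1.1, q.2.1, q.2.2, (L q.1.1).drop (q.1.2 + 1))) ?_
  exact fPair (fFst Primrec.fst) (fPair (fFst Primrec.snd) (fPair (fSnd Primrec.snd)
    (Primrec.list_drop.comp (fAdd (fSnd Primrec.fst) 1) (hL.comp (fFst Primrec.fst)))))

end Prim
end Temporal

namespace Temporal

section Rules
variable {α T : Type} [Primcodable α] [Primcodable T]

theorem pChn {Sf : α → Sys T} (hS : PSys Sf) {q : α → T} {L : α → List (T × T)} (hq : Primrec q) (hL : Primrec L) :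
    PrimrecPred fun a => Chn (Sf a) (q a) (L a) := by
  refine pSuf hL ?_
  have h := hS.up (β := T × T × List (T × T))
  have t1 : Primrec fun q : α × T × T × List (T × T) => q.2.1 := fFst Primrec.snd
  have t2 : Primrec fun q : α × T × T × List (T × T) => q.2.2.1 := fFst (fSnd Primrec.snd)
  have t3 : Primrec fun q : α × T × T × List (T × T) => q.2.2.2 := fSnd (fSnd Primrec.snd)
  exact pAnd (h.le t1 t2) (pAnd (h.le t2 t2) (pAnd (pAll t3 (h.up.le (t2.comp Primrec.fst) (fFst Primrec.snd)))
    (h.le t2 (hq.comp Primrec.fst))))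

theorem pLineF {Sf : α → Sys T} (hS : PSys Sf) {i : α → ℕ} (hi : Primrec i) {fb : α → Prop} (hfb : PrimrecPred fb)
    {q : α → T} {L : α → List (T × T)} (hq : Primrec q) (hL : Primrec L) :
    PrimrecPred fun a => LineF (Sf a) (i a) (fb a) (q a) (L a) := by
  refine pSuf hL ?_
  have h := hS.up (β := T × T × List (T × T))
  have t1 : Primrec fun q : α × T × T × List (T × T) => q.2.1 := fFst Primrec.snd
  have t2 : Primrec fun q : α × T × T × List (T × T) => q.2.2.1 := fFst (fSnd Primrec.snd)
  have t3 : Primrec fun q : α × T × T × List (T × T) => q.2.2.2 := fSnd (fSnd Primrec.snd)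
  have t4 : Primrec fun q : α × T × T × List (T × T) => i q.1 := hi.comp Primrec.fst
  exact pImp (pOr (h.nF t4 t1) (h.nF t4 t2)) (pOr (h.w t4 t2) (pOr (pEx t3 (pOr
    (h.up.w (t4.comp Primrec.fst) (fFst Primrec.snd)) (h.up.w (t4.comp Primrec.fst) (fSnd Primrec.snd))))
    (pOr (h.w t4 (hq.comp Primrec.fst)) (hfb.comp Primrec.fst))))

theorem pAllL {w : α → Wd T} (hw : Primrec w) {p : α → T → Prop} (hp : PrimrecPred fun q : α × T => p q.1 q.2) :
    PrimrecPred fun a => ∀ t ∈ letters (w a), p a t := pAll (fLetters hw) hp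
theorem pRl {Sf : α → Sys T} (hS : PSys Sf) {w : α → Wd T} (hw : Primrec w) :
    PrimrecPred fun a => ∀ t ∈ letters (w a), (Sf a).rl t := pAll (fLetters hw) (hS.up.rl Primrec.snd)

theorem pTrivF {Sf : α → Sys T} (hS : PSys Sf) {τ : α → Tile T} (hτ : Primrec τ) {c : α → T} (hc : Primrec c) :
    PrimrecPred fun a => TrivF (Sf a) (τ a) (c a) := by
  have ll : Primrec fun a => (τ a).ll := fFst (fFst hτ)
  have lr : Primrec fun a => (τ a).lr := fFst (fSnd (fFst hτ))
  have ul : Primrec fun a => (τ a).ul := fFst (fSnd (fSnd (fFst hτ)))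
  have ur : Primrec fun a => (τ a).ur := fSnd (fSnd (fSnd (fFst hτ)))
  have wl : Primrec fun a => (τ a).wl := fFst (fSnd hτ)
  have wr : Primrec fun a => (τ a).wr := fFst (fSnd (fSnd hτ))
  have wb : Primrec fun a => (τ a).wb := fFst (fSnd (fSnd (fSnd hτ)))
  have wt : Primrec fun a => (τ a).wt := fSnd (fSnd (fSnd (fSnd hτ)))
  have h := hS.up (β := ℕ)
  have i0 : Primrec fun q : α × ℕ => q.2 := Primrec.snd
  have up : ∀ {β : Type} [Primcodable β] {f : α → β}, Primrec f → Primrec fun q : α × ℕ => f q.1 :=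
    fun hf => hf.comp Primrec.fst
  have k1 : PrimrecPred fun a => ∀ i < (Sf a).N, (Sf a).nF i (τ a).ll → (∃ t ∈ letters (τ a).wl, (Sf a).w i t) ∨
      (∃ t ∈ letters (τ a).wb, (Sf a).w i t) ∨ (Sf a).gF i (τ a).ul ∨ (Sf a).gF i (τ a).lr ∨ (Sf a).gF i (c a) :=
    pLt hS.N (pImp (h.nF i0 (up ll)) (pOr (pEx (up (fLetters wl)) (h.up.w (i0.comp Primrec.fst) Primrec.snd))
      (pOr (pEx (up (fLetters wb)) (h.up.w (i0.comp Primrec.fst) Primrec.snd))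
      (pOr (h.gF i0 (up ul)) (pOr (h.gF i0 (up lr)) (h.gF i0 (up hc)))))))
  have k2 : PrimrecPred fun a => ∀ i < (Sf a).N, (Sf a).nF i (c a) → (Sf a).w i (c a) ∨ (Sf a).gF i (τ a).ur ∨
      (Sf a).gF i (lastW (τ a).wt) ∨ (Sf a).gF i (lastW (τ a).wr) :=
    pLt hS.N (pImp (h.nF i0 (up hc)) (pOr (h.w i0 (up hc)) (pOr (h.gF i0 (up ur))
      (pOr (h.gF i0 (up (fLast wt))) (h.gF i0 (up (fLast wr)))))))
  have k3 : PrimrecPred fun a => ∀ i < (Sf a).N, LineF (Sf a) i ((Sf a).nF i (τ a).ul ∨ (Sf a).gF i (c a)) (τ a).ul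
      (((τ a).wl.1, (τ a).wl.1) :: (τ a).wl.2) :=
    pLt hS.N (pLineF h i0 (pOr (h.nF i0 (up ul)) (h.gF i0 (up hc))) (up ul)
      (up (fCons (fPair (fFst wl) (fFst wl)) (fSnd wl))))
  have k4 : PrimrecPred fun a => ∀ i < (Sf a).N, LineF (Sf a) i ((Sf a).nF i (τ a).lr ∨ (Sf a).gF i (c a)) (τ a).lr
      (((τ a).wb.1, (τ a).wb.1) :: (τ a).wb.2) :=
    pLt hS.N (pLineF h i0 (pOr (h.nF i0 (up lr)) (h.gF i0 (up hc))) (up lr)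
      (up (fCons (fPair (fFst wb) (fFst wb)) (fSnd wb))))
  have k5 : PrimrecPred fun a => ∀ t ∈ letters (τ a).wl, (Sf a).le t (c a) :=
    pAllL wl (hS.up.le Primrec.snd (hc.comp Primrec.fst))
  have k6 : PrimrecPred fun a => ∀ t ∈ letters (τ a).wb, (Sf a).le t (c a) :=
    pAllL wb (hS.up.le Primrec.snd (hc.comp Primrec.fst))
  refine (pAnd (pChn hS ul (fCons (fPair ll (fFst wl)) (fSnd wl)))
    (pAnd (pChn hS lr (fCons (fPair ll (fFst wb)) (fSnd wb)))
    (pAnd k5 (pAnd k6 (pAnd k3 (pAnd k4 (pAnd k1 k2))))))).of_eq fun a => ?_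
  exact ⟨fun ⟨a1, a2, a3, a4, a5, a6, a7, a8⟩ => ⟨a1, a2, a3, a4, a5, a6, a7, a8⟩,
    fun ⟨a1, a2, a3, a4, a5, a6, a7, a8⟩ => ⟨a1, a2, a3, a4, a5, a6, a7, a8⟩⟩

/-- Primitive recursive tile-valued function, with all components. -/
structure PTile (τ : α → Tile T) : Prop where
  all : Primrec τ
  ll : Primrec fun a => (τ a).ll
  lr : Primrec fun a => (τ a).lr
  ul : Primrec fun a => (τ a).ul
  ur : Primrec fun a => (τ a).ur
  wl : Primrec fun a => (τ a).wl
  wr : Primrec fun a => (τ a).wr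
  wb : Primrec fun a => (τ a).wb
  wt : Primrec fun a => (τ a).wt

theorem PTile.of {τ : α → Tile T} (hτ : Primrec τ) : PTile τ :=
  ⟨hτ, fFst (fFst hτ), fFst (fSnd (fFst hτ)), fFst (fSnd (fSnd (fFst hτ))), fSnd (fSnd (fSnd (fFst hτ))),
    fFst (fSnd hτ), fFst (fSnd (fSnd hτ)), fFst (fSnd (fSnd (fSnd hτ))), fSnd (fSnd (fSnd (fSnd hτ)))⟩

theorem fMk {ll lr ul ur : α → T} {wl wr wb wt : α → Wd T} (h1 : Primrec ll) (h2 : Primrec lr) (h3 : Primrec ul)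
    (h4 : Primrec ur) (h5 : Primrec wl) (h6 : Primrec wr) (h7 : Primrec wb) (h8 : Primrec wt) :
    Primrec fun a => Tile.mk' (ll a) (lr a) (ul a) (ur a) (wl a) (wr a) (wb a) (wt a) :=
  fPair (fPair h1 (fPair h2 (fPair h3 h4))) (fPair h5 (fPair h6 (fPair h7 h8)))

theorem PTile.dual {τ : α → Tile T} (h : PTile τ) : Primrec fun a => (τ a).dual :=
  fMk h.ur h.lr h.ul h.ll (fRev h.wt) (fRev h.wb) (fRev h.wr) (fRev h.wl)
theorem PTile.swp {τ : α → Tile T} (h : PTile τ) : Primrec fun a => (τ a).swp :=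
  fMk h.ll h.ul h.lr h.ur h.wb h.wt h.wl h.wr

theorem pRuleTriv {Sf : α → Sys T} (hS : PSys Sf) {U : α → List T} (hU : Primrec U) {τ : α → Tile T} (hτ : Primrec τ) :
    PrimrecPred fun a => RuleTriv (Sf a) (U a) (τ a) := by
  refine pEx hU (pAnd (hS.up.rl Primrec.snd) (pAnd (hS.up.le Primrec.snd Primrec.snd) (pAnd ?_ ?_)))
  · exact pTrivF hS.up (hτ.comp Primrec.fst) Primrec.snd
  · exact pTrivF hS.up.op ((PTile.of hτ).dual.comp Primrec.fst) Primrec.snd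

theorem pJoin {w1 w2 w : α → Wd T} {m : α → T} (h1 : Primrec w1) (hm : Primrec m) (h2 : Primrec w2) (h : Primrec w) :
    PrimrecPred fun a => Join (w1 a) (m a) (w2 a) (w a) :=
  pOr (pEq h (fPair (fFst h1) (fApp (fSnd h1) (fCons (fPair hm (fFst h2)) (fSnd h2)))))
    (pAnd (pEq (fLast h1) hm) (pAnd (pEq (fFst h2) hm) (pEq h (fPair (fFst h1) (fApp (fSnd h1) (fSnd h2))))))

theorem pRuleCut {Sf : α → Sys T} (hS : PSys Sf) {R : α → List (Tile T)} (hR : Primrec R) {τ : α → Tile T}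
    (hτ : Primrec τ) : PrimrecPred fun a => RuleCut (Sf a) (fun t => t ∈ R a) (τ a) := by
  have t : PTile fun q : (α × Tile T) × Tile T => τ q.1.1 := PTile.of (hτ.comp (fFst Primrec.fst))
  have t1 : PTile fun q : (α × Tile T) × Tile T => q.1.2 := PTile.of (fSnd Primrec.fst)
  have t2 : PTile fun q : (α × Tile T) × Tile T => q.2 := PTile.of Primrec.snd
  refine pEx hR (pEx (hR.comp Primrec.fst) ?_)
  exact pAnd (pEq t1.wr t2.wl) (pAnd (pEq t1.lr t2.ll) (pAnd (pEq t1.ur t2.ul) (pAnd (pEq t.ll t1.ll)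
    (pAnd (pEq t.ul t1.ul) (pAnd (pEq t.wl t1.wl) (pAnd (pEq t.lr t2.lr) (pAnd (pEq t.ur t2.ur)
    (pAnd (pEq t.wr t2.wr) (pAnd (pJoin t1.wb t1.lr t2.wb t.wb) (pAnd (pJoin t1.wt t1.ur t2.wt t.wt)
    (pRl hS.up.up t1.wr)))))))))))

theorem pLoopF {Sf : α → Sys T} (hS : PSys Sf) {τ : α → Tile T} (hτ : Primrec τ) :
    PrimrecPred fun a => LoopF (Sf a) (τ a) := by
  have t := PTile.of hτ
  have t' : PTile fun q : α × ℕ => τ q.1 := PTile.of (hτ.comp Primrec.fst)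
  have h := hS.up (β := ℕ)
  have i0 : Primrec fun q : α × ℕ => q.2 := Primrec.snd
  exact pAnd (hS.le t.ll t.ul) (pLt hS.N (pImp (h.nF i0 t'.ll) (pOr (h.w i0 t'.ll) (pOr (h.gF i0 t'.ul)
    (pOr (h.gF i0 t'.ur) (h.nF i0 (fFst t'.wb)))))))

theorem pRuleLoop {Sf : α → Sys T} (hS : PSys Sf) {R : α → List (Tile T)} (hR : Primrec R) {τ : α → Tile T}
    (hτ : Primrec τ) : PrimrecPred fun a => RuleLoop (Sf a) (fun t => t ∈ R a) (τ a) := by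
  have t0 := PTile.of hτ
  have t : PTile fun q : α × Tile T => τ q.1 := PTile.of (hτ.comp Primrec.fst)
  have C : PTile fun q : α × Tile T => q.2 := PTile.of Primrec.snd
  have h := hS.up (β := Tile T)
  have hR' : Primrec fun q : α × Tile T => R q.1 := hR.comp Primrec.fst
  refine pAnd (pEq t0.wl (fPair t0.ll fNil)) (pAnd (pEq t0.wt (fPair t0.ur fNil)) (pEx hR ?_))
  refine pAnd (pMem hR' (fMk t.ll (fFst t.wb) t.ll t.lr (fPair t.ll fNil) C.wl (fPair (fFst t.wb) fNil) t.wb)) ?_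
  refine pAnd (pMem hR' (fMk t.lr (fLast t.wr) t.ur t.ur t.wr (fPair (fLast t.wr) fNil) C.wt (fPair t.ur fNil))) ?_
  refine pAnd (pEq C.all (fMk (fFst t.wb) t.lr t.lr (fLast t.wr) C.wl t.wr t.wb C.wt)) ?_
  exact pAnd (h.rl t.lr) (pAnd (pRl h t.wb) (pAnd (pRl h t.wr) (pAnd (pRl h C.wl) (pAnd (pRl h C.wt)
    (pAnd (pLoopF h t.all) (pLoopF h.op t.dual))))))

theorem pPtItem {Sf : α → Sys T} (hS : PSys Sf) {a b t : α → T} (ha : Primrec a) (hb : Primrec b) (ht : Primrec t) :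
    PrimrecPred fun x => PtItem (Sf x) (a x) (b x) (t x) := by
  have h := hS.up (β := ℕ)
  have i0 : Primrec fun q : α × ℕ => q.2 := Primrec.snd
  have up : ∀ {f : α → T}, Primrec f → Primrec fun q : α × ℕ => f q.1 := fun hf => hf.comp Primrec.fst
  exact pAnd (hS.le ha ht) (pAnd (hS.le ht hb) (pAnd (hS.rl ht) (pLt hS.N
    (pAnd (pImp (h.nF i0 (up ht)) (h.gF i0 (up hb))) (pImp (h.nP i0 (up ht)) (h.gP i0 (up ha)))))))

theorem pEdgeF {Sf : α → Sys T} (hS : PSys Sf) {b p q : α → T} {w : α → Wd T} (hb : Primrec b) (hp : Primrec p)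
    (hw : Primrec w) (hq : Primrec q) : PrimrecPred fun x => EdgeF (Sf x) (b x) (p x) (w x) (q x) := by
  have h := hS.up (β := ℕ)
  have i0 : Primrec fun q : α × ℕ => q.2 := Primrec.snd
  have up : ∀ {f : α → T}, Primrec f → Primrec fun q : α × ℕ => f q.1 := fun hf => hf.comp Primrec.fst
  have hL : Primrec fun x : α × ℕ => (p x.1, (w x.1).1) :: (w x.1).2 :=
    (fCons (fPair hp (fFst hw)) (fSnd hw)).comp Primrec.fst
  exact pLt hS.N (pAnd (pLineF h i0 (h.gF i0 (up hb)) (up hq) hL) (pImp (h.nF i0 (up hq)) (h.gF i0 (up hb))))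

theorem pSegItem {Sf : α → Sys T} (hS : PSys Sf) {a b p q : α → T} {w : α → Wd T} (ha : Primrec a) (hb : Primrec b)
    (hp : Primrec p) (hw : Primrec w) (hq : Primrec q) :
    PrimrecPred fun x => SegItem (Sf x) (a x) (b x) (p x) (w x) (q x) :=
  pAnd (pChn hS hq (fCons (fPair hp (fFst hw)) (fSnd hw))) (pAnd (hS.le ha hp) (pAnd (hS.le hq hb)
    (pAnd (hS.rl hp) (pAnd (hS.rl hq) (pAnd (pRl hS hw) (pAnd (pEdgeF hS hb hp hw hq)
    (pEdgeF hS.op ha hq (fRev hw) hp)))))))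

theorem pBox {Sf : α → Sys T} (hS : PSys Sf) {a b : α → T} {τ : α → Tile T} (ha : Primrec a) (hb : Primrec b)
    (hτ : Primrec τ) : PrimrecPred fun x => BoxItem (Sf x) (fun _ => True) (a x) (b x) (τ x) := by
  have t := PTile.of hτ
  have tr : PrimrecPred fun _ : α => True := (pEq (Primrec.const 0) (Primrec.const 0)).of_eq fun _ => by simp
  exact pAnd tr (pAnd (hS.le ha t.ll) (pAnd (hS.le t.ur hb) (pAnd (hS.rl t.ll) (pAnd (hS.rl t.lr) (pAnd (hS.rl t.ul)
    (pAnd (hS.rl t.ur) (pAnd (pRl hS t.wl) (pAnd (pRl hS t.wr) (pAnd (pRl hS t.wb) (pAnd (pRl hS t.wt)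
    (pAnd (pEdgeF hS hb t.ul t.wt t.ur) (pAnd (pEdgeF hS hb t.lr t.wr t.ur)
    (pAnd (pEdgeF hS.op ha t.ul (fRev t.wl) t.ll) (pEdgeF hS.op ha t.lr (fRev t.wb) t.ll))))))))))))))

theorem pIsItem {Sf : α → Sys T} (hS : PSys Sf) {W : α → List (Wd T)} (hW : Primrec W) {R : α → List (Tile T)}
    (hR : Primrec R) {a b p q : α → T} (ha : Primrec a) (hb : Primrec b) (hp : Primrec p) (hq : Primrec q) :
    PrimrecPred fun x => IsItem (Sf x) (W x) (fun t => t ∈ R x) (a x) (b x) (p x) (q x) := by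
  have up : ∀ {β : Type} [Primcodable β] {f : α → T}, Primrec f → Primrec fun q : α × β => f q.1 :=
    fun hf => hf.comp Primrec.fst
  have t : PTile fun q : α × Tile T => q.2 := PTile.of Primrec.snd
  have k1 : PrimrecPred fun x => ∃ w ∈ W x, SegItem (Sf x) (a x) (b x) (p x) w (q x) :=
    pEx hW (pSegItem hS.up (up ha) (up hb) (up hp) Primrec.snd (up hq))
  have k2 : PrimrecPred fun x => ∃ τ ∈ R x, BoxItem (Sf x) (fun _ => True) (a x) (b x) τ ∧ p x = τ.ll ∧ q x = τ.ur :=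
    pEx hR (pAnd (pBox hS.up (up ha) (up hb) t.all) (pAnd (pEq (up hp) t.ll) (pEq (up hq) t.ur)))
  refine (pOr (pAnd (pEq hp hq) (pPtItem hS ha hb hp)) (pOr k1 k2)).of_eq fun x => ?_
  refine or_congr Iff.rfl (or_congr Iff.rfl (exists_congr fun τ => ?_))
  exact ⟨fun ⟨a1, a2, a3⟩ => ⟨⟨a1, a2.2⟩, a3⟩, fun ⟨a2, a3⟩ => ⟨a2.1, ⟨trivial, a2.2⟩, a3⟩⟩

theorem pRuleShuf {Sf : α → Sys T} (hS : PSys Sf) {U : α → List T} (hU : Primrec U) {W : α → List (Wd T)}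
    (hW : Primrec W) {R : α → List (Tile T)} (hR : Primrec R) {τ : α → Tile T} (hτ : Primrec τ) :
    PrimrecPred fun a => RuleShuf (Sf a) (U a) (W a) (fun t => t ∈ R a) (τ a) := by
  have t := PTile.of hτ
  have t' : PTile fun q : α × ℕ => τ q.1 := PTile.of (hτ.comp Primrec.fst)
  have h := hS.up (β := ℕ)
  have i0 : Primrec fun q : α × ℕ => q.2 := Primrec.snd
  have t'' : PTile fun q : ((α × ℕ) × T) × T => τ q.1.1.1 := PTile.of (hτ.comp (fFst (fFst Primrec.fst)))
  have f1 : Primrec fun q : ((α × ℕ) × T) × T => q.1.1.1 := fFst (fFst Primrec.fst)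
  have f2 : Primrec fun q : ((α × ℕ) × T) × T => q.1.1.2 := fSnd (fFst Primrec.fst)
  have f3 : Primrec fun q : ((α × ℕ) × T) × T => q.1.2 := fSnd Primrec.fst
  have f4 : Primrec fun q : ((α × ℕ) × T) × T => q.2 := Primrec.snd
  have it := pIsItem h.up.up (hW.comp f1) (hR.comp f1) t''.ll t''.ur f3 f4
  have hU1 : Primrec fun q : α × ℕ => U q.1 := hU.comp Primrec.fst
  have hU2 : Primrec fun q : (α × ℕ) × T => U q.1.1 := hU.comp (fFst Primrec.fst)
  refine pAnd (pEq t.wl (fPair t.ll fNil)) (pAnd (pEq t.wb (fPair t.ll fNil)) (pAnd (pEq t.wt (fPair t.ur fNil))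
    (pAnd (pEq t.wr (fPair t.ur fNil)) (pAnd (hS.rl t.ll) (pAnd (hS.rl t.ur) (pAnd (hS.le t.ll t.ll)
    (pAnd (hS.le t.ur t.ur) (pAnd (hS.le t.ll t.ur) (pAnd (hS.le t.ll t.ul) (pAnd (hS.le t.ll t.lr)
    (pAnd (hS.le t.ul t.ur) (pAnd (hS.le t.lr t.ur) (pAnd ?_ (pLt hS.N (pAnd ?_ ?_)))))))))))))))
  · exact pEx hU (pPtItem hS.up (t.ll.comp Primrec.fst) (t.ur.comp Primrec.fst) Primrec.snd)
  · exact pImp (h.nF i0 t'.ll) (pOr (h.w i0 t'.ll) (pOr (h.gF i0 t'.ur)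
      (pEx hU1 (pEx hU2 (pAnd it (h.up.up.gF f2 f3))))))
  · exact pImp (h.nP i0 t'.ur) (pOr (h.w i0 t'.ur) (pOr (h.gP i0 t'.ll)
      (pEx hU1 (pEx hU2 (pAnd it (h.up.up.gP f2 f4))))))

theorem pStep {Sf : α → Sys T} (hS : PSys Sf) {U : α → List T} (hU : Primrec U) {W : α → List (Wd T)}
    (hW : Primrec W) {R : α → List (Tile T)} (hR : Primrec R) {τ : α → Tile T} (hτ : Primrec τ) :
    PrimrecPred fun a => Step (Sf a) (U a) (W a) (fun t => t ∈ R a) (τ a) :=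
  pOr (pRuleTriv hS hU hτ) (pOr (pRuleCut hS hR hτ) (pOr (pMem hR (PTile.of hτ).swp) (pOr (pRuleLoop hS hR hτ)
    (pRuleShuf hS hU hW hR hτ))))

theorem pTrF {Sf : α → Sys T} (hS : PSys Sf) {σ : α → Tri T} (hσ : Primrec σ) {c : α → T} (hc : Primrec c) :
    PrimrecPred fun a => TrF (Sf a) (σ a) (c a) := by
  have h := hS.up (β := ℕ)
  have i0 : Primrec fun q : α × ℕ => q.2 := Primrec.snd
  have up : ∀ {β : Type} [Primcodable β] {f : α → β}, Primrec f → Primrec fun q : α × ℕ => f q.1 :=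
    fun hf => hf.comp Primrec.fst
  have w1 : Primrec fun a => (σ a).2.1 := fFst (fSnd hσ)
  have w2 : Primrec fun a => (σ a).2.2 := fSnd (fSnd hσ)
  have hL := fCons (fPair (fFst w1) (fFst w1)) (fSnd w1)
  have k1 : PrimrecPred fun a => ∀ t ∈ letters (σ a).2.1, (Sf a).le t (c a) :=
    pAllL w1 (hS.up.le Primrec.snd (hc.comp Primrec.fst))
  have k2 : PrimrecPred fun a => ∀ i < (Sf a).N, LineF (Sf a) i ((Sf a).nF i (σ a).1 ∨ (Sf a).gF i (c a)) (σ a).1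
      (((σ a).2.1.1, (σ a).2.1.1) :: (σ a).2.1.2) :=
    pLt hS.N (pLineF h i0 (pOr (h.nF i0 (up (fFst hσ))) (h.gF i0 (up hc))) (up (fFst hσ)) (up hL))
  have k3 : PrimrecPred fun a => ∀ i < (Sf a).N, (Sf a).nF i (c a) → (Sf a).w i (c a) ∨ (Sf a).gF i (lastW (σ a).2.2) :=
    pLt hS.N (pImp (h.nF i0 (up hc)) (pOr (h.w i0 (up hc)) (h.gF i0 (up (fLast w2)))))
  refine (pAnd (pChn hS (fFst hσ) hL) (pAnd k1 (pAnd k2 k3))).of_eq fun a => ?_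
  exact ⟨fun ⟨a1, a2, a3, a4⟩ => ⟨a1, a2, a3, a4⟩, fun ⟨a1, a2, a3, a4⟩ => ⟨a1, a2, a3, a4⟩⟩

theorem pRuleT1 {Sf : α → Sys T} (hS : PSys Sf) {U : α → List T} (hU : Primrec U) {σ : α → Tri T} (hσ : Primrec σ) :
    PrimrecPred fun a => RuleT1 (Sf a) (U a) (σ a) := by
  have hd : Primrec fun a => (σ a).dual := fPair (fFst hσ) (fPair (fRev (fSnd (fSnd hσ))) (fRev (fFst (fSnd hσ))))
  exact pEx hU (pAnd (hS.up.rl Primrec.snd) (pAnd (hS.up.le Primrec.snd Primrec.snd)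
    (pAnd (pTrF hS.up (hσ.comp Primrec.fst) Primrec.snd) (pTrF hS.up.op (hd.comp Primrec.fst) Primrec.snd))))

theorem pNull {Sf : α → Sys T} (hS : PSys Sf) {g : α → T} (hg : Primrec g) : PrimrecPred fun a => Null (Sf a) (g a) := by
  have h := hS.up (β := ℕ)
  have i0 : Primrec fun q : α × ℕ => q.2 := Primrec.snd
  have g' : Primrec fun q : α × ℕ => g q.1 := hg.comp Primrec.fst
  exact pLt hS.N (pAnd (pNot (h.nF i0 g')) (pAnd (pNot (h.nP i0 g')) (pNot (h.w i0 g'))))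

theorem pRuleT2 {Sf : α → Sys T} (hS : PSys Sf) {R : α → List (Tile T)} (hR : Primrec R) {V : α → List (Tri T)}
    (hV : Primrec V) {σ : α → Tri T} (hσ : Primrec σ) :
    PrimrecPred fun a => RuleT2 (Sf a) (fun t => t ∈ R a) (fun s => s ∈ V a) (σ a) := by
  have s : Primrec fun q : ((α × Tri T) × Tri T) × Tile T => σ q.1.1.1 := hσ.comp (fFst (fFst Primrec.fst))
  have s1 : Primrec fun q : ((α × Tri T) × Tri T) × Tile T => q.1.1.2 := fSnd (fFst Primrec.fst)
  have s2 : Primrec fun q : ((α × Tri T) × Tri T) × Tile T => q.1.2 := fSnd Primrec.fst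
  have t : PTile fun q : ((α × Tri T) × Tri T) × Tile T => q.2 := PTile.of Primrec.snd
  have h := ((hS.up (β := Tri T)).up (β := Tri T)).up (β := Tile T)
  refine pEx hV (pEx (hV.comp Primrec.fst) (pEx (hR.comp (fFst Primrec.fst)) ?_))
  exact pAnd (pEq t.ll (fFst s1)) (pAnd (pEq t.ul (fFst s)) (pAnd (pEq t.ur (fFst s2))
    (pAnd (pEq t.wr (fFst (fSnd s2))) (pAnd (pEq t.wb (fSnd (fSnd s1)))
    (pAnd (pJoin (fFst (fSnd s1)) (fFst s1) t.wl (fFst (fSnd s)))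
    (pAnd (pJoin t.wt (fFst s2) (fSnd (fSnd s2)) (fSnd (fSnd s))) (pAnd (pRl h t.wb) (pAnd (pRl h t.wr)
    (pOr (pNull h t.lr) (pAnd (pEq t.lr (fLast t.wb)) (pEq t.lr (fFst t.wr))))))))))))

theorem pTStep {Sf : α → Sys T} (hS : PSys Sf) {U : α → List T} (hU : Primrec U) {R : α → List (Tile T)}
    (hR : Primrec R) {V : α → List (Tri T)} (hV : Primrec V) {σ : α → Tri T} (hσ : Primrec σ) :
    PrimrecPred fun a => TStep (Sf a) (U a) (fun t => t ∈ R a) (fun s => s ∈ V a) (σ a) :=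
  pOr (pRuleT1 hS hU hσ) (pRuleT2 hS hR hV hσ)

end Rules
end Temporal

namespace Temporal

set_option synthInstance.maxHeartbeats 400000
set_option synthInstance.maxSize 4096

theorem pOKt : PrimrecPred fun q : ℕ × List ℕ => OKt q.1 q.2 := by
  have t : Primrec fun q : (ℕ × List ℕ) × ℕ => q.1.2 := fSnd Primrec.fst
  have u : Primrec fun q : (ℕ × List ℕ) × ℕ => Nat.unpair q.2 := Primrec.unpair.comp Primrec.snd
  refine pAnd (pMem Primrec.snd Primrec.fst) (pLt (fAdd Primrec.fst 1) ?_)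
  exact pAnd (pIff (pMem t (fAdd (fMul Primrec.snd 5) 1)) (pNot (pMem t Primrec.snd)))
    (pIff (pMem t (fAdd (fMul Primrec.snd 5) 2)) (pOr (pMem t (fFst u)) (pMem t (fSnd u))))

theorem ptle' : PrimrecPred fun q : ℕ × List ℕ × List ℕ => tle q.1 q.2.1 q.2.2 := by
  have t : Primrec fun q : (ℕ × List ℕ × List ℕ) × ℕ => q.1.2.1 := fFst (fSnd Primrec.fst)
  have s : Primrec fun q : (ℕ × List ℕ × List ℕ) × ℕ => q.1.2.2 := fSnd (fSnd Primrec.fst)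
  have i3 : Primrec fun q : (ℕ × List ℕ × List ℕ) × ℕ => 5 * q.2 + 3 := fAdd (fMul Primrec.snd 5) 3
  have i4 : Primrec fun q : (ℕ × List ℕ × List ℕ) × ℕ => 5 * q.2 + 4 := fAdd (fMul Primrec.snd 5) 4
  refine pLt (fAdd Primrec.fst 1) ?_
  exact pAnd (pImp (pOr (pMem s Primrec.snd) (pMem s i3)) (pMem t i3))
    (pImp (pOr (pMem t Primrec.snd) (pMem t i4)) (pMem s i4))

section
variable {α : Type} [Primcodable α]

theorem ptle {n : α → ℕ} {s t : α → List ℕ} (hn : Primrec n) (hs : Primrec s) (ht : Primrec t) :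
    PrimrecPred fun a => tle (n a) (s a) (t a) := ptle'.comp (fPair hn (fPair hs ht))

theorem fRep {n : α → ℕ} {t : α → List ℕ} (hn : Primrec n) (ht : Primrec t) : Primrec fun a => rep (n a) (t a) := by
  refine fIte (ptle hn ht ht) (fFilter (p := fun a k => 3 ≤ k % 5 ∧ k ∈ t a)
    (Primrec.list_range.comp (fMul (fAdd hn 1) 5)) (pAnd ?_ ?_)) ht
  · exact Primrec.nat_le.comp (Primrec.const 3) (Primrec.nat_mod.comp Primrec.snd (Primrec.const 5))
  · exact pMem (ht.comp Primrec.fst) Primrec.snd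

theorem pGok {n : α → ℕ} {a : α → Lb} (hn : Primrec n) (ha : Primrec a) : PrimrecPred fun x => gok (n x) (a x) :=
  pOr (pAnd (pEq (fFst ha) (Primrec.const 0)) (pEq (fFst (fSnd ha)) (fSnd (fSnd ha))))
    (pAnd (pEq (fFst ha) (Primrec.const 1)) (ptle hn (fFst (fSnd ha)) (fSnd (fSnd ha))))
end

theorem fTY : Primrec TY :=
  fFilter (p := fun n t => OKt n t) (fSubl (Primrec.list_range.comp (fMul (fAdd Primrec.id 1) 5))) pOKt

theorem fU0 : Primrec U0 := fMap fTY (fRep Primrec.fst Primrec.snd)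

theorem fUL : Primrec UL := by
  refine fApp (fMap fU0 (fPair (Primrec.const 0) (fPair Primrec.snd Primrec.snd))) (fApp ?_ (Primrec.const _))
  refine fFilter (p := fun n (a : Lb) => a.2.1 ≠ a.2.2 ∧ tle n a.2.1 a.2.2) (fFlat fU0 (fMap (fU0.comp Primrec.fst)
    (fPair (Primrec.const 1) (fPair (fSnd Primrec.fst) Primrec.snd)))) ?_
  have a1 : Primrec fun q : ℕ × Lb => q.2.2.1 := fFst (fSnd Primrec.snd)
  have a2 : Primrec fun q : ℕ × Lb => q.2.2.2 := fSnd (fSnd Primrec.snd)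
  exact pAnd (pNot (pEq a1 a2)) (ptle Primrec.fst a1 a2)

theorem pSy : PSys Sy := by
  have f0 : Primrec fun q : ℕ × ℕ × Lb => q.2.2.1 := fFst (fSnd Primrec.snd)
  have f1 : Primrec fun q : ℕ × ℕ × Lb => q.2.2.2.1 := fFst (fSnd (fSnd Primrec.snd))
  have i0 : Primrec fun q : ℕ × ℕ × Lb => q.2.1 := fFst Primrec.snd
  refine ⟨fAdd Primrec.id 1, ?_, ?_, ?_, ?_, ?_⟩
  · have a : Primrec fun q : ℕ × Lb × Lb => q.2.1 := fFst Primrec.snd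
    have b : Primrec fun q : ℕ × Lb × Lb => q.2.2 := fSnd Primrec.snd
    exact pOr (pEq (fFst a) (Primrec.const 2)) (pOr (pEq (fFst b) (Primrec.const 3)) (pAnd (pGok Primrec.fst a)
      (pAnd (pGok Primrec.fst b) (ptle Primrec.fst (fSnd (fSnd a)) (fFst (fSnd b))))))
  · have a : Primrec fun q : ℕ × Lb => q.2.2.1 := fFst (fSnd Primrec.snd)
    exact pAnd (pEq (fFst Primrec.snd) (Primrec.const 0)) (pAnd (pEq a (fSnd (fSnd Primrec.snd)))
      (pMem (fU0.comp Primrec.fst) a))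
  · exact pAnd (pEq f0 (Primrec.const 0)) (pMem f1 (fAdd (fMul i0 5) 3))
  · exact pAnd (pEq f0 (Primrec.const 0)) (pMem f1 (fAdd (fMul i0 5) 4))
  · refine pAnd (pEq f0 (Primrec.const 0)) (pEx (fTY.comp Primrec.fst) ?_)
    exact pAnd (pEq (fRep (fFst Primrec.fst) Primrec.snd) (f1.comp Primrec.fst)) (pMem Primrec.snd (i0.comp Primrec.fst))

/-- All lists over `P` of length at most the length of `L`. -/
def lst {β γ : Type} (P : List γ) (L : List β) : List (List γ) :=
  L.foldr (fun _ acc => [] :: P.flatMap fun p => acc.map (List.cons p)) [[]]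

theorem mem_lst {β γ : Type} {P : List γ} (L : List β) (M : List γ) (hM : ∀ x ∈ M, x ∈ P) (h : M.length ≤ L.length) :
    M ∈ lst P L := by
  induction L generalizing M with
  | nil => simp_all [lst]
  | cons a L ih =>
    change M ∈ [] :: P.flatMap fun p => (lst P L).map (List.cons p)
    cases M with
    | nil => simp
    | cons x M =>
      refine List.mem_cons_of_mem _ (List.mem_flatMap.2 ⟨x, hM x (by simp), List.mem_map_of_mem (ih M ?_ ?_)⟩)
      · exact fun y hy => hM y (by simp [hy])
      · simpa using h

/-- Product of two lists. -/
def pr {β γ : Type} (L : List β) (M : List γ) : List (β × γ) := L.flatMap fun a => M.map fun b => (a, b)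

theorem mem_pr {β γ : Type} {L : List β} {M : List γ} {x : β × γ} (h1 : x.1 ∈ L) (h2 : x.2 ∈ M) : x ∈ pr L M :=
  List.mem_flatMap.2 ⟨x.1, h1, List.mem_map.2 ⟨x.2, h2, rfl⟩⟩

theorem fPr {α β γ : Type} [Primcodable α] [Primcodable β] [Primcodable γ] {L : α → List β} {M : α → List γ}
    (hL : Primrec L) (hM : Primrec M) : Primrec fun a => pr (L a) (M a) :=
  fFlat hL (fMap (hM.comp Primrec.fst) (fPair (fSnd Primrec.fst) Primrec.snd))

def Wn (n : ℕ) : List (Wd Lb) := pr (UL n) (lst (pr (UL n) (UL n)) (UL n))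
def tiles (n : ℕ) : List (Tile Lb) :=
  pr (pr (UL n) (pr (UL n) (pr (UL n) (UL n)))) (pr (Wn n) (pr (Wn n) (pr (Wn n) (Wn n))))
def tris (n : ℕ) : List (Tri Lb) := pr (UL n) (pr (Wn n) (Wn n))

theorem fWn : Primrec Wn := by
  refine fPr fUL ?_
  refine Primrec.list_foldr (h := fun n q => [] :: (pr (UL n) (UL n)).flatMap fun p => q.2.map (List.cons p))
    fUL (Primrec.const [[]]) ?_
  refine fCons fNil (fFlat (fPr (fUL.comp Primrec.fst) (fUL.comp Primrec.fst)) ?_)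
  refine fMap (fSnd (fSnd Primrec.fst)) (fCons ?_ Primrec.snd)
  exact fSnd Primrec.fst

theorem fTiles : Primrec tiles :=
  fPr (fPr fUL (fPr fUL (fPr fUL fUL))) (fPr fWn (fPr fWn (fPr fWn fWn)))
theorem fTris : Primrec tris := fPr fUL (fPr fWn fWn)

theorem CanW.mem {n : ℕ} {w : Wd Lb} (h : CanW (UL n) w) : w ∈ Wn n := by
  obtain ⟨h1, h2⟩ := h
  have h0 : w.1 ∈ UL n := h1 _ (by simp [letters])
  have h3 : ∀ p ∈ w.2, p.1 ∈ UL n ∧ p.2 ∈ UL n := fun p hp =>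
    ⟨h1 _ (List.mem_cons_of_mem _ (List.mem_flatMap.2 ⟨p, hp, by simp⟩)),
      h1 _ (List.mem_cons_of_mem _ (List.mem_flatMap.2 ⟨p, hp, by simp⟩))⟩
  refine mem_pr h0 (mem_lst _ _ (fun p hp => mem_pr (h3 p hp).1 (h3 p hp).2) ?_)
  have hs : (w.1 :: w.2.map Prod.snd) ⊆ UL n := by
    intro x hx
    rcases List.mem_cons.1 hx with rfl | hx
    · exact h0
    · obtain ⟨p, hp, rfl⟩ := List.mem_map.1 hx
      exact (h3 p hp).2
  have := (List.subperm_of_subset h2 hs).length_le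
  simp at this
  omega

theorem CanT.mem {n : ℕ} {τ : Tile Lb} (h : CanT (UL n) τ) : τ ∈ tiles n := by
  obtain ⟨⟨a1, a2, a3, a4⟩, b1, b2, b3, b4⟩ := h
  exact mem_pr (mem_pr a1 (mem_pr a2 (mem_pr a3 a4))) (mem_pr b1.mem (mem_pr b2.mem (mem_pr b3.mem b4.mem)))

theorem CanTri.mem {n : ℕ} {σ : Tri Lb} (h : CanTri (UL n) σ) : σ ∈ tris n :=
  mem_pr h.1 (mem_pr h.2.1.mem h.2.2.mem)

theorem sig0_can (n : ℕ) : CanTri (UL n) sig0 := by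
  have h2 : ((2, [], []) : Lb) ∈ UL n := by simp [UL]
  have h3 : ((3, [], []) : Lb) ∈ UL n := by simp [UL]
  refine ⟨h2, ⟨?_, by simp [sig0]⟩, ⟨?_, by simp [sig0]⟩⟩ <;> simpa [sig0, letters, lettersP]

/-- The decision criterion: `sig0` belongs to every closed set of triangles. -/
def Dec (n : ℕ) : Prop :=
  ∀ R ∈ subl (tiles n), (∀ τ ∈ tiles n, Step (Sy n) (UL n) (Wn n) (fun t => t ∈ R) τ → τ ∈ R) →
    ∀ V ∈ subl (tris n), (∀ σ ∈ tris n, TStep (Sy n) (UL n) (fun t => t ∈ R) (fun s => s ∈ V) σ → σ ∈ V) → sig0 ∈ V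

theorem dec_iff (n : ℕ) : Dec n ↔ ∃ l, CoarseOn n (Set.Ioo (-1) 1) l := by
  classical
  constructor
  · intro h
    refine TFill.coarse ?_
    have := h _ (filter_mem_subl (tiles n) fun τ => decide (Fill (Sy n) τ)) (fun τ hτ hs => ?_)
      _ (filter_mem_subl (tris n) fun σ => decide (TFill (Sy n) σ)) (fun σ hσ hs => ?_)
    · exact of_decide_eq_true (List.mem_filter.1 this).2
    · refine List.mem_filter.2 ⟨hτ, decide_eq_true (Step.sound (Sy_law n) (Step.mono (fun t ht => ?_) hs))⟩
      exact of_decide_eq_true (List.mem_filter.1 ht).2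
    · refine List.mem_filter.2 ⟨hσ, decide_eq_true (TStep.sound (Sy_law n)
        (TStep.mono (fun t ht => ?_) (fun t ht => ?_) hs))⟩
      · exact of_decide_eq_true (List.mem_filter.1 ht).2
      · exact of_decide_eq_true (List.mem_filter.1 ht).2
  · rintro ⟨l, hl⟩ R _ hR V _ hV
    obtain ⟨f, hf, hi⟩ := hl.tamb
    have c1 : Clo (Sy n) (UL n) fun t => t ∈ R := ⟨Wn n, fun w hw => hw.mem, fun τ hτ => hR τ hτ.mem⟩
    have c2 : TClo (Sy n) (UL n) (fun t => t ∈ R) fun s => s ∈ V := fun σ hσ => hV σ hσ.mem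
    exact TAmb.trq c1 c2 hf le_rfl le_rfl (by norm_num) sig0 hi (sig0_can n)

theorem pDec : PrimrecPred Dec := by
  refine pAll (fSubl fTiles) (pImp (pAll (fTiles.comp Primrec.fst) (pImp ?_ ?_))
    (pAll (fSubl (fTris.comp Primrec.fst)) (pImp (pAll (fTris.comp (fFst Primrec.fst)) (pImp ?_ ?_)) ?_)))
  · exact pStep (pSy.comp (fFst Primrec.fst)) (fUL.comp (fFst Primrec.fst)) (fWn.comp (fFst Primrec.fst))
      (fSnd Primrec.fst) Primrec.snd
  · exact pMem (fSnd Primrec.fst) Primrec.snd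
  · exact pTStep (pSy.comp (fFst (fFst Primrec.fst))) (fUL.comp (fFst (fFst Primrec.fst)))
      (fSnd (fFst Primrec.fst)) (fSnd Primrec.fst) Primrec.snd
  · exact pMem (fSnd Primrec.fst) Primrec.snd
  · exact pMem Primrec.snd (Primrec.const sig0)

/-- The validity problem for temporal formulas over the frame `(D, <)`, where
`D = {(x,y) ∈ ℝ² : y > x}` and `<` is the restriction to `D` of the irreflexive
part of the componentwise order on ℝ², is decidable. -/
theorem validity_halfplane_lt_decidable :
    ComputablePred (fun φ : TForm =>
      TValid (fun p q : HalfPlane => p.val ≤ q.val ∧ p.val ≠ q.val) φ) := by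
  have he : Primrec fun φ : TForm => encodeT φ := Primrec.encode
  have h : PrimrecPred fun φ : TForm => ¬ Dec (5 * (5 * (5 * encodeT φ + 1) + 4) + 3) :=
    pNot (pDec.comp (fAdd (fMul (fAdd (fMul (fAdd (fMul he 5) 1) 5) 4) 5) 3))
  have h2 : PrimrecPred fun φ : TForm => TValid HR φ :=
    h.of_eq fun φ => ((valid_iff φ).trans (not_congr (dec_iff _).symm)).symm
  exact h2.computablePred

end Temporal
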